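/- Let q be a prime power and n a positive integer. Then there exists an element α in F_{q^n}* that is simultaneously 2-primitive (i.e., 2·ord(α) = q^n - 1) and 2-normal over F_q if and only if q is odd, and either n >= 5 and gcd(q^3 - q, n) ≠ 1, or n = 4 and q ≡ 1 (mod 4). -/

import Mathlib

open Polynomial

noncomputable section

/-- The action `h ∘ β = Σ_i a_i β^{q^i}` of a polynomial `h = Σ_i a_i x^i` over `F_q`
on an element `β` of an extension field. -/
def polyAct {Fq F : Type*} [Field Fq] [Field F] [Algebra Fq F]
    (q : ℕ) (h : Fq[X]) (β : F) : F :=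
  h.sum fun i a => algebraMap Fq F a * β ^ q ^ i

/-- `h` is the `F_q`-order of `β`: the monic divisor of `x^n - 1` of least degree
annihilating `β`. -/
def IsFqOrder {Fq F : Type*} [Field Fq] [Field F] [Algebra Fq F]
    (q n : ℕ) (h : Fq[X]) (β : F) : Prop :=
  h.Monic ∧ h ∣ (X ^ n - 1 : Fq[X]) ∧ polyAct q h β = 0 ∧
    ∀ h' : Fq[X], h'.Monic → h' ∣ (X ^ n - 1 : Fq[X]) → polyAct q h' β = 0 →
      h.natDegree ≤ h'.natDegree

/-- `α` is `k`-normal over `F_q`: its `F_q`-order has degree `n - k`. -/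
def IsKNormal (Fq : Type*) {F : Type*} [Field Fq] [Field F] [Algebra Fq F]
    (q n k : ℕ) (α : F) : Prop :=
  ∃ h : Fq[X], IsFqOrder q n h α ∧ h.natDegree = n - k

set_option linter.unusedSectionVars false

section Frobenius

variable {Fq F : Type*} [Field Fq] [Field F] [Fintype Fq] [Fintype F] [Algebra Fq F]

variable (Fq F) in
/-- The `F_q`-linear Frobenius map `x ↦ x^q`. -/
def frob : F →ₗ[Fq] F := (FiniteField.frobeniusAlgHom Fq F).toLinearMap

lemma frob_apply (x : F) : frob Fq F x = x ^ Fintype.card Fq := rfl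

lemma frob_pow_apply (i : ℕ) (x : F) : (frob Fq F ^ i) x = x ^ Fintype.card Fq ^ i := by
  induction i with
  | zero => simp
  | succ k ih =>
    rw [pow_succ', Module.End.mul_apply, ih, frob_apply, ← pow_mul, ← pow_succ]

lemma polyAct_eq_aeval (h : Fq[X]) (x : F) :
    polyAct (Fintype.card Fq) h x = aeval (frob Fq F) h x := by
  rw [aeval_eq_sum_range, polyAct, sum_over_range _ (by simp)]
  simp [LinearMap.sum_apply, frob_pow_apply, Algebra.smul_def]

lemma aeval_frob_X_pow_sub_one :
    aeval (frob Fq F) (X ^ Module.finrank Fq F - 1 : Fq[X]) = 0 := by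
  have := minpoly.aeval Fq (frob Fq F)
  rwa [frob, FiniteField.minpoly_frobeniusAlgHom] at this

lemma aeval_frob_mul (f g : Fq[X]) (x : F) :
    aeval (frob Fq F) (f * g) x = aeval (frob Fq F) f (aeval (frob Fq F) g x) := by
  rw [map_mul, Module.End.mul_apply]

lemma aeval_frob_eq_zero_of_dvd {f g : Fq[X]} (hfg : f ∣ g) {x : F}
    (hx : aeval (frob Fq F) f x = 0) : aeval (frob Fq F) g x = 0 := by
  obtain ⟨k, rfl⟩ := hfg
  rw [mul_comm, aeval_frob_mul, hx, map_zero]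

/-- An element annihilated by two polynomials is annihilated by every common
`F_q[X]`-combination dividing both. -/
lemma aeval_frob_gcd {f g d : Fq[X]} (hd : ∃ a b, d = a * f + b * g) {x : F}
    (hf : aeval (frob Fq F) f x = 0) (hg : aeval (frob Fq F) g x = 0) :
    aeval (frob Fq F) d x = 0 := by
  obtain ⟨a, b, rfl⟩ := hd
  rw [map_add, LinearMap.add_apply, aeval_frob_mul, aeval_frob_mul, hf, hg, map_zero, map_zero,
    add_zero]

open Classical in
variable (F) in
/-- The kernel of `f(Frob)` as a finite set. -/
def kerSet (f : Fq[X]) : Finset F := Finset.univ.filter fun x => aeval (frob Fq F) f x = 0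

lemma mem_kerSet {f : Fq[X]} {x : F} : x ∈ kerSet F f ↔ aeval (frob Fq F) f x = 0 := by
  simp [kerSet]

lemma card_kerSet_eq_pow_finrank (f : Fq[X]) :
    (kerSet F f).card = Fintype.card Fq ^ Module.finrank Fq (LinearMap.ker (aeval (frob Fq F) f)) := by
  classical
  rw [← Module.card_eq_pow_finrank (K := Fq), kerSet, ← Fintype.card_subtype]
  exact Fintype.card_congr (Equiv.refl _)

lemma card_kerSet_le {f : Fq[X]} (hf : f ≠ 0) :
    (kerSet F f).card ≤ Fintype.card Fq ^ f.natDegree := by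
  classical
  set q := Fintype.card Fq with hq
  have hq1 : 1 < q := Fintype.one_lt_card
  set L : F[X] := ∑ i ∈ Finset.range (f.natDegree + 1),
    C (algebraMap Fq F (f.coeff i)) * X ^ q ^ i with hL
  have hcoef : L.coeff (q ^ f.natDegree) = algebraMap Fq F f.leadingCoeff := by
    rw [hL, finsetSum_coeff, Finset.sum_eq_single f.natDegree]
    · simp
    · intro i _ hi
      rw [coeff_C_mul, coeff_X_pow, if_neg, mul_zero]
      intro h
      exact hi (Nat.pow_right_injective hq1 h).symm
    · simp
  have hL0 : L ≠ 0 := by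
    intro h
    rw [h, coeff_zero] at hcoef
    exact hf (by simpa using hcoef.symm)
  have hdeg : L.natDegree ≤ q ^ f.natDegree := by
    refine natDegree_sum_le_of_forall_le _ _ fun i hi => (natDegree_C_mul_X_pow_le _ _).trans ?_
    exact Nat.pow_le_pow_right hq1.le (by simpa [Nat.lt_succ_iff] using hi)
  have hsub : kerSet F f ⊆ L.roots.toFinset := by
    intro x hx
    rw [Multiset.mem_toFinset, mem_roots hL0, IsRoot.def, hL, eval_finsetSum]
    rw [mem_kerSet, aeval_eq_sum_range] at hx
    simpa [LinearMap.sum_apply, frob_pow_apply, Algebra.smul_def] using hx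
  exact (Finset.card_le_card hsub).trans ((Multiset.toFinset_card_le _).trans
    ((card_roots' _).trans hdeg))

lemma card_kerSet {f : Fq[X]} (hf : f ∣ X ^ Module.finrank Fq F - 1) :
    (kerSet F f).card = Fintype.card Fq ^ f.natDegree := by
  have hn : 0 < Module.finrank Fq F := Module.finrank_pos
  have hX : (X ^ Module.finrank Fq F - 1 : Fq[X]) ≠ 0 := X_pow_sub_C_ne_zero hn 1
  obtain ⟨g, hg⟩ := hf
  have hf0 : f ≠ 0 := by rintro rfl; simp_all
  have hg0 : g ≠ 0 := by rintro rfl; simp_all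
  have hdeg : Module.finrank Fq F = f.natDegree + g.natDegree := by
    rw [← natDegree_mul hf0 hg0, ← hg]
    exact (natDegree_X_pow_sub_C (R := Fq) (r := 1)).symm
  have hle : ∀ p : Fq[X], p ≠ 0 →
      Module.finrank Fq (LinearMap.ker (aeval (frob Fq F) p)) ≤ p.natDegree := by
    intro p hp
    have := card_kerSet_le (F := F) hp
    rw [card_kerSet_eq_pow_finrank] at this
    exact (Nat.pow_le_pow_iff_right Fintype.one_lt_card).1 this
  have hrange : LinearMap.range (aeval (frob Fq F) g) ≤ LinearMap.ker (aeval (frob Fq F) f) := by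
    rintro _ ⟨y, rfl⟩
    rw [LinearMap.mem_ker, ← aeval_frob_mul, ← hg, aeval_frob_X_pow_sub_one, LinearMap.zero_apply]
  have h1 := Submodule.finrank_mono hrange
  have h2 := LinearMap.finrank_range_add_finrank_ker (aeval (frob Fq F) g)
  have h3 := hle f hf0
  have h4 := hle g hg0
  rw [card_kerSet_eq_pow_finrank]
  congr 1
  omega

open Classical in
variable (F) in
/-- The elements killed by `D(Frob)` but by no `(D / P)(Frob)` with `P ∈ S`. -/
def exactSet (D : Fq[X]) (S : Finset Fq[X]) : Finset F :=
  (kerSet F D).filter fun x => ∀ P ∈ S, x ∉ kerSet F (D / P)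

lemma mem_exactSet {D : Fq[X]} {S : Finset Fq[X]} {x : F} :
    x ∈ exactSet F D S ↔ x ∈ kerSet F D ∧ ∀ P ∈ S, x ∉ kerSet F (D / P) := by
  simp [exactSet]

lemma exactSet_empty (D : Fq[X]) : exactSet F D ∅ = kerSet F D := by
  ext x; simp [mem_exactSet]

lemma kerSet_mono {f g : Fq[X]} (h : f ∣ g) : kerSet F f ⊆ kerSet F g := fun x hx => by
  rw [mem_kerSet] at hx ⊢
  exact aeval_frob_eq_zero_of_dvd h hx

lemma div_div_dvd_div {D P R : Fq[X]} (hP : P ≠ 0) (hR : R ≠ 0) (h : P * R ∣ D) :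
    D / P / R ∣ D / R := by
  obtain ⟨k, rfl⟩ := h
  have h1 : P * R * k / P = R * k := by rw [mul_assoc, mul_div_cancel_left₀ _ hP]
  have h2 : P * R * k / R = P * k := by rw [mul_comm P R, mul_assoc, mul_div_cancel_left₀ _ hR]
  rw [h1, h2, mul_div_cancel_left₀ _ hR]
  exact Dvd.intro_left P rfl

lemma exactSet_insert [DecidableEq Fq[X]] [DecidableEq F] {D P : Fq[X]} {S : Finset Fq[X]} (hP : P ≠ 0)
    (hPD : P ∣ D) (hS : ∀ R ∈ S, R ≠ 0 ∧ R ∣ D ∧ IsCoprime P R) :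
    exactSet F (D / P) S ⊆ exactSet F D S ∧
    exactSet F D (insert P S) = exactSet F D S \ exactSet F (D / P) S := by
  have key : ∀ x ∈ kerSet F (D / P), ∀ R ∈ S, x ∈ kerSet F (D / R) → x ∈ kerSet F (D / P / R) := by
    intro x hx R hR hxR
    obtain ⟨hR0, hRD, hco⟩ := hS R hR
    obtain ⟨k, rfl⟩ := hco.mul_dvd hPD hRD
    have h1 : P * R * k / P = R * k := by rw [mul_assoc, mul_div_cancel_left₀ _ hP]
    have h2 : P * R * k / R = P * k := by rw [mul_comm P R, mul_assoc, mul_div_cancel_left₀ _ hR0]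
    rw [mem_kerSet] at *
    rw [h1] at hx
    rw [h2] at hxR
    rw [h1, mul_div_cancel_left₀ _ hR0]
    obtain ⟨a, b, hab⟩ := hco
    exact aeval_frob_gcd ⟨b, a, by linear_combination (-k) * hab⟩ hx hxR
  have key2 : ∀ x, ∀ R ∈ S, x ∈ kerSet F (D / P / R) → x ∈ kerSet F (D / R) := fun x R hR hx =>
    kerSet_mono (div_div_dvd_div hP (hS R hR).1 ((hS R hR).2.2.mul_dvd hPD (hS R hR).2.1)) hx
  have key3 : kerSet F (D / P) ⊆ kerSet F D :=
    kerSet_mono (Dvd.intro_left P (EuclideanDomain.mul_div_cancel' hP hPD))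
  constructor
  · intro x hx
    rw [mem_exactSet] at hx ⊢
    exact ⟨key3 hx.1, fun R hR h => hx.2 R hR (key x hx.1 R hR h)⟩
  · ext x
    rw [Finset.mem_sdiff, mem_exactSet, mem_exactSet, mem_exactSet, Finset.forall_mem_insert]
    constructor
    · rintro ⟨h1, h2, h3⟩
      exact ⟨⟨h1, h3⟩, fun h => h2 h.1⟩
    · rintro ⟨⟨h1, h2⟩, h3⟩
      exact ⟨h1, fun h => h3 ⟨h, fun R hR h' => h2 R hR (key2 x R hR h')⟩, h2⟩

/-- Elements of `exactSet f S`, with `S` containing all monic irreducible factors of `f`,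
have `F_q`-order exactly `f`. -/
lemma isFqOrder_of_mem_exactSet {f : Fq[X]} {S : Finset Fq[X]} (hf : f.Monic)
    (hfn : f ∣ X ^ Module.finrank Fq F - 1)
    (hS : ∀ P : Fq[X], P.Monic → Irreducible P → P ∣ f → P ∈ S) {x : F} (hx : x ∈ exactSet F f S) :
    IsFqOrder (Fintype.card Fq) (Module.finrank Fq F) f x := by
  classical
  rw [mem_exactSet, mem_kerSet] at hx
  refine ⟨hf, hfn, by rw [polyAct_eq_aeval, hx.1], fun h' hm _ h0 => ?_⟩
  rw [polyAct_eq_aeval] at h0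
  have hd : aeval (frob Fq F) (EuclideanDomain.gcd f h') x = 0 :=
    aeval_frob_gcd ⟨EuclideanDomain.gcdA f h', EuclideanDomain.gcdB f h', by
      rw [EuclideanDomain.gcd_eq_gcd_ab]; ring⟩ hx.1 h0
  obtain ⟨k, hk⟩ := EuclideanDomain.gcd_dvd_left f h'
  by_cases hu : IsUnit k
  · refine natDegree_le_of_dvd ?_ hm.ne_zero
    refine dvd_trans ?_ (EuclideanDomain.gcd_dvd_right f h')
    obtain ⟨u, rfl⟩ := hu
    exact ⟨↑u⁻¹, (Units.eq_mul_inv_iff_mul_eq u).2 hk.symm⟩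
  · exfalso
    obtain ⟨P, hPi, hPk⟩ := WfDvdMonoid.exists_irreducible_factor hu (by
      rintro rfl; rw [mul_zero] at hk; exact hf.ne_zero hk)
    have hPn : Irreducible (normalize P) := (associated_normalize P).irreducible hPi
    have hPkn : normalize P ∣ k := (normalize_dvd_iff).2 hPk
    refine hx.2 (normalize P) (hS _ (monic_normalize hPi.ne_zero) hPn
      (hPkn.trans (Dvd.intro_left _ hk.symm))) ?_
    rw [mem_kerSet]
    refine aeval_frob_eq_zero_of_dvd ?_ hd
    obtain ⟨m, rfl⟩ := hPkn
    refine ⟨m, ?_⟩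
    have h1 : f = normalize P * (EuclideanDomain.gcd f h' * m) := hk.trans (by ring)
    conv_lhs => rw [h1]
    exact mul_div_cancel_left₀ _ hPn.ne_zero

end Frobenius

section Sieve

/-- The additive character `r ↦ exp(2πir)` on rationals. -/
def ee (r : ℚ) : ℂ := Complex.exp (2 * Real.pi * Complex.I * (r : ℂ))

lemma ee_add (r s : ℚ) : ee (r + s) = ee r * ee s := by
  rw [ee, ee, ee, ← Complex.exp_add]; push_cast; ring_nf

lemma ee_int (k : ℤ) : ee k = 1 := by
  rw [ee, Complex.exp_eq_one_iff]; exact ⟨k, by push_cast; ring⟩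

lemma ee_zero : ee 0 = 1 := by simpa using ee_int 0

lemma norm_ee (r : ℚ) : ‖ee r‖ = 1 := by
  rw [ee, show (2 * Real.pi * Complex.I * (r : ℂ)) = ((2 * Real.pi * r : ℝ) : ℂ) * Complex.I by
    push_cast; ring]
  exact Complex.norm_exp_ofReal_mul_I _

lemma ee_eq_one_iff (r : ℚ) : ee r = 1 ↔ r.den = 1 := by
  constructor
  · intro h
    rw [ee, Complex.exp_eq_one_iff] at h
    obtain ⟨k, hk⟩ := h
    have h2 : (2 * Real.pi * Complex.I : ℂ) ≠ 0 := Complex.two_pi_I_ne_zero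
    have : (r : ℂ) = k := mul_left_cancel₀ h2 (by rw [hk]; ring)
    have hr : r = (k : ℚ) := by exact_mod_cast this
    rw [hr]; simp
  · intro h
    rw [← Rat.coe_int_num_of_den_eq_one h]; exact ee_int _

lemma ee_nat_mul (k : ℕ) (r : ℚ) : ee (k * r) = ee r ^ k := by
  induction k with
  | zero => simp [ee_zero]
  | succ k ih => rw [pow_succ, ← ih, ← ee_add]; push_cast; ring_nf

lemma sum_ee_div {l : ℕ} (hl : 0 < l) (x : ℤ) :
    ∑ j ∈ Finset.range l, ee (j * (x / l : ℚ)) = if (l : ℤ) ∣ x then (l : ℂ) else 0 := by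
  have hl' : (l : ℚ) ≠ 0 := by positivity
  simp_rw [ee_nat_mul]
  split_ifs with h
  · obtain ⟨k, rfl⟩ := h
    have : ee (((l * k : ℤ) : ℚ) / l) = 1 := by
      rw [show (((l * k : ℤ) : ℚ) / l) = (k : ℤ) by push_cast; field_simp]; exact ee_int k
    rw [this]; simp
  · have h1 : ee (x / l : ℚ) ≠ 1 := by
      rw [Ne, ee_eq_one_iff]
      intro hd
      apply h
      have := Rat.coe_int_num_of_den_eq_one hd
      refine ⟨(x / l : ℚ).num, ?_⟩
      have h2 : (x : ℚ) = l * ((x / l : ℚ).num : ℚ) := by rw [this]; field_simp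
      exact_mod_cast h2
    have h2 : ee (x / l : ℚ) ^ l = 1 := by
      rw [← ee_nat_mul, mul_div_cancel₀ _ hl']; exact ee_int x
    rw [geom_sum_eq h1, h2]; simp

/-- Weighted counts over `Ω` have main term `θ|Ω|` and twisted sums of size `TE`, the twists
running over frequencies with denominator dividing `N` and coprime to `D`. -/
structure SieveWeight {ι : Type*} (Ω : Finset ι) (X : ι → ℕ) (N : ℕ) (E : ℝ) (u : ℕ → ℝ)
    (D : ℕ) (θ T : ℝ) : Prop where
  twisted : ∀ r : ℚ, r.den ∣ N → r.den.Coprime D → r.den ≠ 1 →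
    ‖∑ w ∈ Ω, (u (X w) : ℂ) * ee (r * X w)‖ ≤ T * E
  count : |∑ w ∈ Ω, u (X w) - θ * Ω.card| ≤ (T - θ) * E

variable {ι : Type*} {Ω : Finset ι} {X : ι → ℕ} {N : ℕ} {E : ℝ}

lemma SieveWeight.one
    (h : ∀ r : ℚ, r.den ∣ N → r.den ≠ 1 → ‖∑ w ∈ Ω, ee (r * X w)‖ ≤ E) :
    SieveWeight Ω X N E (fun _ => 1) 1 1 1 where
  twisted r h1 _ h2 := by simpa using h r h1 h2
  count := by simp

lemma den_add_div_prime {r : ℚ} {D l j : ℕ} (hl : l.Prime) (hlD : l.Coprime D) (hlN : l ∣ N)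
    (hN : r.den ∣ N) (hD : r.den.Coprime D) (hrl : r.den.Coprime l) (hj0 : 0 < j) (hj : j < l) :
    (r + (j : ℚ) / l).den ∣ N ∧ (r + (j : ℚ) / l).den.Coprime D ∧ (r + (j : ℚ) / l).den ≠ 1 := by
  have hjl : j.Coprime l := (Nat.Coprime.symm ((Nat.Prime.coprime_iff_not_dvd hl).2 (Nat.not_dvd_of_pos_of_lt hj0 hj)))
  have hden : ((j : ℚ) / l).den = l := by
    have := Rat.den_div_eq_of_coprime (a := (j : ℤ)) (b := (l : ℤ)) (by exact_mod_cast hl.pos)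
      (by simpa using hjl)
    simpa using this
  have h1 := Rat.add_den_dvd_lcm r ((j : ℚ) / l)
  rw [hden] at h1
  refine ⟨h1.trans (Nat.lcm_dvd hN hlN), ?_, fun h => ?_⟩
  · refine Nat.Coprime.coprime_dvd_left (h1.trans (Nat.lcm_dvd_mul _ _)) ?_
    exact Nat.Coprime.mul_left hD hlD
  · have h2 := Rat.add_den_dvd_lcm (r + (j : ℚ) / l) (-r)
    rw [show r + (j : ℚ) / l + -r = (j : ℚ) / l by ring, hden, h, Rat.neg_den, Nat.lcm_one_left] at h2
    have h3 := Nat.Coprime.eq_one_of_dvd hrl.symm h2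
    exact hl.one_lt.ne' h3

/-- Decomposition of the weighted sum over `l ∣ X` into twisted sums. -/
lemma sum_weight_dvd (u : ℕ → ℝ) {l : ℕ} (hl : 0 < l) (r : ℚ) :
    ∑ w ∈ Ω, ((if l ∣ X w then u (X w) else 0 : ℝ) : ℂ) * ee (r * X w) =
      (1 / l : ℂ) * (∑ w ∈ Ω, (u (X w) : ℂ) * ee (r * X w) + ∑ j ∈ Finset.Ico 1 l,
        ∑ w ∈ Ω, (u (X w) : ℂ) * ee ((r + (j : ℚ) / l) * X w)) := by
  have hl0 : (l : ℂ) ≠ 0 := by exact_mod_cast hl.ne'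
  have h0 : ∑ w ∈ Ω, (u (X w) : ℂ) * ee (r * X w) =
      ∑ w ∈ Ω, (u (X w) : ℂ) * ee ((r + ((0 : ℕ) : ℚ) / l) * X w) := by simp
  have hins : Finset.range l = insert 0 (Finset.Ico 1 l) := by
    rw [Finset.range_eq_Ico]
    exact (Finset.insert_Ico_add_one_left_eq_Ico hl).symm
  rw [h0, ← Finset.sum_insert (f := fun j : ℕ => ∑ w ∈ Ω, (u (X w) : ℂ) * ee ((r + (j : ℚ) / l) * X w))
    (by simp), ← hins, Finset.sum_comm, Finset.mul_sum]
  refine Finset.sum_congr rfl fun w _ => ?_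
  have : ∀ j : ℕ, (u (X w) : ℂ) * ee ((r + (j : ℚ) / l) * X w) =
      (u (X w) : ℂ) * ee (r * X w) * ee (j * (((X w : ℕ) : ℤ) / l : ℚ)) := by
    intro j
    rw [mul_assoc, ← ee_add]; congr 2; push_cast; ring
  simp_rw [this]
  rw [← Finset.mul_sum, sum_ee_div hl]
  by_cases h : l ∣ X w
  · rw [if_pos h, if_pos (by exact_mod_cast h)]; field_simp
  · rw [if_neg h, if_neg (by exact_mod_cast h)]; simp

lemma SieveWeight.sum_twists_le {u : ℕ → ℝ} {D : ℕ} {θ T : ℝ} (h : SieveWeight Ω X N E u D θ T)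
    {l : ℕ} (hl : l.Prime) (hlD : l.Coprime D) (hlN : l ∣ N) {r : ℚ}
    (hN : r.den ∣ N) (hD : r.den.Coprime D) (hrl : r.den.Coprime l) :
    ‖∑ j ∈ Finset.Ico 1 l, ∑ w ∈ Ω, (u (X w) : ℂ) * ee ((r + (j : ℚ) / l) * X w)‖ ≤
      (l - 1) * (T * E) := by
  refine (norm_sum_le_of_le _ (f := fun j : ℕ => ∑ w ∈ Ω, (u (X w) : ℂ) * ee ((r + (j : ℚ) / l) * X w))
    (n := fun _ => T * E) fun j hj => ?_).trans ?_
  · rw [Finset.mem_Ico] at hj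
    obtain ⟨h1, h2, h3⟩ := den_add_div_prime hl hlD hlN hN hD hrl hj.1 hj.2
    exact h.twisted _ h1 h2 h3
  · rw [Finset.sum_const, Nat.card_Ico, nsmul_eq_mul, Nat.cast_sub hl.one_lt.le, Nat.cast_one]

lemma SieveWeight.sum_dvd {u : ℕ → ℝ} {D : ℕ} {θ T : ℝ} (h : SieveWeight Ω X N E u D θ T)
    {l : ℕ} (hl : l.Prime) (hlD : l.Coprime D) (hlN : l ∣ N) :
    |∑ w ∈ Ω, (if l ∣ X w then u (X w) else 0) - (1 / l) * ∑ w ∈ Ω, u (X w)| ≤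
      (1 - 1 / l) * (T * E) := by
  have hl0 : (0 : ℝ) < l := by exact_mod_cast hl.pos
  have h1 := sum_weight_dvd (Ω := Ω) (X := X) u hl.pos 0
  have h2 := h.sum_twists_le hl hlD hlN (r := 0) (by simp) (by simp) (by simp)
  simp only [zero_mul, ee_zero, mul_one] at h1
  have h3 : ((∑ w ∈ Ω, (if l ∣ X w then u (X w) else 0) - (1 / l) * ∑ w ∈ Ω, u (X w) : ℝ) : ℂ) =
      (1 / l : ℂ) * ∑ j ∈ Finset.Ico 1 l, ∑ w ∈ Ω, (u (X w) : ℂ) * ee ((0 + (j : ℚ) / l) * X w) := by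
    push_cast
    rw [h1]; ring
  rw [← Real.norm_eq_abs, ← Complex.norm_real, h3, norm_mul]
  have h4 : ‖(1 / l : ℂ)‖ = 1 / l := by simp
  rw [h4]
  calc (1 / l : ℝ) * _ ≤ 1 / l * ((l - 1) * (T * E)) := by gcongr
    _ = _ := by field_simp

lemma SieveWeight.remove {u : ℕ → ℝ} {D : ℕ} {θ T : ℝ} (h : SieveWeight Ω X N E u D θ T)
    {l : ℕ} (hl : l.Prime) (hlD : l.Coprime D) (hlN : l ∣ N) :
    SieveWeight Ω X N E (fun x => if l ∣ x then 0 else u x) (D * l)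
      (θ * (1 - 1 / l)) (2 * T * (1 - 1 / l)) := by
  have hl0 : (0 : ℝ) < l := by exact_mod_cast hl.pos
  have hl1 : (1 : ℝ) < l := by exact_mod_cast hl.one_lt
  have hl2 : 1 / (l : ℝ) ≤ 1 := by rw [div_le_one hl0]; exact hl1.le
  have hsplit : ∀ x : ℕ, (if l ∣ x then 0 else u x) = u x - if l ∣ x then u x else 0 := by
    intro x; split_ifs <;> simp
  constructor
  · intro r h1 h2 h3
    have hD : r.den.Coprime D := h2.coprime_dvd_right (Dvd.intro _ rfl)
    have hrl : r.den.Coprime l := h2.coprime_dvd_right (Dvd.intro_left _ rfl)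
    have h4 := sum_weight_dvd (Ω := Ω) (X := X) u hl.pos r
    have h5 := h.sum_twists_le hl hlD hlN h1 hD hrl
    have h6 := h.twisted r h1 hD h3
    have h7 : ∑ w ∈ Ω, ((if l ∣ X w then 0 else u (X w) : ℝ) : ℂ) * ee (r * X w) =
        (1 - 1 / l : ℝ) * ∑ w ∈ Ω, (u (X w) : ℂ) * ee (r * X w) -
        (1 / l : ℝ) * ∑ j ∈ Finset.Ico 1 l,
          ∑ w ∈ Ω, (u (X w) : ℂ) * ee ((r + (j : ℚ) / l) * X w) := by
      simp_rw [hsplit, Complex.ofReal_sub, sub_mul, Finset.sum_sub_distrib]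
      rw [h4]; push_cast; ring
    rw [h7]
    refine (norm_sub_le _ _).trans ?_
    rw [norm_mul, norm_mul, Complex.norm_real, Complex.norm_real, Real.norm_of_nonneg (by linarith),
      Real.norm_of_nonneg (by positivity)]
    calc _ ≤ (1 - 1 / l : ℝ) * (T * E) + 1 / l * ((l - 1) * (T * E)) := by
          gcongr
      _ = _ := by field_simp; ring
  · have h1 := h.sum_dvd hl hlD hlN
    have h2 := h.count
    simp_rw [hsplit, Finset.sum_sub_distrib]
    rw [abs_le] at h1 h2 ⊢
    have h3 := mul_le_mul_of_nonneg_left h2.1 (by linarith : 0 ≤ 1 - 1 / (l : ℝ))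
    have h4 := mul_le_mul_of_nonneg_left h2.2 (by linarith : 0 ≤ 1 - 1 / (l : ℝ))
    constructor <;> nlinarith

/-- The indicator of avoiding divisibility by all elements of `K`, times a weight. -/
def avoid (K : Finset ℕ) (u : ℕ → ℝ) (x : ℕ) : ℝ := if ∃ l ∈ K, l ∣ x then 0 else u x

lemma SieveWeight.avoid {u : ℕ → ℝ} {D : ℕ} {θ T : ℝ} (h : SieveWeight Ω X N E u D θ T)
    (K : Finset ℕ) (hK : ∀ l ∈ K, l.Prime ∧ l.Coprime D ∧ l ∣ N) :
    SieveWeight Ω X N E (avoid K u) (D * ∏ l ∈ K, l)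
      (θ * ∏ l ∈ K, (1 - 1 / (l : ℝ))) (T * 2 ^ K.card * ∏ l ∈ K, (1 - 1 / (l : ℝ))) := by
  classical
  induction K using Finset.induction_on with
  | empty =>
    have h0 : _root_.avoid ∅ u = u := by funext x; simp [_root_.avoid]
    simpa [h0] using h
  | insert l K hl ih =>
    obtain ⟨h1, h2, h3⟩ := hK l (Finset.mem_insert_self _ _)
    have h4 := ih fun m hm => hK m (Finset.mem_insert_of_mem hm)
    have h5 := h4.remove h1 (Nat.Coprime.mul_right h2 (Nat.Coprime.prod_right fun m hm =>
      (Nat.coprime_primes h1 (hK m (Finset.mem_insert_of_mem hm)).1).2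
        (fun e => hl (e ▸ hm)))) h3
    have h6 : (fun x => if l ∣ x then 0 else _root_.avoid K u x) = _root_.avoid (insert l K) u := by
      funext x
      by_cases hx : l ∣ x <;> simp [_root_.avoid, hx]
    rw [h6] at h5
    rw [Finset.prod_insert hl, Finset.prod_insert hl, Finset.card_insert_of_notMem hl]
    convert h5 using 1 <;> ring

/-- The indicator of `x ≡ 2 (mod 4)` as a sieve weight. -/
lemma SieveWeight.mod_four (hN : 4 ∣ N)
    (h : ∀ r : ℚ, r.den ∣ N → r.den ≠ 1 → ‖∑ w ∈ Ω, ee (r * X w)‖ ≤ E) :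
    SieveWeight Ω X N E (fun x => if x % 4 = 2 then 1 else 0) 2 (1 / 4) 1 := by
  have key : ∀ r : ℚ, ∑ w ∈ Ω, ((if X w % 4 = 2 then 1 else 0 : ℝ) : ℂ) * ee (r * X w) =
      (1 / 4 : ℂ) * ∑ j ∈ Finset.range 4, ee (-(j / 2 : ℚ)) *
        ∑ w ∈ Ω, ee ((r + (j : ℚ) / 4) * X w) := by
    intro r
    simp_rw [Finset.mul_sum]
    rw [Finset.sum_comm]
    refine Finset.sum_congr rfl fun w _ => ?_
    have h1 : ∀ j : ℕ, ee (-(j / 2 : ℚ)) * ee ((r + (j : ℚ) / 4) * X w) =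
        ee (r * X w) * ee (j * ((((X w : ℕ) : ℤ) - 2 : ℤ) / (4 : ℕ) : ℚ)) := by
      intro j
      rw [← ee_add, ← ee_add]; congr 1; push_cast; ring
    simp_rw [h1]
    rw [← Finset.mul_sum, ← Finset.mul_sum, sum_ee_div (by norm_num)]
    by_cases h2 : X w % 4 = 2
    · rw [if_pos h2, if_pos (by omega)]; push_cast; ring
    · rw [if_neg h2, if_neg (by omega)]; push_cast; ring
  have hden : ∀ r : ℚ, r.den ∣ N → r.den.Coprime 2 → ∀ j ∈ Finset.range 4,
      (r.den ≠ 1 ∨ j ≠ 0) → (r + (j : ℚ) / 4).den ∣ N ∧ (r + (j : ℚ) / 4).den ≠ 1 := by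
    intro r h1 h2 j hj h3
    have h4 : ((j : ℚ) / 4).den ∣ 4 := by
      have := Rat.den_dvd (j : ℤ) 4
      rw [Rat.divInt_eq_div] at this
      have h5 : ((((j : ℤ) : ℚ) / ((4 : ℤ) : ℚ)).den) ∣ 4 := by exact_mod_cast this
      simpa using h5
    refine ⟨(Rat.add_den_dvd_lcm _ _).trans (Nat.lcm_dvd h1 (h4.trans hN)), fun h5 => ?_⟩
    have h6 : r.den ∣ 4 := by
      have := Rat.add_den_dvd_lcm (r + (j : ℚ) / 4) (-((j : ℚ) / 4))
      rw [add_neg_cancel_right, h5, Rat.neg_den, Nat.lcm_one_left] at this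
      exact this.trans h4
    have h7 : r.den = 1 :=
      Nat.Coprime.eq_one_of_dvd (Nat.Coprime.pow_right 2 h2) (by simpa using h6)
    have h8 : ((j : ℚ) / 4).den = 1 := by
      have := Rat.add_den_dvd_lcm (r + (j : ℚ) / 4) (-r)
      rw [show r + (j : ℚ) / 4 + -r = (j : ℚ) / 4 by ring, h5, Rat.neg_den, h7] at this
      simpa using this
    have h9 := Rat.coe_int_num_of_den_eq_one h8
    have h10 : ((j : ℤ) : ℚ) = ((4 * ((j : ℚ) / 4).num : ℤ) : ℚ) := by
      push_cast; rw [h9]; ring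
    have h11 : (j : ℤ) = 4 * ((j : ℚ) / 4).num := by exact_mod_cast h10
    rw [Finset.mem_range] at hj
    have h12 : j ≠ 0 := h3.resolve_left (not_not.2 h7)
    omega
  constructor
  · intro r h1 h2 h3
    rw [key r, norm_mul]
    have h4 : ‖∑ j ∈ Finset.range 4, ee (-(j / 2 : ℚ)) * ∑ w ∈ Ω, ee ((r + (j : ℚ) / 4) * X w)‖
        ≤ ∑ j ∈ Finset.range 4, E := norm_sum_le_of_le _ fun j hj => by
      rw [norm_mul, norm_ee, one_mul]
      have := hden r h1 h2 j hj (Or.inl h3)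
      exact h _ this.1 this.2
    simp only [Finset.sum_const, Finset.card_range, nsmul_eq_mul] at h4
    have h5 : ‖(1 / 4 : ℂ)‖ = 1 / 4 := by norm_num
    rw [h5]
    push_cast at h4
    linarith
  · have h1 := key 0
    have h0 : ∑ j ∈ Finset.range 4, ee (-(j / 2 : ℚ)) * ∑ w ∈ Ω, ee ((0 + (j : ℚ) / 4) * X w) =
        Ω.card + ∑ j ∈ Finset.Ico (1 : ℕ) 4, ee (-(j / 2 : ℚ)) *
          ∑ w ∈ Ω, ee ((0 + (j : ℚ) / 4) * X w) := by
      rw [Finset.range_eq_Ico, Finset.sum_eq_sum_Ico_succ_bot (by norm_num)]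
      simp [ee_zero]
    rw [h0] at h1
    simp only [zero_mul, ee_zero, mul_one] at h1
    have h4 : ‖∑ j ∈ Finset.Ico (1 : ℕ) 4, ee (-(j / 2 : ℚ)) * ∑ w ∈ Ω, ee ((0 + (j : ℚ) / 4) * X w)‖
        ≤ ∑ j ∈ Finset.Ico (1 : ℕ) 4, E := norm_sum_le_of_le _ fun j hj => by
      rw [norm_mul, norm_ee, one_mul]
      rw [Finset.mem_Ico] at hj
      have := hden 0 (by simp) (by simp) j (by rw [Finset.mem_range]; exact hj.2)
        (Or.inr (by omega))
      exact h _ this.1 this.2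
    simp only [Finset.sum_const, Nat.card_Ico, nsmul_eq_mul] at h4
    have h2 : ((∑ w ∈ Ω, (if X w % 4 = 2 then 1 else 0 : ℝ) - 1 / 4 * Ω.card : ℝ) : ℂ) =
        (1 / 4 : ℂ) * ∑ j ∈ Finset.Ico (1 : ℕ) 4, ee (-(j / 2 : ℚ)) *
          ∑ w ∈ Ω, ee ((0 + (j : ℚ) / 4) * X w) := by
      push_cast at h1 ⊢
      rw [h1]; ring
    rw [← Real.norm_eq_abs, ← Complex.norm_real, h2, norm_mul]
    have h5 : ‖(1 / 4 : ℂ)‖ = 1 / 4 := by norm_num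
    rw [h5]
    push_cast at h4
    linarith

end Sieve

section CharSum

variable {F : Type*} [Field F] [Fintype F]

lemma MulChar.norm_apply_le_one (χ : MulChar F ℂ) (a : F) : ‖χ a‖ ≤ 1 := by
  by_cases ha : a = 0
  · simp [ha]
  · obtain ⟨ζ, hζ, h⟩ := χ.apply_mem_rootsOfUnity_orderOf ha
    rw [← h]
    refine (Complex.norm_eq_one_of_pow_eq_one (n := orderOf χ) ?_ ?_).le
    · rw [mem_rootsOfUnity] at hζ
      rw [← Units.val_pow_eq_pow_val, hζ, Units.val_one]
    · exact (orderOf_pos χ).ne'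

lemma MulChar.apply_mul_star {χ : MulChar F ℂ} (a b : F) :
    χ a * star (χ b) = χ (a / b) := by
  rw [MulChar.star_apply', MulChar.inv_apply', ← map_mul, div_eq_mul_inv]

lemma MulChar.sum_shift_mul_star {χ : MulChar F ℂ} (hχ : χ ≠ 1) {d : F} (hd : d ≠ 0) :
    ∑ b, χ (b + d) * star (χ b) = -1 := by
  classical
  have h1 : ∑ b, χ (b + d) * star (χ b) = ∑ b ∈ Finset.univ.erase (0 : F), χ (1 + d / b) := by
    rw [← Finset.add_sum_erase _ _ (Finset.mem_univ (0 : F))]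
    simp only [MulChar.map_zero, star_zero, mul_zero, zero_add]
    refine Finset.sum_congr rfl fun b hb => ?_
    have hb0 : b ≠ 0 := Finset.ne_of_mem_erase hb
    rw [MulChar.apply_mul_star]
    congr 1; field_simp
  have h2 : ∑ b ∈ Finset.univ.erase (0 : F), χ (1 + d / b) =
      ∑ x ∈ Finset.univ.erase (1 : F), χ x := by
    refine Finset.sum_nbij' (fun b => 1 + d / b) (fun x => d / (x - 1)) ?_ ?_ ?_ ?_ ?_
    · intro b hb
      simp_all
    · intro x hx
      simp_all [sub_eq_zero]
    · intro b hb
      have : b ≠ 0 := by simpa using hb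
      field_simp; simp [hd]
    · intro x hx
      have : x - 1 ≠ 0 := by simpa [sub_eq_zero] using hx
      field_simp; ring
    · simp
  rw [h1, h2]
  have h3 := Finset.add_sum_erase Finset.univ χ (Finset.mem_univ (1 : F))
  rw [MulChar.sum_eq_zero_of_ne_one hχ, map_one] at h3
  linear_combination h3

/-- A nontrivial multiplicative character sum over an additive subgroup is at most `√|F|`. -/
lemma MulChar.norm_sum_subgroup_le {χ : MulChar F ℂ} (hχ : χ ≠ 1) (W : Finset F)
    (h0 : (0 : F) ∈ W) (hsub : ∀ x ∈ W, ∀ y ∈ W, x - y ∈ W) :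
    ‖∑ w ∈ W, χ w‖ ≤ Real.sqrt (Fintype.card F) := by
  classical
  have hadd : ∀ x ∈ W, ∀ y ∈ W, x + y ∈ W := fun x hx y hy => by
    have := hsub x hx _ (hsub 0 h0 y hy)
    simpa using this
  have hdiag : ∀ w : F, ∑ b, χ (w + b) * star (χ (w + b)) = (Fintype.card F : ℂ) - 1 := by
    intro w
    refine (Equiv.sum_comp (Equiv.addLeft w) (fun b => χ b * star (χ b))).trans ?_
    rw [← Finset.add_sum_erase _ _ (Finset.mem_univ (0 : F))]
    rw [Finset.sum_congr rfl (g := fun _ => (1 : ℂ))]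
    · simp [Finset.card_erase_of_mem, Nat.cast_pred (Fintype.card_pos (α := F))]
    · intro b hb
      have hb0 := Finset.ne_of_mem_erase hb
      rw [MulChar.apply_mul_star, div_self hb0, map_one]
  have hoff : ∀ w w' : F, w ≠ w' → ∑ b, χ (w + b) * star (χ (w' + b)) = -1 := by
    intro w w' hne
    rw [← MulChar.sum_shift_mul_star hχ (sub_ne_zero.2 hne),
      ← Equiv.sum_comp (Equiv.addLeft w') (fun b => χ (b + (w - w')) * star (χ b))]
    refine Finset.sum_congr rfl fun b _ => ?_
    simp only [Equiv.coe_addLeft]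
    congr 2
    ring
  have htot : ∑ b, (∑ w ∈ W, χ (w + b)) * star (∑ w ∈ W, χ (w + b)) =
      W.card * ((Fintype.card F : ℂ) - W.card) := by
    simp_rw [star_sum, Finset.sum_mul_sum]
    rw [Finset.sum_comm]
    have : ∀ w ∈ W, ∑ b, ∑ w' ∈ W, χ (w + b) * star (χ (w' + b)) =
        (Fintype.card F : ℂ) - W.card := by
      intro w hw
      rw [Finset.sum_comm, ← Finset.add_sum_erase _ _ hw, hdiag,
        Finset.sum_congr rfl (g := fun _ => (-1 : ℂ))]
      · rw [Finset.sum_const, Finset.card_erase_of_mem hw, nsmul_eq_mul,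
          Nat.cast_sub (Finset.card_pos.2 ⟨w, hw⟩)]
        push_cast; ring
      · intro w' hw'
        exact hoff w w' (Finset.ne_of_mem_erase hw').symm
    rw [Finset.sum_congr rfl this, Finset.sum_const, nsmul_eq_mul]
  have htot' : ∑ b, ‖∑ w ∈ W, χ (w + b)‖ ^ 2 = W.card * ((Fintype.card F : ℝ) - W.card) := by
    have h : ∀ z : ℂ, z * star z = ((‖z‖ ^ 2 : ℝ) : ℂ) := fun z => by
      rw [Complex.star_def, Complex.mul_conj, Complex.normSq_eq_norm_sq]
    simp_rw [h] at htot
    exact_mod_cast htot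
  have hconst : ∀ b ∈ W, ‖∑ w ∈ W, χ (w + b)‖ ^ 2 = ‖∑ w ∈ W, χ w‖ ^ 2 := by
    intro b hb
    congr 2
    exact Finset.sum_nbij' (fun w => w + b) (fun w => w - b) (fun w hw => hadd _ hw _ hb)
      (fun w hw => hsub _ hw _ hb) (by simp) (by simp) (by simp)
  have hle : W.card * ‖∑ w ∈ W, χ w‖ ^ 2 ≤ W.card * ((Fintype.card F : ℝ) - W.card) := by
    rw [← htot', ← nsmul_eq_mul, ← Finset.sum_const, ← Finset.sum_congr rfl hconst]
    exact Finset.sum_le_univ_sum_of_nonneg fun b => by positivity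
  have hW : (0 : ℝ) < W.card := by exact_mod_cast Finset.card_pos.2 ⟨0, h0⟩
  refine Real.le_sqrt_of_sq_le ?_
  nlinarith

/-- The character of frequency `r` with respect to a discrete logarithm `X` to base `g`. -/
lemma exists_mulChar_ee {g : Fˣ} (hg : ∀ x, x ∈ Subgroup.zpowers g) {X : F → ℕ}
    (hX : ∀ x ≠ 0, (g : F) ^ X x = x) {r : ℚ} (hr : r.den ∣ Fintype.card F - 1) :
    ∃ χ : MulChar F ℂ, (r.den ≠ 1 → χ ≠ 1) ∧ ∀ x ≠ 0, χ x = ee (r * X x) := by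
  classical
  have hpow : ee r ^ Fintype.card Fˣ = 1 := by
    rw [Fintype.card_units, ← ee_nat_mul]
    obtain ⟨k, hk⟩ := hr
    rw [hk]
    have : (((r.den * k : ℕ) : ℚ) * r) = ((k * r.num : ℤ) : ℚ) := by
      push_cast
      rw [mul_comm (r.den : ℚ), mul_assoc, mul_comm (r.den : ℚ), Rat.mul_den_eq_num]
    rw [this]; exact ee_int _
  have hne : ee r ≠ 0 := fun h => by have := norm_ee r; rw [h] at this; simp at this
  set ζ : ℂˣ := Units.mk0 (ee r) hne
  have hζ : ζ ∈ rootsOfUnity (Fintype.card Fˣ) ℂ := by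
    rw [mem_rootsOfUnity]; ext; exact hpow
  have hspec := MulChar.ofRootOfUnity_spec hζ hg
  refine ⟨MulChar.ofRootOfUnity hζ hg, fun h1 h2 => ?_, fun x hx => ?_⟩
  · rw [h2, MulChar.one_apply_coe] at hspec
    exact h1 ((ee_eq_one_iff r).1 hspec.symm)
  · conv_lhs => rw [← hX x hx]
    rw [map_pow, hspec, mul_comm, ee_nat_mul]; rfl

end CharSum

section Kernel

variable {Fq F : Type*} [Field Fq] [Field F] [Fintype Fq] [Fintype F] [Algebra Fq F]

lemma zero_mem_kerSet (f : Fq[X]) : (0 : F) ∈ kerSet F f := by rw [mem_kerSet, map_zero]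

lemma dvd_div_of_isCoprime {D P R : Fq[X]} (hP : P ≠ 0) (hPD : P ∣ D) (hRD : R ∣ D)
    (hco : IsCoprime P R) : R ∣ D / P := by
  obtain ⟨k, rfl⟩ := hco.mul_dvd hPD hRD
  rw [mul_assoc, mul_div_cancel_left₀ _ hP]
  exact Dvd.intro _ rfl

lemma norm_sum_exactSet_le {χ : MulChar F ℂ} (hχ : χ ≠ 1) (S : Finset Fq[X]) (D : Fq[X])
    (hS : ∀ P ∈ S, P ≠ 0 ∧ P ∣ D) (hco : (S : Set Fq[X]).Pairwise IsCoprime) :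
    ‖∑ w ∈ exactSet F D S, χ w‖ ≤ 2 ^ S.card * Real.sqrt (Fintype.card F) := by
  classical
  induction S using Finset.induction_on generalizing D with
  | empty =>
    rw [exactSet_empty]
    simpa using MulChar.norm_sum_subgroup_le hχ _ (zero_mem_kerSet D) (fun x hx y hy => by
      rw [mem_kerSet] at *; rw [map_sub, hx, hy, sub_zero])
  | insert P S hPS ih =>
    rw [Finset.coe_insert, Set.pairwise_insert_of_symm] at hco
    have hP := hS P (Finset.mem_insert_self _ _)
    have hS' : ∀ R ∈ S, R ≠ 0 ∧ R ∣ D := fun R hR => hS R (Finset.mem_insert_of_mem hR)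
    have hPR : ∀ R ∈ S, IsCoprime P R := fun R hR =>
      hco.2 R hR (fun h => hPS (h ▸ hR))
    obtain ⟨h1, h2⟩ := exactSet_insert (F := F) hP.1 hP.2
      (fun R hR => ⟨(hS' R hR).1, (hS' R hR).2, hPR R hR⟩)
    have h3 := ih D hS' hco.1
    have h4 := ih (D / P) (fun R hR =>
      ⟨(hS' R hR).1, dvd_div_of_isCoprime hP.1 hP.2 (hS' R hR).2 (hPR R hR)⟩) hco.1
    rw [h2, ← add_sub_cancel_right (∑ w ∈ _ \ _, χ w) (∑ w ∈ exactSet F (D / P) S, χ w),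
      Finset.sum_sdiff h1, Finset.card_insert_of_notMem hPS, pow_succ]
    refine (norm_sub_le _ _).trans ?_
    linarith

lemma card_exactSet (S : Finset Fq[X]) (D : Fq[X]) (hD : D ∣ X ^ Module.finrank Fq F - 1)
    (hS : ∀ P ∈ S, P ≠ 0 ∧ P ∣ D) (hco : (S : Set Fq[X]).Pairwise IsCoprime) :
    ((exactSet F D S).card : ℝ) = (Fintype.card Fq : ℝ) ^ D.natDegree *
      ∏ P ∈ S, (1 - 1 / (Fintype.card Fq : ℝ) ^ P.natDegree) := by
  classical
  have hq : (0 : ℝ) < Fintype.card Fq := by exact_mod_cast Fintype.card_pos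
  induction S using Finset.induction_on generalizing D with
  | empty => rw [exactSet_empty, card_kerSet hD]; simp
  | insert P S hPS ih =>
    rw [Finset.coe_insert, Set.pairwise_insert_of_symm] at hco
    have hP := hS P (Finset.mem_insert_self _ _)
    have hS' : ∀ R ∈ S, R ≠ 0 ∧ R ∣ D := fun R hR => hS R (Finset.mem_insert_of_mem hR)
    have hPR : ∀ R ∈ S, IsCoprime P R := fun R hR =>
      hco.2 R hR (fun h => hPS (h ▸ hR))
    obtain ⟨h1, h2⟩ := exactSet_insert (F := F) hP.1 hP.2
      (fun R hR => ⟨(hS' R hR).1, (hS' R hR).2, hPR R hR⟩)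
    have hPd : P * (D / P) = D := EuclideanDomain.mul_div_cancel' hP.1 hP.2
    have hX : (X ^ Module.finrank Fq F - 1 : Fq[X]) ≠ 0 :=
      X_pow_sub_C_ne_zero Module.finrank_pos 1
    have hD0 : D ≠ 0 := ne_zero_of_dvd_ne_zero hX hD
    have hDP0 : D / P ≠ 0 := fun h => hD0 (by rw [← hPd, h, mul_zero])
    have h3 := ih D hD hS' hco.1
    have h4 := ih (D / P) (dvd_trans (Dvd.intro_left P hPd) hD) (fun R hR =>
      ⟨(hS' R hR).1, dvd_div_of_isCoprime hP.1 hP.2 (hS' R hR).2 (hPR R hR)⟩) hco.1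
    have hdeg : D.natDegree = P.natDegree + (D / P).natDegree := by
      rw [← natDegree_mul hP.1 hDP0, hPd]
    rw [h2, Finset.card_sdiff_of_subset h1, Nat.cast_sub (Finset.card_le_card h1), h3, h4,
      Finset.prod_insert hPS, hdeg, pow_add]
    field_simp

lemma aeval_frob_const_mul {c : F} (hc : c ^ Fintype.card Fq = c) (h : Fq[X]) (x : F) :
    aeval (frob Fq F) h (c * x) = c * aeval (frob Fq F) h x := by
  have hci : ∀ i : ℕ, c ^ Fintype.card Fq ^ i = c := by
    intro i
    induction i with
    | zero => simp
    | succ i ih => rw [pow_succ, pow_mul, ih, hc]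
  rw [aeval_eq_sum_range]
  simp only [LinearMap.sum_apply, LinearMap.smul_apply, frob_pow_apply, mul_pow, hci,
    Finset.mul_sum, mul_smul_comm]

lemma const_mul_mem_exactSet {c : F} (hc0 : c ≠ 0) (hc : c ^ Fintype.card Fq = c) {D : Fq[X]}
    {S : Finset Fq[X]} {x : F} (hx : x ∈ exactSet F D S) : c * x ∈ exactSet F D S := by
  rw [mem_exactSet] at *
  simp only [mem_kerSet, aeval_frob_const_mul hc, mul_eq_zero, hc0, false_or] at *
  exact hx

end Kernel

section Criterion

/-- A residue coprime to `M` up to a factor two lifts to an index with `gcd` two. -/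
lemma exists_gcd_eq_two {N M k : ℕ} (hN : 0 < N) (hMN : M ∣ N) (h2 : 2 ∣ N)
    (hk : ∀ l : ℕ, l.Prime → l ≠ 2 → l ∣ M → ¬ l ∣ k) (hpar : ¬ 2 ∣ M ∨ k % 4 = 2) :
    ∃ x, x ≡ k [MOD M] ∧ Nat.gcd x N = 2 := by
  have hM : 0 < M := Nat.pos_of_dvd_of_pos hMN hN
  obtain ⟨k', h1, h3⟩ : ∃ k', Nat.Coprime k' M ∧ 2 * k' ≡ k [MOD M] := by
    rcases hpar with h | h
    · have hco : Nat.Coprime 2 M := (Nat.Prime.coprime_iff_not_dvd Nat.prime_two).2 h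
      have hkM : Nat.Coprime k M := Nat.coprime_of_dvd fun l hl hlk hlM =>
        hk l hl (fun e => h (e ▸ hlM)) hlM hlk
      refine ⟨k * (M + 1) / 2, ?_, ?_⟩
      · have h4 : 2 * (k * (M + 1) / 2) = k * (M + 1) :=
          Nat.mul_div_cancel' (Dvd.dvd.mul_left (by omega) _)
        have h5 : Nat.Coprime (2 * (k * (M + 1) / 2)) M := by
          rw [h4]; exact Nat.Coprime.mul_left hkM (by simp)
        exact Nat.Coprime.coprime_mul_left h5
      · have h4 : 2 * (k * (M + 1) / 2) = k * (M + 1) :=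
          Nat.mul_div_cancel' (Dvd.dvd.mul_left (by omega) _)
        rw [h4, mul_add, mul_one, Nat.ModEq]
        simp
    · refine ⟨k / 2, ?_, by rw [show 2 * (k / 2) = k by omega]⟩
      refine Nat.coprime_of_dvd fun l hl hlk hlM => ?_
      by_cases hl2 : l = 2
      · subst hl2; omega
      · exact hk l hl hl2 hlM (hlk.trans (Dvd.intro 2 (by omega)))
  have : NeZero N := ⟨hN.ne'⟩
  obtain ⟨u, hu⟩ := ZMod.unitsMap_surjective (m := N) (n := M) hMN (ZMod.unitOfCoprime k' h1)
  refine ⟨2 * (u : ZMod N).val, ?_, ?_⟩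
  · refine Nat.ModEq.trans ?_ h3
    refine Nat.ModEq.mul_left 2 ?_
    rw [← ZMod.natCast_eq_natCast_iff]
    have := congrArg Units.val hu
    rw [ZMod.unitsMap_val, ZMod.coe_unitOfCoprime] at this
    rw [← this, ZMod.natCast_val]
  · have := ZMod.val_coe_unit_coprime u
    obtain ⟨N', rfl⟩ := h2
    rw [Nat.gcd_mul_left]
    rw [Nat.Coprime.coprime_dvd_right (Dvd.intro_left 2 rfl) this]

variable {Fq F : Type*} [Field Fq] [Field F] [Fintype Fq] [Fintype F] [Algebra Fq F]

/-- An element of the right `F_q`-order whose index avoids the odd primes of `M` can be scaled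
by `F_q` to be 2-primitive. -/
lemma exists_scaled {f : Fq[X]} {S : Finset Fq[X]} {g : Fˣ} (hg : ∀ x, x ∈ Subgroup.zpowers g)
    {M k : ℕ} (hM : Fintype.card F - 1 = M * (Fintype.card Fq - 1))
    (h2 : 2 ∣ Fintype.card F - 1)
    (hk : ∀ l : ℕ, l.Prime → l ≠ 2 → l ∣ M → ¬ l ∣ k) (hpar : ¬ 2 ∣ M ∨ k % 4 = 2)
    (hα : (g : F) ^ k ∈ exactSet F f S) :
    ∃ β ∈ exactSet F f S, β ≠ 0 ∧ 2 * orderOf β = Fintype.card F - 1 := by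
  classical
  have hN : 0 < Fintype.card F - 1 := by have := Fintype.one_lt_card (α := F); omega
  have hord : orderOf g = Fintype.card F - 1 := by
    rw [orderOf_eq_card_of_forall_mem_zpowers hg, Nat.card_eq_fintype_card, Fintype.card_units]
  obtain ⟨x, hx1, hx2⟩ := exists_gcd_eq_two hN (Dvd.intro _ hM.symm) h2 hk hpar
  have hc : (g ^ x) ^ (Fintype.card Fq - 1) = (g ^ k) ^ (Fintype.card Fq - 1) := by
    rw [← pow_mul, ← pow_mul, pow_eq_pow_iff_modEq, hord, hM]
    exact Nat.ModEq.mul_right' _ hx1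
  have hg0 : (g : F) ≠ 0 := g.ne_zero
  have hc' : ((g : F) ^ x / (g : F) ^ k) ^ (Fintype.card Fq - 1) = 1 := by
    rw [div_pow, div_eq_one_iff_eq (by positivity)]
    exact_mod_cast congrArg Units.val hc
  have hq : Fintype.card Fq = Fintype.card Fq - 1 + 1 := by
    have := Fintype.one_lt_card (α := Fq); omega
  refine ⟨(g : F) ^ x, ?_, by positivity, ?_⟩
  · have := const_mul_mem_exactSet (c := (g : F) ^ x / (g : F) ^ k) (by positivity)
      (by rw [hq, pow_succ, hc', one_mul]) hα
    rwa [div_mul_cancel₀ _ (by positivity)] at this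
  · rw [← Units.val_pow_eq_pow_val, orderOf_units, orderOf_pow, hord, Nat.gcd_comm, hx2]
    exact Nat.mul_div_cancel' h2

end Criterion

section Sieve

/-- The combined sieve: the primes of `K` are treated exactly, those of `R` and the exceptional
sets `Ω j` by a union bound. -/
lemma exists_of_sieve {ι κ : Type*} {Ω₀ : Finset ι} {J : Finset κ} {Ω : κ → Finset ι}
    {X : ι → ℕ} {N D : ℕ} {E θ : ℝ} {u : ℕ → ℝ} (hu : ∀ x, u x = 0 ∨ u x = 1)
    (h₀ : SieveWeight Ω₀ X N E u D θ 1) (hΩ : ∀ j ∈ J, SieveWeight (Ω j) X N E u D θ 1)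
    {K R : Finset ℕ} (hK : ∀ l ∈ K, l.Prime ∧ l.Coprime D ∧ l ∣ N)
    (hR : ∀ l ∈ R, l.Prime ∧ l.Coprime D ∧ l ∣ N) (hKR : Disjoint K R)
    (hσ : ∑ l ∈ R, 1 / (l : ℝ) ≤ 1)
    (hmain : E * ((2 ^ K.card - θ) * (1 - ∑ l ∈ R, 1 / (l : ℝ) + J.card) +
        2 ^ K.card * ∑ l ∈ R, (1 - 1 / (l : ℝ))) <
      θ * ((1 - ∑ l ∈ R, 1 / (l : ℝ)) * Ω₀.card - ∑ j ∈ J, ((Ω j).card : ℝ))) :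
    ∃ w ∈ Ω₀, (∀ j ∈ J, w ∉ Ω j) ∧ u (X w) = 1 ∧ (∀ l ∈ K, ¬ l ∣ X w) ∧ ∀ l ∈ R, ¬ l ∣ X w := by
  classical
  by_contra! hcon
  set v := avoid K u with hv
  have hv01 : ∀ x, v x = 0 ∨ v x = 1 := by
    intro x
    rw [hv, avoid]
    split_ifs
    · exact Or.inl rfl
    · exact hu x
  have hv0 : ∀ x, 0 ≤ v x := fun x => by rcases hv01 x with h | h <;> rw [h] <;> norm_num
  set P : ℝ := ∏ l ∈ K, (1 - 1 / (l : ℝ)) with hP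
  have hPpos : 0 < P := Finset.prod_pos fun l hl => by
    have : (1 : ℝ) < l := by exact_mod_cast (hK l hl).1.one_lt
    rw [sub_pos, div_lt_one (by linarith)]; exact this
  have a₀ := h₀.avoid K hK
  have aΩ := fun j hj => (hΩ j hj).avoid K hK
  rw [← hP] at a₀
  simp only [← hP, one_mul] at a₀ aΩ
  have hpt : ∀ w ∈ Ω₀, v (X w) ≤ ∑ j ∈ J, (if w ∈ Ω j then v (X w) else 0) +
      ∑ l ∈ R, (if l ∣ X w then v (X w) else 0) := by
    intro w hw
    have n1 : 0 ≤ ∑ j ∈ J, (if w ∈ Ω j then v (X w) else 0) :=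
      Finset.sum_nonneg fun j _ => by split_ifs <;> [exact hv0 _; exact le_rfl]
    have n2 : 0 ≤ ∑ l ∈ R, (if l ∣ X w then v (X w) else 0) :=
      Finset.sum_nonneg fun j _ => by split_ifs <;> [exact hv0 _; exact le_rfl]
    by_cases hz : v (X w) = 0
    · linarith
    have hK' : ¬ ∃ l ∈ K, l ∣ X w := fun h => hz (by rw [hv, avoid, if_pos h])
    have hu1 : u (X w) = 1 := by
      have h1 := (hv01 (X w)).resolve_left hz
      rw [hv, avoid, if_neg hK'] at h1; exact h1
    by_cases hJ : ∃ j ∈ J, w ∈ Ω j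
    · obtain ⟨j, hj, hwj⟩ := hJ
      have := Finset.single_le_sum (f := fun j => if w ∈ Ω j then v (X w) else 0)
        (fun j _ => by split_ifs <;> [exact hv0 _; exact le_rfl]) hj
      simp only [hwj, if_true] at this
      linarith
    · push Not at hJ hK'
      obtain ⟨l, hl, hlw⟩ := hcon w hw hJ hu1 hK'
      have := Finset.single_le_sum (f := fun l => if l ∣ X w then v (X w) else 0)
        (fun j _ => by split_ifs <;> [exact hv0 _; exact le_rfl]) hl
      simp only [hlw, if_true] at this
      linarith
  have hsum := Finset.sum_le_sum hpt
  rw [Finset.sum_add_distrib, Finset.sum_comm, Finset.sum_comm (t := R)] at hsum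
  have hj : ∀ j ∈ J, ∑ w ∈ Ω₀, (if w ∈ Ω j then v (X w) else 0) ≤
      θ * P * (Ω j).card + (2 ^ K.card * P - θ * P) * E := by
    intro j hj
    have h1 := (abs_le.1 (aΩ j hj).count).2
    refine le_trans ?_ (sub_le_iff_le_add'.1 h1)
    rw [← Finset.sum_filter]
    exact Finset.sum_le_sum_of_subset_of_nonneg (fun w hw => (Finset.mem_filter.1 hw).2)
      fun w _ _ => hv0 _
  have hl : ∀ l ∈ R, ∑ w ∈ Ω₀, (if l ∣ X w then v (X w) else 0) ≤
      1 / (l : ℝ) * ∑ w ∈ Ω₀, v (X w) + (1 - 1 / (l : ℝ)) * (2 ^ K.card * P * E) := by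
    intro l hl
    obtain ⟨h1, h2, h3⟩ := hR l hl
    have h4 := (abs_le.1 (a₀.sum_dvd h1 (Nat.Coprime.mul_right h2
      (Nat.Coprime.prod_right fun m hm => (Nat.coprime_primes h1 (hK m hm).1).2
        (fun e => Finset.disjoint_left.1 hKR hm (e ▸ hl)))) h3)).2
    linarith
  have s1 := Finset.sum_le_sum hj
  have s2 := Finset.sum_le_sum hl
  rw [Finset.sum_add_distrib, ← Finset.mul_sum, Finset.sum_const, nsmul_eq_mul] at s1
  rw [Finset.sum_add_distrib, ← Finset.sum_mul, ← Finset.sum_mul] at s2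
  have c0 := (abs_le.1 a₀.count).1
  have c1 := mul_le_mul_of_nonneg_left c0 (sub_nonneg.2 hσ)
  have c2 := mul_lt_mul_of_pos_left hmain hPpos
  nlinarith

end Sieve

section Criterion

variable {Fq F : Type*} [Field Fq] [Field F] [Fintype Fq] [Fintype F] [Algebra Fq F]

/-- Data of the sieve over the finite field: `K`, `R` split the odd primes of `M` and
`θ` records whether the index has to be prescribed modulo four. -/
structure PrimeSplit (M N : ℕ) (θ : ℝ) (K R : Finset ℕ) : Prop where
  prime : ∀ l ∈ K ∪ R, l.Prime ∧ l ≠ 2 ∧ l ∣ M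
  cover : ∀ l : ℕ, l.Prime → l ≠ 2 → l ∣ M → l ∈ K ∪ R
  disj : Disjoint K R
  parity : (¬ 2 ∣ M ∧ θ = 1) ∨ (4 ∣ N ∧ θ = 1 / 4)

lemma sieveWeight_base {κ : Type*} {N : ℕ} {E θ : ℝ} {M : ℕ}
    (hpar : (¬ 2 ∣ M ∧ θ = 1) ∨ (4 ∣ N ∧ θ = 1 / 4)) :
    ∃ u : ℕ → ℝ, ∃ D : ℕ, (D = 1 ∨ D = 2) ∧ (∀ x, u x = 0 ∨ u x = 1) ∧
      (∀ x, u x = 1 → ¬ 2 ∣ M ∨ x % 4 = 2) ∧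
      ∀ (Ω : Finset κ) (X : κ → ℕ),
      (∀ r : ℚ, r.den ∣ N → r.den ≠ 1 → ‖∑ w ∈ Ω, ee (r * X w)‖ ≤ E) →
        SieveWeight Ω X N E u D θ 1 := by
  rcases hpar with ⟨h, rfl⟩ | ⟨h, rfl⟩
  · exact ⟨fun _ => 1, 1, Or.inl rfl, fun _ => Or.inr rfl, fun _ _ => Or.inl h,
      fun Ω X hX => SieveWeight.one hX⟩
  · refine ⟨fun x => if x % 4 = 2 then 1 else 0, 2, Or.inr rfl, fun x => ?_, fun x hx => ?_,
      fun Ω X hX => SieveWeight.mod_four h hX⟩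
    · dsimp only; split_ifs <;> simp
    · right; by_contra h'; simp [h'] at hx

lemma exists_dlog : ∃ (g : Fˣ) (X : F → ℕ), (∀ x, x ∈ Subgroup.zpowers g) ∧
    ∀ x ≠ 0, (g : F) ^ X x = x := by
  classical
  obtain ⟨g, hg⟩ := IsCyclic.exists_generator (α := Fˣ)
  have : ∀ x : F, ∃ k : ℕ, x ≠ 0 → (g : F) ^ k = x := by
    intro x
    by_cases hx : x = 0
    · exact ⟨0, fun h => absurd hx h⟩
    · obtain ⟨k, hk⟩ := (mem_powers_iff_mem_zpowers).2 (hg (Units.mk0 x hx))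
      exact ⟨k, fun _ => by simpa using congrArg Units.val hk⟩
  choose X hX using this
  exact ⟨g, X, hg, hX⟩

theorem exists_of_criterion {f : Fq[X]} (hf : f.Monic) (hfn : f ∣ X ^ Module.finrank Fq F - 1)
    {S S₁ S₂ : Finset Fq[X]} (hS : ∀ P, P ∈ S ↔ P.Monic ∧ Irreducible P ∧ P ∣ f)
    (hSne : S.Nonempty) (hS12 : ∀ P, P ∈ S ↔ P ∈ S₁ ∨ P ∈ S₂) (hdisj : Disjoint S₁ S₂)
    {M : ℕ} {θ : ℝ} {K R : Finset ℕ} (hM : Fintype.card F - 1 = M * (Fintype.card Fq - 1))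
    (h2 : 2 ∣ Fintype.card F - 1) (hs : PrimeSplit M (Fintype.card F - 1) θ K R)
    (hσ : ∑ l ∈ R, 1 / (l : ℝ) ≤ 1)
    (hmain : 2 ^ S₁.card * √(Fintype.card F) *
        ((2 ^ K.card - θ) * (1 - ∑ l ∈ R, 1 / (l : ℝ) + S₂.card) +
          2 ^ K.card * ∑ l ∈ R, (1 - 1 / (l : ℝ))) <
      θ * ((Fintype.card Fq : ℝ) ^ f.natDegree *
        (∏ P ∈ S₁, (1 - 1 / (Fintype.card Fq : ℝ) ^ P.natDegree)) *
        (1 - ∑ l ∈ R, 1 / (l : ℝ) - ∑ P ∈ S₂, 1 / (Fintype.card Fq : ℝ) ^ P.natDegree))) :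
    ∃ α : F, α ≠ 0 ∧ 2 * orderOf α = Fintype.card F - 1 ∧
      IsFqOrder (Fintype.card Fq) (Module.finrank Fq F) f α := by
  classical
  obtain ⟨g, X, hg, hX⟩ := exists_dlog (F := F)
  set q : ℝ := ((Fintype.card Fq : ℕ) : ℝ) with hq
  have hq0 : 0 < q := by rw [hq]; exact_mod_cast Fintype.card_pos
  set E : ℝ := 2 ^ S₁.card * √(Fintype.card F) with hE
  have hSP : ∀ P ∈ S, P ≠ 0 ∧ P ∣ f := fun P hP =>
    ⟨((hS P).1 hP).2.1.ne_zero, ((hS P).1 hP).2.2⟩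
  have hco : (S : Set Fq[X]).Pairwise IsCoprime := by
    intro P hP Q hQ hne
    obtain ⟨hPm, hPi, -⟩ := (hS P).1 hP
    obtain ⟨hQm, hQi, -⟩ := (hS Q).1 hQ
    refine (hPi.coprime_iff_not_dvd).2 fun hd => hne ?_
    exact eq_of_monic_of_associated hPm hQm (hPi.associated_of_dvd hQi hd)
  have hS1S : ∀ P ∈ S₁, P ∈ S := fun P hP => (hS12 P).2 (Or.inl hP)
  have hS2S : ∀ P ∈ S₂, P ∈ S := fun P hP => (hS12 P).2 (Or.inr hP)
  have hco1 : (S₁ : Set Fq[X]).Pairwise IsCoprime := hco.mono hS1S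
  have hS2 : ∀ P ∈ S₂, ∀ Q ∈ S₁, IsCoprime P Q := fun P hP Q hQ =>
    hco (hS2S P hP) (hS1S Q hQ) fun e => Finset.disjoint_left.1 hdisj hQ (e ▸ hP)
  have hS1d : ∀ P ∈ S₂, ∀ Q ∈ S₁, Q ≠ 0 ∧ Q ∣ f / P := fun P hP Q hQ =>
    ⟨(hSP Q (hS1S Q hQ)).1, dvd_div_of_isCoprime (hSP P (hS2S P hP)).1 (hSP P (hS2S P hP)).2
      (hSP Q (hS1S Q hQ)).2 (hS2 P hP Q hQ)⟩
  have hchar : ∀ D : Fq[X], (∀ P ∈ S₁, P ≠ 0 ∧ P ∣ D) → ∀ r : ℚ, r.den ∣ Fintype.card F - 1 →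
      r.den ≠ 1 → ‖∑ w ∈ (exactSet F D S₁).erase 0, ee (r * X w)‖ ≤ E := by
    intro D hD r h1 h3
    obtain ⟨χ, hχ, hχX⟩ := exists_mulChar_ee hg hX h1
    have h4 := norm_sum_exactSet_le (hχ h3) S₁ D hD hco1
    have h5 : ∑ w ∈ (exactSet F D S₁).erase 0, ee (r * X w) = ∑ w ∈ exactSet F D S₁, χ w := by
      rw [← Finset.sum_erase (exactSet F D S₁) (MulChar.map_zero χ)]
      exact Finset.sum_congr rfl fun w hw => (hχX w (Finset.ne_of_mem_erase hw)).symm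
    rw [h5]; exact h4
  obtain ⟨u, D, hD, hu, hu4, hw⟩ := sieveWeight_base (κ := F) (E := E) hs.parity
  have hlD : ∀ l ∈ K ∪ R, l.Prime ∧ l.Coprime D ∧ l ∣ Fintype.card F - 1 := by
    intro l hl
    obtain ⟨h1, h3, h4⟩ := hs.prime l hl
    refine ⟨h1, ?_, h4.trans (Dvd.intro _ hM.symm)⟩
    rcases hD with rfl | rfl
    · simp
    · exact (Nat.coprime_primes h1 Nat.prime_two).2 h3
  have hcard0 : ∀ D : Fq[X], ((exactSet F D S₁).erase 0).card + (if S₁ = ∅ then 1 else 0 : ℝ) =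
      (exactSet F D S₁).card := by
    intro D
    split_ifs with h
    · subst h
      rw [exactSet_empty, Finset.card_erase_of_mem (zero_mem_kerSet D),
        Nat.cast_sub (Finset.card_pos.2 ⟨0, zero_mem_kerSet D⟩)]
      simp
    · obtain ⟨P, hP⟩ := Finset.nonempty_iff_ne_empty.2 h
      rw [Finset.erase_eq_of_notMem, add_zero]
      intro h0
      exact (mem_exactSet.1 h0).2 P hP (zero_mem_kerSet _)
  set δ := ∏ P ∈ S₁, (1 - 1 / q ^ P.natDegree) with hδ
  have hA : ((exactSet F f S₁).card : ℝ) = q ^ f.natDegree * δ :=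
    card_exactSet S₁ f hfn (fun P hP => hSP P (hS1S P hP)) hco1
  have hAP : ∀ P ∈ S₂, ((exactSet F (f / P) S₁).card : ℝ) =
      q ^ f.natDegree * δ * (1 / q ^ P.natDegree) := by
    intro P hP
    obtain ⟨hP0, hPf⟩ := hSP P (hS2S P hP)
    have hPd : P * (f / P) = f := EuclideanDomain.mul_div_cancel' hP0 hPf
    have hdeg : f.natDegree = P.natDegree + (f / P).natDegree := by
      rw [← natDegree_mul hP0 (fun h => hf.ne_zero (by rw [← hPd, h, mul_zero])), hPd]
    rw [card_exactSet S₁ (f / P) (dvd_trans (Dvd.intro_left P hPd) hfn) (hS1d P hP) hco1, hdeg,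
      pow_add]
    rw [← hq, ← hδ]
    field_simp
  obtain ⟨w, hw0, hwJ, hwu, hwK, hwR⟩ := exists_of_sieve (J := S₂) (θ := θ)
    (Ω := fun P => (exactSet F (f / P) S₁).erase 0) (Ω₀ := (exactSet F f S₁).erase 0) hu
    (hw _ X (hchar f fun P hP => hSP P (hS1S P hP)))
    (fun P hP => hw _ X (hchar _ (hS1d P hP)))
    (K := K) (R := R) (fun l hl => hlD l (Finset.mem_union_left _ hl))
    (fun l hl => hlD l (Finset.mem_union_right _ hl)) hs.disj hσ (by
      refine lt_of_lt_of_le hmain ?_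
      have hθ : 0 ≤ θ := by rcases hs.parity with ⟨-, h⟩ | ⟨-, h⟩ <;> rw [h] <;> norm_num
      refine mul_le_mul_of_nonneg_left ?_ hθ
      set z : ℝ := if S₁ = ∅ then 1 else 0 with hz
      have e0 : (((exactSet F f S₁).erase 0).card : ℝ) = q ^ f.natDegree * δ - z := by
        rw [← hA, ← hcard0]; ring
      have e1 : ∑ P ∈ S₂, (((exactSet F (f / P) S₁).erase 0).card : ℝ) =
          q ^ f.natDegree * δ * ∑ P ∈ S₂, 1 / q ^ P.natDegree - S₂.card * z := by
        rw [Finset.mul_sum, ← nsmul_eq_mul, ← Finset.sum_const, ← Finset.sum_sub_distrib]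
        refine Finset.sum_congr rfl fun P hP => ?_
        rw [← hAP P hP, ← hcard0]; ring
      rw [e0, e1]
      have hzS : 0 ≤ (S₂.card - (1 - ∑ l ∈ R, 1 / (l : ℝ))) * z := by
        rw [hz]
        split_ifs with h
        · rw [mul_one]
          have h1 : 1 ≤ S₂.card := by
            obtain ⟨P, hP⟩ := hSne
            refine Finset.card_pos.2 ⟨P, ((hS12 P).1 hP).resolve_left (by simp [h])⟩
          have h3 : (1 : ℝ) ≤ S₂.card := by exact_mod_cast h1
          have h4 : 0 ≤ ∑ l ∈ R, 1 / (l : ℝ) := Finset.sum_nonneg fun l _ => by positivity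
          linarith
        · simp
      nlinarith)
  have hw00 : w ≠ 0 := Finset.ne_of_mem_erase hw0
  have hwS : w ∈ exactSet F f S := by
    have hwf := Finset.mem_of_mem_erase hw0
    rw [mem_exactSet]
    refine ⟨(mem_exactSet.1 hwf).1, fun P hP => ?_⟩
    rcases (hS12 P).1 hP with h | h
    · exact (mem_exactSet.1 hwf).2 P h
    · have h1 := exactSet_insert (F := F) (hSP P hP).1 (hSP P hP).2 (S := S₁) fun Q hQ =>
        ⟨(hSP Q (hS1S Q hQ)).1, (hSP Q (hS1S Q hQ)).2, hS2 P h Q hQ⟩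
      have h3 : w ∈ exactSet F f (insert P S₁) := by
        rw [h1.2, Finset.mem_sdiff]
        exact ⟨hwf, fun h' => hwJ P h (Finset.mem_erase.2 ⟨hw00, h'⟩)⟩
      exact (mem_exactSet.1 h3).2 P (Finset.mem_insert_self _ _)
  obtain ⟨β, hβ, hβ0, hβo⟩ := exists_scaled hg hM h2 (k := X w)
    (fun l h1 h3 h4 => by
      rcases Finset.mem_union.1 (hs.cover l h1 h3 h4) with h | h
      · exact hwK l h
      · exact hwR l h) (hu4 _ hwu) (by rw [hX w hw00]; exact hwS)
  exact ⟨β, hβ0, hβo, isFqOrder_of_mem_exactSet hf hfn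
    (fun P h1 h3 h4 => (hS P).2 ⟨h1, h3, h4⟩) hβ⟩

end Criterion

section Necessity

variable {Fq F : Type*} [Field Fq] [Field F] [Fintype Fq] [Fintype F] [Algebra Fq F]

/-- A root of `X ^ n - 1` lying in a field with `Q` elements is trivial if `n` is coprime
to `Q - 1`. -/
lemma eq_one_of_coprime_card {L : Type*} [Field L] [Fintype L] {n : ℕ} {a : L}
    (ha : a ^ n = 1) (hn : 0 < n) (hco : Nat.Coprime n (Fintype.card L - 1)) : a = 1 := by
  have ha0 : a ≠ 0 := by
    rintro rfl
    rw [zero_pow hn.ne'] at ha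
    exact zero_ne_one ha
  have h1 : orderOf a ∣ n := orderOf_dvd_of_pow_eq_one ha
  have h2 : orderOf a ∣ Fintype.card L - 1 :=
    orderOf_dvd_of_pow_eq_one (FiniteField.pow_card_sub_one_eq_one a ha0)
  rw [← orderOf_eq_one_iff]
  exact Nat.dvd_one.1 (hco ▸ Nat.dvd_gcd h1 h2)

lemma gcd_ne_one_of_quadratic_dvd {n : ℕ} (hn : 0 < n) {g : Fq[X]} (hg : g.natDegree = 2)
    (hgm : g.Monic) (hgn : g ∣ X ^ n - 1) :
    Nat.gcd (Fintype.card Fq ^ 3 - Fintype.card Fq) n ≠ 1 := by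
  intro hco
  set q := Fintype.card Fq with hq
  have hq1 : 1 < q := Fintype.one_lt_card
  have hfac : q ^ 3 - q = q * (q ^ 2 - 1) := by
    rw [Nat.mul_sub, mul_one, ← pow_succ']
  have hfac2 : q ^ 2 - 1 = (q + 1) * (q - 1) := by
    simpa using Nat.sq_sub_sq q 1
  rw [hfac] at hco
  have hcq : Nat.Coprime n q := (Nat.Coprime.coprime_mul_right hco).symm
  have hc2 : Nat.Coprime n (q ^ 2 - 1) := (Nat.Coprime.coprime_mul_left hco).symm
  have hc1 : Nat.Coprime n (q - 1) :=
    Nat.Coprime.coprime_dvd_right (hfac2 ▸ Dvd.intro_left _ rfl) hc2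
  have hroot1 : ∀ a : Fq, g.IsRoot a → a = 1 := fun a ha => by
    refine eq_one_of_coprime_card (n := n) ?_ hn hc1
    have := (ha.dvd hgn)
    simpa [sub_eq_zero] using this
  by_cases hirr : Irreducible g
  · have : Fact (Irreducible g) := ⟨hirr⟩
    have hfin : Module.Finite Fq (AdjoinRoot g) := (AdjoinRoot.powerBasis hirr.ne_zero).finite
    have : Finite (AdjoinRoot g) := Module.finite_of_finite Fq
    have : Fintype (AdjoinRoot g) := Fintype.ofFinite _
    have hcard : Fintype.card (AdjoinRoot g) = q ^ 2 := by
      rw [Module.card_eq_pow_finrank (K := Fq),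
        PowerBasis.finrank (AdjoinRoot.powerBasis hirr.ne_zero), AdjoinRoot.powerBasis_dim, hg]
    have h0 : aeval (AdjoinRoot.root g) (X ^ n - 1 : Fq[X]) = 0 :=
      aeval_eq_zero_of_dvd_aeval_eq_zero hgn (by simp)
    have h1 : AdjoinRoot.root g = 1 := by
      refine eq_one_of_coprime_card (n := n) ?_ hn (by rw [hcard]; exact hc2)
      simpa [sub_eq_zero] using h0
    have h2 : g.IsRoot 1 := by
      have h3 : aeval (AdjoinRoot.root g) g = 0 := by simp
      rw [h1, ← map_one (algebraMap Fq (AdjoinRoot g)), aeval_algebraMap_apply] at h3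
      simpa using h3
    have h4 := degree_eq_one_of_irreducible_of_root hirr h2
    rw [degree_eq_natDegree hirr.ne_zero, hg] at h4
    norm_num at h4
  · rw [hgm.irreducible_iff_roots_eq_zero_of_degree_le_three (by omega) (by omega)] at hirr
    obtain ⟨a, ha⟩ := Multiset.exists_mem_of_ne_zero hirr
    have ha' := (mem_roots hgm.ne_zero).1 ha
    obtain rfl := hroot1 a ha'
    obtain ⟨k, hk⟩ := dvd_iff_isRoot.2 ha'
    have hkd : k.natDegree = 1 := by
      have hk0 : k ≠ 0 := by rintro rfl; rw [mul_zero] at hk; exact hgm.ne_zero hk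
      have := congrArg natDegree hk
      rw [natDegree_mul (X_sub_C_ne_zero _) hk0, natDegree_X_sub_C, hg] at this
      omega
    obtain ⟨b, hb⟩ := exists_root_of_degree_eq_one (p := k) (by
      rw [degree_eq_natDegree (by rintro rfl; simp at hkd), hkd]; rfl)
    obtain rfl := hroot1 b (hb.dvd (Dvd.intro_left _ hk.symm))
    obtain ⟨m, rfl⟩ := dvd_iff_isRoot.2 hb
    obtain ⟨c, hc⟩ := hgn
    have hd := congrArg (fun f => (derivative f).eval 1) hc
    rw [hk] at hd
    simp [derivative_mul, derivative_X_pow] at hd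
    have hp : ringChar Fq ∣ n := (ringChar.spec Fq n).1 hd
    have hpq : ringChar Fq ∣ q := (ringChar.spec Fq q).1 (by rw [hq]; exact Nat.cast_card_eq_zero Fq)
    have := Nat.dvd_gcd hp hpq
    rw [hcq] at this
    have := Nat.dvd_one.1 this
    exact CharP.ringChar_ne_one this

/-- If the order divides a small number the element cannot be 2-primitive. -/
lemma le_of_pow_eq_one {q n k : ℕ} {α : F} (hα : 2 * orderOf α = q ^ n - 1) (h : α ^ k = 1)
    (hk : 0 < k) : q ^ n - 1 ≤ 2 * k := by
  rw [← hα]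
  exact Nat.mul_le_mul_left 2 (orderOf_le_of_pow_eq_one hk h)

theorem necessity {q n : ℕ} (hn : 0 < n) (hcard : Fintype.card Fq = q) {α : F} (hα0 : α ≠ 0)
    (hα : 2 * orderOf α = q ^ n - 1) (hnormal : IsKNormal Fq q n 2 α) :
    Odd q ∧ ((5 ≤ n ∧ Nat.gcd (q ^ 3 - q) n ≠ 1) ∨ (n = 4 ∧ q % 4 = 1)) := by
  have hq1 : 1 < q := by rw [← hcard]; exact Fintype.one_lt_card
  have hodd : Odd q := by
    by_contra h
    rw [Nat.not_odd_iff_even] at h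
    have h1 : 0 < q ^ n := by positivity
    obtain ⟨m, hm⟩ := (Nat.even_pow.2 ⟨h, hn.ne'⟩ : Even (q ^ n))
    omega
  refine ⟨hodd, ?_⟩
  obtain ⟨h, ⟨hm, hd, hact, -⟩, hdeg⟩ := hnormal
  obtain ⟨g, hg⟩ := hd
  have hXn : (X ^ n - 1 : Fq[X]).Monic := monic_X_pow_sub_C 1 hn.ne'
  have hgm : g.Monic := hm.of_mul_monic_left (hg ▸ hXn)
  have hsum : n = h.natDegree + g.natDegree := by
    rw [← natDegree_mul hm.ne_zero hgm.ne_zero, ← hg]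
    exact (natDegree_X_pow_sub_C (r := (1 : Fq))).symm
  have hpow0 : ∀ k, α ^ k ≠ 0 := fun k => pow_ne_zero _ hα0
  subst hcard
  rw [polyAct_eq_aeval] at hact
  set q := Fintype.card Fq with hq
  have hdeg0 : h.natDegree ≠ 0 := by
    intro h0
    rw [hm.natDegree_eq_zero.1 h0] at hact
    simp at hact
    exact hα0 hact
  rcases (by omega : n = 3 ∨ n = 4 ∨ 5 ≤ n) with rfl | rfl | h5
  · exfalso
    have h1 : h.natDegree = 1 := by omega
    obtain ⟨c, rfl⟩ : ∃ c : Fq, h = X - C c :=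
      ⟨-h.coeff 0, by rw [map_neg, sub_neg_eq_add]; exact hm.eq_X_add_C h1⟩
    simp [frob_apply, sub_eq_zero, Algebra.smul_def] at hact
    have hc3 : c ^ 3 = 1 := by
      have := congrArg (eval c) hg
      simpa [sub_eq_zero] using this
    have hα1 : α ^ (3 * (q - 1)) = 1 := by
      have h2 : α * (α ^ (q - 1) - algebraMap Fq F c) = 0 := by
        rw [mul_sub, ← pow_succ', Nat.sub_add_cancel hq1.le, hact]; ring
      rw [mul_comm 3, pow_mul, sub_eq_zero.1 ((mul_eq_zero.1 h2).resolve_left hα0), ← map_pow, hc3,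
        map_one]
    have h3 := le_of_pow_eq_one hα hα1 (by omega)
    obtain ⟨m, hm'⟩ : ∃ m, q = m + 1 := ⟨q - 1, by omega⟩
    rw [hm'] at h3 hq1
    have : (m + 1) ^ 3 ≤ 6 * m + 1 := by omega
    nlinarith [sq_nonneg m, Nat.zero_le (m ^ 3)]
  · right
    refine ⟨rfl, ?_⟩
    by_contra hq4
    have hq3 : q % 4 = 3 := by obtain ⟨k, hk⟩ := hodd; omega
    have hns : ¬ IsSquare (-1 : Fq) := by
      rw [FiniteField.isSquare_neg_one_iff]; simp [← hq, hq3]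
    have hdx : (X ^ 2 + 1 : Fq[X]).natDegree = 2 := by
      simpa using (natDegree_X_pow_add_C (n := 2) (r := (1 : Fq)))
    have hmx : (X ^ 2 + 1 : Fq[X]).Monic := by
      simpa using monic_X_pow_add_C (1 : Fq) (n := 2) (by norm_num)
    have hirr : Irreducible (X ^ 2 + 1 : Fq[X]) := by
      rw [hmx.irreducible_iff_roots_eq_zero_of_degree_le_three (by omega) (by omega)]
      refine Multiset.eq_zero_of_forall_notMem fun a ha => hns ⟨a, ?_⟩
      have := (mem_roots hmx.ne_zero).1 ha
      simp only [IsRoot, eval_add, eval_pow, eval_X, eval_one] at this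
      linear_combination -this
    have hfac : (X ^ 4 - 1 : Fq[X]) = (X ^ 2 + 1) * (X ^ 2 - 1) := by ring
    have hdvd : (X ^ 2 + 1 : Fq[X]) ∣ h * g := by rw [← hg, hfac]; exact Dvd.intro _ rfl
    have hdegh : h.natDegree = 2 := by omega
    have hα1 : α ^ q ^ 2 = α ∨ α ^ q ^ 2 = -α := by
      rcases hirr.prime.dvd_or_dvd hdvd with h1 | h1
      · right
        have h2 := eq_of_monic_of_dvd_of_natDegree_le hmx hm h1 (by omega)
        rw [h2] at hact
        simp only [map_add, map_pow, aeval_X, map_one, LinearMap.add_apply, frob_pow_apply,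
          Module.End.one_apply] at hact
        exact eq_neg_of_add_eq_zero_left hact
      · left
        have h2 := eq_of_monic_of_dvd_of_natDegree_le hmx hgm h1 (by omega)
        have h3 : h = X ^ 2 - 1 := by
          rw [h2, hfac, mul_comm h] at hg
          exact (mul_left_cancel₀ hgm.ne_zero (h2 ▸ hg)).symm
        rw [h3] at hact
        simp only [map_sub, map_pow, aeval_X, map_one, LinearMap.sub_apply, frob_pow_apply,
          Module.End.one_apply] at hact
        exact sub_eq_zero.1 hact
    have hq2 : 1 < q ^ 2 := Nat.one_lt_pow (by norm_num) hq1
    have hα2 : α ^ (2 * (q ^ 2 - 1)) = 1 := by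
      have h1 : α ^ (q ^ 2 - 1) = 1 ∨ α ^ (q ^ 2 - 1) = -1 := by
        rcases hα1 with h | h
        · left
          apply mul_left_cancel₀ hα0
          rw [← pow_succ', Nat.sub_add_cancel hq2.le, h, mul_one]
        · right
          apply mul_left_cancel₀ hα0
          rw [← pow_succ', Nat.sub_add_cancel hq2.le, h]; ring
      rw [mul_comm, pow_mul]
      rcases h1 with h | h <;> rw [h] <;> norm_num
    have h3 := le_of_pow_eq_one hα hα2 (by omega)
    obtain ⟨m, hm'⟩ : ∃ m, q ^ 2 = m + 1 := ⟨q ^ 2 - 1, by omega⟩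
    have h4 : q ^ 4 = (m + 1) ^ 2 := by rw [← hm']; ring
    rw [h4, hm'] at h3
    have h5 : (m + 1) ^ 2 ≤ 4 * m + 1 := by omega
    have h6 : 9 ≤ q ^ 2 := by
      have : 3 ≤ q := by omega
      nlinarith
    nlinarith
  · left
    exact ⟨h5, gcd_ne_one_of_quadratic_dvd (by omega) (by omega) hgm (hg ▸ Dvd.intro_left _ rfl)⟩

end Necessity

section Factors

variable {Fq : Type*} [Field Fq] [Fintype Fq]

open UniqueFactorizationMonoid in
/-- The finset of monic irreducible factors. -/
def monicFactors (f : Fq[X]) : Finset Fq[X] :=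
  letI := Classical.decEq Fq
  (normalizedFactors f).toFinset

lemma mem_monicFactors {f : Fq[X]} (hf : f ≠ 0) {P : Fq[X]} :
    P ∈ monicFactors f ↔ P.Monic ∧ Irreducible P ∧ P ∣ f := by
  let := Classical.decEq Fq
  rw [monicFactors, Multiset.mem_toFinset, UniqueFactorizationMonoid.mem_normalizedFactors_iff' hf]
  constructor
  · rintro ⟨h1, h2, h3⟩
    exact ⟨h2 ▸ monic_normalize h1.ne_zero, h1, h3⟩
  · rintro ⟨h1, h2, h3⟩
    exact ⟨h2, h1.normalize_eq_self, h3⟩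

lemma sum_natDegree_monicFactors {f : Fq[X]} (hf : f.Monic) (hsq : Squarefree f) :
    ∑ P ∈ monicFactors f, P.natDegree = f.natDegree := by
  let := Classical.decEq Fq
  have h1 := (UniqueFactorizationMonoid.squarefree_iff_nodup_normalizedFactors hf.ne_zero).1 hsq
  have h2 : (UniqueFactorizationMonoid.normalizedFactors f).prod = f := by
    rw [UniqueFactorizationMonoid.prod_normalizedFactors_eq hf.ne_zero, hf.normalize_eq_self]
  conv_rhs => rw [← h2]
  rw [natDegree_multiset_prod _ (UniqueFactorizationMonoid.zero_notMem_normalizedFactors f),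
    monicFactors, Finset.sum, Multiset.toFinset_val, Multiset.dedup_eq_self.2 h1]

lemma dvd_X_pow_gcd_sub_one {P : Fq[X]} {a b : ℕ} (ha : P ∣ X ^ a - 1) (hb : P ∣ X ^ b - 1) :
    P ∣ X ^ Nat.gcd a b - 1 := by
  rw [← AdjoinRoot.mk_eq_zero, map_sub, map_one, map_pow, sub_eq_zero] at *
  exact pow_gcd_eq_one.2 ⟨ha, hb⟩

lemma X_pow_sub_one_dvd {a b : ℕ} (h : a ∣ b) : (X ^ a - 1 : Fq[X]) ∣ X ^ b - 1 := by
  obtain ⟨c, rfl⟩ := h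
  simpa [pow_mul] using sub_dvd_pow_sub_pow (X ^ a : Fq[X]) 1 c

lemma monic_X_pow_sub_one {n : ℕ} (hn : 0 < n) : (X ^ n - 1 : Fq[X]).Monic :=
  monic_X_pow_sub_C 1 hn.ne'

lemma natDegree_X_pow_sub_one (n : ℕ) : (X ^ n - 1 : Fq[X]).natDegree = n :=
  natDegree_X_pow_sub_C (r := (1 : Fq))

lemma filter_monicFactors_X_pow_sub_one {n : ℕ} (hn : 0 < n) {k : ℕ} :
    (monicFactors (X ^ n - 1 : Fq[X])).filter (fun P => P.natDegree ∣ k) =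
      monicFactors (X ^ Nat.gcd n (Fintype.card Fq ^ k - 1) - 1) := by
  have hq : 0 < Fintype.card Fq ^ k := pow_pos Fintype.card_pos _
  ext P
  rw [Finset.mem_filter, mem_monicFactors (monic_X_pow_sub_one hn).ne_zero,
    mem_monicFactors (monic_X_pow_sub_one (Nat.gcd_pos_of_pos_left _ hn)).ne_zero]
  have hX : (X ^ Fintype.card Fq ^ k - X : Fq[X]) = X * (X ^ (Fintype.card Fq ^ k - 1) - 1) := by
    rw [mul_sub, ← pow_succ', Nat.sub_add_cancel hq, mul_one]
  constructor
  · rintro ⟨⟨h1, h2, h3⟩, h4⟩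
    refine ⟨h1, h2, dvd_X_pow_gcd_sub_one h3 ?_⟩
    rw [h2.natDegree_dvd_iff_dvd_X_pow_card_pow_sub_X, Nat.card_eq_fintype_card, hX] at h4
    refine (h2.prime.dvd_or_dvd h4).resolve_left fun h5 => h2.not_isUnit ?_
    have h6 : P ∣ X ^ n := h5.trans (dvd_pow_self X hn.ne')
    exact isUnit_of_dvd_one (by simpa using dvd_sub h6 h3)
  · rintro ⟨h1, h2, h3⟩
    refine ⟨⟨h1, h2, h3.trans (X_pow_sub_one_dvd (Nat.gcd_dvd_left _ _))⟩, ?_⟩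
    rw [h2.natDegree_dvd_iff_dvd_X_pow_card_pow_sub_X, Nat.card_eq_fintype_card, hX]
    exact Dvd.dvd.mul_left (h3.trans (X_pow_sub_one_dvd (Nat.gcd_dvd_right _ _))) _

lemma squarefree_X_pow_sub_one {n : ℕ} (hn : (n : Fq) ≠ 0) : Squarefree (X ^ n - 1 : Fq[X]) :=
  (separable_X_pow_sub_C (1 : Fq) hn one_ne_zero).squarefree

/-- Numbers of linear, quadratic and higher irreducible factors of `X ^ n - 1`, `n ≠ 0` in `Fq`. -/
lemma card_filter_monicFactors {n : ℕ} (hn : (n : Fq) ≠ 0) :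
    ((monicFactors (X ^ n - 1 : Fq[X])).filter fun P => P.natDegree = 1).card =
        Nat.gcd n (Fintype.card Fq - 1) ∧
    ((monicFactors (X ^ n - 1 : Fq[X])).filter fun P => P.natDegree = 2).card =
        (Nat.gcd n (Fintype.card Fq ^ 2 - 1) - Nat.gcd n (Fintype.card Fq - 1)) / 2 ∧
    ((monicFactors (X ^ n - 1 : Fq[X])).filter fun P => 3 ≤ P.natDegree).card ≤
        (n - Nat.gcd n (Fintype.card Fq ^ 2 - 1)) / 3 := by
  classical
  have hn0 : 0 < n := Nat.pos_of_ne_zero fun h => hn (by simp [h])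
  set S := monicFactors (X ^ n - 1 : Fq[X]) with hS
  have hpos : ∀ P ∈ S, 0 < P.natDegree := fun P hP =>
    ((mem_monicFactors (monic_X_pow_sub_one hn0).ne_zero).1 hP).2.1.natDegree_pos
  have hsum : ∀ k, ∑ P ∈ S.filter (fun P => P.natDegree ∣ k), P.natDegree =
      Nat.gcd n (Fintype.card Fq ^ k - 1) := by
    intro k
    have hd : Nat.gcd n (Fintype.card Fq ^ k - 1) ∣ n := Nat.gcd_dvd_left _ _
    rw [hS, filter_monicFactors_X_pow_sub_one hn0, sum_natDegree_monicFactors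
      (monic_X_pow_sub_one (Nat.gcd_pos_of_pos_left _ hn0))
      ((squarefree_X_pow_sub_one hn).squarefree_of_dvd (X_pow_sub_one_dvd hd)),
      natDegree_X_pow_sub_one]
  have htot : ∑ P ∈ S, P.natDegree = n := by
    rw [hS, sum_natDegree_monicFactors (monic_X_pow_sub_one hn0) (squarefree_X_pow_sub_one hn),
      natDegree_X_pow_sub_one]
  have h1 := hsum 1
  have h2 := hsum 2
  have e1 : S.filter (fun P => P.natDegree ∣ 1) = S.filter fun P => P.natDegree = 1 :=
    Finset.filter_congr fun P _ => Nat.dvd_one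
  have e2 : S.filter (fun P => P.natDegree ∣ 2) =
      (S.filter fun P => P.natDegree = 1) ∪ S.filter fun P => P.natDegree = 2 := by
    rw [← Finset.filter_or]
    exact Finset.filter_congr fun P _ => Nat.dvd_prime Nat.prime_two
  have d2 : Disjoint (S.filter fun P => P.natDegree = 1) (S.filter fun P => P.natDegree = 2) :=
    Finset.disjoint_filter.2 fun P _ h => by omega
  have s1 : ∑ P ∈ S.filter (fun P => P.natDegree = 1), P.natDegree =
      (S.filter fun P => P.natDegree = 1).card := by
    rw [Finset.sum_congr rfl fun P hP => (Finset.mem_filter.1 hP).2]; simp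
  have s2 : ∑ P ∈ S.filter (fun P => P.natDegree = 2), P.natDegree =
      (S.filter fun P => P.natDegree = 2).card * 2 := by
    rw [Finset.sum_congr rfl fun P hP => (Finset.mem_filter.1 hP).2]; simp
  rw [e1, s1, pow_one] at h1
  have h3 := Finset.sum_filter_add_sum_filter_not S (fun P => P.natDegree ∣ 2)
    (fun P => P.natDegree)
  rw [htot, h2] at h3
  rw [e2, Finset.sum_union d2, s1, s2, h1] at h2
  have e3 : S.filter (fun P => ¬ P.natDegree ∣ 2) = S.filter fun P => 3 ≤ P.natDegree := by
    refine Finset.filter_congr fun P hP => ?_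
    have := hpos P hP
    rw [Nat.dvd_prime Nat.prime_two]; omega
  have s3 : (S.filter fun P => 3 ≤ P.natDegree).card * 3 ≤
      ∑ P ∈ S.filter (fun P => 3 ≤ P.natDegree), P.natDegree := by
    rw [← smul_eq_mul]
    exact Finset.card_nsmul_le_sum _ _ _ fun P hP => (Finset.mem_filter.1 hP).2
  rw [e3] at h3
  refine ⟨h1, by omega, by omega⟩

end Factors

section Factors

variable {Fq : Type*} [Field Fq] [Fintype Fq]

/-- Upper bounds for the numbers of linear, quadratic and higher irreducible factors of a
suitable divisor of `X ^ n - 1` of degree `n - 2`. -/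
def factorCounts (q n : ℕ) : ℕ × ℕ × ℕ :=
  if n.gcd (q ^ n) = 1 then
    if 2 ≤ n.gcd (q - 1) then
      (n.gcd (q - 1) - 2, (n.gcd (q ^ 2 - 1) - n.gcd (q - 1)) / 2, (n - n.gcd (q ^ 2 - 1)) / 3)
    else
      (n.gcd (q - 1), (n.gcd (q ^ 2 - 1) - n.gcd (q - 1)) / 2 - 1, (n - n.gcd (q ^ 2 - 1)) / 3)
  else
    (n.gcd (q - 1), (n.gcd (q ^ 2 - 1) - n.gcd (q - 1)) / 2,
      (n / n.gcd (q ^ n) - n.gcd (q ^ 2 - 1)) / 3)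

/-- The irreducible factors of `f` are bounded in number by `c`, sorted by degree. -/
structure FactorBound (f : Fq[X]) (c : ℕ × ℕ × ℕ) : Prop where
  one : ((monicFactors f).filter fun P => P.natDegree = 1).card ≤ c.1
  two : ((monicFactors f).filter fun P => P.natDegree = 2).card ≤ c.2.1
  three : ((monicFactors f).filter fun P => 3 ≤ P.natDegree).card ≤ c.2.2

/-- Cofactor of a squarefree divisor of a squarefree polynomial. -/
lemma monicFactors_cofactor {h f g : Fq[X]} (hh : h.Monic) (hsq : Squarefree h) (hfg : h = g * f) :
    ∀ P ∈ monicFactors f, P ∈ monicFactors h ∧ ¬ P ∣ g := by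
  intro P hP
  have hf : f ≠ 0 := by rintro rfl; rw [mul_zero] at hfg; exact hh.ne_zero hfg
  rw [mem_monicFactors hf] at hP
  rw [mem_monicFactors hh.ne_zero]
  refine ⟨⟨hP.1, hP.2.1, hP.2.2.trans (hfg ▸ Dvd.intro_left _ rfl)⟩, fun hg => ?_⟩
  exact hP.2.1.not_isUnit (hsq P (hfg ▸ mul_dvd_mul hg hP.2.2))

lemma exists_cofactor {n d : ℕ} (hn : 0 < n) {g : Fq[X]} (hg : g.Monic) (hd : g.natDegree = d)
    (hgn : g ∣ X ^ n - 1) :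
    ∃ f : Fq[X], f.Monic ∧ f ∣ X ^ n - 1 ∧ f.natDegree = n - d ∧ X ^ n - 1 = g * f := by
  obtain ⟨f, hf⟩ := hgn
  have hfm : f.Monic := hg.of_mul_monic_left (hf ▸ monic_X_pow_sub_one hn)
  refine ⟨f, hfm, hf ▸ Dvd.intro_left _ rfl, ?_, hf⟩
  have := congrArg natDegree hf
  rw [natDegree_X_pow_sub_one, natDegree_mul hg.ne_zero hfm.ne_zero, hd] at this
  omega

lemma factorBound_of_coprime {n : ℕ} (hn : (n : Fq) ≠ 0) {f g : Fq[X]}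
    (hfg : X ^ n - 1 = g * f) {T : Finset Fq[X]} {d : ℕ}
    (hT : T ⊆ (monicFactors (X ^ n - 1 : Fq[X])).filter fun P => P.natDegree = d)
    (hTg : ∀ P ∈ T, P ∣ g) :
    FactorBound f (n.gcd (Fintype.card Fq - 1) - (if d = 1 then T.card else 0),
      (n.gcd (Fintype.card Fq ^ 2 - 1) - n.gcd (Fintype.card Fq - 1)) / 2 -
        (if d = 2 then T.card else 0), (n - n.gcd (Fintype.card Fq ^ 2 - 1)) / 3) := by
  classical
  have hn0 : 0 < n := Nat.pos_of_ne_zero fun h => hn (by simp [h])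
  obtain ⟨h1, h2, h3⟩ := card_filter_monicFactors hn
  have key := monicFactors_cofactor (monic_X_pow_sub_one hn0) (squarefree_X_pow_sub_one hn) hfg
  have hsub : ∀ e, (monicFactors f).filter (fun P => P.natDegree = e) ⊆
      ((monicFactors (X ^ n - 1 : Fq[X])).filter fun P => P.natDegree = e) \
        (if d = e then T else ∅) := by
    intro e P hP
    rw [Finset.mem_filter] at hP
    rw [Finset.mem_sdiff, Finset.mem_filter]
    refine ⟨⟨(key P hP.1).1, hP.2⟩, fun h => ?_⟩
    split_ifs at h
    · exact (key P hP.1).2 (hTg P h)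
    · simp at h
  refine ⟨?_, ?_, ?_⟩ <;> dsimp only
  · refine (Finset.card_le_card (hsub 1)).trans ?_
    by_cases h : d = 1
    · subst h; simp [Finset.card_sdiff_of_subset hT, h1]
    · simp [h, h1]
  · refine (Finset.card_le_card (hsub 2)).trans ?_
    by_cases h : d = 2
    · subst h; simp [Finset.card_sdiff_of_subset hT, h2]
    · simp [h, h2]
  · refine (Finset.card_le_card fun P hP => ?_).trans h3
    rw [Finset.mem_filter] at hP ⊢
    exact ⟨(key P hP.1).1, hP.2⟩

theorem exists_factor_data {q n : ℕ} (hcard : Fintype.card Fq = q) (hn : 3 ≤ n) (hodd : Odd q)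
    (hgcd : Nat.gcd (q ^ 3 - q) n ≠ 1) :
    ∃ f : Fq[X], f.Monic ∧ f ∣ X ^ n - 1 ∧ f.natDegree = n - 2 ∧
      FactorBound f (factorCounts q n) := by
  classical
  obtain ⟨p, hpc⟩ := CharP.exists Fq
  obtain ⟨k, hp, hpk⟩ := FiniteField.card Fq p
  have := Fact.mk hp
  have hk : 0 < (k : ℕ) := k.pos
  have hq1 : 1 < q := hcard ▸ Fintype.one_lt_card
  have hqpk : q = p ^ (k : ℕ) := by rw [← hcard, hpk]
  have hcast : ∀ m : ℕ, (m : Fq) = 0 ↔ p ∣ m := fun m => CharP.cast_eq_zero_iff Fq p m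
  have hn0 : 0 < n := by omega
  have hfac : q ^ 3 - q = q * (q ^ 2 - 1) := by rw [Nat.mul_sub, mul_one, ← pow_succ']
  by_cases hpn : p ∣ n
  · obtain ⟨a, m, hpm, hnm⟩ := Nat.exists_eq_pow_mul_and_not_dvd hn0.ne' p hp.ne_one
    have ha : a ≠ 0 := by rintro rfl; rw [pow_zero, one_mul] at hnm; exact hpm (hnm ▸ hpn)
    have hpa : 3 ≤ p ^ a := by
      have h2 : p ≠ 2 := by
        rintro rfl
        rw [hqpk] at hodd
        exact absurd hodd (Nat.not_odd_iff_even.2 (Nat.even_pow.2 ⟨even_two, hk.ne'⟩))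
      have := hp.two_le
      exact le_trans (by omega) (Nat.le_self_pow ha p)
    have hm0 : 0 < m := Nat.pos_of_ne_zero fun h => hpm (h ▸ dvd_zero p)
    have hpow : (X ^ n - 1 : Fq[X]) = (X ^ m - 1) ^ p ^ a := by
      rw [sub_pow_char_pow, one_pow, ← pow_mul, mul_comm m, ← hnm]
    have hcop : ∀ j, 0 < j → n.gcd (q ^ j - 1) = m.gcd (q ^ j - 1) := by
      intro j hj
      rw [hnm]
      refine Nat.Coprime.gcd_mul_left_cancel _ (Nat.Coprime.pow_left _ ?_)
      refine (hp.coprime_iff_not_dvd).2 fun h => ?_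
      have h1 : p ∣ q ^ j := dvd_pow (hqpk ▸ dvd_pow_self p hk.ne') hj.ne'
      have h2 := (Nat.dvd_sub_iff_right (Nat.one_le_pow _ _ (by omega)) h1).1 h
      exact hp.one_lt.ne' (Nat.dvd_one.1 h2)
    have hgn : n.gcd (q ^ n) = p ^ a := by
      refine Nat.dvd_antisymm ?_ (Nat.dvd_gcd (hnm ▸ Dvd.intro _ rfl) ?_)
      · have h1 : Nat.Coprime (n.gcd (q ^ n)) m := by
          refine Nat.Coprime.coprime_dvd_left (Nat.gcd_dvd_right _ _) ?_
          rw [hqpk, ← pow_mul]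
          exact Nat.Coprime.pow_left _ ((hp.coprime_iff_not_dvd).2 hpm)
        exact h1.dvd_of_dvd_mul_right (hnm ▸ Nat.gcd_dvd_left n (q ^ n))
      · rw [hqpk, ← pow_mul]
        refine pow_dvd_pow p ?_
        have h1 : a < p ^ a := Nat.lt_pow_self hp.one_lt
        have h2 : p ^ a ≤ n := Nat.le_of_dvd hn0 (hnm ▸ Dvd.intro _ rfl)
        nlinarith
    obtain ⟨f, hf, hfd, hfdeg, hfg⟩ := exists_cofactor (Fq := Fq) hn0 (g := (X - 1) ^ 2) (d := 2)
      (by simpa using (monic_X_sub_C (1 : Fq)).pow 2)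
      (by rw [natDegree_pow, ← C_1, natDegree_X_sub_C])
      (by
        rw [hpow]
        refine (pow_dvd_pow _ (by omega : 2 ≤ p ^ a)).trans (pow_dvd_pow_of_dvd ?_ _)
        simpa using X_pow_sub_one_dvd (Fq := Fq) (one_dvd m))
    refine ⟨f, hf, hfd, hfdeg, ?_⟩
    obtain ⟨h1, h2, h3⟩ := card_filter_monicFactors (Fq := Fq) (n := m)
      (by rw [Ne, hcast]; exact hpm)
    have hsub : monicFactors f ⊆ monicFactors (X ^ m - 1) := by
      intro P hP
      rw [mem_monicFactors hf.ne_zero] at hP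
      rw [mem_monicFactors (monic_X_pow_sub_one hm0).ne_zero]
      exact ⟨hP.1, hP.2.1, hP.2.1.prime.dvd_of_dvd_pow (hpow ▸ hP.2.2.trans hfd)⟩
    have hfc : factorCounts q n = (m.gcd (q - 1), (m.gcd (q ^ 2 - 1) - m.gcd (q - 1)) / 2,
        (m - m.gcd (q ^ 2 - 1)) / 3) := by
      have e1 := hcop 1 one_pos
      rw [pow_one] at e1
      rw [factorCounts, if_neg (by rw [hgn]; omega), hgn, e1, hcop 2 two_pos,
        show n / p ^ a = m by rw [hnm, Nat.mul_div_cancel_left _ (by omega)]]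
    rw [hfc, ← hcard]
    exact ⟨(Finset.card_le_card (Finset.filter_subset_filter _ hsub)).trans h1.le,
      (Finset.card_le_card (Finset.filter_subset_filter _ hsub)).trans h2.le,
      (Finset.card_le_card (Finset.filter_subset_filter _ hsub)).trans h3⟩
  · have hnF : (n : Fq) ≠ 0 := by rw [Ne, hcast]; exact hpn
    have hgn : n.gcd (q ^ n) = 1 := by
      rw [hqpk, ← pow_mul]
      exact Nat.Coprime.pow_right _ ((hp.coprime_iff_not_dvd).2 hpn).symm
    obtain ⟨h1, h2, h3⟩ := card_filter_monicFactors (Fq := Fq) hnF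
    rw [hcard] at h1 h2 h3
    have hmem := fun P => mem_monicFactors (Fq := Fq) (f := X ^ n - 1)
      (monic_X_pow_sub_one hn0).ne_zero (P := P)
    by_cases hL : 2 ≤ n.gcd (q - 1)
    · obtain ⟨P, hP, Q, hQ, hPQ⟩ := Finset.one_lt_card.1 (by rw [h1]; omega :
        1 < ((monicFactors (X ^ n - 1 : Fq[X])).filter fun P => P.natDegree = 1).card)
      have hP' := Finset.mem_filter.1 hP
      have hQ' := Finset.mem_filter.1 hQ
      obtain ⟨hPm, hPi, hPd⟩ := (hmem P).1 hP'.1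
      obtain ⟨hQm, hQi, hQd⟩ := (hmem Q).1 hQ'.1
      have hco : IsCoprime P Q := (hPi.coprime_iff_not_dvd).2 fun hd =>
        hPQ (eq_of_monic_of_associated hPm hQm (hPi.associated_of_dvd hQi hd))
      obtain ⟨f, hf, hfd, hfdeg, hfg⟩ := exists_cofactor (Fq := Fq) hn0 (g := P * Q) (d := 2)
        (hPm.mul hQm) (by rw [natDegree_mul hPm.ne_zero hQm.ne_zero, hP'.2, hQ'.2])
        (hco.mul_dvd hPd hQd)
      refine ⟨f, hf, hfd, hfdeg, ?_⟩
      have := factorBound_of_coprime hnF hfg (T := {P, Q}) (d := 1)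
        (by intro R hR; simp only [Finset.mem_insert, Finset.mem_singleton] at hR
            rcases hR with rfl | rfl <;> assumption)
        (by intro R hR; simp only [Finset.mem_insert, Finset.mem_singleton] at hR
            rcases hR with rfl | rfl
            · exact Dvd.intro _ rfl
            · exact Dvd.intro_left _ rfl)
      rw [hcard, Finset.card_pair hPQ] at this
      simpa [factorCounts, hgn, hL] using this
    · have hG : 0 < (n.gcd (q ^ 2 - 1) - n.gcd (q - 1)) / 2 := by
        have hL1 : n.gcd (q - 1) = 1 := by
          have := Nat.gcd_pos_of_pos_left (q - 1) hn0
          omega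
        have hnodd : ¬ 2 ∣ n := fun h => by
          obtain ⟨c, hc⟩ := hodd
          have := Nat.dvd_gcd h (Dvd.intro c (by omega) : 2 ∣ q - 1)
          rw [hL1] at this; omega
        have hG1 : n.gcd (q ^ 2 - 1) ≠ 1 := by
          intro h
          refine hgcd ?_
          rw [hfac]
          refine Nat.Coprime.mul_left ?_ (Nat.Coprime.symm h)
          rw [hqpk]
          exact Nat.Coprime.pow_left _ ((hp.coprime_iff_not_dvd).2 hpn)
        have hG2 : ¬ 2 ∣ n.gcd (q ^ 2 - 1) := fun h => hnodd (h.trans (Nat.gcd_dvd_left _ _))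
        have := Nat.gcd_pos_of_pos_left (q ^ 2 - 1) hn0
        omega
      obtain ⟨P, hP⟩ := Finset.card_pos.1 (h2 ▸ hG)
      have hP' := Finset.mem_filter.1 hP
      obtain ⟨hPm, hPi, hPd⟩ := (hmem P).1 hP'.1
      obtain ⟨f, hf, hfd, hfdeg, hfg⟩ := exists_cofactor (Fq := Fq) hn0 hPm hP'.2 hPd
      refine ⟨f, hf, hfd, hfdeg, ?_⟩
      have := factorBound_of_coprime hnF hfg (T := {P}) (d := 2)
        (by intro R hR; rw [Finset.mem_singleton] at hR; rw [hR]; exact hP)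
        (by intro R hR; rw [Finset.mem_singleton] at hR; rw [hR])
      rw [hcard, Finset.card_singleton] at this
      simpa [factorCounts, hgn, hL] using this

end Factors

section MonicPolynomials

variable {Fq : Type*} [Field Fq] [Fintype Fq]

variable (Fq) in
/-- The monic polynomials of degree `m`. -/
def monics (m : ℕ) : Finset Fq[X] := by
  classical
  exact Finset.univ.image fun c : Fin m → Fq => X ^ m + ∑ i, C (c i) * X ^ (i : ℕ)

lemma mem_monics {m : ℕ} {f : Fq[X]} : f ∈ monics Fq m ↔ f.Monic ∧ f.natDegree = m := by
  classical
  rw [monics, Finset.mem_image]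
  constructor
  · rintro ⟨c, -, rfl⟩
    have h := degree_sum_fin_lt c
    refine ⟨monic_X_pow_add h, ?_⟩
    rw [natDegree_add_eq_left_of_degree_lt (by rwa [degree_X_pow]), natDegree_X_pow]
  · rintro ⟨hf, rfl⟩
    refine ⟨fun i => f.coeff i, Finset.mem_univ _, ?_⟩
    rw [Fin.sum_univ_eq_sum_range (fun i => C (f.coeff i) * X ^ i)]
    exact hf.as_sum.symm

variable (Fq) in
/-- The monic irreducible polynomials of degree `m`. -/
def irreds (m : ℕ) : Finset Fq[X] := by
  classical
  exact (monics Fq m).filter Irreducible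

lemma mem_irreds {m : ℕ} {f : Fq[X]} :
    f ∈ irreds Fq m ↔ f.Monic ∧ f.natDegree = m ∧ Irreducible f := by
  classical
  rw [irreds, Finset.mem_filter, mem_monics, and_assoc]

/-- Counting the prime powers dividing `f`, weighted by degree. -/
lemma sum_natDegree_prime_powers {m : ℕ} {f : Fq[X]} (hf : f ∈ monics Fq m) :
    ∑ e ∈ Finset.Icc 1 m, ∑ P ∈ irreds Fq e, ∑ j ∈ Finset.Icc 1 m,
      (open Classical in if P ^ j ∣ f then e else 0) = m := by
  classical
  obtain ⟨hfm, hfd⟩ := mem_monics.1 hf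
  have hf0 := hfm.ne_zero
  have h1 : ∀ e ∈ Finset.Icc 1 m, ∀ P ∈ irreds Fq e, (∑ j ∈ Finset.Icc 1 m,
      if P ^ j ∣ f then e else 0) =
      (UniqueFactorizationMonoid.normalizedFactors f).count P * P.natDegree := by
    intro e he P hP
    obtain ⟨hPm, hPd, hPi⟩ := mem_irreds.1 hP
    rw [Finset.mem_Icc] at he
    have hdvd : ∀ j, P ^ j ∣ f ↔ j ≤ (UniqueFactorizationMonoid.normalizedFactors f).count P := by
      intro j
      rw [pow_dvd_iff_le_emultiplicity,
        UniqueFactorizationMonoid.emultiplicity_eq_count_normalizedFactors hPi hf0,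
        hPm.normalize_eq_self, Nat.cast_le]
    rw [← Finset.sum_filter, Finset.sum_const, smul_eq_mul, hPd]
    congr 1
    have hc : (UniqueFactorizationMonoid.normalizedFactors f).count P ≤ m := by
      have := natDegree_le_of_dvd ((hdvd _).2 le_rfl) hf0
      rw [hPm.natDegree_pow, hPd, hfd] at this
      nlinarith
    have : (Finset.Icc 1 m).filter (fun j => P ^ j ∣ f) =
        Finset.Icc 1 ((UniqueFactorizationMonoid.normalizedFactors f).count P) := by
      ext j
      rw [Finset.mem_filter, hdvd, Finset.mem_Icc, Finset.mem_Icc]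
      omega
    rw [this]; simp
  rw [Finset.sum_congr rfl fun e he => Finset.sum_congr rfl (h1 e he)]
  have hprod : (UniqueFactorizationMonoid.normalizedFactors f).prod = f := by
    have h := UniqueFactorizationMonoid.prod_normalizedFactors hf0
    refine eq_of_monic_of_associated ?_ hfm h
    rw [← Multiset.map_id (UniqueFactorizationMonoid.normalizedFactors f)]
    refine monic_multiset_prod_of_monic _ _ ?_
    intro P hP
    have := UniqueFactorizationMonoid.normalize_normalized_factor P hP
    rw [← this]
    exact monic_normalize (UniqueFactorizationMonoid.ne_zero_of_mem_normalizedFactors hP)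
  have hsum : ∑ P ∈ (UniqueFactorizationMonoid.normalizedFactors f).toFinset,
      (UniqueFactorizationMonoid.normalizedFactors f).count P * P.natDegree = m := by
    have := natDegree_multiset_prod (UniqueFactorizationMonoid.normalizedFactors f)
      (UniqueFactorizationMonoid.zero_notMem_normalizedFactors f)
    rw [hprod, hfd, Finset.sum_multiset_map_count] at this
    simpa using this.symm
  have hdisj : (↑(Finset.Icc 1 m) : Set ℕ).PairwiseDisjoint (irreds Fq) := by
    intro a _ b _ hab
    refine Finset.disjoint_left.2 fun P ha hb => hab ?_
    rw [← (mem_irreds.1 ha).2.1, (mem_irreds.1 hb).2.1]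
  rw [← Finset.sum_biUnion hdisj]
  refine Eq.trans (Finset.sum_subset ?_ ?_).symm hsum
  · intro P hP
    rw [Multiset.mem_toFinset] at hP
    have hPi := UniqueFactorizationMonoid.irreducible_of_normalized_factor P hP
    have hPn := UniqueFactorizationMonoid.normalize_normalized_factor P hP
    have hPd := natDegree_le_of_dvd (UniqueFactorizationMonoid.dvd_of_mem_normalizedFactors hP) hf0
    rw [Finset.mem_biUnion]
    refine ⟨P.natDegree, Finset.mem_Icc.2 ⟨hPi.natDegree_pos, hfd ▸ hPd⟩, mem_irreds.2
      ⟨?_, rfl, hPi⟩⟩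
    rw [← hPn]
    exact monic_normalize hPi.ne_zero
  · intro P _ hP
    rw [Multiset.mem_toFinset] at hP
    rw [Multiset.count_eq_zero_of_notMem hP, zero_mul]

variable (φ : Fq[X] →* ℂ)

/-- The sum of `φ` over monic polynomials of degree `m`. -/
def coeffL (m : ℕ) : ℂ := ∑ f ∈ monics Fq m, φ f

/-- The weighted sum of `φ` over prime powers of degree `k`. -/
def vonMangoldtSum (k : ℕ) : ℂ :=
  ∑ e ∈ k.divisors, ∑ P ∈ irreds Fq e, (e : ℂ) * φ P ^ (k / e)

lemma sum_monics_dvd {P : Fq[X]} {d m : ℕ} (hP : P ∈ monics Fq d) (hd : d ≤ m) :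
    ∑ f ∈ monics Fq m, (open Classical in if P ∣ f then φ f else 0) = φ P * coeffL φ (m - d) := by
  classical
  obtain ⟨hPm, hPd⟩ := mem_monics.1 hP
  rw [← Finset.sum_filter, coeffL, Finset.mul_sum]
  symm
  refine Finset.sum_bij (fun g _ => P * g) ?_ ?_ ?_ ?_
  · intro g hg
    obtain ⟨hgm, hgd⟩ := mem_monics.1 hg
    rw [Finset.mem_filter, mem_monics]
    refine ⟨⟨hPm.mul hgm, ?_⟩, Dvd.intro _ rfl⟩
    rw [hPm.natDegree_mul hgm, hPd, hgd]; omega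
  · intro g _ g' _ h
    exact mul_left_cancel₀ hPm.ne_zero h
  · intro f hf
    rw [Finset.mem_filter, mem_monics] at hf
    obtain ⟨⟨hfm, hfd⟩, g, rfl⟩ := hf
    have hgm := hPm.of_mul_monic_left hfm
    refine ⟨g, mem_monics.2 ⟨hgm, ?_⟩, rfl⟩
    rw [hPm.natDegree_mul hgm, hPd] at hfd; omega
  · intro g _
    rw [map_mul]

/-- The logarithmic derivative of the Euler product. -/
theorem mul_coeffL (m : ℕ) :
    (m : ℂ) * coeffL φ m = ∑ k ∈ Finset.Icc 1 m, vonMangoldtSum φ k * coeffL φ (m - k) := by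
  classical
  have h1 : (m : ℂ) * coeffL φ m = ∑ e ∈ Finset.Icc 1 m, ∑ j ∈ Finset.Icc 1 m,
      ∑ P ∈ irreds Fq e, ∑ f ∈ monics Fq m, if P ^ j ∣ f then (e : ℂ) * φ f else 0 := by
    rw [coeffL, Finset.mul_sum]
    have : ∀ f ∈ monics Fq m, (m : ℂ) * φ f = ∑ e ∈ Finset.Icc 1 m, ∑ j ∈ Finset.Icc 1 m,
      ∑ P ∈ irreds Fq e, if P ^ j ∣ f then (e : ℂ) * φ f else 0 := by
      intro f hf
      conv_lhs => rw [← sum_natDegree_prime_powers hf]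
      push_cast
      rw [Finset.sum_mul]
      refine Finset.sum_congr rfl fun e _ => ?_
      rw [Finset.sum_mul, Finset.sum_comm]
      refine Finset.sum_congr rfl fun P _ => ?_
      rw [Finset.sum_mul]
      refine Finset.sum_congr rfl fun j _ => ?_
      split_ifs <;> simp
    rw [Finset.sum_congr rfl this, Finset.sum_comm]
    refine Finset.sum_congr rfl fun e _ => ?_
    rw [Finset.sum_comm]
    refine Finset.sum_congr rfl fun j _ => ?_
    rw [Finset.sum_comm]
  have h2 : ∀ e ∈ Finset.Icc 1 m, ∀ j ∈ Finset.Icc 1 m,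
      (∑ P ∈ irreds Fq e, ∑ f ∈ monics Fq m, if P ^ j ∣ f then (e : ℂ) * φ f else 0) =
      if e * j ≤ m then (∑ P ∈ irreds Fq e, (e : ℂ) * φ P ^ j) * coeffL φ (m - e * j) else 0 := by
    intro e he j hj
    rw [Finset.mem_Icc] at he hj
    have hmem : ∀ P ∈ irreds Fq e, P ^ j ∈ monics Fq (e * j) := fun P hP => by
      obtain ⟨hPm, hPd, -⟩ := mem_irreds.1 hP
      rw [mem_monics, hPm.natDegree_pow, hPd]
      exact ⟨hPm.pow j, mul_comm _ _⟩
    split_ifs with hle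
    · rw [Finset.sum_mul]
      refine Finset.sum_congr rfl fun P hP => ?_
      have := sum_monics_dvd φ (hmem P hP) hle
      rw [mul_assoc, ← map_pow, ← this, Finset.mul_sum]
      refine Finset.sum_congr rfl fun f _ => ?_
      split_ifs <;> simp
    · refine Finset.sum_eq_zero fun P hP => Finset.sum_eq_zero fun f hf => if_neg fun hd => hle ?_
      have := natDegree_le_of_dvd hd (mem_monics.1 hf).1.ne_zero
      rwa [(mem_monics.1 (hmem P hP)).2, (mem_monics.1 hf).2] at this
  rw [h1, Finset.sum_congr rfl fun e he => Finset.sum_congr rfl (h2 e he)]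
  simp_rw [vonMangoldtSum, Finset.sum_mul]
  have h3 : ∀ k ∈ Finset.Icc 1 m, (∑ e ∈ k.divisors, ∑ P ∈ irreds Fq e,
      (e : ℂ) * φ P ^ (k / e) * coeffL φ (m - k)) = ∑ e ∈ Finset.Icc 1 m, ∑ j ∈ Finset.Icc 1 m,
      if e * j = k then (∑ P ∈ irreds Fq e, (e : ℂ) * φ P ^ j * coeffL φ (m - e * j)) else 0 := by
    intro k hk
    rw [Finset.mem_Icc] at hk
    refine Finset.sum_subset_zero_on_sdiff ?_ ?_ ?_
    · intro e he
      have h := Nat.divisor_le he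
      have h' := Nat.pos_of_mem_divisors he
      rw [Finset.mem_Icc]; omega
    · intro e he
      rw [Finset.mem_sdiff, Nat.mem_divisors] at he
      refine Finset.sum_eq_zero fun j _ => if_neg fun h => he.2 ⟨Dvd.intro _ h, by omega⟩
    · intro e he
      have h' := Nat.pos_of_mem_divisors he
      obtain ⟨j, rfl⟩ := Nat.dvd_of_mem_divisors he
      have hj : 0 < j := Nat.pos_of_ne_zero fun h => by simp [h] at hk
      rw [Finset.sum_eq_single j]
      · simp [Nat.mul_div_cancel_left _ h']
      · intro i _ hi
        exact if_neg fun h => hi (Nat.eq_of_mul_eq_mul_left h' h)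
      · intro h
        exact absurd (Finset.mem_Icc.2 ⟨hj, le_trans (Nat.le_mul_of_pos_left _ h') hk.2⟩) h
  rw [Finset.sum_congr rfl h3]
  refine Eq.trans ?_ Finset.sum_comm
  refine Finset.sum_congr rfl fun e he => ?_
  refine Eq.trans ?_ Finset.sum_comm
  refine Finset.sum_congr rfl fun j hj => ?_
  rw [Finset.mem_Icc] at he hj
  rw [Finset.sum_ite_eq]
  have : e * j ∈ Finset.Icc 1 m ↔ e * j ≤ m := by
    rw [Finset.mem_Icc]
    exact ⟨fun h => h.2, fun h => ⟨Nat.mul_pos (by omega) (by omega), h⟩⟩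
  simp only [this]

end MonicPolynomials

section PointSums

variable {Fq K : Type*} [Field Fq] [Fintype Fq] [Field K] [Fintype K] [Algebra Fq K]

lemma card_eq_card_pow_finrank :
    Fintype.card K = Fintype.card Fq ^ Module.finrank Fq K := Module.card_eq_pow_finrank

lemma natDegree_minpoly_dvd_of_pow_eq {t : K} {j : ℕ} (h : t ^ Fintype.card Fq ^ j = t) :
    (minpoly Fq t).natDegree ∣ j := by
  have hi : Irreducible (minpoly Fq t) := minpoly.irreducible (Algebra.IsIntegral.isIntegral t)
  refine hi.natDegree_dvd_of_dvd_X_pow_card_pow_sub_X (minpoly.dvd Fq t ?_)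
  simp [h]

lemma natDegree_minpoly_dvd_finrank (t : K) :
    (minpoly Fq t).natDegree ∣ Module.finrank Fq K :=
  natDegree_minpoly_dvd_of_pow_eq (by
    rw [← card_eq_card_pow_finrank (K := K)]; exact FiniteField.pow_card t)

lemma pow_card_pow_natDegree_minpoly (t : K) :
    t ^ Fintype.card Fq ^ (minpoly Fq t).natDegree = t := by
  have hi : Irreducible (minpoly Fq t) := minpoly.irreducible (Algebra.IsIntegral.isIntegral t)
  have h := (hi.natDegree_dvd_iff_dvd_X_pow_card_pow_sub_X
    (n := (minpoly Fq t).natDegree)).1 dvd_rfl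
  have h2 := (minpoly.dvd_iff (A := Fq) (x := t)).1 h
  simpa [sub_eq_zero] using h2

lemma aeval_minpoly_eq_prod (t v : K) :
    aeval v (minpoly Fq t) =
      ∏ j ∈ Finset.range (minpoly Fq t).natDegree, (v - t ^ Fintype.card Fq ^ j) := by
  classical
  set e := (minpoly Fq t).natDegree with he
  have hintegral : IsIntegral Fq t := Algebra.IsIntegral.isIntegral t
  have hinj : Set.InjOn (fun j => t ^ Fintype.card Fq ^ j) (Finset.range e : Set ℕ) := by
    have key : ∀ a b, a < b → b < e → t ^ Fintype.card Fq ^ a ≠ t ^ Fintype.card Fq ^ b := by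
      intro a b hab hb h
      have h1 : (t ^ Fintype.card Fq ^ (b - a)) ^ Fintype.card Fq ^ a
          = t ^ Fintype.card Fq ^ a := by
        rw [← pow_mul, ← pow_add, Nat.sub_add_cancel hab.le, h]
      have hinj : Function.Injective (fun x : K => x ^ Fintype.card Fq ^ a) := by
        clear h1 h hab
        induction a with
        | zero => intro x y h; simpa using h
        | succ a ih =>
          intro x y h
          simp only [pow_succ, pow_mul] at h
          exact ih ((FiniteField.frobeniusAlgHom Fq K).injective h)
      have := Nat.le_of_dvd (by omega) (natDegree_minpoly_dvd_of_pow_eq (hinj h1))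
      omega
    intro a ha b hb hab
    simp only [Finset.coe_range, Set.mem_Iio] at ha hb
    rcases lt_trichotomy a b with h | h | h
    · exact absurd hab (key a b h hb)
    · exact h
    · exact absurd hab.symm (key b a h ha)
  have hm : ((minpoly Fq t).map (algebraMap Fq K)).Monic := (minpoly.monic hintegral).map _
  have hprod : ∏ a ∈ (Finset.range e).image (fun j => t ^ Fintype.card Fq ^ j), (X - C a) =
      (minpoly Fq t).map (algebraMap Fq K) := by
    symm
    refine eq_of_monic_of_dvd_of_natDegree_le
      (monic_prod_of_monic _ (fun a => X - C a) fun a _ => monic_X_sub_C a) hm ?_ ?_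
    · refine Finset.prod_dvd_of_coprime ?_ ?_
      · intro a _ b _ hab
        exact isCoprime_X_sub_C_of_isUnit_sub (sub_ne_zero.2 hab).isUnit
      · intro a ha
        obtain ⟨j, -, rfl⟩ := Finset.mem_image.1 ha
        rw [dvd_iff_isRoot, IsRoot, eval_map_algebraMap]
        clear ha
        induction j with
        | zero => simp
        | succ j ih =>
          have h := aeval_algHom_apply (FiniteField.frobeniusAlgHom Fq K)
            (t ^ Fintype.card Fq ^ j) (minpoly Fq t)
          rw [ih, map_zero] at h
          rwa [pow_succ, pow_mul]
    · rw [natDegree_map, natDegree_prod_of_monic _ _ fun a _ => monic_X_sub_C a]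
      simp only [natDegree_X_sub_C, Finset.sum_const, smul_eq_mul, mul_one]
      rw [Finset.card_image_of_injOn hinj, Finset.card_range]
  rw [← eval_map_algebraMap, ← hprod, eval_prod, Finset.prod_image hinj]
  simp

lemma aeval_minpoly_pow_eq_prod (t v : K) :
    aeval v (minpoly Fq t) ^ (Module.finrank Fq K / (minpoly Fq t).natDegree) =
      ∏ j ∈ Finset.range (Module.finrank Fq K), (v - t ^ Fintype.card Fq ^ j) := by
  obtain ⟨s, hs⟩ := natDegree_minpoly_dvd_finrank (Fq := Fq) t
  have hpos : 0 < (minpoly Fq t).natDegree :=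
    minpoly.natDegree_pos (Algebra.IsIntegral.isIntegral t)
  rw [hs, Nat.mul_div_cancel_left _ hpos, aeval_minpoly_eq_prod]
  clear hs
  have hper : ∀ i, t ^ Fintype.card Fq ^ ((minpoly Fq t).natDegree * i) = t := by
    intro i
    induction i with
    | zero => simp
    | succ i ih => rw [mul_add, mul_one, pow_add, pow_mul, ih, pow_card_pow_natDegree_minpoly]
  induction s with
  | zero => simp
  | succ s ih =>
    rw [pow_succ, ih, mul_add, mul_one, Finset.prod_range_add]
    congr 1
    refine Finset.prod_congr rfl fun j _ => ?_
    rw [pow_add, pow_mul, hper]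

lemma splits_map_of_natDegree_dvd {P : Fq[X]} (hP : Irreducible P)
    (hd : P.natDegree ∣ Module.finrank Fq K) : (P.map (algebraMap Fq K)).Splits := by
  have hd' := hP.natDegree_dvd_iff_dvd_X_pow_card_pow_sub_X.1 hd
  have h4 : Nat.card Fq ^ Module.finrank Fq K = Fintype.card K := by
    rw [Nat.card_eq_fintype_card]; exact card_eq_card_pow_finrank.symm
  rw [h4] at hd'
  have h3 := (FiniteField.isSplittingField_sub K Fq).splits'
  refine h3.of_dvd ?_ (Polynomial.map_dvd _ hd')
  have h5 : (X ^ Fintype.card K - X : Fq[X]) ≠ 0 :=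
    FiniteField.X_pow_card_sub_X_ne_zero Fq (p := Fintype.card K) Fintype.one_lt_card
  exact Polynomial.map_ne_zero h5

lemma vonMangoldtSum_eq_sum (φ : Fq[X] →* ℂ) :
    vonMangoldtSum φ (Module.finrank Fq K) =
      ∑ t : K, φ (minpoly Fq t) ^ (Module.finrank Fq K / (minpoly Fq t).natDegree) := by
  classical
  set k := Module.finrank Fq K with hk
  have hk0 : k ≠ 0 := Module.finrank_pos.ne'
  have hdisj : (↑(k.divisors) : Set ℕ).PairwiseDisjoint (irreds Fq) := by
    intro a _ b _ hab
    refine Finset.disjoint_left.2 fun P ha hb => hab ?_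
    rw [← (mem_irreds.1 ha).2.1, (mem_irreds.1 hb).2.1]
  have hmaps : ∀ t ∈ (Finset.univ : Finset K), minpoly Fq t ∈ k.divisors.biUnion (irreds Fq) := by
    intro t _
    have hintegral : IsIntegral Fq t := Algebra.IsIntegral.isIntegral t
    rw [Finset.mem_biUnion]
    exact ⟨_, Nat.mem_divisors.2 ⟨natDegree_minpoly_dvd_finrank t, hk0⟩,
      mem_irreds.2 ⟨minpoly.monic hintegral, rfl, minpoly.irreducible hintegral⟩⟩
  rw [← Finset.sum_fiberwise_of_maps_to hmaps, Finset.sum_biUnion hdisj, vonMangoldtSum]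
  refine Finset.sum_congr rfl fun e he => Finset.sum_congr rfl fun P hP => ?_
  obtain ⟨hPm, hPd, hPi⟩ := mem_irreds.1 hP
  have hcard : (Finset.univ.filter fun t : K => minpoly Fq t = P).card = e := by
    have hset : (Finset.univ.filter fun t : K => minpoly Fq t = P) = P.rootSet K := by
      ext t
      simp only [Finset.coe_filter, Finset.mem_univ, true_and, Set.mem_ofPred_eq]
      rw [mem_rootSet]
      constructor
      · rintro rfl
        exact ⟨hPm.ne_zero, minpoly.aeval _ _⟩
      · rintro ⟨-, h⟩
        exact (minpoly.eq_of_irreducible_of_monic hPi h hPm).symm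
    have hsplit := splits_map_of_natDegree_dvd (K := K) hPi (hPd ▸ Nat.dvd_of_mem_divisors he)
    have := card_rootSet_eq_natDegree (PerfectField.separable_of_irreducible hPi) hsplit
    rw [← Nat.card_eq_fintype_card, Nat.card_coe_set_eq, ← hset, Set.ncard_coe_finset, hPd] at this
    exact this
  rw [Finset.sum_congr rfl (g := fun _ => φ P ^ (k / e)), Finset.sum_const, hcard, nsmul_eq_mul]
  intro t ht
  rw [(Finset.mem_filter.1 ht).2, hPd]

end PointSums

section LFunction

variable {Fq F : Type*} [Field Fq] [Fintype Fq] [Field F] [Fintype F] [Algebra Fq F]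

/-- Evaluation of polynomials at `v` followed by a multiplicative character. -/
def evalChar (χ : MulChar F ℂ) (v : F) : Fq[X] →* ℂ :=
  χ.toMonoidHom.comp ((aeval v : Fq[X] →ₐ[Fq] F) : Fq[X] →* F)

lemma evalChar_apply (χ : MulChar F ℂ) (v : F) (f : Fq[X]) :
    evalChar χ v f = χ (aeval v f) := rfl

lemma coeffL_evalChar (χ : MulChar F ℂ) (v : F) (m : ℕ) :
    coeffL (evalChar (Fq := Fq) χ v) m =
      ∑ c : Fin m → Fq, χ (v ^ m + ∑ i, c i • v ^ (i : ℕ)) := by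
  classical
  rw [coeffL, monics, Finset.sum_image]
  · refine Finset.sum_congr rfl fun c _ => ?_
    rw [evalChar_apply]
    simp [Algebra.smul_def]
  · intro c _ c' _ h
    have h' := add_left_cancel h
    funext j
    have := congrArg (fun f => coeff f (j : ℕ)) h'
    simpa [finsetSum_coeff, coeff_C_mul, coeff_X_pow, ← Fin.ext_iff] using this

lemma exists_smul_pow_eq {n : ℕ} (hn : Module.finrank Fq F = n) {v : F}
    (hv : LinearIndependent Fq fun i : Fin n => v ^ (i : ℕ)) {m : ℕ} (hm : n ≤ m) (y : F) :
    ∃ c : Fin m → Fq, ∑ i, c i • v ^ (i : ℕ) = y := by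
  classical
  rcases Nat.eq_zero_or_pos n with h0 | hpos
  · exact absurd Module.finrank_pos (by rw [hn, h0]; exact lt_irrefl _ : ¬ 0 < Module.finrank Fq F)
  have : Nonempty (Fin n) := ⟨⟨0, hpos⟩⟩
  let b := basisOfLinearIndependentOfCardEqFinrank hv (by simp [hn])
  let c : ℕ → Fq := fun i => if h : i < n then b.repr y ⟨i, h⟩ else 0
  refine ⟨fun i => c i, ?_⟩
  rw [Fin.sum_univ_eq_sum_range (fun i => c i • v ^ i), ← Finset.sum_range_add_sum_Ico _ hm,
    Finset.sum_eq_zero (s := Finset.Ico n m), add_zero,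
    ← Fin.sum_univ_eq_sum_range (fun i => c i • v ^ i)]
  · conv_rhs => rw [← b.sum_repr y]
    refine Finset.sum_congr rfl fun i _ => ?_
    simp [c, b]
  · intro i hi
    rw [Finset.mem_Ico] at hi
    simp [c, show ¬ i < n by omega]

lemma sum_shift_eq_zero {χ : MulChar F ℂ} (hχ : χ ≠ 1) {n : ℕ} (hn : Module.finrank Fq F = n) {v : F}
    (hv : LinearIndependent Fq fun i : Fin n => v ^ (i : ℕ)) {m : ℕ} (hm : n ≤ m) (w : F) :
    ∑ c : Fin m → Fq, χ (w + ∑ i, c i • v ^ (i : ℕ)) = 0 := by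
  classical
  have h1 : ∀ y : F, ∑ c : Fin m → Fq, χ (w + ∑ i, c i • v ^ (i : ℕ)) =
      ∑ c : Fin m → Fq, χ (w + ∑ i, c i • v ^ (i : ℕ) + y) := by
    intro y
    obtain ⟨b, hb⟩ := exists_smul_pow_eq hn hv hm y
    rw [← Equiv.sum_comp (Equiv.addRight b)]
    refine Finset.sum_congr rfl fun c _ => ?_
    simp [add_smul, Finset.sum_add_distrib, hb, add_assoc]
  have h2 : (Fintype.card F : ℂ) * ∑ c : Fin m → Fq, χ (w + ∑ i, c i • v ^ (i : ℕ)) = 0 := by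
    rw [← nsmul_eq_mul, ← Finset.card_univ, ← Finset.sum_const, Finset.sum_congr rfl fun y _ => h1 y,
      Finset.sum_comm]
    refine Finset.sum_eq_zero fun c _ => ?_
    rw [← MulChar.sum_eq_zero_of_ne_one hχ]
    exact Equiv.sum_comp (Equiv.addLeft (w + ∑ i, c i • v ^ (i : ℕ))) (fun x => χ x)
  exact (mul_eq_zero.1 h2).resolve_left (by exact_mod_cast Fintype.card_ne_zero)

lemma coeffL_evalChar_eq_zero {χ : MulChar F ℂ} (hχ : χ ≠ 1) {n : ℕ}
    (hn : Module.finrank Fq F = n) {v : F}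
    (hv : LinearIndependent Fq fun i : Fin n => v ^ (i : ℕ)) {m : ℕ} (hm : n ≤ m) :
    coeffL (evalChar (Fq := Fq) χ v) m = 0 := by
  rw [coeffL_evalChar, sum_shift_eq_zero hχ hn hv hm]

lemma sum_combination_eq {χ : MulChar F ℂ} (hχ : ∀ a : Fq, a ≠ 0 → χ (algebraMap Fq F a) = 1)
    (v : F) (m : ℕ) :
    ∑ c : Fin m → Fq, χ (∑ i, c i • v ^ (i : ℕ)) =
      (Fintype.card Fq - 1 : ℂ) * ∑ j ∈ Finset.range m, coeffL (evalChar (Fq := Fq) χ v) j := by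
  classical
  induction m with
  | zero => simp [MulChar.map_zero]
  | succ m ih =>
    rw [Finset.sum_range_succ, mul_add, ← ih, ← (Fin.snocEquiv (fun _ => Fq)).sum_comp,
      Fintype.sum_prod_type, ← Finset.add_sum_erase _ _ (Finset.mem_univ (0 : Fq))]
    congr 1
    · refine Finset.sum_congr rfl fun c _ => ?_
      simp [Fin.sum_univ_castSucc, Fin.snocEquiv]
    · have : ∀ a ∈ Finset.univ.erase (0 : Fq), ∑ c : Fin m → Fq,
          χ (∑ i, (Fin.snocEquiv (fun _ => Fq)) (a, c) i • v ^ (i : ℕ)) =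
          coeffL (evalChar (Fq := Fq) χ v) m := by
        intro a ha
        have ha0 := Finset.ne_of_mem_erase ha
        rw [coeffL_evalChar, ← Equiv.sum_comp (MulAction.toPerm (Units.mk0 a ha0) :
          Equiv.Perm (Fin m → Fq))]
        refine Finset.sum_congr rfl fun c _ => ?_
        have h1 : ∑ i, (Fin.snocEquiv (fun _ => Fq)) (a, (MulAction.toPerm (Units.mk0 a ha0) c)) i •
            v ^ (i : ℕ) = algebraMap Fq F a * (v ^ m + ∑ i, c i • v ^ (i : ℕ)) := by
          simp only [Fin.sum_univ_castSucc, Fin.snocEquiv, Equiv.coe_fn_mk, Fin.snoc_castSucc,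
            Fin.snoc_last, Fin.val_castSucc, Fin.val_last, MulAction.toPerm_apply, Pi.smul_apply,
            mul_add, Finset.mul_sum, Units.smul_def, Units.val_mk0, smul_eq_mul]
          rw [add_comm, ← Algebra.smul_def]
          simp only [← Algebra.smul_def, smul_smul]
        rw [h1, map_mul, hχ a ha0, one_mul]
      rw [Finset.sum_congr rfl this, Finset.sum_const, Finset.card_erase_of_mem (Finset.mem_univ _),
        Finset.card_univ, nsmul_eq_mul, Nat.cast_sub Fintype.card_pos, Nat.cast_one]

lemma sum_coeffL_eq_zero {χ : MulChar F ℂ} (hχ1 : χ ≠ 1)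
    (hχ : ∀ a : Fq, a ≠ 0 → χ (algebraMap Fq F a) = 1) {n : ℕ}
    (hn : Module.finrank Fq F = n) {v : F}
    (hv : LinearIndependent Fq fun i : Fin n => v ^ (i : ℕ)) :
    ∑ j ∈ Finset.range n, coeffL (evalChar (Fq := Fq) χ v) j = 0 := by
  have h := sum_combination_eq hχ v n
  have h0 := sum_shift_eq_zero hχ1 hn hv le_rfl 0
  simp only [zero_add] at h0
  rw [h0] at h
  refine (mul_eq_zero.1 h.symm).resolve_left ?_
  rw [sub_eq_zero]
  exact_mod_cast (Fintype.one_lt_card (α := Fq)).ne'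

lemma coeffL_zero (φ : Fq[X] →* ℂ) : coeffL φ 0 = 1 := by
  have : monics Fq 0 = {1} := by
    ext f
    rw [mem_monics, Finset.mem_singleton]
    exact ⟨fun h => eq_one_of_monic_natDegree_zero h.1 h.2, fun h => by simp [h]⟩
  rw [coeffL, this, Finset.sum_singleton, map_one]

/-- The reciprocal roots of the `L`-function in the quartic case. -/
theorem exists_reciprocal_roots {χ : MulChar F ℂ} (hχ1 : χ ≠ 1)
    (hχ : ∀ a : Fq, a ≠ 0 → χ (algebraMap Fq F a) = 1)
    (hn : Module.finrank Fq F = 4) {v : F}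
    (hv : LinearIndependent Fq fun i : Fin 4 => v ^ (i : ℕ)) :
    ∃ a b : ℂ, ∀ k, 1 ≤ k → vonMangoldtSum (evalChar (Fq := Fq) χ v) k = -(1 + a ^ k + b ^ k) := by
  set φ := evalChar (Fq := Fq) χ v with hφ
  have hA0 := coeffL_zero φ
  have hA : ∀ m, 4 ≤ m → coeffL φ m = 0 := fun m hm => coeffL_evalChar_eq_zero hχ1 hn hv hm
  have hsum := sum_coeffL_eq_zero hχ1 hχ hn hv
  rw [← hφ] at hsum
  simp only [Finset.sum_range_succ, Finset.sum_range_zero, hA0, zero_add] at hsum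
  set A1 := coeffL φ 1
  set A2 := coeffL φ 2
  set A3 := coeffL φ 3
  obtain ⟨a, ha⟩ := IsAlgClosed.exists_root (X ^ 2 + C (1 + A1) * X + C (-A3) : ℂ[X]) (by
    have : (X ^ 2 + C (1 + A1) * X + C (-A3) : ℂ[X]).degree = 2 := by compute_degree!
    rw [this]; decide)
  simp only [IsRoot, eval_add, eval_mul, eval_pow, eval_X, eval_C] at ha
  obtain ⟨b, hb⟩ : ∃ b, b = -(1 + A1) - a := ⟨_, rfl⟩
  have e1 : A1 = -(1 + a + b) := by rw [hb]; ring
  have e3 : A3 = -(a * b) := by rw [hb]; linear_combination -ha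
  have e2 : A2 = a + b + a * b := by linear_combination hsum - e1 - e3
  have hrec : ∀ m, vonMangoldtSum φ (m + 4) + vonMangoldtSum φ (m + 3) * A1 +
      vonMangoldtSum φ (m + 2) * A2 + vonMangoldtSum φ (m + 1) * A3 = 0 := by
    intro m
    have h := mul_coeffL φ (m + 4)
    rw [hA (m + 4) (by omega), mul_zero] at h
    have hs : ∑ k ∈ Finset.Icc (m + 1) (m + 4), vonMangoldtSum φ k * coeffL φ (m + 4 - k) =
        ∑ k ∈ Finset.Icc 1 (m + 4), vonMangoldtSum φ k * coeffL φ (m + 4 - k) := by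
      refine Finset.sum_subset (Finset.Icc_subset_Icc_left (by omega)) fun k hk hk' => ?_
      rw [Finset.mem_Icc] at hk hk'
      rw [hA _ (by omega), mul_zero]
    rw [← hs, Finset.sum_Icc_succ_top (by omega), Finset.sum_Icc_succ_top (by omega),
      Finset.sum_Icc_succ_top (by omega), Finset.Icc_self, Finset.sum_singleton,
      show m + 4 - (m + 1) = 3 by omega, show m + 4 - (m + 1 + 1) = 2 by omega,
      show m + 4 - (m + 1 + 1 + 1) = 1 by omega, show m + 4 - (m + 3 + 1) = 0 by omega, hA0] at h
    linear_combination -h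
  have h1 := mul_coeffL φ 1
  have h2 := mul_coeffL φ 2
  have h3 := mul_coeffL φ 3
  simp [Finset.sum_Icc_succ_top, hA0] at h1 h2 h3
  refine ⟨a, b, ?_⟩
  have l1 : vonMangoldtSum φ 1 = -(1 + a ^ 1 + b ^ 1) := by
    rw [← h1, pow_one, pow_one]; exact e1
  have l2 : vonMangoldtSum φ 2 = -(1 + a ^ 2 + b ^ 2) := by
    linear_combination (-1 : ℂ) * h2 - A1 * l1 + (1 + a + b) * e1 + 2 * e2
  have l3 : vonMangoldtSum φ 3 = -(1 + a ^ 3 + b ^ 3) := by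
    linear_combination (-1 : ℂ) * h3 - A2 * l1 - A1 * l2 + (1 + a + b) * e2 +
      (1 + a ^ 2 + b ^ 2) * e1 + 3 * e3
  intro k
  induction k using Nat.strong_induction_on with
  | _ k ih =>
    intro hk
    match k, hk with
    | 1, _ => exact l1
    | 2, _ => exact l2
    | 3, _ => exact l3
    | m + 4, _ =>
      have i1 := ih (m + 1) (by omega) (by omega)
      have i2 := ih (m + 2) (by omega) (by omega)
      have i3 := ih (m + 3) (by omega) (by omega)
      have := hrec m
      rw [i1, i2, i3, e1, e2, e3] at this
      linear_combination this

lemma vonMangoldtSum_one (φ : Fq[X] →* ℂ) : vonMangoldtSum φ 1 = ∑ t : Fq, φ (X - C t) := by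
  have h := vonMangoldtSum_eq_sum (K := Fq) φ
  rw [Module.finrank_self] at h
  rw [h]
  refine Finset.sum_congr rfl fun t _ => ?_
  have : minpoly Fq t = X - C t := minpoly.eq_X_sub_C' t
  rw [this, natDegree_X_sub_C, Nat.div_one, pow_one]

end LFunction

section Stepanov

variable {K : Type*} [Field K] [Fintype K]

/-- A family of polynomials of degree less than `B` with more than `B` members is dependent. -/
lemma exists_relation_of_degree_lt {ι : Type*} [Fintype ι] {B : ℕ} (w : ι → K[X])
    (hw : ∀ i, (w i).degree < B) (hB : B < Fintype.card ι) :
    ∃ g : ι → K, ∑ i, g i • w i = 0 ∧ ∃ i, g i ≠ 0 := by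
  refine Fintype.not_linearIndependent_iff.1 fun hli => ?_
  let w' : ι → degreeLT K B := fun i => ⟨w i, mem_degreeLT.2 (hw i)⟩
  have h' : LinearIndependent K w' :=
    LinearIndependent.of_comp (degreeLT K B).subtype hli
  have := (degreeLTEquiv K B).finiteDimensional
  have h2 := h'.fintype_card_le_finrank
  rw [(degreeLTEquiv K B).finrank_eq, Module.finrank_fin_fun] at h2
  omega

set_option maxHeartbeats 1600000 in
/-- The Stepanov bound for the number of points at which a power of a polynomial takes
a prescribed value. -/
theorem card_filter_pow_eq_le {p s r d ρ m : ℕ} [hp : Fact p.Prime] [CharP K p] (hr : r = p ^ s)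
    (hK : Fintype.card K = r ^ 2) (hd : r = d * ρ + 1) {f : K[X]} (hfm : f.natDegree = m)
    (hf0 : f ≠ 0) (hmd : Nat.Coprime m d) (hd1 : 1 ≤ d) (hbig : (d * m + 2 * d + 1) * (m + 2) < r)
    {ζ : K} (hζ : ζ ≠ 0) [DecidableEq K] :
    (Finset.univ.filter fun x : K => eval x f ^ (ρ * (r + 1)) = ζ).card ≤
      ρ * r + (2 * m + 2) * r := by
  classical
  have hρ : (m + 2) * (m + 2) ≤ ρ := by
    by_contra h
    have : d * ρ + d ≤ d * ((m + 2) * (m + 2)) := by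
      have : ρ + 1 ≤ (m + 2) * (m + 2) := by omega
      nlinarith
    nlinarith
  have hρ2 : m + 2 ≤ ρ := by nlinarith
  obtain ⟨D, hD⟩ : ∃ D, ρ = D + m + 1 := ⟨ρ - (m + 1), by omega⟩
  set I := ρ + m + 2 with hI
  have hjle : ∀ j : Fin d, ((j : ℕ) + 1) * ρ ≤ r := fun j => by
    have := j.2
    nlinarith
  let w : Fin d × Fin I × Fin D → K[X] := fun a =>
    X ^ (r * (a.2.2 : ℕ) + a.2.1) * f ^ (r - ((a.1 : ℕ) + 1) * ρ)
  obtain ⟨b, hb, a₀, hb0⟩ := exists_relation_of_degree_lt (B := r * (D - 1) + I + m * r) w (by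
    rintro ⟨j, i, l⟩
    have hne : w (j, i, l) ≠ 0 := mul_ne_zero (pow_ne_zero _ X_ne_zero) (pow_ne_zero _ hf0)
    rw [degree_eq_natDegree hne, Nat.cast_lt]
    simp only [w]
    rw [natDegree_mul (pow_ne_zero _ X_ne_zero) (pow_ne_zero _ hf0), natDegree_X_pow,
      natDegree_pow, hfm]
    have h1 : (r - ((j : ℕ) + 1) * ρ) * m ≤ m * r := by
      rw [mul_comm]; exact Nat.mul_le_mul_left _ (Nat.sub_le _ _)
    have h2 : r * (l : ℕ) ≤ r * (D - 1) := Nat.mul_le_mul_left _ (by omega)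
    have := i.2
    omega) (by
    simp only [Fintype.card_prod, Fintype.card_fin]
    obtain ⟨D', rfl⟩ : ∃ D', D = D' + 1 := ⟨D - 1, by omega⟩
    rw [Nat.add_sub_cancel]
    rw [hI, hd]
    subst hD
    rw [hd] at hbig
    nlinarith)
  have hfrob : ∀ x : K, iterateFrobenius K p s x = x ^ r := fun x => by
    rw [iterateFrobenius_def, hr]
  have hsurj : Function.Surjective (iterateFrobenius K p s) :=
    Finite.surjective_of_injective (iterateFrobenius K p s).injective
  choose c hc using fun a : Fin d × Fin I × Fin D => hsurj (b a * (ζ⁻¹) ^ ((a.1 : ℕ) + 1))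
  let A : Fin d × Fin I → K[X] := fun a => ∑ l : Fin D, C (c (a.1, a.2, l)) * X ^ (l : ℕ)
  let T : Fin d × Fin I → K[X] := fun a =>
    A a * (X ^ ((a.2 : ℕ) * r) * f ^ (1 + ((a.1 : ℕ) + 1) * ρ))
  set h := ∑ a, T a with hh
  have hAdeg : ∀ a, A a ≠ 0 → (A a).natDegree < D := fun a ha => by
    have := degree_sum_fin_lt (fun l => c (a.1, a.2, l))
    exact (natDegree_lt_iff_degree_lt ha).2 this
  have hfac : ∀ a : Fin d × Fin I,
      (X ^ ((a.2 : ℕ) * r) * f ^ (1 + ((a.1 : ℕ) + 1) * ρ) : K[X]) ≠ 0 := fun a =>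
    mul_ne_zero (pow_ne_zero _ X_ne_zero) (pow_ne_zero _ hf0)
  have hTA : ∀ a, T a ≠ 0 → A a ≠ 0 := fun a ha h0 => ha (by simp only [T, h0, zero_mul])
  have hTdeg : ∀ a, T a ≠ 0 → (T a).natDegree =
      (A a).natDegree + ((a.2 : ℕ) * r + (1 + ((a.1 : ℕ) + 1) * ρ) * m) := fun a ha => by
    simp only [T]
    rw [natDegree_mul (hTA a ha) (hfac a), natDegree_mul (pow_ne_zero _ X_ne_zero)
      (pow_ne_zero _ hf0), natDegree_X_pow, natDegree_pow, hfm]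
  -- the summands have different degrees
  have hpair : Set.Pairwise {a | a ∈ Finset.univ ∧ T a ≠ 0} (Function.onFun Ne (degree ∘ T)) := by
    rintro ⟨j, i⟩ ⟨-, h1⟩ ⟨j', i'⟩ ⟨-, h2⟩ hne heq
    simp only [Function.comp_apply] at heq
    have hdeg := natDegree_eq_of_degree_eq heq
    rw [hTdeg _ h1, hTdeg _ h2] at hdeg
    have e1 := hAdeg _ (hTA _ h1)
    have e2 := hAdeg _ (hTA _ h2)
    generalize (A (j, i)).natDegree = e at hdeg e1
    generalize (A (j', i')).natDegree = e' at hdeg e2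
    simp only at hdeg
    have hz : (r : ℤ) * (d * ((i : ℤ) - i') + m * ((j : ℤ) - j')) =
        m * ((j : ℤ) - j') - d * ((e : ℤ) - e') := by
      have h3 : ((e + ((i : ℕ) * r + (1 + ((j : ℕ) + 1) * ρ) * m) : ℕ) : ℤ) =
        ((e' + ((i' : ℕ) * r + (1 + ((j' : ℕ) + 1) * ρ) * m) : ℕ) : ℤ) := by rw [hdeg]
      push_cast at h3
      have h4 : (r : ℤ) = d * ρ + 1 := by exact_mod_cast hd
      linear_combination (d : ℤ) * h3 - (m * ((j : ℤ) - j')) * (-h4)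
    have hj := j.2
    have hj' := j'.2
    have hsmall : |(m : ℤ) * ((j : ℤ) - j') - d * ((e : ℤ) - e')| < r := by
      have h4 : (r : ℤ) = d * ρ + 1 := by exact_mod_cast hd
      have h5 : (ρ : ℤ) = D + m + 1 := by exact_mod_cast hD
      rw [abs_lt, h4, h5]
      have a1 : ((j : ℕ) : ℤ) - j' ≤ d := by omega
      have a2 : -(d : ℤ) ≤ (j : ℤ) - j' := by omega
      have a3 : ((e : ℕ) : ℤ) - e' ≤ D := by omega
      have a4 : -(D : ℤ) ≤ (e : ℤ) - e' := by omega
      have hm0 : (0 : ℤ) ≤ m := by positivity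
      have hd0 : (0 : ℤ) ≤ d := by positivity
      constructor <;> linarith [mul_le_mul_of_nonneg_left a1 hm0, mul_le_mul_of_nonneg_left a2 hm0,
        mul_le_mul_of_nonneg_left a3 hd0, mul_le_mul_of_nonneg_left a4 hd0]
    have hzero : (d : ℤ) * ((i : ℤ) - i') + m * ((j : ℤ) - j') = 0 := by
      by_contra hx
      rw [← hz, abs_mul] at hsmall
      have := Int.one_le_abs hx
      have hr0 : (0 : ℤ) ≤ r := by positivity
      rw [abs_of_nonneg hr0] at hsmall
      nlinarith
    have hdvd : (d : ℤ) ∣ (j : ℤ) - j' := by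
      have h6 : (d : ℤ) ∣ m * ((j : ℤ) - j') := ⟨-((i : ℤ) - i'), by linear_combination hzero⟩
      exact (Nat.isCoprime_iff_coprime.2 hmd.symm).dvd_of_dvd_mul_left h6
    have hjj : (j : ℤ) - j' = 0 := by
      refine Int.eq_zero_of_abs_lt_dvd hdvd ?_
      rw [abs_lt]; omega
    rw [hjj, mul_zero, add_zero] at hzero
    have hii : (i : ℤ) - i' = 0 := by
      rcases mul_eq_zero.1 hzero with h | h
      · omega
      · exact h
    refine hne (Prod.ext (Fin.ext ?_) (Fin.ext ?_)) <;> simp only <;> omega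
  have hne : h ≠ 0 := by
    intro h0
    have hdeg := degree_sum_eq_of_disjoint T Finset.univ hpair
    rw [← hh, h0, degree_zero] at hdeg
    have hT0 : T (a₀.1, a₀.2.1) ≠ 0 := by
      refine mul_ne_zero (fun hA => hb0 ?_) (hfac _)
      have := congrArg (fun g => coeff g (a₀.2.2 : ℕ)) hA
      simp only [A, finsetSum_coeff, coeff_C_mul, coeff_X_pow, coeff_zero] at this
      rw [Finset.sum_eq_single a₀.2.2] at this
      · rw [if_pos rfl, mul_one] at this
        have h1 := hc a₀
        rw [show c a₀ = 0 from this, map_zero] at h1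
        exact (mul_eq_zero.1 h1.symm).resolve_right (pow_ne_zero _ (inv_ne_zero hζ))
      · intro l _ hl
        rw [if_neg fun hx => hl (Fin.ext hx.symm), mul_zero]
      · intro hx; exact absurd (Finset.mem_univ _) hx
    have hle := Finset.le_sup (f := fun a => (T a).degree) (Finset.mem_univ (a₀.1, a₀.2.1))
    rw [← hdeg, le_bot_iff, degree_eq_bot] at hle
    exact hT0 hle
  have hroot : ∀ x : K, eval x f ^ (ρ * (r + 1)) = ζ → eval x h = 0 := by
    intro x hx
    have hxQ : x ^ (r * r) = x := by rw [← sq, ← hK]; exact FiniteField.pow_card x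
    have hpow : (eval x h) ^ r = 0 := by
      have hbx := congrArg (eval x) hb
      rw [eval_zero, eval_finsetSum] at hbx
      rw [← hfrob, hh, eval_finsetSum, map_sum, ← hbx, Fintype.sum_prod_type, Fintype.sum_prod_type]
      refine Finset.sum_congr rfl fun j _ => ?_
      rw [Fintype.sum_prod_type]
      refine Finset.sum_congr rfl fun i _ => ?_
      simp only [T, A, w]
      rw [eval_mul, eval_finsetSum, Finset.sum_mul, map_sum]
      refine Finset.sum_congr rfl fun l _ => ?_
      rw [map_mul, eval_mul, eval_C, map_mul, hc]
      simp only [hfrob, eval_smul, eval_mul, eval_pow, eval_X, smul_eq_mul]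
      have e1 : (eval x f ^ (1 + ((j : ℕ) + 1) * ρ)) ^ r =
          ζ ^ ((j : ℕ) + 1) * eval x f ^ (r - ((j : ℕ) + 1) * ρ) := by
        have hjl := hjle j
        rw [← hx, ← pow_mul, ← pow_mul, ← pow_add]
        congr 1
        zify [hjl]
        ring
      have e2 : (x ^ ((i : ℕ) * r)) ^ r = x ^ (i : ℕ) := by
        rw [← pow_mul, mul_assoc, mul_comm, pow_mul, hxQ]
      rw [mul_pow, e1, e2, pow_add, ← pow_mul x, inv_pow]
      have := pow_ne_zero ((j : ℕ) + 1) hζ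
      field_simp
      ring
    exact pow_eq_zero_iff (by omega) |>.1 hpow
  have hcount : (Finset.univ.filter fun x : K => eval x f ^ (ρ * (r + 1)) = ζ).card ≤
      h.natDegree := by
    refine le_trans (Finset.card_le_card (t := h.roots.toFinset) fun x hx => ?_)
      ((Multiset.toFinset_card_le _).trans (card_roots' h))
    rw [Multiset.mem_toFinset, mem_roots hne]
    exact hroot x (Finset.mem_filter.1 hx).2
  refine hcount.trans (natDegree_sum_le_of_forall_le _ _ fun a _ => ?_)
  by_cases ha : T a = 0
  · rw [ha, natDegree_zero]; exact Nat.zero_le _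
  · rw [hTdeg a ha]
    have e1 := hAdeg a (hTA a ha)
    have e2 := a.2.2
    have e3 := hjle a.1
    have e4 : (a.2 : ℕ) * r ≤ (ρ + m + 1) * r := Nat.mul_le_mul_right _ (by omega)
    have e5 : (1 + ((a.1 : ℕ) + 1) * ρ) * m ≤ r * m := by
      refine Nat.mul_le_mul_right _ ?_
      have := a.1.2
      nlinarith
    have e6 : D ≤ r := by nlinarith
    nlinarith

end Stepanov

section Equidistribution

variable {F : Type*} [Field F] [Fintype F]

lemma card_units_pow_eq {d E : ℕ} (hdE : Fintype.card F - 1 = d * E) (w : Fˣ) :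
    Nat.card {u : Fˣ // u ^ E = w ^ E} = E := by
  classical
  have h := IsCyclic.card_powMonoidHom_ker (G := Fˣ) E
  rw [Nat.card_eq_fintype_card, Nat.card_eq_fintype_card (α := Fˣ), Fintype.card_units, hdE,
    Nat.gcd_eq_right (dvd_mul_left _ _), ← Nat.card_eq_fintype_card] at h
  refine Eq.trans ?_ h
  refine Nat.card_congr ((Equiv.divRight w).subtypeEquiv fun u => ?_)
  rw [MonoidHom.mem_ker, powMonoidHom_apply, Equiv.divRight_apply, div_pow, div_eq_one]

lemma exists_pow_eq_of_pow_eq_one {d E : ℕ} (hE : 0 < E) (hdE : Fintype.card F - 1 = d * E) {x : Fˣ}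
    (hx : x ^ E = 1) : ∃ y : Fˣ, y ^ d = x := by
  classical
  obtain ⟨g, hg⟩ := IsCyclic.exists_generator (α := Fˣ)
  obtain ⟨i, rfl⟩ := (Submonoid.mem_powers_iff _ _).1 ((mem_powers_iff_mem_zpowers).2 (hg x))
  have ho : orderOf g = d * E := by
    rw [orderOf_eq_card_of_forall_mem_zpowers hg, Nat.card_eq_fintype_card, Fintype.card_units, hdE]
  rw [← pow_mul] at hx
  have h := orderOf_dvd_of_pow_eq_one hx
  rw [ho] at h
  obtain ⟨k, rfl⟩ := Nat.dvd_of_mul_dvd_mul_right hE h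
  exact ⟨g ^ k, by rw [← pow_mul, mul_comm]⟩

/-- A character sum is small when the values are nearly equidistributed among the classes
modulo `d`-th powers. -/
lemma norm_sum_mulChar_le {χ : MulChar F ℂ} (hχ1 : χ ≠ 1) {d E U : ℕ}
    (hdE : Fintype.card F - 1 = d * E) (hχd : χ ^ d = 1) {T : Type*} [Fintype T] (w : T → F)
    [DecidableEq F] (hU : ∀ u : F, u ≠ 0 → (Finset.univ.filter fun t => w t ^ E = u ^ E).card ≤ U) :
    ‖∑ t, χ (w t)‖ ≤ (d : ℝ) * U - Fintype.card T + (Finset.univ.filter fun t => w t = 0).card := by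
  classical
  have hcard : 1 < Fintype.card F := Fintype.one_lt_card
  have hE : 0 < E := by
    rcases Nat.eq_zero_or_pos E with h | h
    · rw [h, mul_zero] at hdE; omega
    · exact h
  have hd : 0 < d := by
    rcases Nat.eq_zero_or_pos d with h | h
    · rw [h, zero_mul] at hdE; omega
    · exact h
  have hfib : ∀ x : F, x ≠ 0 →
      (Finset.univ.filter fun u : Fˣ => x ^ E = (u : F) ^ E).card = E := by
    intro x hx
    have := card_units_pow_eq hdE (Units.mk0 x hx)
    rw [Nat.card_eq_fintype_card, Fintype.card_subtype] at this
    refine Eq.trans ?_ this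
    congr 1
    ext u
    simp only [Finset.mem_filter, Finset.mem_univ, true_and, Units.ext_iff, Units.val_pow_eq_pow_val,
      Units.val_mk0]
    exact eq_comm
  have hval : ∀ x : F, x ≠ 0 → ∀ u : Fˣ, x ^ E = (u : F) ^ E → χ u = χ x := by
    intro x hx u h
    obtain ⟨y, hy⟩ := exists_pow_eq_of_pow_eq_one hE hdE (x := u / Units.mk0 x hx) (by
      rw [div_pow, div_eq_one, Units.ext_iff]
      simpa using h.symm)
    have h1 : (u : F) = x * (y : F) ^ d := by
      have := congrArg (fun z : Fˣ => (z : F)) hy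
      simp only [Units.val_pow_eq_pow_val, Units.val_div_eq_div_val, Units.val_mk0] at this
      rw [this]; field_simp
    have h2 : χ ((y : F) ^ d) = 1 := by
      rw [map_pow, ← MulChar.pow_apply_coe, hχd, MulChar.one_apply_coe]
    rw [h1, map_mul, h2, mul_one]
  set N : Fˣ → ℕ := fun u => (Finset.univ.filter fun t => w t ^ E = (u : F) ^ E).card with hN
  have hz : ∀ t, w t = 0 → ∀ u : Fˣ, w t ^ E ≠ (u : F) ^ E := fun t ht u h => by
    rw [ht, zero_pow hE.ne'] at h
    exact pow_ne_zero E u.ne_zero h.symm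
  have hsum : ∑ u : Fˣ, (N u : ℂ) * χ u = E * ∑ t, χ (w t) := by
    have : ∀ u : Fˣ, (N u : ℂ) * χ u = ∑ t, if w t ^ E = (u : F) ^ E then χ u else 0 := by
      intro u
      rw [← Finset.sum_filter, Finset.sum_const, nsmul_eq_mul]
    rw [Finset.sum_congr rfl fun u _ => this u, Finset.sum_comm, Finset.mul_sum]
    refine Finset.sum_congr rfl fun t _ => ?_
    by_cases ht : w t = 0
    · rw [Finset.sum_eq_zero fun u _ => if_neg (hz t ht u), ht, MulChar.map_zero, mul_zero]
    · rw [← Finset.sum_filter, Finset.sum_congr rfl fun u hu => hval _ ht u (Finset.mem_filter.1 hu).2,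
        Finset.sum_const, hfib _ ht, nsmul_eq_mul]
  have hN2 : ∑ u : Fˣ, (N u : ℝ) =
      E * (Fintype.card T - (Finset.univ.filter fun t => w t = 0).card) := by
    have h1 : ∑ u : Fˣ, N u = ∑ t : T, if w t = 0 then 0 else E := by
      simp only [hN, Finset.card_filter]
      rw [Finset.sum_comm]
      refine Finset.sum_congr rfl fun t _ => ?_
      rw [← Finset.card_filter]
      split_ifs with ht
      · exact Finset.card_eq_zero.2 (Finset.filter_eq_empty_iff.2 fun u _ => hz t ht u)
      · exact hfib _ ht
    have h2 := congrArg (Nat.cast : ℕ → ℝ) h1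
    rw [Nat.cast_sum] at h2
    rw [h2, Nat.cast_sum]
    have h3 : ∀ t : T, ((if w t = 0 then 0 else E : ℕ) : ℝ) =
        E * (1 - if w t = 0 then (1 : ℝ) else 0) := fun t => by split_ifs <;> simp
    rw [Finset.sum_congr rfl fun t _ => h3 t, ← Finset.mul_sum, Finset.sum_sub_distrib,
      Finset.sum_boole, Finset.sum_const, Finset.card_univ, nsmul_eq_mul, mul_one]
  have hχsum : ∑ u : Fˣ, χ u = 0 := by
    have h := MulChar.sum_eq_zero_of_ne_one hχ1
    rw [← h]
    refine Finset.sum_bij_ne_zero (fun u _ _ => (u : F)) (fun _ _ _ => Finset.mem_univ _)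
      (fun _ _ _ _ _ _ h => Units.ext h) (fun x _ hx => ?_) fun _ _ _ => rfl
    by_cases h0 : x = 0
    · rw [h0, MulChar.map_zero] at hx; exact absurd rfl hx
    · exact ⟨Units.mk0 x h0, Finset.mem_univ _, by simpa using hx, rfl⟩
  have hmain : ‖(E : ℂ) * ∑ t, χ (w t)‖ ≤ ∑ u : Fˣ, ((U : ℝ) - N u) := by
    have h1 : (E : ℂ) * ∑ t, χ (w t) = ∑ u : Fˣ, (((N u : ℝ) - U : ℝ) : ℂ) * χ u := by
      rw [← hsum]
      push_cast
      simp only [sub_mul, Finset.sum_sub_distrib, ← Finset.mul_sum, hχsum, mul_zero, sub_zero]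
    rw [h1]
    refine (norm_sum_le _ _).trans (Finset.sum_le_sum fun u _ => ?_)
    rw [norm_mul, Complex.norm_real]
    have h2 : (N u : ℝ) ≤ U := by exact_mod_cast hU u u.ne_zero
    rw [Real.norm_of_nonpos (by linarith)]
    calc _ ≤ -((N u : ℝ) - U) * 1 :=
          mul_le_mul_of_nonneg_left (MulChar.norm_apply_le_one χ _) (by linarith)
      _ = _ := by ring
  rw [Finset.sum_sub_distrib, hN2, Finset.sum_const, Finset.card_univ, Fintype.card_units, hdE,
    norm_mul, Complex.norm_natCast, nsmul_eq_mul] at hmain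
  push_cast at hmain
  have hE' : (0 : ℝ) < E := by exact_mod_cast hE
  refine le_of_mul_le_mul_left ?_ hE'
  linarith

end Equidistribution

section Growth

lemma le_one_of_pow_le {x C : ℝ} {j₀ : ℕ} (h : ∀ j, j₀ ≤ j → x ^ j ≤ C) : x ≤ 1 := by
  by_contra hx
  obtain ⟨j, hj⟩ := ((tendsto_pow_atTop_atTop_of_one_lt (not_le.1 hx)).eventually_gt_atTop C).exists_forall_of_atTop
  exact absurd (h (max j j₀) (le_max_right _ _)) (not_le.2 (hj _ (le_max_left _ _)))

lemma norm_le_one_of_power_sum_le {A B : ℂ} {C : ℝ} {j₀ : ℕ}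
    (h : ∀ j, j₀ ≤ j → ‖A ^ j + B ^ j‖ ≤ C) : ‖A‖ ≤ 1 ∧ ‖B‖ ≤ 1 := by
  have hAB : ‖A * B‖ ≤ 1 := by
    refine le_one_of_pow_le (C := (C * C + C) / 2) (j₀ := j₀) fun j hj => ?_
    have h1 := h j hj
    have h2 := h (2 * j) (by omega)
    have h3 : 2 * (A * B) ^ j = (A ^ j + B ^ j) * (A ^ j + B ^ j) - (A ^ (2 * j) + B ^ (2 * j)) := by
      rw [mul_pow, pow_mul', pow_mul']; ring
    have h4 : ‖2 * (A * B) ^ j‖ ≤ C * C + C := by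
      rw [h3]
      refine (norm_sub_le _ _).trans (add_le_add ?_ h2)
      rw [norm_mul]
      exact mul_le_mul h1 h1 (norm_nonneg _) ((norm_nonneg _).trans h1)
    rw [norm_mul, norm_pow, Complex.norm_ofNat] at h4
    linarith
  rw [norm_mul] at hAB
  have key : ∀ {A B : ℂ}, (∀ j, j₀ ≤ j → ‖A ^ j + B ^ j‖ ≤ C) → ‖B‖ ≤ 1 → ‖A‖ ≤ 1 := by
    intro A B h hB
    refine le_one_of_pow_le (C := C + 1) (j₀ := j₀) fun j hj => ?_
    have h1 : ‖A ^ j‖ ≤ ‖A ^ j + B ^ j‖ + ‖B ^ j‖ := by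
      calc _ = ‖(A ^ j + B ^ j) - B ^ j‖ := by rw [add_sub_cancel_right]
        _ ≤ _ := norm_sub_le _ _
    rw [norm_pow, norm_pow] at h1
    have := pow_le_one₀ (norm_nonneg B) hB (n := j)
    linarith [h j hj]
  rcases le_or_gt ‖B‖ 1 with hB | hB
  · exact ⟨key h hB, hB⟩
  · have hA : ‖A‖ ≤ 1 := by nlinarith [norm_nonneg A]
    exact ⟨hA, key (fun j hj => by rw [add_comm]; exact h j hj) hA⟩

end Growth

section WeilBound

variable {Fq F : Type*} [Field Fq] [Fintype Fq] [Field F] [Fintype F] [Algebra Fq F]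

section Extension

variable {K : Type*} [Field K] [Fintype K] [Algebra Fq K] [Algebra F K] [IsScalarTower Fq F K]

lemma sub_pow_card_pow (x y : K) (i : ℕ) :
    (x - y) ^ Fintype.card Fq ^ i = x ^ Fintype.card Fq ^ i - y ^ Fintype.card Fq ^ i := by
  obtain ⟨p, hp⟩ := CharP.exists Fq
  have : CharP K p := charP_of_injective_algebraMap (algebraMap Fq K).injective p
  obtain ⟨e, hpp, he⟩ := FiniteField.card Fq p
  have : Fact p.Prime := ⟨hpp⟩
  rw [he, ← pow_mul]
  exact sub_pow_char_pow _ _ _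

/-- The norm-like product over the powers of Frobenius as a power of a fixed product of four
linear factors. -/
lemma prod_range_sub_pow_eq {j : ℕ} {v t : K} (hv : v ^ Fintype.card Fq ^ 4 = v) :
    ∏ i ∈ Finset.range (4 * j), (v - t ^ Fintype.card Fq ^ i) =
      (∏ c ∈ Finset.range 4, (v ^ Fintype.card Fq ^ (4 - c) - t) ^ Fintype.card Fq ^ c) ^
        (∑ a ∈ Finset.range j, Fintype.card Fq ^ (4 * a)) := by
  set q := Fintype.card Fq with hq
  have hv' : ∀ a : ℕ, v ^ q ^ (4 * a) = v := by
    intro a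
    induction a with
    | zero => simp
    | succ a ih => rw [mul_add, mul_one, pow_add, pow_mul, ih, hv]
  have hstep : ∀ a c : ℕ, c < 4 →
      v - t ^ q ^ (4 * a + c) = ((v ^ q ^ (4 - c) - t) ^ q ^ c) ^ q ^ (4 * a) := by
    intro a c hc
    rw [← pow_mul, ← pow_add, sub_pow_card_pow (Fq := Fq), ← hq, ← pow_mul, ← pow_add,
      show 4 - c + (c + 4 * a) = 4 * (a + 1) by omega, hv', add_comm c]
  induction j with
  | zero => simp
  | succ j ih =>
    rw [mul_add, mul_one, Finset.prod_range_add, ih, Finset.sum_range_succ, pow_add]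
    congr 1
    rw [← Finset.prod_pow]
    refine Finset.prod_congr rfl fun c hc => hstep j c (Finset.mem_range.1 hc)

/-- Each class modulo `d`-th powers contains about the expected number of values. -/
lemma card_filter_class_le {d r ρ : ℕ} (hd1 : 1 ≤ d) {j : ℕ}
    (hdM : d ∣ 1 + Fintype.card Fq + Fintype.card Fq ^ 2 + Fintype.card Fq ^ 3)
    (hr : r = Fintype.card Fq ^ (4 * j)) (hρ : r = d * ρ + 1)
    (hK : Fintype.card K = r ^ 2) {m : ℕ} (hm : m = 1 + Fintype.card Fq + Fintype.card Fq ^ 2)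
    (hbig : (d * m + 2 * d + 1) * (m + 2) < r) {v : K} (hv : v ^ Fintype.card Fq ^ 4 = v)
    (hv3 : ∀ c, 0 < c → c < 4 → v ^ Fintype.card Fq ^ c ≠ v) {ζ : K} (hζ : ζ ≠ 0)
    [DecidableEq K] :
    (Finset.univ.filter fun t : K => (∏ c ∈ Finset.range 4,
      (v ^ Fintype.card Fq ^ (4 - c) - t) ^ Fintype.card Fq ^ c) ^ (ρ * (r + 1)) = ζ).card ≤
        ρ * r + (2 * m + 2) * r + 1 := by
  classical
  set q := Fintype.card Fq with hq
  obtain ⟨p, hp⟩ := CharP.exists Fq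
  have : CharP K p := charP_of_injective_algebraMap (algebraMap Fq K).injective p
  obtain ⟨e, hpp, he⟩ := FiniteField.card Fq p
  have : Fact p.Prime := ⟨hpp⟩
  set V : ℕ → K := fun c => v ^ q ^ (4 - c) with hV
  have hδ : ∀ c, c < 3 → V c - V 3 ≠ 0 := by
    intro c hc h
    have h1 : v ^ q ^ (4 - c) = v ^ q ^ 1 := by simpa [hV, sub_eq_zero] using h
    have h2 := congrArg (fun x => x ^ q ^ 3) h1
    simp only [← pow_mul, ← pow_add] at h2
    rw [show 4 - c + 3 = 4 + (3 - c) by omega, pow_add, pow_mul, hv] at h2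
    exact hv3 (3 - c) (by omega) (by omega) h2
  set f : K[X] := ∏ c ∈ Finset.range 3, (C (V c - V 3) * X + C 1) ^ q ^ c with hf
  have hlin : ∀ c ∈ Finset.range 3, (C (V c - V 3) * X + C 1) ^ q ^ c ≠ (0 : K[X]) := fun c hc =>
    pow_ne_zero _ (fun h0 => by
      have := natDegree_linear (b := (1 : K)) (hδ c (Finset.mem_range.1 hc))
      rw [h0, natDegree_zero] at this
      omega)
  have hfm : f.natDegree = m := by
    rw [hf, natDegree_prod _ _ hlin, Finset.sum_congr rfl fun c hc => by
      rw [natDegree_pow, natDegree_linear (hδ c (Finset.mem_range.1 hc)), mul_one]]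
    simp [Finset.sum_range_succ, hm]
  have hf0 : f ≠ 0 := Finset.prod_ne_zero_iff.2 hlin
  have hcop : Nat.Coprime m d := by
    refine Nat.Coprime.coprime_dvd_right hdM ?_
    have h1 : Nat.Coprime m (q ^ 3) := by
      refine Nat.Coprime.pow_right _ ?_
      rw [hm, show 1 + q + q ^ 2 = 1 + q * (1 + q) by ring]
      simp
    rw [← hm]
    simpa using h1
  have hst := card_filter_pow_eq_le (p := p) (s := e * (4 * j)) (hr.trans (by rw [hq, he, ← pow_mul])) hK hρ
    hfm hf0 hcop hd1 hbig hζ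
  refine le_trans ?_ (Nat.add_le_add_right hst 1)
  set S := Finset.univ.filter fun t : K =>
    (∏ c ∈ Finset.range 4, (v ^ q ^ (4 - c) - t) ^ q ^ c) ^ (ρ * (r + 1)) = ζ with hS
  have hinj : (S.erase (V 3)).card ≤
      (Finset.univ.filter fun x : K => eval x f ^ (ρ * (r + 1)) = ζ).card := by
    refine Finset.card_le_card_of_injOn (fun t => (V 3 - t)⁻¹) (fun t ht => ?_)
      fun t _ t' _ h => sub_right_injective (inv_injective h)
    obtain ⟨hne, ht⟩ := Finset.mem_erase.1 ht
    have ht := (Finset.mem_filter.1 ht).2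
    refine Finset.mem_filter.2 ⟨Finset.mem_univ _, ?_⟩
    set y := V 3 - t with hy
    have hy0 : y ≠ 0 := sub_ne_zero.2 hne.symm
    obtain ⟨M', hM'⟩ := hdM
    have hone : (y ^ (1 + q + q ^ 2 + q ^ 3)) ^ (ρ * (r + 1)) = 1 := by
      have h1 : (1 + q + q ^ 2 + q ^ 3) * (ρ * (r + 1)) = (Fintype.card K - 1) * M' := by
        rw [hM', hK]
        have h2 : r ^ 2 - 1 = d * ρ * (r + 1) := by
          have h3 : r - 1 = d * ρ := by omega
          rw [← h3]
          have h4 : 1 ≤ r := by omega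
          zify [h4, Nat.one_le_pow 2 r h4]
          ring
        rw [h2]; ring
      rw [← pow_mul, h1, pow_mul, FiniteField.pow_card_sub_one_eq_one _ hy0, one_pow]
    have hprod : ∏ c ∈ Finset.range 4, (v ^ q ^ (4 - c) - t) ^ q ^ c =
        eval y⁻¹ f * y ^ (1 + q + q ^ 2 + q ^ 3) := by
      rw [hf, eval_prod, Finset.prod_range_succ]
      have h1 : ∀ c ∈ Finset.range 3, (v ^ q ^ (4 - c) - t) ^ q ^ c =
          eval y⁻¹ ((C (V c - V 3) * X + C 1) ^ q ^ c) * y ^ q ^ c := by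
        intro c _
        rw [eval_pow, ← mul_pow]
        congr 1
        simp only [eval_add, eval_mul, eval_C, eval_X]
        rw [add_mul, mul_assoc, inv_mul_cancel₀ hy0, hy, hV]
        ring
      rw [Finset.prod_congr rfl h1, Finset.prod_mul_distrib, mul_assoc]
      congr 1
      have h2 : v ^ q ^ (4 - 3) - t = y := rfl
      rw [h2, Finset.prod_pow_eq_pow_sum, ← pow_add]
      simp [Finset.sum_range_succ]
    rw [hprod, mul_pow, hone, mul_one] at ht
    exact ht
  have := Finset.pred_card_le_card_erase (s := S) (a := V 3)
  omega

end Extension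

lemma natDegree_minpoly_ge_of_linearIndependent {k : ℕ} {v : F}
    (hv : LinearIndependent Fq fun i : Fin k => v ^ (i : ℕ)) : k ≤ (minpoly Fq v).natDegree := by
  by_contra hlt
  rw [not_le] at hlt
  have h0 := minpoly.aeval Fq v
  rw [aeval_eq_sum_range' hlt, ← Fin.sum_univ_eq_sum_range
    (fun i => (minpoly Fq v).coeff i • v ^ i)] at h0
  have h1 := Fintype.linearIndependent_iff.1 hv _ h0 ⟨_, hlt⟩
  have h2 := minpoly.monic (Algebra.IsIntegral.isIntegral (R := Fq) v)
  rw [Monic, leadingCoeff] at h2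
  simp [h2] at h1

lemma norm_vonMangoldtSum_le {χ : MulChar F ℂ} (hχ1 : χ ≠ 1) {d : ℕ} (hχd : χ ^ d = 1)
    (hdM : d ∣ 1 + Fintype.card Fq + Fintype.card Fq ^ 2 + Fintype.card Fq ^ 3)
    (hn : Module.finrank Fq F = 4) {v : F}
    (hv : LinearIndependent Fq fun i : Fin 4 => v ^ (i : ℕ)) :
    ∃ (B : ℝ) (j₀ : ℕ), 0 ≤ B ∧ ∀ j, j₀ ≤ j → ‖vonMangoldtSum (evalChar (Fq := Fq) χ v) (8 * j)‖ ≤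
      B * (Fintype.card Fq : ℝ) ^ (4 * j) := by
  classical
  set q := Fintype.card Fq with hq
  have hq1 : 1 < q := Fintype.one_lt_card
  have hcF : Fintype.card F = q ^ 4 := by rw [card_eq_card_pow_finrank (Fq := Fq), hn]
  set m := 1 + q + q ^ 2 with hm
  have hd1 : 1 ≤ d := Nat.pos_of_dvd_of_pos hdM (by positivity)
  obtain ⟨M', hM'⟩ := hdM
  have hcM : q ^ 4 - 1 = d * (M' * (q - 1)) := by
    rw [← mul_assoc, ← hM', hm]
    zify [hq1.le, Nat.one_le_pow 4 q (by omega)]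
    ring
  set E := M' * (q - 1) with hE
  have hvmin := natDegree_minpoly_ge_of_linearIndependent hv
  have hv4 : v ^ q ^ 4 = v := by rw [← hcF]; exact FiniteField.pow_card v
  have hv3 : ∀ c, 0 < c → c < 4 → v ^ q ^ c ≠ v := fun c h0 h4 h => by
    have := Nat.le_of_dvd h0 (natDegree_minpoly_dvd_of_pow_eq (Fq := Fq) h)
    omega
  obtain ⟨p, hp⟩ := CharP.exists F
  obtain ⟨e, hpp, he⟩ := FiniteField.card F p
  have : Fact p.Prime := ⟨hpp⟩
  refine ⟨d * (2 * m + 2) + d + 4, (d * m + 2 * d + 1) * (m + 2) + 1, by positivity, fun j hj => ?_⟩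
  have hj0 : 0 < j := by omega
  have : NeZero (2 * j) := ⟨by omega⟩
  let K := FiniteField.Extension F p (2 * j)
  let _ : Fintype K := Fintype.ofFinite K
  let _ : Algebra Fq K := ((algebraMap F K).comp (algebraMap Fq F)).toAlgebra
  have : IsScalarTower Fq F K := IsScalarTower.of_algebraMap_eq fun _ => rfl
  have hFK : Module.finrank F K = 2 * j := FiniteField.finrank_extension F p (2 * j)
  have hrank : Module.finrank Fq K = 4 * (2 * j) := by
    rw [← Module.finrank_mul_finrank Fq F K, hn, hFK]
  set r := q ^ (4 * j) with hr
  have hK : Fintype.card K = r ^ 2 := by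
    rw [card_eq_card_pow_finrank (Fq := Fq), hrank, hr, ← pow_mul]
    congr 1; ring
  have hr1 : 1 ≤ r := Nat.one_le_pow _ _ (by omega)
  obtain ⟨ρ, hρ⟩ : d ∣ r - 1 := by
    refine dvd_trans ⟨_, hcM⟩ ?_
    have := Nat.sub_dvd_pow_sub_pow (q ^ 4) 1 j
    rwa [one_pow, ← pow_mul] at this
  have hρ' : r = d * ρ + 1 := by omega
  have hbig : (d * m + 2 * d + 1) * (m + 2) < r := by
    have h1 : 4 * j < q ^ (4 * j) := Nat.lt_pow_self hq1
    omega
  have hexp : (∑ a ∈ Finset.range (2 * j), q ^ (4 * a)) * E = ρ * (r + 1) := by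
    have h1 : (∑ a ∈ Finset.range (2 * j), q ^ (4 * a)) * (q ^ 4 - 1) = r ^ 2 - 1 := by
      have h3 := geom_sum_mul_of_one_le (x := q ^ 4) (Nat.one_le_pow 4 q (by omega)) (2 * j)
      rw [← pow_mul, show 4 * (2 * j) = 4 * j * 2 by ring, pow_mul q (4 * j) 2] at h3
      rw [← h3]
      simp only [pow_mul]
    refine Nat.eq_of_mul_eq_mul_left hd1 ?_
    have h2 : r ^ 2 - 1 = d * ρ * (r + 1) := by
      rw [← hρ]
      zify [hr1, Nat.one_le_pow 2 r hr1]
      ring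
    calc _ = (∑ a ∈ Finset.range (2 * j), q ^ (4 * a)) * (d * E) := by ring
      _ = _ := by rw [← hcM, h1, h2]; ring
  set v' : K := algebraMap F K v with hv'
  have hv4' : v' ^ q ^ 4 = v' := by rw [hv', ← map_pow, hv4]
  have hv3' : ∀ c, 0 < c → c < 4 → v' ^ q ^ c ≠ v' := fun c h0 h4 h => by
    rw [hv', ← map_pow] at h
    exact hv3 c h0 h4 ((algebraMap F K).injective h)
  set w : K → F := fun t => aeval v (minpoly Fq t) ^ (Module.finrank Fq K / (minpoly Fq t).natDegree)
    with hw
  set G : K → K := fun t => ∏ c ∈ Finset.range 4, (v' ^ q ^ (4 - c) - t) ^ q ^ c with hG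
  have hwG : ∀ t, algebraMap F K (w t) = G t ^ (∑ a ∈ Finset.range (2 * j), q ^ (4 * a)) := by
    intro t
    rw [hw, map_pow, ← aeval_algebraMap_apply, aeval_minpoly_pow_eq_prod, hrank]
    exact prod_range_sub_pow_eq (Fq := Fq) hv4'
  have hsum : vonMangoldtSum (evalChar (Fq := Fq) χ v) (8 * j) = ∑ t : K, χ (w t) := by
    have h := vonMangoldtSum_eq_sum (K := K) (evalChar (Fq := Fq) χ v)
    rw [hrank, show 4 * (2 * j) = 8 * j by ring] at h
    rw [h]
    refine Finset.sum_congr rfl fun t _ => ?_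
    rw [evalChar_apply, ← map_pow, hw, hrank, show 4 * (2 * j) = 8 * j by ring]
  have hcls : ∀ u : F, u ≠ 0 → (Finset.univ.filter fun t => w t ^ E = u ^ E).card ≤
      ρ * r + (2 * m + 2) * r + 1 := by
    intro u hu
    refine le_trans (Finset.card_le_card fun t ht => ?_) (card_filter_class_le (Fq := Fq) (K := K) hd1
      ⟨M', hM'⟩ hr hρ' hK hm hbig hv4' hv3' (ζ := algebraMap F K (u ^ E)) (by simp [hu]))
    refine Finset.mem_filter.2 ⟨Finset.mem_univ _, ?_⟩
    rw [← (Finset.mem_filter.1 ht).2, map_pow, hwG, ← pow_mul, hexp]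
  have hzero : (Finset.univ.filter fun t => w t = 0).card ≤ 4 := by
    refine le_trans (Finset.card_le_card (t := (Finset.range 4).image fun c => v' ^ q ^ (4 - c))
      fun t ht => ?_) (Finset.card_image_le.trans (by simp))
    have h1 := hwG t
    rw [(Finset.mem_filter.1 ht).2, map_zero] at h1
    have h2 := eq_zero_of_pow_eq_zero h1.symm
    obtain ⟨c, hc, h3⟩ := Finset.prod_eq_zero_iff.1 h2
    exact Finset.mem_image.2 ⟨c, hc, sub_eq_zero.1 (eq_zero_of_pow_eq_zero h3)⟩
  have hmain := norm_sum_mulChar_le hχ1 (hcF ▸ hcM) hχd w hcls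
  rw [hsum]
  refine hmain.trans ?_
  rw [hK]
  have hz : ((Finset.univ.filter fun t => w t = 0).card : ℝ) ≤ 4 := by exact_mod_cast hzero
  have hrr : (r : ℝ) = d * ρ + 1 := by exact_mod_cast hρ'
  have hr1' : (1 : ℝ) ≤ r := by exact_mod_cast hr1
  have hrq : (q : ℝ) ^ (4 * j) = r := by rw [hr]; push_cast; rfl
  rw [hrq]
  push_cast
  have hd0 : (0 : ℝ) ≤ d := by positivity
  have e1 : (d : ℝ) * (ρ * r) = (r - 1) * r := by rw [hrr]; ring
  have e2 : (d : ℝ) ≤ d * r := by nlinarith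
  nlinarith

/-- The Weil bound for the character sum along a generic affine line. -/
theorem norm_one_add_sum_le {χ : MulChar F ℂ} (hχ1 : χ ≠ 1) {d : ℕ} (hχd : χ ^ d = 1)
    (hdM : d ∣ 1 + Fintype.card Fq + Fintype.card Fq ^ 2 + Fintype.card Fq ^ 3)
    (hn : Module.finrank Fq F = 4) {v : F}
    (hv : LinearIndependent Fq fun i : Fin 4 => v ^ (i : ℕ)) :
    ‖1 + ∑ t : Fq, χ (v - algebraMap Fq F t)‖ ≤ 2 * √(Fintype.card Fq) := by
  set q := Fintype.card Fq with hq
  have hq1 : 1 < q := Fintype.one_lt_card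
  have hcF : Fintype.card F = q ^ 4 := by rw [card_eq_card_pow_finrank (Fq := Fq), hn]
  have htriv : ∀ a : Fq, a ≠ 0 → χ (algebraMap Fq F a) = 1 := by
    intro a ha
    have ha' : algebraMap Fq F a ≠ 0 := by simpa using ha
    obtain ⟨y, hy⟩ := exists_pow_eq_of_pow_eq_one (F := F) (d := 1 + q + q ^ 2 + q ^ 3) (E := q - 1)
      (by omega) (by
        rw [hcF]
        zify [hq1.le, Nat.one_le_pow 4 q (by omega)]
        ring) (x := Units.mk0 _ ha') (by
        ext
        simp only [Units.val_pow_eq_pow_val, Units.val_mk0, Units.val_one]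
        rw [← map_pow, hq, FiniteField.pow_card_sub_one_eq_one a ha, map_one])
    obtain ⟨k, hk⟩ := hdM
    have h1 : algebraMap Fq F a = (y : F) ^ (d * k) := by
      rw [← hk]; simpa using (congrArg (fun z : Fˣ => (z : F)) hy).symm
    rw [h1, map_pow, pow_mul, ← MulChar.pow_apply_coe, hχd, MulChar.one_apply_coe, one_pow]
  obtain ⟨a, b, hab⟩ := exists_reciprocal_roots hχ1 htriv hn hv
  obtain ⟨B, j₀, hB, hbound⟩ := norm_vonMangoldtSum_le hχ1 hχd hdM hn hv
  rw [← hq] at hbound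
  have hq0 : (0 : ℝ) < q := by positivity
  have hqc : (q : ℂ) ≠ 0 := by exact_mod_cast hq0.ne'
  have hAB : ‖a ^ 8 / (q : ℂ) ^ 4‖ ≤ 1 ∧ ‖b ^ 8 / (q : ℂ) ^ 4‖ ≤ 1 := by
    refine norm_le_one_of_power_sum_le (C := B + 1) (j₀ := max j₀ 1) fun j hj => ?_
    have h1 := hbound j (le_of_max_le_left hj)
    rw [hab _ (by have := le_of_max_le_right hj; omega), norm_neg] at h1
    have h2 : (a ^ 8 / (q : ℂ) ^ 4) ^ j + (b ^ 8 / (q : ℂ) ^ 4) ^ j =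
        (a ^ (8 * j) + b ^ (8 * j)) / (q : ℂ) ^ (4 * j) := by
      rw [div_pow, div_pow, ← pow_mul, ← pow_mul, ← pow_mul, add_div]
    rw [h2, norm_div, norm_pow, Complex.norm_natCast, div_le_iff₀ (by positivity)]
    have h3 : (1 : ℝ) ≤ (q : ℝ) ^ (4 * j) := one_le_pow₀ (by exact_mod_cast hq1.le)
    have h4 : ‖a ^ (8 * j) + b ^ (8 * j)‖ ≤ ‖1 + a ^ (8 * j) + b ^ (8 * j)‖ + 1 := by
      calc _ = ‖(1 + a ^ (8 * j) + b ^ (8 * j)) - 1‖ := by congr 1; ring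
        _ ≤ _ := (norm_sub_le _ _).trans (by simp)
    linarith
  have hroot : ∀ z : ℂ, ‖z ^ 8 / (q : ℂ) ^ 4‖ ≤ 1 → ‖z‖ ≤ √q := by
    intro z hz
    rw [norm_div, norm_pow, norm_pow, Complex.norm_natCast, div_le_one (by positivity)] at hz
    refine le_of_pow_le_pow_left₀ (n := 8) (by norm_num) (Real.sqrt_nonneg _) (hz.trans_eq ?_)
    rw [show 8 = 2 * 4 from rfl, pow_mul, Real.sq_sqrt hq0.le]
  have h1 := hab 1 le_rfl
  rw [vonMangoldtSum_one] at h1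
  simp only [evalChar_apply, map_sub, aeval_X, aeval_C, pow_one] at h1
  rw [h1, show 1 + -(1 + a + b) = -(a + b) by ring, norm_neg]
  linarith [norm_add_le a b, hroot a hAB.1, hroot b hAB.2]

end WeilBound

section Quartic

variable {Fq F : Type*} [Field Fq] [Field F] [Fintype Fq] [Fintype F] [Algebra Fq F]

/-- The combination of two eigenvectors of Frobenius has a quadratic `F_q`-order. -/
lemma sub_mem_exactSet [DecidableEq Fq[X]] {a b : Fq} (hab : a ≠ b) {x y : F} (hx0 : x ≠ 0) (hy0 : y ≠ 0)
    (hx : frob Fq F x = a • x) (hy : frob Fq F y = b • y) :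
    x - y ∈ exactSet F ((X - C a) * (X - C b)) {X - C a, X - C b} := by
  have key : ∀ c : Fq, aeval (frob Fq F) (X - C c) (x - y) = (a - c) • x - (b - c) • y := by
    intro c
    rw [map_sub (aeval (R := Fq) (frob Fq F)), aeval_X, aeval_C, LinearMap.sub_apply,
      map_sub (frob Fq F), hx, hy, Module.algebraMap_end_apply, smul_sub, sub_smul, sub_smul]
    abel
  have hab' : a - b ≠ 0 := sub_ne_zero.2 hab
  have hba' : b - a ≠ 0 := sub_ne_zero.2 hab.symm
  rw [mem_exactSet, mem_kerSet]
  refine ⟨?_, fun P hP => ?_⟩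
  · rw [aeval_frob_mul, key, sub_self, zero_smul, sub_zero, map_smul, map_sub (aeval (R := Fq) (frob Fq F)), aeval_X,
      aeval_C, LinearMap.sub_apply, hx, Module.algebraMap_end_apply, sub_self, smul_zero]
  · rw [mem_kerSet]
    rcases Finset.mem_insert.1 hP with rfl | hP
    · rw [mul_div_cancel_left₀ _ (X_sub_C_ne_zero a), key, sub_self, zero_smul, sub_zero]
      exact smul_ne_zero hab' hx0
    · rw [Finset.mem_singleton.1 hP, mul_div_cancel_right₀ _ (X_sub_C_ne_zero b), key, sub_self,
        zero_smul, zero_sub]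
      exact neg_ne_zero.2 (smul_ne_zero hba' hy0)

set_option maxHeartbeats 3200000 in
/-- A sieve criterion for degree four along a line spanned by two eigenvectors of Frobenius. -/
theorem exists_of_criterion_four {q : ℕ} (hcard : Fintype.card Fq = q)
    (hn : Module.finrank Fq F = 4) (hq4 : q % 4 = 1) {K R : Finset ℕ}
    (hprime : ∀ l ∈ K ∪ R, l.Prime ∧ l ≠ 2 ∧ l ∣ 1 + q + q ^ 2 + q ^ 3)
    (hcover : ∀ l : ℕ, l.Prime → l ≠ 2 → l ∣ 1 + q + q ^ 2 + q ^ 3 → l ∈ K ∪ R)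
    (hKR : Disjoint K R) (hσ : ∑ l ∈ R, 1 / (l : ℝ) ≤ 1)
    (hmain : 2 * √(q : ℝ) * ((2 ^ K.card - 1) * (1 - ∑ l ∈ R, 1 / (l : ℝ)) +
        2 ^ K.card * ∑ l ∈ R, (1 - 1 / (l : ℝ))) < (1 - ∑ l ∈ R, 1 / (l : ℝ)) * (q + 1)) :
    ∃ α : F, α ≠ 0 ∧ 2 * orderOf α = q ^ 4 - 1 ∧ IsKNormal Fq q 4 2 α := by
  classical
  subst hcard
  set q := Fintype.card Fq with hq
  have hq1 : 1 < q := Fintype.one_lt_card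
  have hcF : Fintype.card F = q ^ 4 := by rw [card_eq_card_pow_finrank (Fq := Fq), hn]
  set M := 1 + q + q ^ 2 + q ^ 3 with hM
  have hMq : Fintype.card F - 1 = M * (q - 1) := by
    rw [hcF, hM]
    zify [hq1.le, Nat.one_le_pow 4 q (by omega)]
    ring
  obtain ⟨b, hb⟩ : ∃ b, q = 4 * b + 1 := ⟨q / 4, by omega⟩
  have hb0 : 0 < b := by omega
  obtain ⟨M₀, hM₀, hM₀odd, hM₀1⟩ : ∃ M₀, M = 4 * M₀ ∧ M₀ % 2 = 1 ∧ 1 < M₀ := by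
    refine ⟨(2 * b + 1) * (2 * (4 * b ^ 2 + 2 * b) + 1), by rw [hM, hb]; ring, ?_, by nlinarith⟩
    rw [← Nat.odd_iff, Nat.odd_mul]
    exact ⟨odd_two_mul_add_one _, odd_two_mul_add_one _⟩
  -- an eigenvector of Frobenius
  obtain ⟨ι, hι⟩ : ∃ ι : Fq, ι * ι = -1 := by
    obtain ⟨ι, h⟩ := (FiniteField.isSquare_neg_one_iff (F := Fq)).2 (by omega)
    exact ⟨ι, h.symm⟩
  have hchar : (2 : Fq) ≠ 0 := by
    have : ringChar Fq ≠ 2 := fun h => by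
      have := FiniteField.even_card_iff_char_two.1 h
      omega
    exact Ring.two_ne_zero this
  have hm1 : (-1 : Fq) ≠ 1 := fun h => hchar (by linear_combination -h)
  have hι0 : ι ≠ 0 := fun h => by rw [h, mul_zero] at hι; exact one_ne_zero (neg_eq_zero.1 hι.symm)
  have hι1 : ι ≠ 1 := fun h => hm1 (by rw [← hι, h, mul_one])
  have hι4 : ι ^ 4 = 1 := by linear_combination (ι * ι - 1) * hι
  have hιF : algebraMap Fq F ι ≠ 0 := by simpa using hι0
  obtain ⟨y, hy⟩ := exists_pow_eq_of_pow_eq_one (F := F) (d := q - 1) (E := M) (by omega)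
    (by rw [hMq, mul_comm]) (x := Units.mk0 _ hιF) (by
      ext
      simp only [Units.val_pow_eq_pow_val, Units.val_mk0, Units.val_one]
      rw [hM₀, pow_mul, ← map_pow, hι4, map_one, one_pow])
  set v : F := (y : F) with hv
  have hv0 : v ≠ 0 := y.ne_zero
  have hvq1 : v ^ (q - 1) = algebraMap Fq F ι := by
    simpa using congrArg (fun z : Fˣ => (z : F)) hy
  have hvq : v ^ q = ι • v := by
    rw [show q = q - 1 + 1 by omega, pow_succ, hvq1, Algebra.smul_def]
  have hvk : ∀ k : ℕ, frob Fq F (v ^ k) = ι ^ k • v ^ k := fun k => by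
    rw [frob_apply, ← hq, ← pow_mul, mul_comm, pow_mul, hvq, _root_.smul_pow]
  have hvind : LinearIndependent Fq fun i : Fin 4 => v ^ (i : ℕ) := by
    have hd : (minpoly Fq v).natDegree = 4 := by
      have h1 := pow_card_pow_natDegree_minpoly (Fq := Fq) v
      have h2 := natDegree_minpoly_dvd_finrank (Fq := Fq) v
      rw [hn] at h2
      have h3 : (minpoly Fq v).natDegree ∈ Nat.divisors 4 := Nat.mem_divisors.2 ⟨h2, by norm_num⟩
      rw [show Nat.divisors 4 = {1, 2, 4} by decide] at h3
      simp only [Finset.mem_insert, Finset.mem_singleton] at h3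
      rcases h3 with h | h | h
      · rw [h, ← hq, pow_one, hvq] at h1
        have h4 : (ι - 1) • v = 0 := by rw [sub_smul, h1, one_smul, sub_self]
        exact absurd h4 (smul_ne_zero (sub_ne_zero.2 hι1) hv0)
      · rw [h, ← hq, pow_two, pow_mul, hvq, _root_.smul_pow, hvq, smul_smul, ← pow_succ] at h1
        have h5 : ι ^ (q + 1) = -1 := by
          rw [hb, show 4 * b + 1 + 1 = 4 * b + 2 by ring, pow_add, pow_mul, hι4, one_pow, one_mul,
            pow_two, hι]
        rw [h5] at h1
        have h4 : ((-1 : Fq) - 1) • v = 0 := by rw [sub_smul, h1, one_smul, sub_self]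
        exact absurd h4 (smul_ne_zero (sub_ne_zero.2 hm1) hv0)
      · exact h
    have := linearIndependent_pow (K := Fq) v
    rwa [hd] at this
  have hvt : ∀ t : Fq, v - algebraMap Fq F t ≠ 0 := fun t h => by
    have h1 : v ^ q = v := by rw [sub_eq_zero.1 h, ← map_pow, hq, FiniteField.pow_card]
    rw [hvq] at h1
    have h4 : (ι - 1) • v = 0 := by rw [sub_smul, h1, one_smul, sub_self]
    exact smul_ne_zero (sub_ne_zero.2 hι1) hv0 h4
  -- discrete logarithms
  obtain ⟨g, X', hg, hX⟩ := exists_dlog (F := F)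
  have hord : orderOf g = M * (q - 1) := by
    rw [orderOf_eq_card_of_forall_mem_zpowers hg, Nat.card_eq_fintype_card, Fintype.card_units, hMq]
  have hgpow : ∀ k, (g : F) ^ k = 1 ↔ M * (q - 1) ∣ k := fun k => by
    rw [← hord, orderOf_dvd_iff_pow_eq_one, Units.ext_iff]; simp
  have hL1 : M₀ ∣ X' v := by
    have h1 : (g : F) ^ (4 * X' v * (q - 1)) = 1 := by
      rw [mul_comm 4, mul_assoc, pow_mul, hX v hv0, mul_comm 4, pow_mul, hvq1, ← map_pow, hι4, map_one]
    have h2 := Nat.dvd_of_mul_dvd_mul_right (by omega) ((hgpow _).1 h1)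
    rw [hM₀] at h2
    exact Nat.dvd_of_mul_dvd_mul_left (by norm_num) h2
  have hL2 : X' v % 2 = 1 := by
    by_contra hL
    obtain ⟨s, hs⟩ := hL1
    have hs2 : s % 2 = 0 := by
      by_contra h
      apply hL
      rw [hs, Nat.mul_mod, hM₀odd]; omega
    have h1 : (g : F) ^ (2 * X' v * (q - 1)) = 1 := by
      rw [hgpow]
      refine Nat.mul_dvd_mul_right ⟨s / 2, ?_⟩ _
      rw [hs, hM₀]
      have : s = 2 * (s / 2) := by omega
      rw [this]; simp only [Nat.mul_div_cancel_left _ (show 0 < 2 by norm_num)]; ring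
    rw [mul_comm 2, mul_assoc, pow_mul, hX v hv0, mul_comm 2, pow_mul, hvq1, pow_two, ← map_mul, hι,
      map_neg, map_one] at h1
    have h2 : algebraMap Fq F (-1) = algebraMap Fq F 1 := by rw [map_neg, map_one, h1]
    exact hm1 ((algebraMap Fq F).injective h2)
  have hodd : ∀ l : ℕ, l.Prime → l ≠ 2 → l ∣ M → l ∣ M₀ := fun l hl h2 hlM => by
    rw [hM₀] at hlM
    rcases (Nat.Prime.dvd_mul hl).1 hlM with h | h
    · exact absurd ((Nat.prime_dvd_prime_iff_eq hl Nat.prime_two).1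
        (hl.dvd_of_dvd_pow (n := 2) (by simpa using h))) h2
    · exact h
  obtain ⟨l₀, hl₀, hl₀M⟩ := Nat.exists_prime_and_dvd hM₀1.ne'
  have hl₀2 : l₀ ≠ 2 := fun h => by rw [h] at hl₀M; omega
  have hl₀K := hcover l₀ hl₀ hl₀2 (hM₀ ▸ hl₀M.mul_left 4)
  -- the sieve
  let Z : Option Fq → ℕ := fun o => o.elim 0 fun t => X' (v - algebraMap Fq F t)
  have hsum : ∀ r : ℚ, r.den ∣ M₀ → r.den ≠ 1 →
      ‖∑ w ∈ (Finset.univ : Finset (Option Fq)), ee (r * Z w)‖ ≤ 2 * √(q : ℝ) := by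
    intro r h1 h3
    have hrN : r.den ∣ Fintype.card F - 1 := by
      rw [hMq, hM₀, mul_assoc]; exact (h1.mul_right _).mul_left _
    obtain ⟨χ, hχ, hχX⟩ := exists_mulChar_ee hg hX hrN
    have hχd : χ ^ r.den = 1 := by
      ext u
      rw [MulChar.pow_apply_coe, MulChar.one_apply_coe, hχX _ u.ne_zero, ← ee_nat_mul]
      have : ((r.den : ℚ) * (r * (X' (u : F) : ℚ))) = ((r.num * X' (u : F) : ℤ) : ℚ) := by
        rw [← mul_assoc, Rat.den_mul_eq_num]; push_cast; rfl
      rw [this, ee_int]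
    have h4 := norm_one_add_sum_le (hχ h3) hχd (h1.trans (Dvd.intro_left 4 hM₀.symm)) hn hvind
    rw [Fintype.sum_option]
    simp only [Z, Option.elim]
    rw [Nat.cast_zero, mul_zero, ee_zero]
    rw [Finset.sum_congr rfl fun t _ => hχX _ (hvt t)] at h4
    exact h4
  obtain ⟨w, -, -, -, hwK, hwR⟩ := exists_of_sieve (κ := Unit) (J := ∅) (Ω := fun _ => ∅) (θ := 1)
    (u := fun _ => 1) (D := 1) (fun _ => Or.inr rfl) (SieveWeight.one hsum) (by simp) (K := K) (R := R)
    (fun l hl => by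
      obtain ⟨h1, h2, h3⟩ := hprime l (Finset.mem_union_left _ hl)
      exact ⟨h1, by simp, hodd l h1 h2 h3⟩)
    (fun l hl => by
      obtain ⟨h1, h2, h3⟩ := hprime l (Finset.mem_union_right _ hl)
      exact ⟨h1, by simp, hodd l h1 h2 h3⟩) hKR hσ (by
      simpa [← hq] using hmain)
  have hwl : ∀ l ∈ K ∪ R, ¬ l ∣ Z w := fun l hl => by
    rcases Finset.mem_union.1 hl with h | h
    · exact hwK l h
    · exact hwR l h
  obtain ⟨t, rfl⟩ : ∃ t, w = some t := by
    rcases w with - | t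
    · exact absurd (dvd_zero l₀) (hwl l₀ hl₀K)
    · exact ⟨t, rfl⟩
  have ht0 : t ≠ 0 := by
    rintro rfl
    refine hwl l₀ hl₀K ?_
    simp only [Z, Option.elim, map_zero, sub_zero]
    exact hl₀M.trans hL1
  set x := v - algebraMap Fq F t with hx
  have hxZ : Z (some t) = X' x := rfl
  obtain ⟨j, hj⟩ : ∃ j, (X' x + j * X' v) % 4 = 2 := by
    have h1 : X' v % 4 = 1 ∨ X' v % 4 = 3 := by omega
    have h2 : X' x % 4 < 4 := Nat.mod_lt _ (by norm_num)
    have h3 : ∀ j, (X' x + j * X' v) % 4 = (X' x % 4 + (j % 4) * (X' v % 4)) % 4 := fun j => by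
      rw [Nat.add_mod, Nat.mul_mod]; omega
    generalize X' x % 4 = e at h2 h3
    rcases h1 with h1 | h1
    · refine ⟨6 - e, ?_⟩; rw [h3, h1]; omega
    · refine ⟨e + 2, ?_⟩; rw [h3, h1]; omega
  have hpow : (g : F) ^ (X' x + j * X' v) = v ^ (j + 1) - t • v ^ j := by
    rw [pow_add, hX x (hvt t), mul_comm j, pow_mul, hX v hv0, hx, Algebra.smul_def]; ring
  have hιj : ι ^ (j + 1) ≠ ι ^ j := fun h => by
    rw [pow_succ] at h
    exact hι1 (mul_left_cancel₀ (pow_ne_zero j hι0) (h.trans (mul_one _).symm))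
  have hmem := sub_mem_exactSet (F := F) hιj (x := v ^ (j + 1)) (y := t • v ^ j) (pow_ne_zero _ hv0)
    (smul_ne_zero ht0 (pow_ne_zero _ hv0)) (hvk _) (by rw [map_smul, hvk, smul_comm])
  rw [← hpow] at hmem
  have h2F : 2 ∣ Fintype.card F - 1 := by
    rw [hMq, hM₀]; exact ((Dvd.intro 2 rfl : 2 ∣ 4).mul_right _).mul_right _
  obtain ⟨β, hβ, hβ0, hβo⟩ := exists_scaled hg hMq h2F (k := X' x + j * X' v)
    (fun l h1 h2 h3 hd => hwl l (hcover l h1 h2 h3)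
      ((Nat.dvd_add_left (((hodd l h1 h2 h3).trans hL1).mul_left j)).1 hd)) (Or.inr hj) hmem
  have hroot : ∀ k : ℕ, (X - C (ι ^ k) : Fq[X]) ∣ X ^ Module.finrank Fq F - 1 := fun k => by
    rw [dvd_iff_isRoot, hn]
    simp [← pow_mul, mul_comm k, pow_mul ι 4, hι4]
  have hmonic : ((X - C (ι ^ (j + 1))) * (X - C (ι ^ j)) : Fq[X]).Monic :=
    (monic_X_sub_C _).mul (monic_X_sub_C _)
  have hFq := isFqOrder_of_mem_exactSet hmonic
    ((isCoprime_X_sub_C_of_isUnit_sub (sub_ne_zero.2 hιj).isUnit).mul_dvd (hroot _) (hroot _))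
    (fun P hPm hPi hPd => by
      rcases hPi.prime.dvd_or_dvd hPd with h | h
      · exact Finset.mem_insert.2 (Or.inl (eq_of_monic_of_associated hPm (monic_X_sub_C _)
          (hPi.associated_of_dvd (irreducible_X_sub_C _) h)))
      · exact Finset.mem_insert.2 (Or.inr (Finset.mem_singleton.2 (eq_of_monic_of_associated hPm
          (monic_X_sub_C _) (hPi.associated_of_dvd (irreducible_X_sub_C _) h))))) hβ
  rw [hn] at hFq
  refine ⟨β, hβ0, by rw [hβo, hcF], _, hFq, ?_⟩
  rw [natDegree_mul (X_sub_C_ne_zero _) (X_sub_C_ne_zero _), natDegree_X_sub_C, natDegree_X_sub_C]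

end Quartic

section PrimeBound

/-- The odd primes dividing `M` split into at most `k` core primes and at most `s` further primes
whose reciprocals sum to at most `σ`. -/
def PrimeBound (M k s : ℕ) (σ : ℝ) : Prop :=
  ∃ K R : Finset ℕ, (∀ l ∈ K ∪ R, l.Prime ∧ l ≠ 2 ∧ l ∣ M) ∧
    (∀ l : ℕ, l.Prime → l ≠ 2 → l ∣ M → l ∈ K ∪ R) ∧ Disjoint K R ∧
    K.card ≤ k ∧ R.card ≤ s ∧ ∑ l ∈ R, 1 / (l : ℝ) ≤ σ

lemma prod_primes_le {M : ℕ} (hM : 0 < M) {R : Finset ℕ} (hR : ∀ l ∈ R, l.Prime ∧ l ∣ M) :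
    ∏ l ∈ R, l ≤ M :=
  Nat.le_of_dvd hM (Finset.prod_primes_dvd M (fun l hl => (hR l hl).1.prime) fun l hl => (hR l hl).2)

/-- Comparison of a set of primes with the set `A` of the possible small ones. -/
lemma pow_card_mul_prod_le {M a : ℕ} (hM : 0 < M) {R A : Finset ℕ}
    (hR : ∀ l ∈ R, l.Prime ∧ l ∣ M) (hA : ∀ l ∈ R, l < a → l ∈ A) (hAa : ∀ p ∈ A, p ≤ a) :
    a ^ R.card * ∏ p ∈ A, p ≤ M * a ^ A.card := by
  have h1 : (∏ l ∈ R \ A, a) * ∏ l ∈ R ∩ A, l ≤ M := by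
    refine le_trans ?_ (prod_primes_le hM hR)
    rw [← Finset.prod_sdiff (Finset.inter_subset_left (s₁ := R) (s₂ := A)), Finset.sdiff_inter_self_left]
    refine Nat.mul_le_mul_right _ (Finset.prod_le_prod' fun l hl => ?_)
    rw [Finset.mem_sdiff] at hl
    by_contra h
    exact hl.2 (hA l hl.1 (by omega))
  have h2 : ∏ p ∈ A, p ≤ (∏ p ∈ A \ R, a) * ∏ p ∈ R ∩ A, p := by
    rw [← Finset.prod_sdiff (Finset.inter_subset_right (s₁ := R) (s₂ := A)), Finset.sdiff_inter_self_right]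
    exact Nat.mul_le_mul_right _ (Finset.prod_le_prod' fun l hl => hAa l (Finset.mem_sdiff.1 hl).1)
  rw [Finset.prod_const] at h1 h2
  have h3 : (R \ A).card + (R ∩ A).card = R.card := Finset.card_sdiff_add_card_inter R A
  have h4 : (A \ R).card + (R ∩ A).card = A.card := by
    rw [Finset.inter_comm]; exact Finset.card_sdiff_add_card_inter A R
  calc a ^ R.card * ∏ p ∈ A, p
      ≤ a ^ R.card * (a ^ (A \ R).card * ∏ p ∈ R ∩ A, p) := Nat.mul_le_mul_left _ h2
    _ = (a ^ (R \ A).card * ∏ p ∈ R ∩ A, p) * a ^ A.card := by rw [← h3, ← h4]; ring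
    _ ≤ M * a ^ A.card := Nat.mul_le_mul_right _ h1

lemma sum_one_div_le {a s : ℕ} (ha : 0 < a) {R A : Finset ℕ} (hA : ∀ l ∈ R, l < a → l ∈ A)
    (hAa : ∀ p ∈ A, 0 < p ∧ p ≤ a) (hs : R.card ≤ s) :
    ∑ l ∈ R, 1 / (l : ℝ) ≤ ∑ p ∈ A, 1 / (p : ℝ) + ((s : ℝ) - A.card) / a := by
  have ha' : (0 : ℝ) < a := by exact_mod_cast ha
  have h1 : ∑ l ∈ R \ A, 1 / (l : ℝ) ≤ (R \ A).card / (a : ℝ) := by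
    rw [div_eq_mul_one_div, ← nsmul_eq_mul]
    refine Finset.sum_le_card_nsmul _ _ _ fun l hl => ?_
    rw [Finset.mem_sdiff] at hl
    refine one_div_le_one_div_of_le ha' ?_
    by_contra h
    exact hl.2 (hA l hl.1 (by exact_mod_cast not_le.1 h))
  have h2 : (A \ R).card / (a : ℝ) ≤ ∑ l ∈ A \ R, 1 / (l : ℝ) := by
    rw [div_eq_mul_one_div, ← nsmul_eq_mul]
    refine Finset.card_nsmul_le_sum _ _ _ fun l hl => ?_
    obtain ⟨h0, h1⟩ := hAa l (Finset.mem_sdiff.1 hl).1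
    exact one_div_le_one_div_of_le (by exact_mod_cast h0) (by exact_mod_cast h1)
  have h3 : ((R \ A).card : ℝ) + (R ∩ A).card = R.card := by
    exact_mod_cast Finset.card_sdiff_add_card_inter R A
  have h4 : ((A \ R).card : ℝ) + (R ∩ A).card = A.card := by
    rw [Finset.inter_comm]; exact_mod_cast Finset.card_sdiff_add_card_inter A R
  have h5 : (R.card : ℝ) ≤ s := by exact_mod_cast hs
  rw [← Finset.sum_sdiff (Finset.inter_subset_left (s₁ := R) (s₂ := A)),
    ← Finset.sum_sdiff (Finset.inter_subset_right (s₁ := R) (s₂ := A)),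
    Finset.sdiff_inter_self_left, Finset.sdiff_inter_self_right]
  have h6 : ((R \ A).card : ℝ) / a ≤ (A \ R).card / (a : ℝ) + ((s : ℝ) - A.card) / a := by
    rw [← add_div]
    exact div_le_div_of_nonneg_right (by linarith) ha'.le
  linarith

/-- The odd prime factors. -/
def oddPrimes (M : ℕ) : Finset ℕ := M.primeFactors.erase 2

lemma mem_oddPrimes {M : ℕ} (hM : M ≠ 0) {l : ℕ} : l ∈ oddPrimes M ↔ l.Prime ∧ l ≠ 2 ∧ l ∣ M := by
  rw [oddPrimes, Finset.mem_erase, Nat.mem_primeFactors_of_ne_zero hM]; tauto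

lemma primeBound_split {M : ℕ} (hM : M ≠ 0) {C : Finset ℕ} {s : ℕ} {σ : ℝ}
    (hs : (oddPrimes M \ C).card ≤ s) (hσ : ∑ l ∈ oddPrimes M \ C, 1 / (l : ℝ) ≤ σ) :
    PrimeBound M C.card s σ := by
  refine ⟨oddPrimes M ∩ C, oddPrimes M \ C, fun l hl => ?_, fun l h1 h2 h3 => ?_,
    Finset.disjoint_left.2 fun l h1 h2 => ?_, Finset.card_le_card Finset.inter_subset_right, hs, hσ⟩
  · rw [Finset.union_comm, Finset.sdiff_union_inter] at hl
    exact (mem_oddPrimes hM).1 hl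
  · rw [Finset.union_comm, Finset.sdiff_union_inter]
    exact (mem_oddPrimes hM).2 ⟨h1, h2, h3⟩
  · exact (Finset.mem_sdiff.1 h2).2 (Finset.mem_inter.1 h1).2

/-- Bound from the size of `M₀` and a list `C ∪ A` of the small primes. -/
lemma primeBound_of_size {M M₀ a s : ℕ} (hM : M ≠ 0) (hM₀ : 0 < M₀)
    (hdvd : ∀ l ∈ oddPrimes M, l ∣ M₀) (ha : 0 < a) {C A : Finset ℕ}
    (hA : ∀ l ∈ oddPrimes M, l < a → l ∈ C ∨ l ∈ A) (hAa : ∀ p ∈ A, 0 < p ∧ p ≤ a)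
    (hs : M₀ * a ^ A.card < a ^ (s + 1) * ∏ p ∈ A, p) :
    PrimeBound M C.card s (∑ p ∈ A, 1 / (p : ℝ) + ((s : ℝ) - A.card) / a) := by
  have hA' : ∀ l ∈ oddPrimes M \ C, l < a → l ∈ A := fun l hl h =>
    (hA l (Finset.mem_sdiff.1 hl).1 h).resolve_left (Finset.mem_sdiff.1 hl).2
  have h1 := pow_card_mul_prod_le hM₀ (R := oddPrimes M \ C) (A := A) (a := a) (fun l hl =>
    ⟨((mem_oddPrimes hM).1 (Finset.mem_sdiff.1 hl).1).1, hdvd l (Finset.mem_sdiff.1 hl).1⟩) hA'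
    fun p hp => (hAa p hp).2
  have h2 : (oddPrimes M \ C).card ≤ s := by
    by_contra h
    have h3 : a ^ (s + 1) ≤ a ^ (oddPrimes M \ C).card := Nat.pow_le_pow_right ha (by omega)
    exact absurd ((Nat.mul_le_mul_right _ h3).trans h1) (by omega)
  exact primeBound_split hM h2 (sum_one_div_le ha hA' hAa h2)

/-- Bound from a partial factorisation. -/
lemma primeBound_of_rem {M a r m : ℕ} (hM : M ≠ 0) (ha : 0 < a) (hm : 0 < m) {C A : Finset ℕ}
    (h : ∀ l ∈ oddPrimes M, l ∈ C ∨ l ∈ A ∨ (a ≤ l ∧ l ∣ m)) (hr : m < a ^ (r + 1)) :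
    PrimeBound M C.card (A.card + r) (∑ p ∈ A, 1 / (p : ℝ) + r / a) := by
  set R := oddPrimes M \ C
  have ha' : (0 : ℝ) < a := by exact_mod_cast ha
  have hR : ∀ l ∈ R \ A, l.Prime ∧ a ≤ l ∧ l ∣ m := fun l hl => by
    obtain ⟨h1, h2⟩ := Finset.mem_sdiff.1 hl
    obtain ⟨h3, h4⟩ := Finset.mem_sdiff.1 h1
    exact ⟨((mem_oddPrimes hM).1 h3).1, ((h l h3).resolve_left h4).resolve_left h2⟩
  have h1 : (R \ A).card ≤ r := by
    by_contra hc
    have h2 : a ^ (R \ A).card ≤ ∏ l ∈ R \ A, l := by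
      rw [← Finset.prod_const]
      exact Finset.prod_le_prod' fun l hl => (hR l hl).2.1
    have h3 := prod_primes_le hm (R := R \ A) fun l hl => ⟨(hR l hl).1, (hR l hl).2.2⟩
    have h4 : a ^ (r + 1) ≤ a ^ (R \ A).card := Nat.pow_le_pow_right ha (by omega)
    omega
  refine primeBound_split hM ?_ ?_
  · rw [← Finset.card_sdiff_add_card_inter R A, add_comm]
    exact add_le_add (Finset.card_le_card Finset.inter_subset_right) h1
  · rw [← Finset.sum_sdiff (Finset.inter_subset_left (s₁ := R) (s₂ := A)),
      Finset.sdiff_inter_self_left, add_comm]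
    refine add_le_add (Finset.sum_le_sum_of_subset_of_nonneg Finset.inter_subset_right
      fun i _ _ => by positivity) ?_
    have h2 : ∑ l ∈ R \ A, 1 / (l : ℝ) ≤ (R \ A).card / (a : ℝ) := by
      rw [div_eq_mul_one_div, ← nsmul_eq_mul]
      exact Finset.sum_le_card_nsmul _ _ _ fun l hl =>
        one_div_le_one_div_of_le ha' (by exact_mod_cast (hR l hl).2.1)
    exact h2.trans (div_le_div_of_nonneg_right (by exact_mod_cast h1) ha'.le)

/-- All primes in the core: their number is controlled by the size of `M`. -/
lemma primeBound_full {M ν C : ℕ} (hM : M ≠ 0) {A : Finset ℕ}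
    (hA : ∀ l ∈ oddPrimes M, l < 2 ^ ν → l ∈ A) (hAa : ∀ p ∈ A, 0 < p ∧ p ≤ 2 ^ ν)
    (hC : (2 ^ ν) ^ A.card ≤ C * ∏ p ∈ A, p) :
    ∃ t, PrimeBound M t 0 0 ∧ 2 ^ (ν * t) ≤ C * M := by
  refine ⟨(oddPrimes M).card, ?_, ?_⟩
  · exact primeBound_split hM (C := oddPrimes M) (by simp) (by simp)
  · have h1 := pow_card_mul_prod_le (Nat.pos_of_ne_zero hM) (R := oddPrimes M) (A := A) (a := 2 ^ ν)
      (fun l hl => ⟨((mem_oddPrimes hM).1 hl).1, ((mem_oddPrimes hM).1 hl).2.2⟩) hA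
      fun p hp => (hAa p hp).2
    have h2 : 0 < ∏ p ∈ A, p := Finset.prod_pos fun p hp => (hAa p hp).1
    refine Nat.le_of_mul_le_mul_right ?_ h2
    rw [pow_mul]
    calc _ ≤ _ := h1
      _ ≤ M * (C * ∏ p ∈ A, p) := Nat.mul_le_mul_left _ hC
      _ = _ := by ring

end PrimeBound

section Criteria

variable (Fq F : Type*) [Field Fq] [Field F] [Fintype Fq] [Fintype F] [Algebra Fq F]

/-- Existence of a 2-primitive 2-normal element. -/
def HasTwoTwo (q n : ℕ) : Prop :=
  ∃ α : F, α ≠ 0 ∧ 2 * orderOf α = q ^ n - 1 ∧ IsKNormal Fq q n 2 α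

/-- The weight attached to `k` core primes. -/
def coreWeight (n k : ℕ) : ℕ := if n % 2 = 0 then 4 * 2 ^ k else 2 ^ k

lemma one_le_coreWeight (n k : ℕ) : 1 ≤ coreWeight n k := by
  have := Nat.one_le_two_pow (n := k)
  unfold coreWeight; split_ifs <;> omega

variable {Fq F}

lemma hasTwoTwo_four {q : ℕ} (hcard : Fintype.card Fq = q) (hn : Module.finrank Fq F = 4)
    (hq4 : q % 4 = 1) {k s : ℕ} {σ : ℝ} (hs : 1 ≤ s) (hσ : σ < 1)
    (hP : PrimeBound (1 + q + q ^ 2 + q ^ 3) k s σ)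
    (hmain : 2 * √(q : ℝ) * ((2 ^ k - 1) * (1 - σ) + 2 ^ k * (s - σ)) < (1 - σ) * (q + 1)) :
    HasTwoTwo Fq F q 4 := by
  obtain ⟨K, R, h1, h2, h3, h4, h5, h6⟩ := hP
  refine exists_of_criterion_four hcard hn hq4 h1 h2 h3 (h6.trans hσ.le) ?_
  rw [Finset.sum_sub_distrib, Finset.sum_const, nsmul_eq_mul, mul_one]
  set τ := ∑ l ∈ R, 1 / (l : ℝ)
  have hk : (2 : ℝ) ^ K.card ≤ 2 ^ k := pow_le_pow_right₀ (by norm_num) h4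
  have hk1 : (1 : ℝ) ≤ 2 ^ K.card := one_le_pow₀ (by norm_num)
  have hR : (R.card : ℝ) ≤ s := by exact_mod_cast h5
  have hs' : (1 : ℝ) ≤ s := by exact_mod_cast hs
  have hτ : τ ≤ σ := h6
  have hτR : τ ≤ R.card := by
    have := Finset.sum_le_card_nsmul R (fun l => 1 / (l : ℝ)) 1 fun l hl => by
      have h7 : (1 : ℝ) ≤ l := by
        exact_mod_cast (h1 l (Finset.mem_union_right _ hl)).1.one_lt.le
      exact div_le_one_of_le₀ h7 (by linarith)
    simpa only [nsmul_eq_mul, mul_one] using this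
  have hq0 : 0 ≤ 2 * √(q : ℝ) := by positivity
  -- compare after dividing by `1 - σ` and `1 - τ`
  have e1 : (1 - σ) * ((2 ^ K.card - 1) * (1 - τ) + 2 ^ K.card * (R.card - τ)) ≤
      (1 - τ) * ((2 ^ k - 1) * (1 - σ) + 2 ^ k * (s - σ)) := by
    have e2 : (1 - σ) * (R.card - τ) ≤ (1 - τ) * (s - σ) := by nlinarith
    have e3 : (1 - σ) * ((2 ^ K.card - 1) * (1 - τ)) ≤ (1 - τ) * ((2 ^ k - 1) * (1 - σ)) := by
      have : 0 ≤ (1 - σ) * (1 - τ) := mul_nonneg (by linarith) (by linarith)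
      nlinarith
    have e4 : 2 ^ K.card * ((1 - σ) * (R.card - τ)) ≤ 2 ^ k * ((1 - τ) * (s - σ)) :=
      mul_le_mul hk e2 (mul_nonneg (by linarith) (by linarith)) (by positivity)
    nlinarith
  have e5 : (1 - σ) * (2 * √(q : ℝ) *
      ((2 ^ K.card - 1) * (1 - τ) + 2 ^ K.card * (R.card - τ))) < (1 - σ) * ((1 - τ) * (q + 1)) := by
    calc _ = 2 * √(q : ℝ) * ((1 - σ) * ((2 ^ K.card - 1) * (1 - τ) + 2 ^ K.card * (R.card - τ))) := by
          ring
      _ ≤ 2 * √(q : ℝ) * ((1 - τ) * ((2 ^ k - 1) * (1 - σ) + 2 ^ k * (s - σ))) :=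
          mul_le_mul_of_nonneg_left e1 hq0
      _ = (1 - τ) * (2 * √(q : ℝ) * ((2 ^ k - 1) * (1 - σ) + 2 ^ k * (s - σ))) := by ring
      _ < (1 - τ) * ((1 - σ) * (q + 1)) := mul_lt_mul_of_pos_left hmain (by linarith)
      _ = _ := by ring
  exact lt_of_mul_lt_mul_left e5 (by linarith)

/-- The sizes of the objects in the general criterion. -/
lemma exists_of_primeBound {q n : ℕ} (hcard : Fintype.card Fq = q) (hn : Module.finrank Fq F = n)
    (hn5 : 5 ≤ n) (hodd : Odd q) {f : Fq[X]} (hf : f.Monic) (hfn : f ∣ X ^ n - 1)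
    (hfd : f.natDegree = n - 2) {S₁ S₂ : Finset Fq[X]} (hS12 : ∀ P, P ∈ monicFactors f ↔ P ∈ S₁ ∨ P ∈ S₂)
    (hdisj : Disjoint S₁ S₂) {M k s : ℕ} {σ : ℝ} (hM : q ^ n - 1 = M * (q - 1))
    (hP : PrimeBound M k s σ) (hσ : σ < 1)
    (hmain : ∀ ρ : ℝ, 0 ≤ ρ → ρ ≤ σ → 2 ^ S₁.card * ((coreWeight n k - 1) * (1 - ρ + S₂.card) + coreWeight n k * (s - ρ)) <
      √((q : ℝ) ^ (n - 4)) * (∏ P ∈ S₁, (1 - 1 / (q : ℝ) ^ P.natDegree)) *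
        (1 - ρ - ∑ P ∈ S₂, 1 / (q : ℝ) ^ P.natDegree)) :
    HasTwoTwo Fq F q n := by
  obtain ⟨K, R, h1, h2, h3, h4, h5, h6⟩ := hP
  subst hcard
  set q := Fintype.card Fq with hq
  have hq1 : 1 < q := Fintype.one_lt_card
  have hcF : Fintype.card F = q ^ n := by rw [card_eq_card_pow_finrank (Fq := Fq), hn]
  have hf0 : f ≠ 0 := hf.ne_zero
  set τ := ∑ l ∈ R, 1 / (l : ℝ) with hτ
  have hτ0 : 0 ≤ τ := Finset.sum_nonneg fun _ _ => by positivity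
  obtain ⟨c, hc⟩ := hodd
  obtain ⟨θ, hθ, hpar, hθW⟩ : ∃ θ : ℝ, 0 < θ ∧
      ((¬ 2 ∣ M ∧ θ = 1) ∨ (4 ∣ Fintype.card F - 1 ∧ θ = 1 / 4)) ∧
      θ * coreWeight n k = 2 ^ k := by
    unfold coreWeight
    by_cases hn2 : n % 2 = 0
    · refine ⟨1 / 4, by norm_num, Or.inr ⟨?_, rfl⟩, ?_⟩
      · rw [hcF]
        obtain ⟨m, hm⟩ : 2 ∣ n := Nat.dvd_of_mod_eq_zero hn2
        have e1 : q ^ 2 - 1 ∣ q ^ n - 1 := by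
          rw [hm, pow_mul]
          simpa using Nat.sub_dvd_pow_sub_pow (q ^ 2) 1 m
        refine Dvd.dvd.trans ⟨c * (c + 1), ?_⟩ e1
        rw [hc]
        refine Nat.sub_eq_of_eq_add ?_
        ring
      · rw [if_pos hn2]; push_cast; ring
    · refine ⟨1, one_pos, Or.inl ⟨?_, rfl⟩, by rw [if_neg hn2]; push_cast; ring⟩
      have e1 : M = ∑ i ∈ Finset.range n, q ^ i := by
        have := Nat.geomSum_eq (m := q) hq1 n
        rw [this, hM, Nat.mul_div_cancel _ (by omega)]
      have hqo : Odd q := ⟨c, hc⟩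
      rw [e1, ← even_iff_two_dvd, Nat.not_even_iff_odd, Finset.odd_sum_iff_odd_card_odd]
      rw [Finset.filter_true_of_mem fun i _ => hqo.pow, Finset.card_range, Nat.odd_iff]
      omega
  have h2F : 2 ∣ Fintype.card F - 1 := by
    rw [hcF]
    have : Odd (q ^ n) := Odd.pow ⟨c, hc⟩
    exact (Nat.Odd.sub_odd this odd_one).two_dvd
  have hne : (monicFactors f).Nonempty := by
    obtain ⟨P, hPm, hPi, hPf⟩ := exists_monic_irreducible_factor f (by
      intro hu
      have := natDegree_eq_zero_of_isUnit hu
      omega)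
    exact ⟨P, (mem_monicFactors hf0).2 ⟨hPm, hPi, hPf⟩⟩
  obtain ⟨α, hα0, hαo, hαf⟩ := exists_of_criterion (F := F) hf (by rwa [hn]) (S := monicFactors f)
    (fun P => mem_monicFactors hf0) hne hS12 hdisj (M := M) (θ := θ) (K := K) (R := R)
    (by rw [hcF, hM]) h2F ⟨h1, h2, h3, hpar⟩ (h6.trans hσ.le) (by
      rw [Finset.sum_sub_distrib, Finset.sum_const, nsmul_eq_mul, mul_one, ← hτ, ← hq, hcF, hfd]
      have hm := hmain τ hτ0 h6
      have hk : (2 : ℝ) ^ K.card ≤ 2 ^ k := pow_le_pow_right₀ (by norm_num) h4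
      have hR : (R.card : ℝ) ≤ s := by exact_mod_cast h5
      have hτR : τ ≤ R.card := by
        have := Finset.sum_le_card_nsmul R (fun l => 1 / (l : ℝ)) 1 fun l hl => by
          have h7 : (1 : ℝ) ≤ l := by
            exact_mod_cast (h1 l (Finset.mem_union_right _ hl)).1.one_lt.le
          exact div_le_one_of_le₀ h7 (by linarith)
        simpa only [nsmul_eq_mul, mul_one] using this
      have hS2 : (0 : ℝ) ≤ S₂.card := by positivity
      have hq0 : (0 : ℝ) < q := by exact_mod_cast (by omega : 0 < q)
      have e1 : √((q ^ n : ℕ) : ℝ) = (q : ℝ) ^ 2 * √((q : ℝ) ^ (n - 4)) := by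
        rw [show n = n - 4 + 4 by omega]
        push_cast
        rw [pow_add, show (q : ℝ) ^ 4 = (q ^ 2) ^ 2 by ring, Real.sqrt_mul (by positivity),
          Real.sqrt_sq (by positivity)]
        ring
      have e2 : (q : ℝ) ^ (n - 2) = (q : ℝ) ^ 2 * √((q : ℝ) ^ (n - 4)) * √((q : ℝ) ^ (n - 4)) := by
        rw [mul_assoc, Real.mul_self_sqrt (by positivity), ← pow_add]
        congr 1
        omega
      have e3 : (2 ^ K.card - θ) * (1 - τ + S₂.card) + 2 ^ K.card * (R.card - τ) ≤
          θ * ((coreWeight n k - 1) * (1 - τ + S₂.card) + coreWeight n k * (s - τ)) := by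
        have e4 : θ * ((coreWeight n k - 1) * (1 - τ + S₂.card) + coreWeight n k * (s - τ)) =
            (2 ^ k - θ) * (1 - τ + S₂.card) + 2 ^ k * (s - τ) := by
          rw [← hθW]; ring
        rw [e4]
        refine add_le_add (mul_le_mul_of_nonneg_right (by linarith) (by linarith))
          (mul_le_mul hk (by linarith) (by linarith) (by positivity))
      rw [e1, e2]
      set Q := (q : ℝ) ^ 2 * √((q : ℝ) ^ (n - 4)) with hQ
      have hQ0 : 0 < Q := by positivity
      calc _ ≤ 2 ^ S₁.card * Q * (θ * ((coreWeight n k - 1) * (1 - τ + S₂.card) + coreWeight n k * (s - τ))) :=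
            mul_le_mul_of_nonneg_left e3 (by positivity)
        _ = θ * Q * (2 ^ S₁.card * ((coreWeight n k - 1) * (1 - τ + S₂.card) + coreWeight n k * (s - τ))) := by
            ring
        _ < θ * Q * (√((q : ℝ) ^ (n - 4)) * (∏ P ∈ S₁, (1 - 1 / (q : ℝ) ^ P.natDegree)) *
        (1 - τ - ∑ P ∈ S₂, 1 / (q : ℝ) ^ P.natDegree)) := mul_lt_mul_of_pos_left hm (by positivity)
        _ = _ := by ring)
  rw [hn] at hαf
  exact ⟨α, hα0, by rw [hαo, hcF], f, hαf, hfd⟩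

/-- Criterion with the polynomial factors in the union part. -/
lemma hasTwoTwo_of_union {q n : ℕ} (hcard : Fintype.card Fq = q) (hn : Module.finrank Fq F = n)
    (hn5 : 5 ≤ n) (hodd : Odd q) {f : Fq[X]} (hf : f.Monic) (hfn : f ∣ X ^ n - 1)
    (hfd : f.natDegree = n - 2) {M k s ω : ℕ} {σ τ : ℝ} (hM : q ^ n - 1 = M * (q - 1))
    (hP : PrimeBound M k s σ) (hσ : σ < 1) (hω : (monicFactors f).card ≤ ω)
    (hτ : ∑ P ∈ monicFactors f, 1 / (q : ℝ) ^ P.natDegree ≤ τ)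
    (hmain : (coreWeight n k - 1) * (1 + ω) + coreWeight n k * s <
      √((q : ℝ) ^ (n - 4)) * (1 - σ - τ)) :
    HasTwoTwo Fq F q n := by
  refine exists_of_primeBound hcard hn hn5 hodd hf hfn hfd (S₁ := ∅) (S₂ := monicFactors f)
    (by simp) (by simp) hM hP hσ fun ρ hρ hρσ => ?_
  have hW : (1 : ℝ) ≤ coreWeight n k := by exact_mod_cast one_le_coreWeight n k
  have hω' : ((monicFactors f).card : ℝ) ≤ ω := by exact_mod_cast hω
  have e1 : √((q : ℝ) ^ (n - 4)) * (1 - σ - τ) ≤ √((q : ℝ) ^ (n - 4)) *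
      (1 - ρ - ∑ P ∈ monicFactors f, 1 / (q : ℝ) ^ P.natDegree) :=
    mul_le_mul_of_nonneg_left (by linarith) (Real.sqrt_nonneg _)
  simp only [Finset.card_empty, pow_zero, one_mul, Finset.prod_empty, mul_one]
  refine lt_of_le_of_lt ?_ (hmain.trans_le e1)
  refine add_le_add (mul_le_mul_of_nonneg_left (by linarith) (by linarith))
    (mul_le_mul_of_nonneg_left (by linarith) (by linarith))

/-- Criterion with the polynomial factors in the core part. -/
lemma hasTwoTwo_of_core {q n : ℕ} (hcard : Fintype.card Fq = q) (hn : Module.finrank Fq F = n)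
    (hn5 : 5 ≤ n) (hodd : Odd q) {f : Fq[X]} (hf : f.Monic) (hfn : f ∣ X ^ n - 1)
    (hfd : f.natDegree = n - 2) {M k s : ℕ} {σ π : ℝ} (hM : q ^ n - 1 = M * (q - 1))
    (hP : PrimeBound M k s σ) (hσ : σ < 1)
    (hπ : π ≤ ∏ P ∈ monicFactors f, ((1 - 1 / (q : ℝ) ^ P.natDegree) / 2))
    (hmain : coreWeight n k * (1 + s) - 1 < √((q : ℝ) ^ (n - 4)) * π * (1 - σ)) :
    HasTwoTwo Fq F q n := by
  refine exists_of_primeBound hcard hn hn5 hodd hf hfn hfd (S₁ := monicFactors f) (S₂ := ∅)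
    (by simp) (by simp) hM hP hσ fun ρ hρ hρσ => ?_
  have hW : (1 : ℝ) ≤ coreWeight n k := by exact_mod_cast one_le_coreWeight n k
  simp only [Finset.card_empty, Finset.sum_empty, Nat.cast_zero, add_zero, sub_zero]
  rw [Finset.prod_div_distrib, Finset.prod_const] at hπ
  set Y := ∏ P ∈ monicFactors f, (1 - 1 / (q : ℝ) ^ P.natDegree)
  have h2 : (0 : ℝ) < 2 ^ (monicFactors f).card := by positivity
  have hπ' : 2 ^ (monicFactors f).card * π ≤ Y := by
    rw [le_div_iff₀ h2] at hπ; linarith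
  set w : ℝ := (coreWeight n k : ℝ)
  have hs0 : (0 : ℝ) ≤ s := by positivity
  have hr : 0 ≤ √((q : ℝ) ^ (n - 4)) := Real.sqrt_nonneg _
  calc 2 ^ (monicFactors f).card * ((w - 1) * (1 - ρ) + w * (s - ρ))
      ≤ 2 ^ (monicFactors f).card * (w * (1 + s) - 1) :=
        mul_le_mul_of_nonneg_left (by nlinarith) h2.le
    _ < 2 ^ (monicFactors f).card * (√((q : ℝ) ^ (n - 4)) * π * (1 - σ)) :=
        mul_lt_mul_of_pos_left hmain h2
    _ = √((q : ℝ) ^ (n - 4)) * (2 ^ (monicFactors f).card * π) * (1 - σ) := by ring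
    _ ≤ √((q : ℝ) ^ (n - 4)) * Y * (1 - σ) :=
        mul_le_mul_of_nonneg_right (mul_le_mul_of_nonneg_left hπ' hr) (by linarith)
    _ ≤ √((q : ℝ) ^ (n - 4)) * Y * (1 - ρ) := by
        refine mul_le_mul_of_nonneg_left (by linarith) (mul_nonneg hr ?_)
        refine Finset.prod_nonneg fun P _ => ?_
        have hq1 : (1 : ℝ) ≤ q := by exact_mod_cast hcard ▸ Fintype.one_lt_card.le
        have := div_le_one_of_le₀ (one_le_pow₀ hq1 (n := P.natDegree)) (by positivity)
        linarith

end Criteria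

section Numeric

/-- The odd primes below 256. -/
def oddPrimeList : List ℕ :=
  [3, 5, 7, 11, 13, 17, 19, 23, 29, 31, 37, 41, 43, 47, 53, 59, 61, 67, 71, 73, 79, 83, 89, 97,
    101, 103, 107, 109, 113, 127, 131, 137, 139, 149, 151, 157, 163, 167, 173, 179, 181, 191, 193,
    197, 199, 211, 223, 227, 229, 233, 239, 241, 251]

lemma mem_oddPrimeList {l : ℕ} (hl : l.Prime) (h2 : l ≠ 2) (h : l < 256) : l ∈ oddPrimeList := by
  have key : ∀ l < 256, l ∈ oddPrimeList ∨ l < 3 ∨ ∃ d ∈ [2, 3, 5, 7, 11, 13], d ∣ l ∧ d < l := by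
    decide +kernel
  rcases key l h with h1 | h1 | ⟨d, hd, hdl, hlt⟩
  · exact h1
  · have := hl.two_le; omega
  · rcases (Nat.dvd_prime hl).1 hdl with rfl | rfl
    · simp at hd
    · omega

/-- The odd primes below 100. -/
def trialPrimes : List ℕ := oddPrimeList.take 24

/-- Remove common factors with `g` repeatedly. -/
def strip (g : ℕ) : ℕ → ℕ → ℕ
  | 0, M => M
  | e + 1, M => strip g e (M / M.gcd g)

lemma strip_pos (g : ℕ) : ∀ e M, 0 < M → 0 < strip g e M
  | 0, _, h => h
  | e + 1, _, h => strip_pos g e _ (Nat.div_pos (Nat.le_of_dvd h (Nat.gcd_dvd_left _ _))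
      (Nat.gcd_pos_of_pos_left _ h))

lemma dvd_strip {g l : ℕ} (hl : l.Prime) (hg : ¬ l ∣ g) : ∀ e M, l ∣ M → l ∣ strip g e M
  | 0, _, h => h
  | e + 1, M, h => by
    refine dvd_strip hl hg e _ ?_
    rw [← Nat.div_mul_cancel (Nat.gcd_dvd_left M g)] at h
    exact (hl.dvd_mul.1 h).resolve_right fun h' => hg (h'.trans (Nat.gcd_dvd_right _ _))

/-- Number of base-101 digits minus one, with fuel. -/
def logCount : ℕ → ℕ → ℕ
  | 0, _ => 0
  | e + 1, m => bif Nat.blt m 101 then 0 else logCount e (m / 101) + 1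

/-- Numerator and denominator of the sum of the reciprocals. -/
def recipSum : List ℕ → ℕ × ℕ
  | [] => (0, 1)
  | p :: L => ((recipSum L).1 * p + (recipSum L).2, (recipSum L).2 * p)

lemma recipSum_spec : ∀ L : List ℕ, (∀ p ∈ L, 0 < p) →
    0 < (recipSum L).2 ∧ (L.map fun p : ℕ => 1 / (p : ℝ)).sum = (recipSum L).1 / (recipSum L).2
  | [], _ => by simp [recipSum]
  | p :: L, h => by
    obtain ⟨h1, h2⟩ := recipSum_spec L fun p hp => h p (List.mem_cons_of_mem _ hp)
    have hp : 0 < p := h p List.mem_cons_self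
    refine ⟨Nat.mul_pos h1 hp, ?_⟩
    have h1' : ((recipSum L).2 : ℝ) ≠ 0 := by positivity
    have hp' : (p : ℝ) ≠ 0 := by positivity
    rw [List.map_cons, List.sum_cons, h2, recipSum]
    push_cast
    field_simp
    ring

/-- Test of the criterion with polynomial factors in the union part. -/
def testUnion (q n W s sn sd a₁ a₂ a₃ : ℕ) : Bool :=
  Nat.blt (q ^ 3 * sn + sd * (a₁ * q ^ 2 + a₂ * q + a₃)) (q ^ 3 * sd) &&
    Nat.blt (((W * (1 + (a₁ + a₂ + a₃) + s) - (1 + (a₁ + a₂ + a₃))) * (q ^ 3 * sd)) ^ 2)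
      (q ^ (n - 4) * (q ^ 3 * sd - (q ^ 3 * sn + sd * (a₁ * q ^ 2 + a₂ * q + a₃))) ^ 2)

/-- Test of the criterion with polynomial factors in the core part. -/
def testCore (q n W s sn sd a₁ a₂ a₃ : ℕ) : Bool :=
  Nat.blt sn sd &&
    Nat.blt ((2 ^ (a₁ + a₂ + a₃) * (W * (1 + s) - 1) * (sd * q ^ (a₁ + 2 * a₂ + 3 * a₃))) ^ 2)
      (q ^ (n - 4) * ((q - 1) ^ a₁ * (q ^ 2 - 1) ^ a₂ * (q ^ 3 - 1) ^ a₃ * (sd - sn)) ^ 2)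

/-- The tests for a partial factorisation with small primes `A`, the first `k` of them core, and
`r` large primes. -/
def testSplit (q n : ℕ) (A : List ℕ) (r k : ℕ) : Bool :=
  let R := recipSum (A.drop k)
  let sn := R.1 * 101 + r * R.2
  let sd := R.2 * 101
  let c := factorCounts q n
  let s := (A.drop k).length + r
  testUnion q n (coreWeight n k) s sn sd c.1 c.2.1 c.2.2 ||
    testCore q n (coreWeight n k) s sn sd c.1 c.2.1 c.2.2

/-- The inequality in degree four. -/
def testFour (q k s sn sd : ℕ) : Bool :=
  Nat.blt sn sd && Nat.ble 1 s &&
    Nat.blt (4 * q * ((2 ^ k - 1) * (sd - sn) + 2 ^ k * (s * sd - sn)) ^ 2)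
      (((sd - sn) * (q + 1)) ^ 2)

/-- The test for degree four. -/
def testSplitFour (q : ℕ) (A : List ℕ) (r k : ℕ) : Bool :=
  let R := recipSum (A.drop k)
  testFour q k ((A.drop k).length + r) (R.1 * 101 + r * R.2) (R.2 * 101)

/-- `q` has a small prime factor without being a power of it. -/
def notPrimePow (L : List ℕ) (q : ℕ) : Bool :=
  L.any fun l => Nat.beq (q % l) 0 && !Nat.beq (l ^ 20 % q) 0

/-- Run a test on the partial factorisation of `M`. -/
def runSplit (M : ℕ) (test : List ℕ → ℕ → ℕ → Bool) : Bool :=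
  let A := trialPrimes.filter fun l => Nat.beq (M % l) 0
  let m := strip (2 * trialPrimes.prod) 8 M
  let r := logCount 200 m
  Nat.blt m (101 ^ (r + 1)) && (test A r 0 || test A r 1 || test A r 2 || test A r 3)

def checkGeneral (E : List (ℕ × ℕ)) (n q : ℕ) : Bool :=
  notPrimePow [3, 5, 7, 11, 13] q || Nat.beq (Nat.gcd (q ^ 3 - q) n) 1 ||
    runSplit ((q ^ n - 1) / (q - 1)) (testSplit q n) || notPrimePow oddPrimeList q ||
    E.any fun e => Nat.beq e.1 q && Nat.beq e.2 n

def checkFour (E : List ℕ) (q : ℕ) : Bool :=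
  notPrimePow [3, 5, 7, 11, 13] q ||
    runSplit (1 + q + q ^ 2 + q ^ 3) (testSplitFour q) || notPrimePow oddPrimeList q ||
    E.any fun e => Nat.beq e q

/-- Check an arithmetic progression. -/
def allSteps (test : ℕ → Bool) (d : ℕ) : ℕ → ℕ → Bool
  | 0, _ => true
  | e + 1, q => bif test q then allSteps test d e (q + d) else false

lemma allSteps_spec {test : ℕ → Bool} {d : ℕ} : ∀ {e q : ℕ}, allSteps test d e q = true →
    ∀ i < e, test (q + i * d) = true
  | 0, _, _, i, hi => absurd hi (Nat.not_lt_zero i)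
  | e + 1, q, h, i, hi => by
    rw [allSteps] at h
    cases ht : test q
    · rw [ht] at h; exact absurd h (by simp)
    · rw [ht, cond_true] at h
      rcases i with - | i
      · simpa using ht
      · have := allSteps_spec h i (by omega)
        rwa [show q + d + i * d = q + (i + 1) * d by ring] at this

end Numeric

section NumericPrimes

lemma PrimeBound.mono {M k k' s : ℕ} {σ : ℝ} (h : PrimeBound M k s σ) (hk : k ≤ k') :
    PrimeBound M k' s σ := by
  obtain ⟨K, R, h1, h2, h3, h4, h5, h6⟩ := h
  exact ⟨K, R, h1, h2, h3, h4.trans hk, h5, h6⟩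

lemma mem_trialPrimes {l : ℕ} (hl : l.Prime) (h2 : l ≠ 2) (h : l < 101) : l ∈ trialPrimes := by
  have key : ∀ l ∈ oddPrimeList, l ∈ trialPrimes ∨ 101 ≤ l := by decide +kernel
  exact (key l (mem_oddPrimeList hl h2 (by omega))).resolve_right (by omega)

lemma not_dvd_trialPrimes {l : ℕ} (hl : l.Prime) (h : 101 ≤ l) : ¬ l ∣ 2 * trialPrimes.prod := by
  intro hd
  rcases (hl.dvd_mul).1 hd with h2 | h2
  · have := Nat.le_of_dvd (by norm_num) h2; omega
  · obtain ⟨p, hp, hlp⟩ := (Prime.dvd_prod_iff hl.prime).1 h2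
    have key : ∀ p ∈ trialPrimes, 0 < p ∧ p < 101 := by decide +kernel
    have := Nat.le_of_dvd (key p hp).1 hlp
    have := (key p hp).2
    omega

/-- Prime data from the partial factorisation by trial division. -/
lemma primeBound_of_trial {M r : ℕ} (hM : M ≠ 0)
    (hr : strip (2 * trialPrimes.prod) 8 M < 101 ^ (r + 1)) (k : ℕ) {A : List ℕ}
    (hA : A = trialPrimes.filter fun l => Nat.beq (M % l) 0) :
    PrimeBound M k ((A.drop k).length + r)
      (((recipSum (A.drop k)).1 * 101 + r * (recipSum (A.drop k)).2 : ℕ) /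
        ((recipSum (A.drop k)).2 * 101 : ℕ)) := by
  have hnd : A.Nodup := hA ▸ List.Nodup.filter _ (by decide +kernel)
  have hpos : ∀ p ∈ A.drop k, 0 < p := fun p hp => by
    have h1 := List.mem_of_mem_drop hp
    rw [hA] at h1
    have key : ∀ p ∈ trialPrimes, 0 < p := by decide +kernel
    exact key p (List.mem_of_mem_filter h1)
  obtain ⟨hd, hsum⟩ := recipSum_spec _ hpos
  have hnd' : (A.drop k).Nodup := hnd.sublist (List.drop_sublist _ _)
  have h := primeBound_of_rem hM (a := 101) (by norm_num)
    (strip_pos (2 * trialPrimes.prod) 8 M (Nat.pos_of_ne_zero hM))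
    (C := (A.take k).toFinset) (A := (A.drop k).toFinset) (fun l hl => ?_) hr
  · rw [List.toFinset_card_of_nodup hnd', List.sum_toFinset _ hnd', hsum] at h
    have hk : (A.take k).toFinset.card ≤ k :=
      (List.toFinset_card_le _).trans (List.length_take_le _ _)
    convert h.mono hk using 1
    have hd' : ((recipSum (A.drop k)).2 : ℝ) ≠ 0 := by positivity
    push_cast
    field_simp
  · obtain ⟨h1, h2, h3⟩ := (mem_oddPrimes hM).1 hl
    rcases lt_or_ge l 101 with h4 | h4
    · have : l ∈ A := by
        rw [hA, List.mem_filter]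
        exact ⟨mem_trialPrimes h1 h2 h4, by rw [Nat.beq_eq]; exact Nat.mod_eq_zero_of_dvd h3⟩
      rw [← List.take_append_drop k A, List.mem_append] at this
      rcases this with h | h
      · exact Or.inl (List.mem_toFinset.2 h)
      · exact Or.inr (Or.inl (List.mem_toFinset.2 h))
    · exact Or.inr (Or.inr ⟨h4, dvd_strip h1 (not_dvd_trialPrimes h1 h4) _ _ h3⟩)

lemma runSplit_spec {M : ℕ} (hM : M ≠ 0) {test : List ℕ → ℕ → ℕ → Bool}
    (h : runSplit M test = true) :
    ∃ A r k, test A r k = true ∧ PrimeBound M k ((A.drop k).length + r)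
      (((recipSum (A.drop k)).1 * 101 + r * (recipSum (A.drop k)).2 : ℕ) /
        ((recipSum (A.drop k)).2 * 101 : ℕ)) ∧ 0 < (recipSum (A.drop k)).2 := by
  simp only [runSplit, Bool.and_eq_true, Bool.or_eq_true, Nat.blt_eq] at h
  obtain ⟨hr, h⟩ := h
  have hpos : ∀ k, 0 < (recipSum ((trialPrimes.filter fun l => Nat.beq (M % l) 0).drop k)).2 :=
    fun k => (recipSum_spec _ fun p hp => by
      have h1 := List.mem_of_mem_drop hp
      have key : ∀ p ∈ trialPrimes, 0 < p := by decide +kernel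
      exact key p (List.mem_of_mem_filter h1)).1
  rcases h with ((h | h) | h) | h <;>
    exact ⟨_, _, _, h, primeBound_of_trial hM hr _ rfl, hpos _⟩

lemma notPrimePow_spec {L : List ℕ} {q : ℕ} (hL : ∀ l ∈ L, l.Prime ∧ 3 ≤ l) (hq : IsPrimePow q)
    (hlt : q < 3 ^ 20) : notPrimePow L q = false := by
  rw [← Bool.not_eq_true]
  intro h
  simp only [notPrimePow, List.any_eq_true, Bool.and_eq_true, Nat.beq_eq,
    Bool.not_eq_true'] at h
  obtain ⟨l, hl, h1, h2⟩ := h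
  obtain ⟨p, e, hp, he, rfl⟩ := hq
  have hp' := hp.nat_prime
  have hlp : l = p := (Nat.prime_dvd_prime_iff_eq (hL l hl).1 hp').1
    ((hL l hl).1.dvd_of_dvd_pow (Nat.dvd_of_mod_eq_zero h1))
  subst hlp
  have he20 : e < 20 := by
    by_contra hge
    have h3 : 3 ^ 20 ≤ l ^ e := (Nat.pow_le_pow_left (hL l hl).2 20).trans
      (Nat.pow_le_pow_right (by have := (hL l hl).2; omega) (not_lt.1 hge))
    omega
  rw [Nat.mod_eq_zero_of_dvd (pow_dvd_pow l he20.le)] at h2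
  exact absurd h2 (by decide)

lemma prime_of_mem_oddPrimeList : ∀ l ∈ oddPrimeList, l.Prime ∧ 3 ≤ l := by
  simp only [oddPrimeList, List.forall_mem_cons]
  norm_num

lemma natCast_lt_sqrt_mul {X Y D : ℕ} (h : X ^ 2 < D * Y ^ 2) : (X : ℝ) < √(D : ℝ) * Y := by
  have h' : (X : ℝ) ^ 2 < D * (Y : ℝ) ^ 2 := by exact_mod_cast h
  have := Real.lt_sqrt_of_sq_lt h'
  rwa [Real.sqrt_mul (Nat.cast_nonneg _), Real.sqrt_sq (Nat.cast_nonneg _)] at this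

end NumericPrimes

section NumericSound

variable {Fq F : Type*} [Field Fq] [Field F] [Fintype Fq] [Fintype F] [Algebra Fq F]

lemma one_le_natDegree_of_mem_monicFactors {f : Fq[X]} (hf : f ≠ 0) {P : Fq[X]}
    (hP : P ∈ monicFactors f) : 1 ≤ P.natDegree :=
  ((mem_monicFactors hf).1 hP).2.1.natDegree_pos

/-- Decomposition of the monic irreducible factors by degree. -/
lemma FactorBound.prod_split {f : Fq[X]} (hf : f ≠ 0) {R : Type*} [CommMonoid R] (g : Fq[X] → R) :
    ∏ P ∈ monicFactors f, g P =
      (∏ P ∈ (monicFactors f).filter fun P => P.natDegree = 1, g P) *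
        ((∏ P ∈ (monicFactors f).filter fun P => P.natDegree = 2, g P) *
          ∏ P ∈ (monicFactors f).filter fun P => 3 ≤ P.natDegree, g P) := by
  rw [← Finset.prod_filter_mul_prod_filter_not (monicFactors f) fun P => P.natDegree = 1]
  congr 1
  rw [← Finset.prod_filter_mul_prod_filter_not _ fun P => P.natDegree = 2, Finset.filter_filter,
    Finset.filter_filter]
  congr 1 <;> refine Finset.prod_congr (Finset.filter_congr fun P hP => ?_) fun _ _ => rfl
  · omega
  · have := one_le_natDegree_of_mem_monicFactors hf hP
    omega

lemma FactorBound.sum_split {f : Fq[X]} (hf : f ≠ 0) {R : Type*} [AddCommMonoid R] (g : Fq[X] → R) :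
    ∑ P ∈ monicFactors f, g P =
      (∑ P ∈ (monicFactors f).filter fun P => P.natDegree = 1, g P) +
        ((∑ P ∈ (monicFactors f).filter fun P => P.natDegree = 2, g P) +
          ∑ P ∈ (monicFactors f).filter fun P => 3 ≤ P.natDegree, g P) :=
  FactorBound.prod_split (R := Multiplicative R) hf g

variable {f : Fq[X]} {a₁ a₂ a₃ : ℕ}

lemma FactorBound.card_le (h : FactorBound f (a₁, a₂, a₃)) (hf : f ≠ 0) :
    (monicFactors f).card ≤ a₁ + a₂ + a₃ := by
  rw [Finset.card_eq_sum_ones, FactorBound.sum_split hf, ← Finset.card_eq_sum_ones,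
    ← Finset.card_eq_sum_ones, ← Finset.card_eq_sum_ones]
  have := h.one; have := h.two; have := h.three
  dsimp only at *
  omega

lemma FactorBound.sum_le (h : FactorBound f (a₁, a₂, a₃)) (hf : f ≠ 0) {q : ℕ} (hq : 1 < q) :
    ∑ P ∈ monicFactors f, 1 / (q : ℝ) ^ P.natDegree ≤ a₁ / q + a₂ / (q : ℝ) ^ 2 + a₃ / (q : ℝ) ^ 3 := by
  have hq' : (1 : ℝ) < q := by exact_mod_cast hq
  have aux : ∀ (S : Finset Fq[X]) (d a : ℕ), (∀ P ∈ S, d ≤ P.natDegree) → S.card ≤ a →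
      ∑ P ∈ S, 1 / (q : ℝ) ^ P.natDegree ≤ a / (q : ℝ) ^ d := fun S d a hS ha => by
    calc ∑ P ∈ S, 1 / (q : ℝ) ^ P.natDegree ≤ S.card • (1 / (q : ℝ) ^ d) :=
          Finset.sum_le_card_nsmul _ _ _ fun P hP =>
            one_div_le_one_div_of_le (by positivity) (pow_le_pow_right₀ hq'.le (hS P hP))
      _ = S.card / (q : ℝ) ^ d := by rw [nsmul_eq_mul, mul_one_div]
      _ ≤ a / (q : ℝ) ^ d := by gcongr
  rw [FactorBound.sum_split hf, add_assoc]
  refine add_le_add ?_ (add_le_add ?_ ?_)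
  · simpa using aux _ 1 a₁ (fun P hP => (Finset.mem_filter.1 hP).2.ge) h.one
  · exact aux _ 2 a₂ (fun P hP => (Finset.mem_filter.1 hP).2.ge) h.two
  · exact aux _ 3 a₃ (fun P hP => (Finset.mem_filter.1 hP).2) h.three

lemma FactorBound.le_prod (h : FactorBound f (a₁, a₂, a₃)) (hf : f ≠ 0) {q : ℕ} (hq : 1 < q) :
    ((1 - 1 / (q : ℝ) ^ 1) / 2) ^ a₁ * (((1 - 1 / (q : ℝ) ^ 2) / 2) ^ a₂ *
      ((1 - 1 / (q : ℝ) ^ 3) / 2) ^ a₃) ≤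
      ∏ P ∈ monicFactors f, ((1 - 1 / (q : ℝ) ^ P.natDegree) / 2) := by
  have hq' : (1 : ℝ) < q := by exact_mod_cast hq
  have hnn : ∀ d : ℕ, 0 ≤ (1 - 1 / (q : ℝ) ^ d) / 2 := fun d => by
    have : 1 / (q : ℝ) ^ d ≤ 1 := by
      rw [div_le_one (by positivity)]; exact one_le_pow₀ hq'.le
    linarith
  have hle : ∀ d : ℕ, (1 - 1 / (q : ℝ) ^ d) / 2 ≤ 1 := fun d => by
    have : 0 ≤ 1 / (q : ℝ) ^ d := by positivity
    linarith
  have aux : ∀ (S : Finset Fq[X]) (d a : ℕ), (∀ P ∈ S, d ≤ P.natDegree) → S.card ≤ a →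
      ((1 - 1 / (q : ℝ) ^ d) / 2) ^ a ≤ ∏ P ∈ S, ((1 - 1 / (q : ℝ) ^ P.natDegree) / 2) :=
    fun S d a hS ha => by
    refine (pow_le_pow_of_le_one (hnn d) (hle d) ha).trans ?_
    rw [← Finset.prod_const]
    refine Finset.prod_le_prod (fun _ _ => hnn d) fun P hP => ?_
    have := one_div_le_one_div_of_le (by positivity) (pow_le_pow_right₀ hq'.le (hS P hP))
    linarith
  rw [FactorBound.prod_split hf]
  have h1 := aux _ 1 a₁ (fun P hP => (Finset.mem_filter.1 hP).2.ge) h.one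
  have h2 := aux _ 2 a₂ (fun P hP => (Finset.mem_filter.1 hP).2.ge) h.two
  have h3 := aux _ 3 a₃ (fun P hP => (Finset.mem_filter.1 hP).2) h.three
  have hn1 := pow_nonneg (hnn 1) a₁
  have hn2 := pow_nonneg (hnn 2) a₂
  have hn3 := pow_nonneg (hnn 3) a₃
  exact mul_le_mul h1 (mul_le_mul h2 h3 hn3 (hn2.trans h2)) (mul_nonneg hn2 hn3) (hn1.trans h1)

variable {q n M k s sn sd : ℕ}

lemma testUnion_spec {W : ℕ} (hW : 1 ≤ W) (hsd : 0 < sd) (hq : 0 < q)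
    (h : testUnion q n W s sn sd a₁ a₂ a₃ = true) :
    (sn : ℝ) / sd + (a₁ / q + a₂ / (q : ℝ) ^ 2 + a₃ / (q : ℝ) ^ 3) < 1 ∧
    ((W : ℝ) - 1) * (1 + (a₁ + a₂ + a₃ : ℕ)) + W * s < √((q : ℝ) ^ (n - 4)) *
      (1 - sn / sd - (a₁ / q + a₂ / (q : ℝ) ^ 2 + a₃ / (q : ℝ) ^ 3)) := by
  simp only [testUnion, Bool.and_eq_true, Nat.blt_eq] at h
  obtain ⟨h1, h2⟩ := h
  have hq0 : (q : ℝ) ≠ 0 := by positivity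
  have hsd' : (0 : ℝ) < sd := by exact_mod_cast hsd
  have hq3 : (0 : ℝ) < (q : ℝ) ^ 3 := by positivity
  constructor
  · have h3 := (Nat.cast_lt (α := ℝ)).2 h1
    push_cast at h3
    rw [← mul_lt_mul_iff_left₀ (mul_pos hq3 hsd'), one_mul]
    refine lt_of_eq_of_lt ?_ h3
    field_simp
  have h3 := natCast_lt_sqrt_mul h2
  have h4 : 1 + (a₁ + a₂ + a₃) ≤ W * (1 + (a₁ + a₂ + a₃) + s) :=
    (Nat.le_add_right _ s).trans (Nat.le_mul_of_pos_left _ hW)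
  push_cast [Nat.cast_sub h1.le, Nat.cast_sub h4] at h3
  rw [← mul_lt_mul_iff_left₀ (mul_pos hq3 hsd')]
  push_cast
  refine lt_of_eq_of_lt ?_ (h3.trans_eq ?_)
  · ring
  · field_simp
    ring

lemma hasTwoTwo_of_testUnion (hcard : Fintype.card Fq = q) (hn : Module.finrank Fq F = n)
    (hn5 : 5 ≤ n) (hodd : Odd q) (hf : f.Monic) (hfn : f ∣ X ^ n - 1) (hfd : f.natDegree = n - 2)
    (hc : FactorBound f (a₁, a₂, a₃)) (hM : q ^ n - 1 = M * (q - 1)) (hsd : 0 < sd)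
    (hP : PrimeBound M k s ((sn : ℝ) / sd))
    (h : testUnion q n (coreWeight n k) s sn sd a₁ a₂ a₃ = true) : HasTwoTwo Fq F q n := by
  have hq : 1 < q := hcard ▸ Fintype.one_lt_card
  obtain ⟨h1, h2⟩ := testUnion_spec (one_le_coreWeight n k) hsd (by omega) h
  have h3 : (0 : ℝ) ≤ a₁ / q + a₂ / (q : ℝ) ^ 2 + a₃ / (q : ℝ) ^ 3 := by positivity
  exact hasTwoTwo_of_union hcard hn hn5 hodd hf hfn hfd hM hP (by linarith)
    (hc.card_le hf.ne_zero) (hc.sum_le hf.ne_zero hq) h2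

lemma hasTwoTwo_of_testCore (hcard : Fintype.card Fq = q) (hn : Module.finrank Fq F = n)
    (hn5 : 5 ≤ n) (hodd : Odd q) (hf : f.Monic) (hfn : f ∣ X ^ n - 1) (hfd : f.natDegree = n - 2)
    (hc : FactorBound f (a₁, a₂, a₃)) (hM : q ^ n - 1 = M * (q - 1)) (hsd : 0 < sd)
    (hP : PrimeBound M k s ((sn : ℝ) / sd))
    (h : testCore q n (coreWeight n k) s sn sd a₁ a₂ a₃ = true) : HasTwoTwo Fq F q n := by
  simp only [testCore, Bool.and_eq_true, Nat.blt_eq] at h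
  obtain ⟨h1, h2⟩ := h
  have hq : 1 < q := hcard ▸ Fintype.one_lt_card
  have hq0 : (0 : ℝ) < q := by positivity
  have hsd' : (0 : ℝ) < sd := by exact_mod_cast hsd
  have hσ : (sn : ℝ) / sd < 1 := by
    rw [div_lt_one hsd']
    exact_mod_cast h1
  refine hasTwoTwo_of_core hcard hn hn5 hodd hf hfn hfd hM hP hσ (hc.le_prod hf.ne_zero hq) ?_
  have h3 := natCast_lt_sqrt_mul h2
  have hW := one_le_coreWeight n k
  have h4 : 1 ≤ coreWeight n k * (1 + s) := Nat.mul_pos hW (by omega)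
  have hp : ∀ d : ℕ, 1 ≤ q ^ d := fun d => Nat.one_le_pow _ _ (by omega)
  push_cast [Nat.cast_sub h1.le, Nat.cast_sub h4, Nat.cast_sub hq.le, Nat.cast_sub (hp 2),
    Nat.cast_sub (hp 3)] at h3
  have hD : (0 : ℝ) < 2 ^ (a₁ + a₂ + a₃) * (sd * (q : ℝ) ^ (a₁ + 2 * a₂ + 3 * a₃)) := by positivity
  rw [← mul_lt_mul_iff_left₀ hD]
  refine lt_of_eq_of_lt ?_ (h3.trans_eq ?_)
  · ring
  · have e : ∀ d : ℕ, (1 - 1 / (q : ℝ) ^ d) / 2 = ((q : ℝ) ^ d - 1) / (2 * (q : ℝ) ^ d) := fun d => by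
      field_simp
    rw [e, e, e, div_pow, div_pow, div_pow, mul_pow, mul_pow, mul_pow]
    simp only [← pow_mul, pow_add]
    field_simp
    rw [one_mul]

lemma hasTwoTwo_of_testFour (hcard : Fintype.card Fq = q) (hn : Module.finrank Fq F = 4)
    (hq4 : q % 4 = 1) (hsd : 0 < sd) (hP : PrimeBound (1 + q + q ^ 2 + q ^ 3) k s ((sn : ℝ) / sd))
    (h : testFour q k s sn sd = true) : HasTwoTwo Fq F q 4 := by
  simp only [testFour, Bool.and_eq_true, Nat.blt_eq, Nat.ble_eq] at h
  obtain ⟨⟨h1, h2⟩, h3⟩ := h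
  have hsd' : (0 : ℝ) < sd := by exact_mod_cast hsd
  have hσ : (sn : ℝ) / sd < 1 := by
    rw [div_lt_one hsd']
    exact_mod_cast h1
  refine hasTwoTwo_four hcard hn hq4 h2 hσ hP ?_
  have h4 : sn ≤ s * sd := h1.le.trans (Nat.le_mul_of_pos_left _ h2)
  have h5 : (4 * q * ((2 ^ k - 1) * (sd - sn) + 2 ^ k * (s * sd - sn)) ^ 2 : ℝ) <
      ((sd - sn) * (q + 1)) ^ 2 := by
    have := (Nat.cast_lt (α := ℝ)).2 h3
    push_cast [Nat.cast_sub h1.le, Nat.cast_sub h4, Nat.cast_sub (Nat.one_le_two_pow (n := k))] at this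
    exact this
  have h6 : (0 : ℝ) ≤ sd - sn := by
    have : (sn : ℝ) < sd := by exact_mod_cast h1
    linarith
  have h7 := abs_lt_of_sq_lt_sq (a := 2 * √(q : ℝ) * ((2 ^ k - 1) * (sd - sn) + 2 ^ k * (s * sd - sn)))
    (b := ((sd - sn) * (q + 1) : ℝ)) (by
      rw [mul_pow, mul_pow, Real.sq_sqrt (Nat.cast_nonneg _)]
      linarith) (by positivity)
  have h8 := (abs_lt.1 h7).2
  rw [← mul_lt_mul_iff_left₀ hsd']
  refine lt_of_eq_of_lt ?_ (h8.trans_eq ?_) <;> field_simp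

/-- Soundness of the check for degrees at least five. -/
theorem hasTwoTwo_of_checkGeneral {E : List (ℕ × ℕ)} (hqp : IsPrimePow q) (hlt : q < 3 ^ 20)
    (hcard : Fintype.card Fq = q) (hn : Module.finrank Fq F = n) (hn5 : 5 ≤ n) (hodd : Odd q)
    (hgcd : Nat.gcd (q ^ 3 - q) n ≠ 1) (h : checkGeneral E n q = true) :
    HasTwoTwo Fq F q n ∨ (q, n) ∈ E := by
  have hq : 1 < q := hcard ▸ Fintype.one_lt_card
  rw [checkGeneral, notPrimePow_spec (by norm_num) hqp hlt,
    notPrimePow_spec prime_of_mem_oddPrimeList hqp hlt] at h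
  simp only [Bool.false_or, Bool.or_false, Bool.or_eq_true, Nat.beq_eq, hgcd, false_or,
    List.any_eq_true, Bool.and_eq_true] at h
  rcases h with h | ⟨e, he, rfl, rfl⟩
  · left
    have hdvd : (q - 1) ∣ q ^ n - 1 := by simpa using Nat.sub_dvd_pow_sub_pow q 1 n
    have hM : q ^ n - 1 = (q ^ n - 1) / (q - 1) * (q - 1) := (Nat.div_mul_cancel hdvd).symm
    have hM0 : (q ^ n - 1) / (q - 1) ≠ 0 := by
      intro h0
      rw [h0, zero_mul] at hM
      have := Nat.one_lt_pow (n := n) (by omega) hq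
      omega
    obtain ⟨f, hf, hfn, hfd, hc⟩ := exists_factor_data hcard (by omega) hodd hgcd
    obtain ⟨A, r, k, ht, hP, hpos⟩ := runSplit_spec hM0 h
    rw [testSplit, Bool.or_eq_true] at ht
    rcases ht with ht | ht
    · exact hasTwoTwo_of_testUnion hcard hn hn5 hodd hf hfn hfd hc hM (by omega) hP ht
    · exact hasTwoTwo_of_testCore hcard hn hn5 hodd hf hfn hfd hc hM (by omega) hP ht
  · exact Or.inr he

/-- Soundness of the check in degree four. -/
theorem hasTwoTwo_of_checkFour {E : List ℕ} (hqp : IsPrimePow q) (hlt : q < 3 ^ 20)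
    (hcard : Fintype.card Fq = q) (hn : Module.finrank Fq F = 4) (hq4 : q % 4 = 1)
    (h : checkFour E q = true) : HasTwoTwo Fq F q 4 ∨ q ∈ E := by
  rw [checkFour, notPrimePow_spec (by norm_num) hqp hlt,
    notPrimePow_spec prime_of_mem_oddPrimeList hqp hlt] at h
  simp only [Bool.false_or, Bool.or_false, Bool.or_eq_true, Nat.beq_eq, List.any_eq_true] at h
  rcases h with h | ⟨e, he, rfl⟩
  · obtain ⟨A, r, k, ht, hP, hpos⟩ := runSplit_spec (by omega) h
    exact Or.inl (hasTwoTwo_of_testFour hcard hn hq4 (by omega) hP ht)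
  · exact Or.inr he

end NumericSound

section Tiers

/-- The test for all `q` with `Q₀ ≤ q ≤ Q₁`, for a polynomial of degree `n - 2`; `P` lists the
possible small primes, the first `k` of which are core. -/
def tierGeneral (P : List ℕ) (n Q₀ Q₁ k a s : ℕ) : Bool :=
  let A := (P.drop k).filter fun l => Nat.blt l a
  let R := recipSum A
  Nat.ble A.length s && Nat.ble a 256 &&
    Nat.blt ((Q₁ ^ n - 1) / (Q₁ - 1) * a ^ A.length) (a ^ (s + 1) * A.prod) &&
    testUnion Q₀ n (coreWeight n k) s (R.1 * a + (s - A.length) * R.2) (R.2 * a) (n - 2) 0 0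

/-- The analogous test in degree four. -/
def tierFour (P : List ℕ) (Q₀ Q₁ k a s : ℕ) : Bool :=
  let A := (P.drop k).filter fun l => Nat.blt l a
  let R := recipSum A
  Nat.ble A.length s && Nat.ble a 256 &&
    Nat.blt ((1 + Q₁ + Q₁ ^ 2 + Q₁ ^ 3) / 4 * a ^ A.length) (a ^ (s + 1) * A.prod) &&
    testFour Q₀ k s (R.1 * a + (s - A.length) * R.2) (R.2 * a)

/-- Run a tier test on consecutive intervals, given by factors and parameters. -/
def tierChain (T : ℕ → ℕ → ℕ → ℕ → ℕ → Bool) : ℕ → List (ℕ × ℕ × ℕ × ℕ) → Bool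
  | _, [] => true
  | Q, e :: L => T Q (Q * e.1) e.2.1 e.2.2.1 e.2.2.2 && tierChain T (Q * e.1) L

lemma tierChain_spec {T : ℕ → ℕ → ℕ → ℕ → ℕ → Bool} {q : ℕ} : ∀ {Q : ℕ} {L : List (ℕ × ℕ × ℕ × ℕ)},
    tierChain T Q L = true → Q ≤ q → q < Q * (L.map Prod.fst).prod →
    ∃ Q₀ Q₁ k a s, T Q₀ Q₁ k a s = true ∧ Q₀ ≤ q ∧ q ≤ Q₁ ∧ Q ≤ Q₀
  | Q, [], _, h1, h2 => by simp at h2; omega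
  | Q, e :: L, h, h1, h2 => by
    rw [tierChain, Bool.and_eq_true] at h
    rcases le_or_gt q (Q * e.1) with h3 | h3
    · exact ⟨_, _, _, _, _, h.1, h1, h3, le_rfl⟩
    · rw [List.map_cons, List.prod_cons, ← mul_assoc] at h2
      obtain ⟨Q₀, Q₁, k, a, s, h4, h5, h6, h7⟩ := tierChain_spec h.2 h3.le h2
      refine ⟨Q₀, Q₁, k, a, s, h4, h5, h6, le_trans ?_ h7⟩
      rcases Nat.eq_zero_or_pos e.1 with h0 | h0
      · rw [h0] at h2; simp at h2
      · exact Nat.le_mul_of_pos_right _ h0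

lemma primeBound_of_tier {M M₀ B a s k : ℕ} {P A : List ℕ} (hM : M ≠ 0) (hM₀ : 0 < M₀)
    (hdvd : ∀ l ∈ oddPrimes M, l ∣ M₀) (hB : M₀ ≤ B) (ha : a ≤ 256)
    (hP : ∀ l ∈ oddPrimes M, l < 256 → l ∈ P) (hPnd : P.Nodup) (hPpos : ∀ p ∈ P, 0 < p)
    (hA : A = (P.drop k).filter fun l => Nat.blt l a) (hs : A.length ≤ s)
    (h : B * a ^ A.length < a ^ (s + 1) * A.prod) :
    0 < (recipSum A).2 * a ∧
    PrimeBound M k s (((recipSum A).1 * a + (s - A.length) * (recipSum A).2 : ℕ) /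
        ((recipSum A).2 * a : ℕ)) := by
  have ha0 : 0 < a := by
    rcases Nat.eq_zero_or_pos a with rfl | h0
    · simp at h
    · exact h0
  have hnd : A.Nodup := hA ▸ List.Nodup.filter _ (hPnd.sublist (List.drop_sublist _ _))
  have hApos : ∀ p ∈ A, 0 < p ∧ p ≤ a := fun p hp => by
    rw [hA, List.mem_filter, Nat.blt_eq] at hp
    exact ⟨hPpos p (List.mem_of_mem_drop hp.1), hp.2.le⟩
  obtain ⟨hd, hsum⟩ := recipSum_spec A fun p hp => (hApos p hp).1
  refine ⟨Nat.mul_pos hd ha0, ?_⟩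
  have h1 := primeBound_of_size (s := s) hM hM₀ hdvd ha0 (C := (P.take k).toFinset) (A := A.toFinset)
    (fun l hl hla => ?_) (fun p hp => hApos p (List.mem_toFinset.1 hp)) ?_
  · rw [List.toFinset_card_of_nodup hnd, List.sum_toFinset _ hnd, hsum] at h1
    have hk : (P.take k).toFinset.card ≤ k :=
      (List.toFinset_card_le _).trans (List.length_take_le _ _)
    convert h1.mono hk using 1
    have hd' : ((recipSum A).2 : ℝ) ≠ 0 := by positivity
    have ha' : (a : ℝ) ≠ 0 := by positivity
    push_cast [Nat.cast_sub hs]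
    field_simp
  · have := hP l hl (by omega)
    rw [← List.take_append_drop k P, List.mem_append] at this
    rcases this with h | h
    · exact Or.inl (List.mem_toFinset.2 h)
    · refine Or.inr (List.mem_toFinset.2 ?_)
      rw [hA, List.mem_filter, Nat.blt_eq]
      exact ⟨h, hla⟩
  · rw [List.toFinset_card_of_nodup hnd, List.prod_toFinset _ hnd, List.map_id']
    exact (Nat.mul_le_mul_right _ hB).trans_lt h

lemma testFour_mono {Q₀ q k s sn sd : ℕ} (h0 : 1 ≤ Q₀) (hq : Q₀ ≤ q)
    (h : testFour Q₀ k s sn sd = true) : testFour q k s sn sd = true := by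
  simp only [testFour, Bool.and_eq_true, Nat.blt_eq] at h ⊢
  refine ⟨h.1, ?_⟩
  obtain ⟨-, h⟩ := h
  set D := sd - sn
  set Y := (2 ^ k - 1) * D + 2 ^ k * (s * sd - sn)
  have h1 : (Q₀ + 1) ^ 2 * q ≤ (q + 1) ^ 2 * Q₀ := by
    obtain ⟨d, rfl⟩ := Nat.exists_eq_add_of_le hq
    have : d ≤ d * ((Q₀ + d) * Q₀) := Nat.le_mul_of_pos_right _ (by positivity)
    nlinarith
  refine lt_of_mul_lt_mul_right (a := Q₀) ?_ (Nat.zero_le _)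
  calc 4 * q * Y ^ 2 * Q₀ = 4 * Q₀ * Y ^ 2 * q := by ring
    _ < (D * (Q₀ + 1)) ^ 2 * q := Nat.mul_lt_mul_of_pos_right h (by omega)
    _ = D ^ 2 * ((Q₀ + 1) ^ 2 * q) := by ring
    _ ≤ D ^ 2 * ((q + 1) ^ 2 * Q₀) := Nat.mul_le_mul_left _ h1
    _ = (D * (q + 1)) ^ 2 * Q₀ := by ring

variable {Fq F : Type*} [Field Fq] [Field F] [Fintype Fq] [Fintype F] [Algebra Fq F]

lemma sum_natDegree_monicFactors_le {f : Fq[X]} (hf : f ≠ 0) :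
    ∑ P ∈ monicFactors f, P.natDegree ≤ f.natDegree := by
  have hd : ∏ P ∈ monicFactors f, P ∣ f := by
    refine Finset.prod_dvd_of_coprime (fun P hP Q hQ hPQ => ?_) fun P hP => ((mem_monicFactors hf).1 hP).2.2
    obtain ⟨h1, h2, -⟩ := (mem_monicFactors hf).1 hP
    obtain ⟨h3, h4, -⟩ := (mem_monicFactors hf).1 hQ
    exact (h2.isCoprime_or_dvd Q).resolve_right fun h => hPQ
      (eq_of_monic_of_associated h1 h3 (h2.associated_of_dvd h4 h))
  rw [← natDegree_prod_of_monic _ _ fun P hP => ((mem_monicFactors hf).1 hP).1]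
  exact natDegree_le_of_dvd hd hf

lemma card_monicFactors_le {f : Fq[X]} (hf : f ≠ 0) : (monicFactors f).card ≤ f.natDegree := by
  refine le_trans ?_ (sum_natDegree_monicFactors_le hf)
  rw [Finset.card_eq_sum_ones]
  exact Finset.sum_le_sum fun P hP => one_le_natDegree_of_mem_monicFactors hf hP

lemma sum_one_div_monicFactors_le {f : Fq[X]} (hf : f ≠ 0) {q : ℕ} (hq : 1 < q) :
    ∑ P ∈ monicFactors f, 1 / (q : ℝ) ^ P.natDegree ≤ f.natDegree / q := by
  have hq' : (1 : ℝ) < q := by exact_mod_cast hq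
  calc ∑ P ∈ monicFactors f, 1 / (q : ℝ) ^ P.natDegree ≤ (monicFactors f).card • (1 / (q : ℝ)) := by
        refine Finset.sum_le_card_nsmul _ _ _ fun P hP => ?_
        refine one_div_le_one_div_of_le (by positivity) ?_
        exact le_self_pow₀ hq'.le (by have := one_le_natDegree_of_mem_monicFactors hf hP; omega)
    _ = (monicFactors f).card / q := by rw [nsmul_eq_mul, mul_one_div]
    _ ≤ f.natDegree / q := by gcongr; exact card_monicFactors_le hf

lemma pow_sub_one_eq_geom_mul {q : ℕ} (hq : 1 < q) (n : ℕ) :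
    q ^ n - 1 = (∑ i ∈ Finset.range n, q ^ i) * (q - 1) := by
  rw [Nat.geomSum_eq hq, Nat.div_mul_cancel]
  simpa using Nat.sub_dvd_pow_sub_pow q 1 n

variable {q n : ℕ}

theorem hasTwoTwo_of_tierGeneral {P : List ℕ} {Q₀ Q₁ k a s : ℕ} (hcard : Fintype.card Fq = q)
    (hn : Module.finrank Fq F = n) (hn5 : 5 ≤ n) (hodd : Odd q) (hgcd : Nat.gcd (q ^ 3 - q) n ≠ 1)
    (hP : ∀ l ∈ oddPrimes (∑ i ∈ Finset.range n, q ^ i), l < 256 → l ∈ P) (hPnd : P.Nodup)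
    (hPpos : ∀ p ∈ P, 0 < p) (hQ : 1 ≤ Q₀) (h0 : Q₀ ≤ q) (h1 : q ≤ Q₁)
    (h : tierGeneral P n Q₀ Q₁ k a s = true) : HasTwoTwo Fq F q n := by
  have hq : 1 < q := hcard ▸ Fintype.one_lt_card
  simp only [tierGeneral, Bool.and_eq_true, Nat.ble_eq, Nat.blt_eq] at h
  obtain ⟨⟨⟨hs, ha⟩, hsize⟩, ht⟩ := h
  obtain ⟨f, hf, hfn, hfd, -⟩ := exists_factor_data hcard (by omega) hodd hgcd
  have hMpos : 0 < ∑ i ∈ Finset.range n, q ^ i :=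
    Finset.sum_pos (fun i _ => pow_pos (by omega) i) ⟨0, Finset.mem_range.2 (by omega)⟩
  rw [← Nat.geomSum_eq (by omega)] at hsize
  obtain ⟨hpos, hPB⟩ := primeBound_of_tier hMpos.ne' hMpos
    (fun l hl => ((mem_oddPrimes hMpos.ne').1 hl).2.2)
    (Finset.sum_le_sum fun i _ => Nat.pow_le_pow_left h1 i) ha hP hPnd hPpos rfl hs hsize
  obtain ⟨h2, h3⟩ := testUnion_spec (one_le_coreWeight n k) hpos (by omega) ht
  simp only [Nat.cast_zero, zero_div, add_zero] at h2 h3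
  have hQ' : (0 : ℝ) < Q₀ := by exact_mod_cast hQ
  have h0' : (Q₀ : ℝ) ≤ q := by exact_mod_cast h0
  have h4 : ((n - 2 : ℕ) : ℝ) / q ≤ (n - 2 : ℕ) / Q₀ := by gcongr
  have h5 : (0 : ℝ) ≤ ((n - 2 : ℕ) : ℝ) / q := by positivity
  refine hasTwoTwo_of_union hcard hn hn5 hodd hf hfn hfd (pow_sub_one_eq_geom_mul hq n) hPB
    (by linarith) (hfd ▸ card_monicFactors_le hf.ne_zero)
    (hfd ▸ sum_one_div_monicFactors_le hf.ne_zero hq) (h3.trans_le ?_)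
  refine mul_le_mul (Real.sqrt_le_sqrt (pow_le_pow_left₀ hQ'.le h0' _)) (by linarith) (by linarith)
    (Real.sqrt_nonneg _)

theorem hasTwoTwo_of_tierFour {P : List ℕ} {Q₀ Q₁ k a s : ℕ} (hcard : Fintype.card Fq = q)
    (hn : Module.finrank Fq F = 4) (hq4 : q % 4 = 1)
    (hP : ∀ l ∈ oddPrimes (1 + q + q ^ 2 + q ^ 3), l < 256 → l ∈ P) (hPnd : P.Nodup)
    (hPpos : ∀ p ∈ P, 0 < p) (hQ : 1 ≤ Q₀) (h0 : Q₀ ≤ q) (h1 : q ≤ Q₁)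
    (h : tierFour P Q₀ Q₁ k a s = true) : HasTwoTwo Fq F q 4 := by
  simp only [tierFour, Bool.and_eq_true, Nat.ble_eq, Nat.blt_eq] at h
  obtain ⟨⟨⟨hs, ha⟩, hsize⟩, ht⟩ := h
  have hM : 1 + q + q ^ 2 + q ^ 3 ≠ 0 := by omega
  have h4 : 4 ∣ 1 + q + q ^ 2 + q ^ 3 := by
    apply Nat.dvd_of_mod_eq_zero
    simp [Nat.add_mod, Nat.pow_mod, hq4]
  have hdvd : ∀ l ∈ oddPrimes (1 + q + q ^ 2 + q ^ 3), l ∣ (1 + q + q ^ 2 + q ^ 3) / 4 := by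
    intro l hl
    obtain ⟨h5, h6, h7⟩ := (mem_oddPrimes hM).1 hl
    rw [← Nat.mul_div_cancel' h4] at h7
    refine (h5.dvd_mul.1 h7).resolve_left fun h8 => h6 ?_
    exact (Nat.prime_dvd_prime_iff_eq h5 Nat.prime_two).1 (h5.dvd_of_dvd_pow (n := 2) h8)
  obtain ⟨hpos, hPB⟩ := primeBound_of_tier hM
    (B := (1 + Q₁ + Q₁ ^ 2 + Q₁ ^ 3) / 4) (Nat.div_pos (Nat.le_of_dvd (by omega) h4) (by norm_num))
    hdvd (Nat.div_le_div_right (by gcongr)) ha hP hPnd hPpos rfl hs hsize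
  exact hasTwoTwo_of_testFour hcard hn hq4 hpos hPB (testFour_mono hQ h0 ht)

end Tiers

section Large

lemma two_mul_geom_le {q : ℕ} (hq : 3 ≤ q) : ∀ n, 2 * ∑ i ∈ Finset.range (n + 1), q ^ i ≤ 3 * q ^ n
  | 0 => by simp
  | n + 1 => by
    have := two_mul_geom_le hq n
    rw [Finset.sum_range_succ, mul_add]
    have h : 3 * q ^ n ≤ q ^ (n + 1) := by
      rw [pow_succ, mul_comm]; exact Nat.mul_le_mul_left _ hq
    omega

lemma natCast_le_sqrt_mul {a b d : ℕ} (h : a ^ 2 ≤ d * b ^ 2) : (a : ℝ) ≤ √(d : ℝ) * b := by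
  have h' : (a : ℝ) ^ 2 ≤ d * (b : ℝ) ^ 2 := by exact_mod_cast h
  have := Real.le_sqrt_of_sq_le h'
  rwa [Real.sqrt_mul (Nat.cast_nonneg _), Real.sqrt_sq (Nat.cast_nonneg _)] at this

lemma exists_primeBound_of_list {M ν C : ℕ} (hM : M ≠ 0) {A : List ℕ} (hnd : A.Nodup)
    (hA : ∀ l ∈ oddPrimes M, l < 2 ^ ν → l ∈ A) (hAa : ∀ p ∈ A, 0 < p ∧ p ≤ 2 ^ ν)
    (hC : (2 ^ ν) ^ A.length ≤ C * A.prod) :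
    ∃ t, PrimeBound M t 0 0 ∧ 2 ^ (ν * t) ≤ C * M := by
  refine primeBound_full hM (A := A.toFinset) (fun l hl h => List.mem_toFinset.2 (hA l hl h))
    (fun p hp => hAa p (List.mem_toFinset.1 hp)) ?_
  rwa [List.toFinset_card_of_nodup hnd, List.prod_toFinset _ hnd, List.map_id']

/-- Upper bound for `∏ 256 / p` over the odd primes `p < 256`. -/
def eightBitConst : ℕ := 1348232063410523022914893501

/-- Upper bound for `∏ 64 / p` over the odd primes `p < 64`. -/
def sixBitConst : ℕ := 86463849

/-- Upper bound for `∏ 1024 / p` over the primes in `primesOneModTen`. -/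
def tenBitConst : ℕ := 22216477672929882997518

/-- The prime five and the primes below 1024 which are one modulo ten. -/
def primesOneModTen : List ℕ :=
  [5, 11, 31, 41, 61, 71, 101, 131, 151, 181, 191, 211, 241, 251, 271, 281, 311, 331, 401, 421, 431,
    461, 491, 521, 541, 571, 601, 631, 641, 661, 691, 701, 751, 761, 811, 821, 881, 911, 941, 971,
    991, 1021]

lemma exists_primeBound_eight {M : ℕ} (hM : M ≠ 0) :
    ∃ t, PrimeBound M t 0 0 ∧ 2 ^ (8 * t) ≤ eightBitConst * M :=
  exists_primeBound_of_list hM (A := oddPrimeList) (by decide +kernel)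
    (fun l hl h => by
      obtain ⟨h1, h2, -⟩ := (mem_oddPrimes hM).1 hl
      exact mem_oddPrimeList h1 h2 h) (by decide +kernel) (by decide +kernel)

lemma exists_primeBound_six {M : ℕ} (hM : M ≠ 0) :
    ∃ t, PrimeBound M t 0 0 ∧ 2 ^ (6 * t) ≤ sixBitConst * M :=
  exists_primeBound_of_list hM (A := oddPrimeList.filter fun l => Nat.blt l 64) (by decide +kernel)
    (fun l hl h => by
      obtain ⟨h1, h2, -⟩ := (mem_oddPrimes hM).1 hl
      rw [List.mem_filter, Nat.blt_eq]
      exact ⟨mem_oddPrimeList h1 h2 (by omega), h⟩) (by decide +kernel) (by decide +kernel)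

lemma mem_primesOneModTen {l : ℕ} (hl : l.Prime) (h1 : l = 5 ∨ l % 10 = 1) (h : l < 1024) :
    l ∈ primesOneModTen := by
  have key : ∀ l < 1024, l ≠ 5 → l % 10 = 1 → l ∈ primesOneModTen ∨ l < 3 ∨
      ∃ d ∈ oddPrimeList.take 10, d ∣ l ∧ d < l := by
    decide +kernel
  rcases eq_or_ne l 5 with rfl | h5
  · decide
  rcases key l h h5 (h1.resolve_left h5) with h1 | h1 | ⟨d, hd, hdl, hlt⟩
  · exact h1
  · have := hl.two_le; omega
  · rcases (Nat.dvd_prime hl).1 hdl with rfl | rfl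
    · exact absurd hd (by decide)
    · omega

/-- Odd prime divisors of `1 + q + q ^ 2 + q ^ 3 + q ^ 4`. -/
lemma eq_five_or_mod_ten {q l : ℕ} (hl : l.Prime) (h2 : l ≠ 2)
    (h : l ∣ ∑ i ∈ Finset.range 5, q ^ i) : l = 5 ∨ l % 10 = 1 := by
  have : Fact l.Prime := ⟨hl⟩
  have h0 : ∑ i ∈ Finset.range 5, (q : ZMod l) ^ i = 0 := by
    have := (ZMod.natCast_eq_zero_iff _ _).2 h
    exact_mod_cast this
  have h5 : (q : ZMod l) ^ 5 = 1 := by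
    have := geom_sum_mul (q : ZMod l) 5
    rw [h0, zero_mul] at this
    exact (sub_eq_zero.1 this.symm)
  rcases eq_or_ne (q : ZMod l) 1 with h1 | h1
  · left
    rw [h1] at h0
    have h6 : ((5 : ℕ) : ZMod l) = 0 := by simpa using h0
    exact (Nat.prime_dvd_prime_iff_eq hl (by norm_num)).1 ((ZMod.natCast_eq_zero_iff _ _).1 h6)
  · right
    have : Fact (Nat.Prime 5) := ⟨by norm_num⟩
    have hord : orderOf (q : ZMod l) = 5 := orderOf_eq_prime h5 h1
    have hq0 : (q : ZMod l) ≠ 0 := by rintro h; rw [h] at h5; simp at h5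
    have h6 : 5 ∣ l - 1 := by
      rw [← hord]
      exact orderOf_dvd_of_pow_eq_one (ZMod.pow_card_sub_one_eq_one hq0)
    have := hl.two_le
    have := hl.eq_two_or_odd
    omega

lemma exists_primeBound_five {q : ℕ} :
    ∃ t, PrimeBound (∑ i ∈ Finset.range 5, q ^ i) t 0 0 ∧
      2 ^ (10 * t) ≤ tenBitConst * ∑ i ∈ Finset.range 5, q ^ i := by
  have hM : ∑ i ∈ Finset.range 5, q ^ i ≠ 0 := by simp [Finset.sum_range_succ]
  refine exists_primeBound_of_list hM (A := primesOneModTen) (by decide +kernel)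
    (fun l hl h => ?_) (by decide +kernel) (by decide +kernel)
  obtain ⟨h1, h2, h3⟩ := (mem_oddPrimes hM).1 hl
  exact mem_primesOneModTen h1 (eq_five_or_mod_ten h1 h2 h3) h

variable {Fq F : Type*} [Field Fq] [Field F] [Fintype Fq] [Fintype F] [Algebra Fq F] {q n : ℕ}

lemma hasTwoTwo_four_of_large (hcard : Fintype.card Fq = q) (hn : Module.finrank Fq F = 4)
    (hq4 : q % 4 = 1) (hq : 2 * 16 ^ 4 * eightBitConst ≤ q) : HasTwoTwo Fq F q 4 := by
  have hM : 1 + q + q ^ 2 + q ^ 3 ≠ 0 := by omega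
  have hq3 : 3 ≤ q := le_trans (by decide +kernel) hq
  obtain ⟨t, hP, ht⟩ := exists_primeBound_eight hM
  have hMle : 1 + q + q ^ 2 + q ^ 3 ≤ 2 * q ^ 3 := by
    have := two_mul_geom_le hq3 3
    simp only [Finset.sum_range_succ, Finset.sum_range_zero] at this
    nlinarith
  have hle : 16 * 4 ^ t ≤ q := by
    rw [← Nat.pow_le_pow_iff_left (n := 4) (by norm_num)]
    calc (16 * 4 ^ t) ^ 4 = 16 ^ 4 * 2 ^ (8 * t) := by
          rw [mul_pow, ← pow_mul, show (4 : ℕ) = 2 ^ 2 by norm_num, ← pow_mul]; ring_nf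
      _ ≤ 16 ^ 4 * (eightBitConst * (2 * q ^ 3)) :=
          Nat.mul_le_mul_left _ (ht.trans (Nat.mul_le_mul_left _ hMle))
      _ = (2 * 16 ^ 4 * eightBitConst) * q ^ 3 := by ring
      _ ≤ q * q ^ 3 := Nat.mul_le_mul_right _ hq
      _ = q ^ 4 := by ring
  obtain ⟨K, R, h1, h2, h3, h4, h5, h6⟩ := hP
  have hP' : PrimeBound (1 + q + q ^ 2 + q ^ 3) t 1 0 := ⟨K, R, h1, h2, h3, h4, by omega, h6⟩
  refine hasTwoTwo_four hcard hn hq4 le_rfl zero_lt_one hP' ?_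
  have h7 : ((4 * 2 ^ t : ℕ) : ℝ) ≤ √(q : ℝ) * (1 : ℕ) := natCast_le_sqrt_mul (by
    rw [mul_pow, ← pow_mul, mul_comm t, pow_mul]
    norm_num
    exact hle)
  push_cast at h7
  have h8 : √(q : ℝ) * √(q : ℝ) = q := Real.mul_self_sqrt (Nat.cast_nonneg _)
  have h9 : (0 : ℝ) ≤ √(q : ℝ) := Real.sqrt_nonneg _
  push_cast
  nlinarith

/-- The union criterion when all primes are core. -/
lemma hasTwoTwo_of_full (hcard : Fintype.card Fq = q) (hn : Module.finrank Fq F = n)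
    (hn5 : 5 ≤ n) (hodd : Odd q) (hgcd : Nat.gcd (q ^ 3 - q) n ≠ 1) {t : ℕ}
    (hP : PrimeBound (∑ i ∈ Finset.range n, q ^ i) t 0 0)
    (h : ((coreWeight n t : ℝ) - 1) * (1 + (n - 2 : ℕ)) <
      √((q : ℝ) ^ (n - 4)) * (1 - (n - 2 : ℕ) / q)) : HasTwoTwo Fq F q n := by
  have hq : 1 < q := hcard ▸ Fintype.one_lt_card
  obtain ⟨f, hf, hfn, hfd, -⟩ := exists_factor_data hcard (by omega) hodd hgcd
  refine hasTwoTwo_of_union hcard hn hn5 hodd hf hfn hfd (pow_sub_one_eq_geom_mul hq n) hP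
    zero_lt_one (hfd ▸ card_monicFactors_le hf.ne_zero)
    (hfd ▸ sum_one_div_monicFactors_le hf.ne_zero hq) ?_
  simpa using h

lemma hasTwoTwo_five_of_large (hcard : Fintype.card Fq = q) (hn : Module.finrank Fq F = 5)
    (hodd : Odd q) (hgcd : Nat.gcd (q ^ 3 - q) 5 ≠ 1) (hq : 2 * 16 ^ 5 * tenBitConst ≤ q) :
    HasTwoTwo Fq F q 5 := by
  have hq3 : 3 ≤ q := le_trans (by decide +kernel) hq
  obtain ⟨t, hP, ht⟩ := exists_primeBound_five (q := q)
  refine hasTwoTwo_of_full hcard hn le_rfl hodd hgcd hP ?_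
  have hle : 16 * 4 ^ t ≤ q := by
    rw [← Nat.pow_le_pow_iff_left (n := 5) (by norm_num)]
    calc (16 * 4 ^ t) ^ 5 = 16 ^ 5 * 2 ^ (10 * t) := by
          rw [mul_pow, ← pow_mul, show (4 : ℕ) = 2 ^ 2 by norm_num, ← pow_mul]; ring_nf
      _ ≤ 16 ^ 5 * (tenBitConst * (2 * q ^ 4)) :=
          Nat.mul_le_mul_left _ (ht.trans (Nat.mul_le_mul_left _ (by
            have : 2 * ∑ i ∈ Finset.range 5, q ^ i ≤ 3 * q ^ 4 := two_mul_geom_le hq3 4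
            omega)))
      _ = (2 * 16 ^ 5 * tenBitConst) * q ^ 4 := by ring
      _ ≤ q * q ^ 4 := Nat.mul_le_mul_right _ hq
      _ = q ^ 5 := by ring
  have h7 : ((4 * 2 ^ t : ℕ) : ℝ) ≤ √(q : ℝ) * (1 : ℕ) := natCast_le_sqrt_mul (by
    rw [mul_pow, ← pow_mul, mul_comm t, pow_mul]
    norm_num
    exact hle)
  have hq' : (3 : ℝ) ≤ q := by exact_mod_cast hq3
  have h8 : √(q : ℝ) * √(q : ℝ) = q := Real.mul_self_sqrt (Nat.cast_nonneg _)
  have h9 : √(q : ℝ) / q ≤ 1 := by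
    rw [div_le_one (by linarith)]
    have : 1 ≤ √(q : ℝ) := Real.one_le_sqrt.2 (by linarith)
    nlinarith
  have h10 : √(q : ℝ) * (1 - 3 / q) = √(q : ℝ) - 3 * (√(q : ℝ) / q) := by ring
  norm_num [coreWeight] at h7 ⊢
  rw [h10]
  linarith

lemma hasTwoTwo_six_of_large (hcard : Fintype.card Fq = q) (hn : Module.finrank Fq F = 6)
    (hodd : Odd q) (hgcd : Nat.gcd (q ^ 3 - q) 6 ≠ 1) (hq : 2 * 20 ^ 8 * eightBitConst ≤ q ^ 3) :
    HasTwoTwo Fq F q 6 := by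
  have hq1 : 1 < q := hcard ▸ Fintype.one_lt_card
  have hq3 : 3 ≤ q := by obtain ⟨m, rfl⟩ := hodd; omega
  have hM : ∑ i ∈ Finset.range 6, q ^ i ≠ 0 := by simp [Finset.sum_range_succ]
  obtain ⟨t, hP, ht⟩ := exists_primeBound_eight hM
  refine hasTwoTwo_of_full hcard hn (by norm_num) hodd hgcd hP ?_
  have hle : 20 * 2 ^ t ≤ q := by
    rw [← Nat.pow_le_pow_iff_left (n := 8) (by norm_num)]
    calc (20 * 2 ^ t) ^ 8 = 20 ^ 8 * 2 ^ (8 * t) := by rw [mul_pow, ← pow_mul, mul_comm t]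
      _ ≤ 20 ^ 8 * (eightBitConst * (2 * q ^ 5)) :=
          Nat.mul_le_mul_left _ (ht.trans (Nat.mul_le_mul_left _ (by
            have : 2 * ∑ i ∈ Finset.range 6, q ^ i ≤ 3 * q ^ 5 := two_mul_geom_le hq3 5
            omega)))
      _ = (2 * 20 ^ 8 * eightBitConst) * q ^ 5 := by ring
      _ ≤ q ^ 3 * q ^ 5 := Nat.mul_le_mul_right _ hq
      _ = q ^ 8 := by ring
  have hle' : (20 * 2 ^ t : ℝ) ≤ q := by exact_mod_cast hle
  have hq' : (3 : ℝ) ≤ q := by exact_mod_cast hq3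
  have h10 : (q : ℝ) * (1 - 4 / q) = q - 4 := by field_simp
  norm_num [coreWeight, Real.sqrt_sq (Nat.cast_nonneg q)]
  rw [h10]
  linarith

lemma hasTwoTwo_seven_of_large (hcard : Fintype.card Fq = q) (hn : Module.finrank Fq F = 7)
    (hodd : Odd q) (hgcd : Nat.gcd (q ^ 3 - q) 7 ≠ 1) (hq : 2 * 49 ^ 3 * sixBitConst ≤ q ^ 3)
    (hq35 : 35 ≤ q) : HasTwoTwo Fq F q 7 := by
  have hM : ∑ i ∈ Finset.range 7, q ^ i ≠ 0 := by simp [Finset.sum_range_succ]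
  obtain ⟨t, hP, ht⟩ := exists_primeBound_six hM
  refine hasTwoTwo_of_full hcard hn (by norm_num) hodd hgcd hP ?_
  have hle : 49 * 4 ^ t ≤ q ^ 3 := by
    rw [← Nat.pow_le_pow_iff_left (n := 3) (by norm_num)]
    calc (49 * 4 ^ t) ^ 3 = 49 ^ 3 * 2 ^ (6 * t) := by
          rw [mul_pow, ← pow_mul, show (4 : ℕ) = 2 ^ 2 by norm_num, ← pow_mul]; ring_nf
      _ ≤ 49 ^ 3 * (sixBitConst * (2 * q ^ 6)) :=
          Nat.mul_le_mul_left _ (ht.trans (Nat.mul_le_mul_left _ (by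
            have : 2 * ∑ i ∈ Finset.range 7, q ^ i ≤ 3 * q ^ 6 := two_mul_geom_le (by omega) 6
            omega)))
      _ = (2 * 49 ^ 3 * sixBitConst) * q ^ 6 := by ring
      _ ≤ q ^ 3 * q ^ 6 := Nat.mul_le_mul_right _ hq
      _ = (q ^ 3) ^ 3 := by ring
  have h7 : ((7 * 2 ^ t : ℕ) : ℝ) ≤ √((q ^ 3 : ℕ) : ℝ) * (1 : ℕ) := natCast_le_sqrt_mul (by
    rw [mul_pow, ← pow_mul, mul_comm t, pow_mul]
    norm_num
    exact hle)
  have hq' : (35 : ℝ) ≤ q := by exact_mod_cast hq35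
  have h8 : (6 : ℝ) / 7 ≤ 1 - 5 / q := by
    have : (5 : ℝ) / q ≤ 1 / 7 := by rw [div_le_div_iff₀ (by linarith) (by norm_num)]; linarith
    linarith
  norm_num [coreWeight] at h7 ⊢
  have h9 := mul_le_mul_of_nonneg_left h8 (Real.sqrt_nonneg ((q : ℝ) ^ 3))
  linarith

lemma coreWeight_le (n t : ℕ) : coreWeight n t ≤ 4 * 2 ^ t := by
  unfold coreWeight; split_ifs <;> omega

lemma hasTwoTwo_of_gt (hcard : Fintype.card Fq = q) (hn : Module.finrank Fq F = n)
    (hn8 : 8 ≤ n) (hodd : Odd q) (hgcd : Nat.gcd (q ^ 3 - q) n ≠ 1) (hnq : n < q)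
    (h : 3 * 4 ^ 6 * sixBitConst * (n - 1) ^ 6 * q ^ (n + 5) ≤
      2 * q ^ (3 * (n - 4)) * (q - (n - 2)) ^ 6) :
    HasTwoTwo Fq F q n := by
  have hM : ∑ i ∈ Finset.range n, q ^ i ≠ 0 := by
    refine (Finset.sum_pos (fun i _ => pow_pos (by omega) i) ⟨0, Finset.mem_range.2 (by omega)⟩).ne'
  obtain ⟨t, hP, ht⟩ := exists_primeBound_six hM
  refine hasTwoTwo_of_full hcard hn (by omega) hodd hgcd hP ?_
  have hgeom := two_mul_geom_le (by omega : 3 ≤ q) (n - 1)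
  rw [show n - 1 + 1 = n by omega] at hgeom
  have hle : (4 * (n - 1) * 2 ^ t * q) ^ 2 ≤ q ^ (n - 4) * (q - (n - 2)) ^ 2 := by
    rw [← Nat.pow_le_pow_iff_left (n := 3) (by norm_num)]
    refine le_of_mul_le_mul_left ?_ (by norm_num : 0 < 2)
    calc 2 * ((4 * (n - 1) * 2 ^ t * q) ^ 2) ^ 3
        = 2 * (4 ^ 6 * (n - 1) ^ 6 * 2 ^ (6 * t) * q ^ 6) := by
          rw [mul_comm 6 t, pow_mul]; ring
      _ ≤ 2 * (4 ^ 6 * (n - 1) ^ 6 * (sixBitConst * ∑ i ∈ Finset.range n, q ^ i) * q ^ 6) := by gcongr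
      _ = 4 ^ 6 * (n - 1) ^ 6 * sixBitConst * (2 * ∑ i ∈ Finset.range n, q ^ i) * q ^ 6 := by ring
      _ ≤ 4 ^ 6 * (n - 1) ^ 6 * sixBitConst * (3 * q ^ (n - 1)) * q ^ 6 := by gcongr
      _ = 3 * 4 ^ 6 * sixBitConst * (n - 1) ^ 6 * q ^ (n + 5) := by
          rw [show n + 5 = n - 1 + 6 by omega, pow_add]; ring
      _ ≤ 2 * q ^ (3 * (n - 4)) * (q - (n - 2)) ^ 6 := h
      _ = 2 * (q ^ (n - 4) * (q - (n - 2)) ^ 2) ^ 3 := by rw [mul_comm 3, pow_mul]; ring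
  have h1 := natCast_le_sqrt_mul hle
  have hq0 : (0 : ℝ) < q := by exact_mod_cast (by omega : 0 < q)
  push_cast [Nat.cast_sub (by omega : n - 2 ≤ q)] at h1
  have h2 : (coreWeight n t : ℝ) ≤ 4 * 2 ^ t := by exact_mod_cast coreWeight_le n t
  have h3 : ((n - 1 : ℕ) : ℝ) = 1 + (n - 2 : ℕ) := by
    rw [show n - 1 = 1 + (n - 2) by omega]; push_cast; ring
  have h4 : (0 : ℝ) < 1 + (n - 2 : ℕ) := by positivity
  rw [← mul_lt_mul_iff_left₀ hq0]
  calc ((coreWeight n t : ℝ) - 1) * (1 + (n - 2 : ℕ)) * q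
      < 4 * 2 ^ t * (1 + (n - 2 : ℕ)) * q := by gcongr; linarith
    _ = 4 * (n - 1 : ℕ) * 2 ^ t * q := by rw [h3]; ring
    _ ≤ _ := h1
    _ = _ := by field_simp

end Large

section Core

variable {Fq F : Type*} [Field Fq] [Field F] [Fintype Fq] [Fintype F] [Algebra Fq F] {q n : ℕ}

/-- The criterion with everything in the core, in terms of the density `π` of the factors. -/
lemma hasTwoTwo_of_density (hcard : Fintype.card Fq = q) (hn : Module.finrank Fq F = n)
    (hn5 : 5 ≤ n) (hodd : Odd q) {f : Fq[X]} (hf : f.Monic) (hfn : f ∣ X ^ n - 1)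
    (hfd : f.natDegree = n - 2) {π : ℝ} (hπ0 : 0 ≤ π)
    (hπ : π ≤ ∏ P ∈ monicFactors f, ((1 - 1 / (q : ℝ) ^ P.natDegree) / 2))
    (h : 4 ^ 6 * (sixBitConst : ℝ) * (q : ℝ) ^ 12 ≤ (q : ℝ) ^ (2 * n) * π ^ 6) :
    HasTwoTwo Fq F q n := by
  have hq : 1 < q := hcard ▸ Fintype.one_lt_card
  have hq3 : 3 ≤ q := by obtain ⟨m, rfl⟩ := hodd; omega
  have hM : ∑ i ∈ Finset.range n, q ^ i ≠ 0 :=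
    (Finset.sum_pos (fun i _ => pow_pos (by omega) i) ⟨0, Finset.mem_range.2 (by omega)⟩).ne'
  obtain ⟨t, hP, ht⟩ := exists_primeBound_six hM
  have hMq : ∑ i ∈ Finset.range n, q ^ i ≤ q ^ n := by
    have h1 := two_mul_geom_le hq3 (n - 1)
    rw [show n - 1 + 1 = n by omega] at h1
    have h2 : 3 * q ^ (n - 1) ≤ q ^ n := by
      conv_rhs => rw [show n = (n - 1) + 1 by omega, pow_succ, mul_comm]
      exact Nat.mul_le_mul_right _ hq3
    omega
  refine hasTwoTwo_of_core hcard hn hn5 hodd hf hfn hfd (pow_sub_one_eq_geom_mul hq n) hP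
    zero_lt_one hπ ?_
  have hq0 : (0 : ℝ) < q := by exact_mod_cast (by omega : 0 < q)
  have h2 : (coreWeight n t : ℝ) ≤ 4 * 2 ^ t := by exact_mod_cast coreWeight_le n t
  have ht' : (2 : ℝ) ^ (6 * t) ≤ sixBitConst * (q : ℝ) ^ n := by
    exact_mod_cast ht.trans (Nat.mul_le_mul_left _ hMq)
  have h3 : (4 * 2 ^ t : ℝ) ≤ √((q : ℝ) ^ (n - 4)) * π := by
    rw [← pow_le_pow_iff_left₀ (by positivity) (by positivity) (by norm_num : (6 : ℕ) ≠ 0),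
      ← mul_le_mul_iff_left₀ (by positivity : (0 : ℝ) < (q : ℝ) ^ 12)]
    have h4 : √((q : ℝ) ^ (n - 4)) ^ 6 = (q : ℝ) ^ (3 * (n - 4)) := by
      rw [show 6 = 2 * 3 by norm_num, pow_mul, Real.sq_sqrt (by positivity), ← pow_mul, mul_comm]
    calc (4 * 2 ^ t : ℝ) ^ 6 * (q : ℝ) ^ 12 = 4 ^ 6 * 2 ^ (6 * t) * (q : ℝ) ^ 12 := by
          rw [mul_pow, ← pow_mul, mul_comm t]
      _ ≤ 4 ^ 6 * (sixBitConst * (q : ℝ) ^ n) * (q : ℝ) ^ 12 := by gcongr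
      _ = (4 ^ 6 * (sixBitConst : ℝ) * (q : ℝ) ^ 12) * (q : ℝ) ^ n := by ring
      _ ≤ ((q : ℝ) ^ (2 * n) * π ^ 6) * (q : ℝ) ^ n := by gcongr
      _ = (q : ℝ) ^ (3 * (n - 4) + 12) * π ^ 6 := by
          rw [show 3 * (n - 4) + 12 = 2 * n + n by omega, pow_add]; ring
      _ = (√((q : ℝ) ^ (n - 4)) * π) ^ 6 * (q : ℝ) ^ 12 := by rw [mul_pow, h4, pow_add]; ring
  norm_num
  linarith

/-- Lower bound for the density of the factors from their number. -/
lemma pow_le_prod_monicFactors {f : Fq[X]} (hf : f ≠ 0) (hq : 1 < q) {y : ℝ} (hy0 : 0 ≤ y)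
    (hy : y ≤ (1 - 1 / q) / 2) {m : ℕ} (hm : (monicFactors f).card ≤ m) :
    y ^ m ≤ ∏ P ∈ monicFactors f, ((1 - 1 / (q : ℝ) ^ P.natDegree) / 2) := by
  have hq' : (1 : ℝ) < q := by exact_mod_cast hq
  have hy1 : y ≤ 1 := by
    have : 0 ≤ 1 / (q : ℝ) := by positivity
    linarith
  calc y ^ m ≤ y ^ (monicFactors f).card := pow_le_pow_of_le_one hy0 hy1 hm
    _ = ∏ P ∈ monicFactors f, y := (Finset.prod_const _).symm
    _ ≤ _ := Finset.prod_le_prod (fun _ _ => hy0) fun P hP => hy.trans (by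
      have : 1 / (q : ℝ) ^ P.natDegree ≤ 1 / (q : ℝ) ^ 1 :=
        one_div_le_one_div_of_le (by positivity)
          (pow_le_pow_right₀ hq'.le (one_le_natDegree_of_mem_monicFactors hf hP))
      rw [pow_one] at this
      linarith)

lemma hasTwoTwo_of_seventeen_le (hcard : Fintype.card Fq = q) (hn : Module.finrank Fq F = n)
    (hodd : Odd q) (hgcd : Nat.gcd (q ^ 3 - q) n ≠ 1)
    (h : 17 ≤ q ∧ 60 ≤ n ∨ 29 ≤ q ∧ 29 ≤ n) : HasTwoTwo Fq F q n := by
  have hq1 : 1 < q := by omega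
  obtain ⟨f, hf, hfn, hfd, -⟩ := exists_factor_data hcard (by omega) hodd hgcd
  have hq17 : (17 : ℝ) ≤ q := by exact_mod_cast (by omega : 17 ≤ q)
  have hy : (8 / 17 : ℝ) ≤ (1 - 1 / q) / 2 := by
    have : 1 / (q : ℝ) ≤ 1 / 17 := one_div_le_one_div_of_le (by norm_num) hq17
    linarith
  refine hasTwoTwo_of_density hcard hn (by omega) hodd hf hfn hfd (by positivity)
    (pow_le_prod_monicFactors hf.ne_zero hq1 (by norm_num) hy
      (hfd ▸ card_monicFactors_le hf.ne_zero)) ?_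
  obtain ⟨m, rfl⟩ : ∃ m, n = m + 6 := ⟨n - 6, by omega⟩
  have key : 4 ^ 6 * (sixBitConst : ℝ) ≤ ((q : ℝ) ^ 2 * (8 / 17) ^ 6) ^ m * (8 / 17) ^ 24 := by
    have aux : ∀ (a : ℕ) (b : ℕ), 17 ≤ a → a ≤ q → b ≤ m →
        ((a : ℝ) ^ 2 * (8 / 17) ^ 6) ^ b ≤ ((q : ℝ) ^ 2 * (8 / 17) ^ 6) ^ m := fun a b h1 h2 h3 => by
      have h2' : (a : ℝ) ≤ q := by exact_mod_cast h2
      have h4 : (1 : ℝ) ≤ (q : ℝ) ^ 2 * (8 / 17) ^ 6 := by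
        have : (17 : ℝ) ^ 2 ≤ (q : ℝ) ^ 2 := by gcongr
        norm_num at this ⊢
        linarith
      refine le_trans ?_ (pow_le_pow_right₀ h4 h3)
      gcongr
    rcases h with ⟨h1, h2⟩ | ⟨h1, h2⟩
    · refine le_trans ?_ (mul_le_mul_of_nonneg_right (aux 17 54 le_rfl h1 (by omega)) (by positivity))
      norm_num [sixBitConst]
    · refine le_trans ?_ (mul_le_mul_of_nonneg_right (aux 29 23 (by norm_num) h1 (by omega))
        (by positivity))
      norm_num [sixBitConst]
  calc 4 ^ 6 * (sixBitConst : ℝ) * (q : ℝ) ^ 12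
      ≤ (((q : ℝ) ^ 2 * (8 / 17) ^ 6) ^ m * (8 / 17) ^ 24) * (q : ℝ) ^ 12 := by gcongr
    _ = (q : ℝ) ^ (2 * (m + 6)) * ((8 / 17) ^ (m + 6 - 2)) ^ 6 := by
      rw [show m + 6 - 2 = m + 4 by omega, mul_pow, ← pow_mul, ← pow_mul, ← pow_mul,
        show 2 * (m + 6) = 2 * m + 12 by ring, show (m + 4) * 6 = 6 * m + 24 by ring, pow_add,
        pow_add]
      ring

/-- Few factors of `f` are linear. -/
lemma two_mul_card_monicFactors_le {f : Fq[X]} (hf : f ≠ 0) {a b c : ℕ}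
    (h : FactorBound f (a, b, c)) : 2 * (monicFactors f).card ≤ f.natDegree + a := by
  have h1 := sum_natDegree_monicFactors_le hf
  have h2 : ∑ P ∈ monicFactors f, 2 ≤
      ∑ P ∈ monicFactors f, (P.natDegree + if P.natDegree = 1 then 1 else 0) := by
    refine Finset.sum_le_sum fun P hP => ?_
    have := one_le_natDegree_of_mem_monicFactors hf hP
    split_ifs <;> omega
  rw [Finset.sum_add_distrib, ← Finset.card_filter, Finset.sum_const, smul_eq_mul] at h2
  have := h.one
  dsimp only at this
  omega

lemma factorCounts_one_le (hq : 1 < q) (n : ℕ) : (factorCounts q n).1 ≤ q - 1 := by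
  have : n.gcd (q - 1) ≤ q - 1 := Nat.gcd_le_right _ (by omega)
  unfold factorCounts
  split_ifs <;> dsimp only <;> omega

lemma hasTwoTwo_of_five_le (hcard : Fintype.card Fq = q) (hn : Module.finrank Fq F = n)
    (hodd : Odd q) (hgcd : Nat.gcd (q ^ 3 - q) n ≠ 1) (hq5 : 5 ≤ q) (hq15 : q ≤ 15)
    (hn60 : 60 ≤ n) (h : q = 5 → 120 ≤ n) : HasTwoTwo Fq F q n := by
  have hq1 : 1 < q := by omega
  obtain ⟨f, hf, hfn, hfd, hfb⟩ := exists_factor_data hcard (by omega) hodd hgcd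
  have hc := two_mul_card_monicFactors_le hf.ne_zero (a := (factorCounts q n).1) hfb
  have hc' := factorCounts_one_le hq1 n
  have hy0 : (0 : ℝ) ≤ (1 - 1 / q) / 2 := by
    have : 1 / (q : ℝ) ≤ 1 := by rw [div_le_one (by positivity)]; exact_mod_cast hq1.le
    linarith
  have hy1 : (1 - 1 / (q : ℝ)) / 2 ≤ 1 := by
    have : 0 ≤ 1 / (q : ℝ) := by positivity
    linarith
  refine hasTwoTwo_of_density hcard hn (by omega) hodd hf hfn hfd (pow_nonneg hy0 _)
    (pow_le_prod_monicFactors hf.ne_zero hq1 hy0 le_rfl le_rfl) ?_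
  set y := (1 - 1 / (q : ℝ)) / 2 with hy
  have h1 : (y ^ 3) ^ (n + (q - 3)) ≤ (y ^ (monicFactors f).card) ^ 6 := by
    rw [← pow_mul, ← pow_mul]
    exact pow_le_pow_of_le_one hy0 hy1 (by omega)
  refine le_trans ?_ (mul_le_mul_of_nonneg_left h1 (by positivity))
  rw [pow_mul, pow_add, ← mul_assoc, ← mul_pow]
  have aux : ∀ b : ℕ, b ≤ n → 1 ≤ (q : ℝ) ^ 2 * y ^ 3 →
      4 ^ 6 * (sixBitConst : ℝ) * (q : ℝ) ^ 12 ≤ ((q : ℝ) ^ 2 * y ^ 3) ^ b * (y ^ 3) ^ (q - 3) →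
      4 ^ 6 * (sixBitConst : ℝ) * (q : ℝ) ^ 12 ≤ ((q : ℝ) ^ 2 * y ^ 3) ^ n * (y ^ 3) ^ (q - 3) :=
    fun b hb h2 h3 => h3.trans (mul_le_mul_of_nonneg_right (pow_le_pow_right₀ h2 hb) (by positivity))
  have h7 : q = 5 ∨ q = 7 ∨ q = 9 ∨ q = 11 ∨ q = 13 ∨ q = 15 := by
    obtain ⟨m, rfl⟩ := hodd; omega
  clear_value y
  rcases h7 with h7 | h7 | h7 | h7 | h7 | h7
  · exact aux 120 (h h7) (by subst h7 hy; norm_num) (by subst h7 hy; norm_num [sixBitConst])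
  all_goals exact aux 60 hn60 (by subst h7 hy; norm_num) (by subst h7 hy; norm_num [sixBitConst])

lemma hasTwoTwo_three (hcard : Fintype.card Fq = 3) (hn : Module.finrank Fq F = n)
    (hgcd : Nat.gcd (3 ^ 3 - 3) n ≠ 1) (hn96 : 96 ≤ n) : HasTwoTwo Fq F 3 n := by
  obtain ⟨f, hf, hfn, hfd, hfb⟩ := exists_factor_data hcard (by omega) (by decide) hgcd
  have hfb' : FactorBound f (2, 3, n / 3) := by
    have h1 : n.gcd (3 - 1) ∣ 2 := Nat.gcd_dvd_right _ _
    have h2 : n.gcd (3 ^ 2 - 1) ≤ 8 := Nat.gcd_le_right _ (by norm_num)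
    have h3 : n.gcd (3 - 1) ≤ 2 := Nat.le_of_dvd (by norm_num) h1
    have h4 : 0 < n.gcd (3 - 1) := Nat.gcd_pos_of_pos_right _ (by norm_num)
    have h5 : n.gcd (3 - 1) = 1 → n.gcd (3 ^ 2 - 1) ≤ 7 := fun h => by
      by_contra h6
      have h7 : n.gcd (3 ^ 2 - 1) = 8 := by omega
      have h8 : 8 ∣ n := h7 ▸ Nat.gcd_dvd_left _ _
      rw [Nat.gcd_eq_right (by omega)] at h
      omega
    have h6 : n / n.gcd (3 ^ n) ≤ n := Nat.div_le_self _ _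
    obtain ⟨k1, k2, k3⟩ := hfb
    unfold factorCounts at k1 k2 k3
    refine ⟨k1.trans ?_, k2.trans ?_, k3.trans ?_⟩ <;> split_ifs <;> dsimp only <;> omega
  refine hasTwoTwo_of_density hcard hn (by omega) (by decide) hf hfn hfd ?_
    (hfb'.le_prod hf.ne_zero (by norm_num)) ?_
  · norm_num
  norm_num [sixBitConst]
  have h1 : ((13 / 27 : ℝ) ^ 2) ^ n ≤ ((13 / 27 : ℝ) ^ (n / 3)) ^ 6 := by
    rw [← pow_mul, ← pow_mul]
    exact pow_le_pow_of_le_one (by norm_num) (by norm_num) (by omega)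
  have h2 : (((3 : ℝ) ^ 2) * (13 / 27) ^ 2) ^ 96 ≤ (((3 : ℝ) ^ 2) * (13 / 27) ^ 2) ^ n :=
    pow_le_pow_right₀ (by norm_num) hn96
  rw [mul_pow _ _ n] at h2
  have h3 := mul_le_mul_of_nonneg_left h1 (by positivity : (0 : ℝ) ≤ (3 ^ 2) ^ n)
  have h4 := h2.trans h3
  rw [mul_pow, mul_pow, pow_mul]
  norm_num at h4 ⊢
  linarith

lemma hasTwoTwo_of_gt_of_le (hcard : Fintype.card Fq = q) (hn : Module.finrank Fq F = n)
    (hn9 : 9 ≤ n) (hodd : Odd q) (hgcd : Nat.gcd (q ^ 3 - q) n ≠ 1) {Q : ℕ} (hnQ : n < Q)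
    (hQ : Q ≤ q) (h : 3 * 4 ^ 6 * sixBitConst * (n - 1) ^ 6 ≤
      2 * Q ^ (2 * n - 17) * (Q - (n - 2)) ^ 6) : HasTwoTwo Fq F q n := by
  refine hasTwoTwo_of_gt hcard hn (by omega) hodd hgcd (by omega) ?_
  calc 3 * 4 ^ 6 * sixBitConst * (n - 1) ^ 6 * q ^ (n + 5)
      ≤ 2 * Q ^ (2 * n - 17) * (Q - (n - 2)) ^ 6 * q ^ (n + 5) := by gcongr
    _ ≤ 2 * q ^ (2 * n - 17) * (q - (n - 2)) ^ 6 * q ^ (n + 5) := by gcongr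
    _ = 2 * q ^ (3 * (n - 4)) * (q - (n - 2)) ^ 6 := by
      rw [show 3 * (n - 4) = (2 * n - 17) + (n + 5) by omega, pow_add _ (2 * n - 17)]; ring

lemma hasTwoTwo_eight_of_large (hcard : Fintype.card Fq = q) (hn : Module.finrank Fq F = 8)
    (hodd : Odd q) (hgcd : Nat.gcd (q ^ 3 - q) 8 ≠ 1) (hq : 2301 ≤ q) : HasTwoTwo Fq F q 8 := by
  refine hasTwoTwo_of_gt hcard hn le_rfl hodd hgcd (by omega) ?_
  obtain ⟨r, rfl⟩ : ∃ r, q = r + 6 := ⟨q - 6, by omega⟩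
  have h1 : 2295 ^ 5 ≤ r ^ 5 := Nat.pow_le_pow_left (by omega) 5
  have h2 : 3 * 4 ^ 6 * sixBitConst * 7 ^ 6 * (r + 6) ≤ 2 * 2295 ^ 5 * r := by
    norm_num [sixBitConst]; omega
  calc 3 * 4 ^ 6 * sixBitConst * (8 - 1) ^ 6 * (r + 6) ^ (8 + 5)
      = (3 * 4 ^ 6 * sixBitConst * 7 ^ 6 * (r + 6)) * (r + 6) ^ 12 := by ring
    _ ≤ (2 * 2295 ^ 5 * r) * (r + 6) ^ 12 := Nat.mul_le_mul_right _ h2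
    _ ≤ (2 * r ^ 5 * r) * (r + 6) ^ 12 := by gcongr
    _ = 2 * (r + 6) ^ (3 * (8 - 4)) * (r + 6 - (8 - 2)) ^ 6 := by
      rw [show r + 6 - (8 - 2) = r by omega]; ring

lemma hasTwoTwo_of_sixteen_le (hcard : Fintype.card Fq = q) (hn : Module.finrank Fq F = n)
    (hn16 : 16 ≤ n) (hodd : Odd q) (hgcd : Nat.gcd (q ^ 3 - q) n ≠ 1) (hnq : n < q) :
    HasTwoTwo Fq F q n := by
  refine hasTwoTwo_of_gt_of_le hcard hn (by omega) hodd hgcd hnq le_rfl ?_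
  have h1 : 3 * 4 ^ 6 * sixBitConst ≤ 2 * 17 ^ 9 * 3 ^ 6 := by norm_num [sixBitConst]
  have h2 : n - 1 ≤ q := by omega
  have h3 : 17 ≤ q := by omega
  have h4 : 3 ≤ q - (n - 2) := by omega
  calc 3 * 4 ^ 6 * sixBitConst * (n - 1) ^ 6 ≤ (2 * 17 ^ 9 * 3 ^ 6) * q ^ 6 :=
        Nat.mul_le_mul h1 (Nat.pow_le_pow_left h2 6)
    _ ≤ (2 * q ^ 9 * 3 ^ 6) * q ^ 6 := by gcongr
    _ = 2 * q ^ 15 * 3 ^ 6 := by ring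
    _ ≤ 2 * q ^ (2 * n - 17) * (q - (n - 2)) ^ 6 := by
        gcongr <;> omega

end Core

section Assembly

/-- The pairs `(q, n)` with `5 ≤ n` which are not settled by a sieve. -/
def generalExceptions : List (ℕ × ℕ) :=
  [(5, 5), (11, 5), (31, 5), (3, 6), (5, 6), (7, 6), (9, 6), (11, 6), (13, 6), (17, 6), (19, 6),
    (23, 6), (25, 6), (27, 6), (29, 6), (31, 6), (37, 6), (41, 6), (43, 6), (47, 6), (49, 6),
    (59, 6), (61, 6), (67, 6), (73, 6), (79, 6), (89, 6), (101, 6), (103, 6), (109, 6), (121, 6),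
    (139, 6), (3, 8), (5, 8), (9, 8), (3, 12)]

/-- The `q` which are not settled by a sieve in degree four. -/
def fourExceptions : List ℕ :=
  [5, 9, 13, 17, 29, 37, 41, 53, 73, 89, 109, 113, 125, 137, 149, 173, 197, 233, 293, 317, 353, 389,
    509, 593, 797, 857, 1217, 2309]

lemma allSteps_odd {test : ℕ → Bool} {e q : ℕ} (h : allSteps test 2 e 3 = true) (hodd : Odd q)
    (h3 : 3 ≤ q) (hq : q < 3 + 2 * e) : test q = true := by
  obtain ⟨m, rfl⟩ := hodd
  have := allSteps_spec h (m - 1) (by omega)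
  rwa [show 3 + (m - 1) * 2 = 2 * m + 1 by omega] at this

variable {Fq F : Type*} [Field Fq] [Field F] [Fintype Fq] [Fintype F] [Algebra Fq F] {q n : ℕ}

lemma hasTwoTwo_of_allSteps {e : ℕ}
    (h : allSteps (checkGeneral generalExceptions n) 2 e 3 = true) (hq : q < 3 + 2 * e)
    (he : e ≤ 10 ^ 6) (hqp : IsPrimePow q)
    (hcard : Fintype.card Fq = q) (hn : Module.finrank Fq F = n) (hn5 : 5 ≤ n) (hodd : Odd q)
    (hgcd : Nat.gcd (q ^ 3 - q) n ≠ 1) : HasTwoTwo Fq F q n ∨ (q, n) ∈ generalExceptions := by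
  have hq1 : 1 < q := hcard ▸ Fintype.one_lt_card
  have hq3 : 3 ≤ q := by obtain ⟨m, rfl⟩ := hodd; omega
  exact hasTwoTwo_of_checkGeneral hqp (hq.trans (by norm_num; omega)) hcard hn hn5 hodd hgcd
    (allSteps_odd h hodd hq3 hq)

lemma hasTwoTwo_of_tierChain {P : List ℕ} {Q : ℕ} {L : List (ℕ × ℕ × ℕ × ℕ)}
    (h : tierChain (tierGeneral P n) Q L = true) (hQ : 1 ≤ Q)
    (hcard : Fintype.card Fq = q) (hn : Module.finrank Fq F = n) (hn5 : 5 ≤ n) (hodd : Odd q)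
    (hgcd : Nat.gcd (q ^ 3 - q) n ≠ 1)
    (hP : ∀ l ∈ oddPrimes (∑ i ∈ Finset.range n, q ^ i), l < 256 → l ∈ P) (hPnd : P.Nodup)
    (hPpos : ∀ p ∈ P, 0 < p) (h0 : Q ≤ q) (h1 : q < Q * (L.map Prod.fst).prod) :
    HasTwoTwo Fq F q n := by
  obtain ⟨Q₀, Q₁, k, a, s, h2, h3, h4, h5⟩ := tierChain_spec h h0 h1
  exact hasTwoTwo_of_tierGeneral hcard hn hn5 hodd hgcd hP hPnd hPpos (hQ.trans h5) h3 h4 h2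

lemma mem_oddPrimeList_of_mem_oddPrimes {M : ℕ} (hM : M ≠ 0) :
    ∀ l ∈ oddPrimes M, l < 256 → l ∈ oddPrimeList := fun l hl h => by
  obtain ⟨h1, h2, -⟩ := (mem_oddPrimes hM).1 hl
  exact mem_oddPrimeList h1 h2 h

lemma geom_ne_zero (hn : n ≠ 0) : ∑ i ∈ Finset.range n, q ^ i ≠ 0 := by
  obtain ⟨m, rfl⟩ := Nat.exists_eq_succ_of_ne_zero hn
  rw [Finset.sum_range_succ', pow_zero]
  omega

lemma hasTwoTwo_five (hqp : IsPrimePow q) (hcard : Fintype.card Fq = q)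
    (hn : Module.finrank Fq F = 5) (hodd : Odd q) (hgcd : Nat.gcd (q ^ 3 - q) 5 ≠ 1) :
    HasTwoTwo Fq F q 5 ∨ (q, 5) ∈ generalExceptions := by
  rcases lt_or_ge q 400 with hq | hq
  · exact hasTwoTwo_of_allSteps (e := 199) (by decide +kernel) (by omega) (by norm_num) hqp hcard hn
      le_rfl hodd hgcd
  left
  rcases lt_or_ge q (400 * 64 ^ 15) with hq' | hq'
  · refine hasTwoTwo_of_tierChain (Q := 400)
      (P := oddPrimeList.filter fun l => l == 5 || l % 10 == 1)
      (L := [(64, 0, 100, 10), (64, 0, 100, 14), (64, 0, 100, 17), (64, 0, 100, 21), (64, 0, 100, 25),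
        (64, 0, 100, 28), (64, 0, 100, 32), (64, 0, 100, 35), (64, 0, 100, 39), (64, 0, 100, 43),
        (64, 0, 100, 46), (64, 0, 100, 50), (64, 0, 100, 53), (64, 0, 100, 57), (64, 0, 100, 61)])
      (by decide +kernel) (by norm_num) hcard hn le_rfl hodd hgcd (fun l hl h => ?_)
      (by decide +kernel) (by decide +kernel) hq (hq'.trans_le (by decide +kernel))
    have hM := geom_ne_zero (q := q) (n := 5) (by norm_num)
    obtain ⟨h1, h2, h3⟩ := (mem_oddPrimes hM).1 hl
    rw [List.mem_filter]
    refine ⟨mem_oddPrimeList h1 h2 h, ?_⟩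
    simpa using eq_five_or_mod_ten h1 h2 h3
  · exact hasTwoTwo_five_of_large hcard hn hodd hgcd (le_trans (by decide +kernel) hq')

lemma hasTwoTwo_six (hqp : IsPrimePow q) (hcard : Fintype.card Fq = q)
    (hn : Module.finrank Fq F = 6) (hodd : Odd q) (hgcd : Nat.gcd (q ^ 3 - q) 6 ≠ 1) :
    HasTwoTwo Fq F q 6 ∨ (q, 6) ∈ generalExceptions := by
  rcases lt_or_ge q 1100 with hq | hq
  · exact hasTwoTwo_of_allSteps (e := 549) (by decide +kernel) (by omega) (by norm_num) hqp hcard hn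
      (by norm_num) hodd hgcd
  left
  rcases lt_or_ge q (1100 * (32 * 64 ^ 5)) with hq' | hq'
  · exact hasTwoTwo_of_tierChain (Q := 1100) (P := oddPrimeList)
      (L := [(32, 2, 60, 15), (64, 2, 60, 20), (64, 2, 60, 25), (64, 2, 60, 30), (64, 3, 60, 35),
        (64, 3, 60, 40)])
      (by decide +kernel) (by norm_num) hcard hn (by norm_num) hodd hgcd
      (mem_oddPrimeList_of_mem_oddPrimes (geom_ne_zero (by norm_num)))
      (by decide +kernel) (by decide +kernel) hq (hq'.trans_le (by decide +kernel))
  · exact hasTwoTwo_six_of_large hcard hn hodd hgcd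
      (le_trans (by decide +kernel) (Nat.pow_le_pow_left hq' 3))

lemma hasTwoTwo_seven (hqp : IsPrimePow q) (hcard : Fintype.card Fq = q)
    (hn : Module.finrank Fq F = 7) (hodd : Odd q) (hgcd : Nat.gcd (q ^ 3 - q) 7 ≠ 1) :
    HasTwoTwo Fq F q 7 ∨ (q, 7) ∈ generalExceptions := by
  rcases lt_or_ge q 60 with hq | hq
  · exact hasTwoTwo_of_allSteps (e := 29) (by decide +kernel) (by omega) (by norm_num) hqp hcard hn
      (by norm_num) hodd hgcd
  left
  rcases lt_or_ge q (60 * 64 ^ 2) with hq' | hq'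
  · exact hasTwoTwo_of_tierChain (Q := 60) (P := oddPrimeList)
      (L := [(64, 2, 60, 14), (64, 2, 60, 21)])
      (by decide +kernel) (by norm_num) hcard hn (by norm_num) hodd hgcd
      (mem_oddPrimeList_of_mem_oddPrimes (geom_ne_zero (by norm_num)))
      (by decide +kernel) (by decide +kernel) hq (hq'.trans_le (by decide +kernel))
  · exact hasTwoTwo_seven_of_large hcard hn hodd hgcd
      (le_trans (by decide +kernel) (Nat.pow_le_pow_left hq' 3)) (by omega)

lemma hasTwoTwo_of_le_fifteen (hqp : IsPrimePow q) (hcard : Fintype.card Fq = q)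
    (hn : Module.finrank Fq F = n) (hn8 : 8 ≤ n) (hn15 : n ≤ 15) (hodd : Odd q)
    (hgcd : Nat.gcd (q ^ 3 - q) n ≠ 1) : HasTwoTwo Fq F q n ∨ (q, n) ∈ generalExceptions := by
  rcases eq_or_ne n 8 with rfl | h8
  · rcases lt_or_ge q 2301 with hq | hq
    · exact hasTwoTwo_of_allSteps (e := 1149) (by decide +kernel) hq (by norm_num) hqp hcard
        hn (by norm_num) hodd hgcd
    · exact .inl (hasTwoTwo_eight_of_large hcard hn hodd hgcd hq)
  rcases eq_or_ne n 9 with rfl | h9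
  · rcases lt_or_ge q 401 with hq | hq
    · exact hasTwoTwo_of_allSteps (e := 199) (by decide +kernel) hq (by norm_num) hqp hcard
        hn (by norm_num) hodd hgcd
    · exact .inl (hasTwoTwo_of_gt_of_le hcard hn (by norm_num) hodd hgcd (by norm_num) hq
        (by decide +kernel))
  rcases lt_or_ge q 101 with hq | hq
  · have h : (List.range 6).all (fun i =>
        allSteps (checkGeneral generalExceptions (i + 10)) 2 49 3) = true := by decide +kernel
    rw [List.all_eq_true] at h
    have h1 := h (n - 10) (List.mem_range.2 (by omega))
    rw [show n - 10 + 10 = n by omega] at h1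
    exact hasTwoTwo_of_allSteps h1 (by omega) (by norm_num) hqp hcard hn (by omega) hodd hgcd
  · have h : ∀ n < 16, 10 ≤ n → 3 * 4 ^ 6 * sixBitConst * (n - 1) ^ 6 ≤
        2 * 101 ^ (2 * n - 17) * (101 - (n - 2)) ^ 6 := by decide +kernel
    exact .inl (hasTwoTwo_of_gt_of_le hcard hn (by omega) hodd hgcd (by omega) hq
      (h n (by omega) (by omega)))

lemma hasTwoTwo_of_sixteen_le_lt (hqp : IsPrimePow q) (hcard : Fintype.card Fq = q)
    (hn : Module.finrank Fq F = n) (hn16 : 16 ≤ n) (hn60 : n < 60) (hodd : Odd q)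
    (hgcd : Nat.gcd (q ^ 3 - q) n ≠ 1) : HasTwoTwo Fq F q n ∨ (q, n) ∈ generalExceptions := by
  rcases lt_or_ge n q with hq | hq
  · exact .inl (hasTwoTwo_of_sixteen_le hcard hn hn16 hodd hgcd hq)
  rcases lt_or_ge q 29 with hq' | hq'
  · have h : (List.range 44).all (fun i =>
        allSteps (checkGeneral generalExceptions (i + 16)) 2 13 3) = true := by decide +kernel
    rw [List.all_eq_true] at h
    have h1 := h (n - 16) (List.mem_range.2 (by omega))
    rw [show n - 16 + 16 = n by omega] at h1
    exact hasTwoTwo_of_allSteps h1 (by omega) (by norm_num) hqp hcard hn (by omega) hodd hgcd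
  · exact .inl (hasTwoTwo_of_seventeen_le hcard hn hodd hgcd (.inr ⟨hq', by omega⟩))

lemma hasTwoTwo_of_sixty_le (hqp : IsPrimePow q) (hcard : Fintype.card Fq = q)
    (hn : Module.finrank Fq F = n) (hn60 : 60 ≤ n) (hodd : Odd q)
    (hgcd : Nat.gcd (q ^ 3 - q) n ≠ 1) : HasTwoTwo Fq F q n ∨ (q, n) ∈ generalExceptions := by
  have hq1 : 1 < q := hcard ▸ Fintype.one_lt_card
  rcases le_or_gt 17 q with hq | hq
  · exact .inl (hasTwoTwo_of_seventeen_le hcard hn hodd hgcd (.inl ⟨hq, hn60⟩))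
  have hm : q = 3 ∨ 5 ≤ q ∧ q ≤ 15 := by obtain ⟨m, rfl⟩ := hodd; omega
  rcases hm with rfl | ⟨h5, h15⟩
  · rcases lt_or_ge n 96 with h | h
    · have h1 : (List.range 36).all (fun i => checkGeneral generalExceptions (i + 60) 3) = true := by
        decide +kernel
      rw [List.all_eq_true] at h1
      have h2 := h1 (n - 60) (List.mem_range.2 (by omega))
      rw [show n - 60 + 60 = n by omega] at h2
      exact hasTwoTwo_of_checkGeneral hqp (by norm_num) hcard hn (by omega) hodd hgcd h2
    · exact .inl (hasTwoTwo_three hcard hn hgcd h)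
  rcases eq_or_ne q 5 with rfl | hq5
  · rcases lt_or_ge n 120 with h | h
    · have h1 : (List.range 60).all (fun i => checkGeneral generalExceptions (i + 60) 5) = true := by
        decide +kernel
      rw [List.all_eq_true] at h1
      have h2 := h1 (n - 60) (List.mem_range.2 (by omega))
      rw [show n - 60 + 60 = n by omega] at h2
      exact hasTwoTwo_of_checkGeneral hqp (by norm_num) hcard hn (by omega) hodd hgcd h2
    · exact .inl (hasTwoTwo_of_five_le hcard hn hodd hgcd h5 h15 hn60 fun _ => h)
  · exact .inl (hasTwoTwo_of_five_le hcard hn hodd hgcd h5 h15 hn60 fun h => absurd h hq5)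

lemma hasTwoTwo_or_mem_generalExceptions (hqp : IsPrimePow q) (hcard : Fintype.card Fq = q)
    (hn : Module.finrank Fq F = n) (hn5 : 5 ≤ n) (hodd : Odd q)
    (hgcd : Nat.gcd (q ^ 3 - q) n ≠ 1) : HasTwoTwo Fq F q n ∨ (q, n) ∈ generalExceptions := by
  rcases lt_or_ge n 8 with h8 | h8
  · have hm : n = 5 ∨ n = 6 ∨ n = 7 := by omega
    rcases hm with rfl | rfl | rfl
    · exact hasTwoTwo_five hqp hcard hn hodd hgcd
    · exact hasTwoTwo_six hqp hcard hn hodd hgcd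
    · exact hasTwoTwo_seven hqp hcard hn hodd hgcd
  rcases lt_or_ge n 16 with h16 | h16
  · exact hasTwoTwo_of_le_fifteen hqp hcard hn h8 (by omega) hodd hgcd
  rcases lt_or_ge n 60 with h60 | h60
  · exact hasTwoTwo_of_sixteen_le_lt hqp hcard hn h16 h60 hodd hgcd
  · exact hasTwoTwo_of_sixty_le hqp hcard hn h60 hodd hgcd

lemma hasTwoTwo_four_or_mem_fourExceptions (hqp : IsPrimePow q) (hcard : Fintype.card Fq = q)
    (hn : Module.finrank Fq F = 4) (hq4 : q % 4 = 1) :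
    HasTwoTwo Fq F q 4 ∨ q ∈ fourExceptions := by
  have hq1 : 1 < q := hcard ▸ Fintype.one_lt_card
  rcases lt_or_ge q 60005 with hq | hq
  · have h : (List.range 15).all (fun j =>
        allSteps (checkFour fourExceptions) 4 1000 (5 + 4000 * j)) = true := by decide +kernel
    rw [List.all_eq_true] at h
    have h1 := h ((q - 5) / 4000) (List.mem_range.2 (by omega))
    have h2 := allSteps_spec h1 ((q - 5) % 4000 / 4) (by omega)
    rw [show 5 + 4000 * ((q - 5) / 4000) + (q - 5) % 4000 / 4 * 4 = q by omega] at h2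
    exact hasTwoTwo_of_checkFour hqp (hq.trans (by norm_num)) hcard hn hq4 h2
  left
  rcases lt_or_ge q (60000 * (8 * 64 ^ 15)) with hq' | hq'
  · have hT : tierChain (tierFour oddPrimeList) 60000 [(8, 1, 37, 12), (64, 3, 37, 15),
        (64, 3, 37, 18), (64, 3, 37, 22), (64, 3, 37, 25), (64, 3, 37, 29), (64, 3, 60, 29),
        (64, 3, 60, 32), (64, 3, 60, 35), (64, 3, 60, 39), (64, 3, 120, 38), (64, 3, 120, 41),
        (64, 3, 120, 43), (64, 3, 120, 46), (64, 3, 120, 49), (64, 3, 120, 51)] = true := by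
      decide +kernel
    obtain ⟨Q₀, Q₁, k, a, s, h2, h3, h4, h5⟩ :=
      tierChain_spec hT (by omega) (hq'.trans_le (by decide +kernel))
    exact hasTwoTwo_of_tierFour hcard hn hq4 (mem_oddPrimeList_of_mem_oddPrimes (by omega))
      (by decide +kernel) (by decide +kernel) (by omega) h3 h4 h2
  · exact hasTwoTwo_four_of_large hcard hn hq4 (le_trans (by decide +kernel) hq')

end Assembly

section PackedArithmetic

/-- Continuation-passing evaluation of a number. -/
def forceNat {β : Sort*} (x : ℕ) (k : ℕ → β) : β :=
  Nat.rec (k 0) (fun d _ => k d.succ) x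

lemma forceNat_eq {β : Sort*} (x : ℕ) (k : ℕ → β) : forceNat x k = k x := by
  cases x <;> rfl

/-- The combination of the entries of a table whose coefficients are the base `B` digits of the
second argument, added to the third argument. -/
def foldTable (B : ℕ) : List ℕ → ℕ → ℕ → ℕ
  | [], _, acc => acc
  | t :: T, m, acc => foldTable B T (Nat.div m B) (Nat.add acc (Nat.mul (Nat.mod m B) t))

/-- Reduction modulo `p` of the first base `B` digits. -/
def modDigits (B p : ℕ) : ℕ → ℕ → ℕ
  | 0, _ => 0
  | k + 1, m => Nat.add (Nat.mod (Nat.mod m B) p) (Nat.mul B (modDigits B p k (Nat.div m B)))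

/-- The number with the given base `B` digits. -/
def packList (B : ℕ) : List ℕ → ℕ
  | [] => 0
  | c :: l => c + B * packList B l

/-- Evaluation of a list of coefficients. -/
def listEval {R : Type*} [CommRing R] (θ : R) : List ℕ → R
  | [] => 0
  | c :: a => c + θ * listEval θ a

/-- The powers of `B` starting from the first argument, followed by `s`. -/
def basisTable (B s : ℕ) : ℕ → ℕ → List ℕ
  | 0, _ => [s]
  | k + 1, t => t :: basisTable B s k (t * B)

/-- Reduction with respect to a table. -/
def reduceBy (B p N : ℕ) (T : List ℕ) (m : ℕ) : ℕ := modDigits B p N (foldTable B T m 0)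

/-- The reductions of the successive multiples of `t` by powers of the variable. -/
def powerTable (B p N : ℕ) (T : List ℕ) : ℕ → ℕ → List ℕ
  | 0, _ => []
  | k + 1, t => forceNat t fun t => t :: powerTable B p N T k (reduceBy B p N T (t * B))

/-- Powers by repeated squaring. -/
def packPowAux (B p N : ℕ) (T : List ℕ) (a : ℕ) : ℕ → ℕ → ℕ
  | 0, _ => 1
  | k + 1, e => forceNat (packPowAux B p N T a k (Nat.div e 2)) fun h =>
      forceNat (reduceBy B p N T (Nat.mul h h)) fun s =>
        Nat.rec s (fun _ _ => reduceBy B p N T (Nat.mul a s)) (Nat.mod e 2)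

/-- Powers modulo `p` and a polynomial. -/
def packPow (B p N : ℕ) (T : List ℕ) (a e : ℕ) : ℕ := packPowAux B p N T a (Nat.log2 e + 1) e

/-- Subtraction of one. -/
def packPred (B p N a : ℕ) : ℕ := modDigits B p N (Nat.add a (p - 1))

variable {R : Type*} [CommRing R]

/-- `a` is the value at `B` and `v` the value at `θ` of a common polynomial, of degree less than
`D`, with natural coefficients of sum at most `S`. -/
def Represents (B : ℕ) (θ : R) (S D a : ℕ) (v : R) : Prop :=
  ∃ P : ℕ[X], P.eval B = a ∧ P.eval 1 ≤ S ∧ (∀ i, D ≤ i → P.coeff i = 0) ∧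
    P.eval₂ (Nat.castRingHom R) θ = v

variable {B : ℕ} {θ : R} {S S' D D' a b : ℕ} {v w : R}

lemma Represents.mono (h : Represents B θ S D a v) (hS : S ≤ S') (hD : D ≤ D') :
    Represents B θ S' D' a v := by
  obtain ⟨P, h1, h2, h3, h4⟩ := h
  exact ⟨P, h1, h2.trans hS, fun i hi => h3 i (hD.trans hi), h4⟩

lemma Represents.add (h : Represents B θ S D a v) (h' : Represents B θ S' D b w) :
    Represents B θ (S + S') D (a + b) (v + w) := by
  obtain ⟨P, h1, h2, h3, h4⟩ := h
  obtain ⟨Q, k1, k2, k3, k4⟩ := h'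
  refine ⟨P + Q, by rw [eval_add, h1, k1], by rw [eval_add]; omega, fun i hi => ?_, ?_⟩
  · rw [coeff_add, h3 i hi, k3 i hi]
  · rw [eval₂_add, h4, k4]

lemma Represents.mul (h : Represents B θ S (D + 1) a v) (h' : Represents B θ S' (D' + 1) b w) :
    Represents B θ (S * S') (D + D' + 1) (a * b) (v * w) := by
  obtain ⟨P, h1, h2, h3, h4⟩ := h
  obtain ⟨Q, k1, k2, k3, k4⟩ := h'
  refine ⟨P * Q, by rw [eval_mul, h1, k1], by rw [eval_mul]; exact Nat.mul_le_mul h2 k2,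
    fun i hi => ?_, ?_⟩
  · rw [coeff_mul]
    refine Finset.sum_eq_zero fun x hx => ?_
    rw [Finset.HasAntidiagonal.mem_antidiagonal] at hx
    rcases le_or_gt (D + 1) x.1 with hx1 | hx1
    · rw [h3 _ hx1, zero_mul]
    · rw [k3 _ (by omega), mul_zero]
  · rw [eval₂_mul, h4, k4]

lemma represents_natCast (c : ℕ) : Represents B θ c 1 c (c : R) :=
  ⟨C c, by simp, by simp, fun i hi => by rw [coeff_C, if_neg (by omega)], by simp⟩

lemma represents_var : Represents B θ 1 2 B θ :=
  ⟨X, by simp, by simp, fun i hi => by rw [coeff_X, if_neg (by omega)], by simp⟩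

lemma Represents.eq_zero (hB : 0 < B) (h : Represents B θ S D 0 v) : v = 0 := by
  obtain ⟨P, h1, -, -, rfl⟩ := h
  have h0 : P = 0 := by
    ext i
    rw [eval_eq_sum, Polynomial.sum, Finset.sum_eq_zero_iff] at h1
    by_contra hi
    have := h1 i (mem_support_iff.2 hi)
    rcases mul_eq_zero.1 this with h | h
    · exact hi h
    · exact (pow_pos hB i).ne' h
  rw [h0, eval₂_zero]

lemma eval_eq_coeff_zero_add (P : ℕ[X]) (c : ℕ) : P.eval c = P.coeff 0 + c * P.divX.eval c := by
  conv_lhs => rw [← divX_mul_X_add P]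
  simp
  ring

lemma eval₂_eq_coeff_zero_add (P : ℕ[X]) (θ : R) : P.eval₂ (Nat.castRingHom R) θ =
    P.coeff 0 + θ * P.divX.eval₂ (Nat.castRingHom R) θ := by
  conv_lhs => rw [← divX_mul_X_add P]
  simp [eval₂_mul]
  ring

lemma eval_mod_div {P : ℕ[X]} (hP : P.eval 1 < B) :
    P.eval B % B = P.coeff 0 ∧ P.eval B / B = P.divX.eval B := by
  have h := eval_eq_coeff_zero_add P 1
  have h0 : P.coeff 0 < B := by omega
  rw [eval_eq_coeff_zero_add P B]
  exact ⟨by rw [Nat.add_mul_mod_self_left, Nat.mod_eq_of_lt h0],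
    by rw [Nat.add_mul_div_left _ _ (by omega), Nat.div_eq_of_lt h0, zero_add]⟩

variable (B θ S D) in
/-- The entries of the table represent the successive multiples of `c` by powers of `θ`. -/
def RepresentsTable : List ℕ → R → Prop
  | [], _ => True
  | t :: T, c => Represents B θ S D t c ∧ RepresentsTable T (c * θ)

lemma represents_foldTable : ∀ (T : List ℕ) (c : R) (P : ℕ[X]) (acc S' : ℕ) (u : R),
    RepresentsTable B θ S (D + 1) T c → (∀ i, T.length ≤ i → P.coeff i = 0) → P.eval 1 < B →
    Represents B θ S' (D + 1) acc u →
    Represents B θ (S' + P.eval 1 * S) (D + 1) (foldTable B T (P.eval B) acc)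
      (u + c * P.eval₂ (Nat.castRingHom R) θ)
  | [], c, P, acc, S', u, _, hP, _, hacc => by
    have h0 : P = 0 := by ext i; exact hP i (Nat.zero_le _)
    simpa [foldTable, h0] using hacc
  | t :: T, c, P, acc, S', u, hT, hP, hPB, hacc => by
    obtain ⟨h1, h2⟩ := eval_mod_div hPB
    have h3 := eval_eq_coeff_zero_add P 1
    change Represents B θ _ (D + 1) (foldTable B T (P.eval B / B) (acc + P.eval B % B * t)) _
    rw [h1, h2]
    have key := represents_foldTable T (c * θ) P.divX (acc + P.coeff 0 * t)
      (S' + P.coeff 0 * S) (u + (P.coeff 0 : R) * c) hT.2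
      (fun i hi => by rw [coeff_divX]; exact hP _ (by simpa using hi)) (by omega)
      (hacc.add (((represents_natCast (P.coeff 0)).mul (D := 0) hT.1).mono le_rfl (by omega)))
    have e1 : S' + P.eval 1 * S = S' + P.coeff 0 * S + P.divX.eval 1 * S := by rw [h3]; ring
    have e2 : u + c * P.eval₂ (Nat.castRingHom R) θ = u + (P.coeff 0 : R) * c +
        c * θ * P.divX.eval₂ (Nat.castRingHom R) θ := by rw [eval₂_eq_coeff_zero_add]; ring
    rw [e1, e2]
    exact key

lemma natCast_mod_eq {p : ℕ} (hp : (p : R) = 0) (a : ℕ) : ((a % p : ℕ) : R) = a := by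
  conv_rhs => rw [← Nat.mod_add_div a p]
  push_cast
  rw [hp, zero_mul, add_zero]

lemma represents_modDigits {p : ℕ} (hp : (p : R) = 0) (hp1 : 0 < p) : ∀ (k : ℕ) (P : ℕ[X]),
    (∀ i, k ≤ i → P.coeff i = 0) → P.eval 1 < B →
    Represents B θ (k * p) k (modDigits B p k (P.eval B)) (P.eval₂ (Nat.castRingHom R) θ)
  | 0, P, hP, _ => by
    have h0 : P = 0 := by ext i; exact hP i (Nat.zero_le _)
    exact ⟨0, by simp [modDigits], by simp, by simp, by simp [h0]⟩
  | k + 1, P, hP, hPB => by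
    obtain ⟨h1, h2⟩ := eval_mod_div hPB
    have h3 := eval_eq_coeff_zero_add P 1
    change Represents B θ _ _ (P.eval B % B % p + B * modDigits B p k (P.eval B / B)) _
    rw [h1, h2, eval₂_eq_coeff_zero_add]
    obtain ⟨Q, k1, k2, k3, k4⟩ := represents_modDigits hp hp1 k P.divX
      (fun i hi => by rw [coeff_divX]; exact hP _ (by omega)) (by omega)
    have hm : P.coeff 0 % p < p := Nat.mod_lt _ hp1
    refine ⟨C (P.coeff 0 % p) + X * Q, by simp [k1], ?_, fun i hi => ?_, ?_⟩
    · simp only [eval_add, eval_C, eval_mul, eval_X, one_mul, add_mul]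
      omega
    · obtain ⟨j, rfl⟩ : ∃ j, i = j + 1 := ⟨i - 1, by omega⟩
      rw [coeff_add, coeff_C_succ, coeff_X_mul, k3 j (by omega)]
    · simp only [eval₂_add, eval₂_C, eval₂_mul, eval₂_X, k4, Nat.coe_castRingHom,
        natCast_mod_eq hp]

lemma represents_packList {p : ℕ} : ∀ l : List ℕ, (∀ c ∈ l, c < p) →
    Represents B θ (l.length * p) l.length (packList B l) (listEval θ l)
  | [], _ => ⟨0, by simp [packList], by simp, by simp, by simp [listEval]⟩
  | c :: l, h => by
    obtain ⟨Q, k1, k2, k3, k4⟩ := represents_packList l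
      fun d hd => h d (List.mem_cons_of_mem _ hd)
    have hc := h c List.mem_cons_self
    refine ⟨C c + X * Q, by simp [k1, packList], ?_, fun i hi => ?_, by
      simp [k4, listEval, eval₂_mul]⟩
    · simp only [eval_add, eval_C, eval_mul, eval_X, one_mul, add_mul, List.length_cons]
      omega
    · rw [List.length_cons] at hi
      obtain ⟨j, rfl⟩ : ∃ j, i = j + 1 := ⟨i - 1, by omega⟩
      rw [coeff_add, coeff_C_succ, coeff_X_mul, k3 j (by omega)]

variable {p N : ℕ} {T : List ℕ}

lemma represents_reduceBy (hp : (p : R) = 0) (hp1 : 0 < p) (hN : 0 < N)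
    (hT : RepresentsTable B θ (N * p) N T 1) (hB : (N * p) ^ 3 < B) (hS : S ≤ (N * p) ^ 2)
    (h : Represents B θ S T.length a v) :
    Represents B θ (N * p) N (reduceBy B p N T a) v := by
  obtain ⟨P, rfl, h2, h3, rfl⟩ := h
  obtain ⟨M, rfl⟩ : ∃ M, N = M + 1 := ⟨N - 1, by omega⟩
  have hpos : 0 < (M + 1) * p := Nat.mul_pos hN hp1
  have h4 : (P.eval 1) * ((M + 1) * p) < B := lt_of_le_of_lt
    (by rw [pow_succ]; exact Nat.mul_le_mul_right _ (h2.trans hS)) hB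
  have h5 : P.eval 1 < B := lt_of_le_of_lt (Nat.le_mul_of_pos_right _ hpos) h4
  obtain ⟨Q, k1, k2, k3, k4⟩ := represents_foldTable T 1 P 0 0 (0 : R) hT h3 h5
    ⟨0, by simp, by simp, by simp, by simp⟩
  rw [zero_add] at k2
  have := represents_modDigits (θ := θ) hp hp1 (M + 1) Q k3 (lt_of_le_of_lt k2 h4)
  rwa [k1, k4, zero_add, one_mul] at this

lemma representsTable_basisTable {s : ℕ} (hp1 : 0 < p) (hN : 0 < N)
    (hs : Represents B θ (N * p) N s (θ ^ N)) : ∀ k i, i + k = N →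
      RepresentsTable B θ (N * p) N (basisTable B s k (B ^ i)) (θ ^ i)
  | 0, i, h => by
    obtain rfl : i = N := h
    exact ⟨hs, trivial⟩
  | k + 1, i, h => by
    refine ⟨⟨X ^ i, by simp, ?_, fun j hj => ?_, by simp⟩, ?_⟩
    · rw [eval_pow, eval_X, one_pow]
      exact Nat.mul_pos hN hp1
    · rw [coeff_X_pow, if_neg (by omega)]
    · rw [← pow_succ, ← pow_succ]
      exact representsTable_basisTable hp1 hN hs k (i + 1) (by omega)

lemma length_basisTable (s : ℕ) : ∀ k t, (basisTable B s k t).length = k + 1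
  | 0, _ => rfl
  | k + 1, t => by rw [basisTable, List.length_cons, length_basisTable]

lemma length_powerTable : ∀ k t, (powerTable B p N T k t).length = k
  | 0, _ => rfl
  | k + 1, t => by rw [powerTable, forceNat_eq, List.length_cons, length_powerTable]

lemma representsTable_powerTable (hp : (p : R) = 0) (hp1 : 0 < p) (hN : 0 < N)
    (hT : RepresentsTable B θ (N * p) N T 1) (hB : (N * p) ^ 3 < B) (hTl : T.length = N + 1) :
    ∀ k t (c : R), Represents B θ (N * p) N t c →
      RepresentsTable B θ (N * p) N (powerTable B p N T k t) c
  | 0, _, _, _ => trivial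
  | k + 1, t, c, ht => by
    rw [powerTable, forceNat_eq]
    refine ⟨ht, representsTable_powerTable hp hp1 hN hT hB hTl k _ _ ?_⟩
    obtain ⟨M, rfl⟩ : ∃ M, N = M + 1 := ⟨N - 1, by omega⟩
    refine represents_reduceBy hp hp1 hN hT hB ?_ (hTl ▸ ht.mul (D' := 1) represents_var)
    rw [mul_one]
    exact Nat.le_self_pow (by norm_num) _

lemma represents_mul (hp : (p : R) = 0) (hp1 : 0 < p) (hN : 0 < N)
    (hT : RepresentsTable B θ (N * p) N T 1) (hB : (N * p) ^ 3 < B) (hTl : T.length + 1 = 2 * N)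
    (h : Represents B θ (N * p) N a v) (h' : Represents B θ (N * p) N b w) :
    Represents B θ (N * p) N (reduceBy B p N T (a * b)) (v * w) := by
  obtain ⟨M, rfl⟩ : ∃ M, N = M + 1 := ⟨N - 1, by omega⟩
  refine represents_reduceBy hp hp1 hN hT hB (pow_two ((M + 1) * p)).ge ?_
  have hlen : T.length = M + M + 1 := by omega
  rw [hlen]
  exact h.mul h'

lemma represents_pow (hp : (p : R) = 0) (hp1 : 0 < p) (hN : 0 < N)
    (hT : RepresentsTable B θ (N * p) N T 1) (hB : (N * p) ^ 3 < B) (hTl : T.length + 1 = 2 * N)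
    (h : Represents B θ (N * p) N a v) (e : ℕ) :
    Represents B θ (N * p) N (packPow B p N T a e) (v ^ e) := by
  have key : ∀ k e, e < 2 ^ k → Represents B θ (N * p) N (packPowAux B p N T a k e) (v ^ e) := by
    intro k
    induction k with
    | zero =>
      intro e he
      obtain rfl : e = 0 := by omega
      rw [packPowAux, pow_zero]
      have := (represents_natCast (B := B) (θ := θ) 1).mono (Nat.mul_pos hN hp1) hN
      rwa [Nat.cast_one] at this
    | succ k ih =>
      intro e he
      have ih := ih (e / 2) (by omega)
      have hs := represents_mul hp hp1 hN hT hB hTl ih ih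
      rw [packPowAux, forceNat_eq, forceNat_eq]
      change Represents B θ _ _ (Nat.rec (reduceBy B p N T (packPowAux B p N T a k (e / 2) *
        packPowAux B p N T a k (e / 2))) (fun _ _ => reduceBy B p N T (a * reduceBy B p N T
        (packPowAux B p N T a k (e / 2) * packPowAux B p N T a k (e / 2)))) (e % 2)) _
      rw [← pow_add] at hs
      rcases Nat.mod_two_eq_zero_or_one e with h2 | h2
      · rw [h2]
        rw [show e / 2 + e / 2 = e by omega] at hs
        exact hs
      · rw [h2]
        have hm := represents_mul hp hp1 hN hT hB hTl h hs
        rw [← pow_succ', show e / 2 + e / 2 + 1 = e by omega] at hm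
        exact hm
  exact key _ _ Nat.lt_log2_self

lemma represents_modDigits_of_le (hp : (p : R) = 0) (hp1 : 0 < p) (hB : (N * p) ^ 3 < B)
    (hS : S ≤ (N * p) ^ 2) (hN : 0 < N) (h : Represents B θ S N a v) :
    Represents B θ (N * p) N (modDigits B p N a) v := by
  obtain ⟨P, rfl, h2, h3, rfl⟩ := h
  refine represents_modDigits hp hp1 N P h3 (lt_of_le_of_lt (h2.trans (hS.trans ?_)) hB)
  exact Nat.pow_le_pow_right (Nat.mul_pos hN hp1) (by norm_num)

lemma represents_add_pred_mul (hp : (p : R) = 0) (hp1 : 0 < p) (hB : (N * p) ^ 3 < B) (hN : 2 ≤ N)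
    (h : Represents B θ (N * p) N a v) (h' : Represents B θ (N * p) N b w) :
    Represents B θ (N * p) N (modDigits B p N (a + (p - 1) * b)) (v - w) := by
  obtain ⟨M, rfl⟩ : ∃ M, N = M + 1 := ⟨N - 1, by omega⟩
  have := h.add (((represents_natCast (B := B) (θ := θ) (p - 1)).mul (D := 0) h').mono
    (D' := M + 1) le_rfl (by omega))
  rw [Nat.cast_pred hp1, hp] at this
  have h2 := represents_modDigits_of_le hp hp1 hB ?_ (by omega) this
  · rwa [show v + (0 - 1) * w = v - w by ring] at h2
  · calc (M + 1) * p + (p - 1) * ((M + 1) * p) = p * ((M + 1) * p) := by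
          obtain ⟨c, rfl⟩ : ∃ c, p = c + 1 := ⟨p - 1, by omega⟩
          rw [Nat.add_sub_cancel]; ring
      _ ≤ ((M + 1) * p) ^ 2 := by
          rw [pow_two]
          exact Nat.mul_le_mul_right _ (Nat.le_mul_of_pos_left _ (by omega))

lemma represents_pred (hp : (p : R) = 0) (hp1 : 0 < p) (hB : (N * p) ^ 3 < B) (hN : 2 ≤ N)
    (h : Represents B θ (N * p) N a v) :
    Represents B θ (N * p) N (packPred B p N a) (v - 1) := by
  have h1 := (represents_natCast (B := B) (θ := θ) 1).mono (S' := N * p) (D' := N)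
    (Nat.mul_pos (by omega) hp1) (by omega)
  have := represents_add_pred_mul hp hp1 hB hN h h1
  rwa [Nat.cast_one, mul_one] at this

end PackedArithmetic

section Certificate

/-- Continuation-passing evaluation of a list of numbers. -/
def forceList {β : Sort*} : List ℕ → (List ℕ → β) → β
  | [], k => k []
  | c :: l, k => forceNat c fun c => forceList l fun l' => k (c :: l')

lemma forceList_eq {β : Sort*} : ∀ (l : List ℕ) (k : List ℕ → β), forceList l k = k l
  | [], _ => rfl
  | c :: l, k => by rw [forceList, forceNat_eq, forceList_eq l]

/-- The value at `x` of the `q`-polynomial attached to a monic polynomial, whose other coefficients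
are listed in increasing order. -/
def applyOp (B p q N : ℕ) (T : List ℕ) : List ℕ → ℕ → ℕ
  | [], x => x
  | c :: o, x => forceNat (packPow B p N T x q) fun y => forceNat (applyOp B p q N T o y) fun z =>
      modDigits B p N (Nat.add (reduceBy B p N T (Nat.mul c x)) z)

/-- Successive application of several operators. -/
def applyOps (B p q N : ℕ) (T : List ℕ) : List (List ℕ) → ℕ → ℕ
  | [], x => x
  | o :: L, x => forceNat (applyOp B p q N T o x) fun y => applyOps B p q N T L y

/-- An element which vanishes if a proper divisor of the product of the operators kills `x`. -/
def opsWitness (B p q N : ℕ) (T : List ℕ) : List (List ℕ) → ℕ → ℕ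
  | [], _ => 1
  | o :: L, x => forceNat (applyOps B p q N T L x) fun β => forceNat (applyOp B p q N T o x) fun y =>
      forceNat (if Nat.ble o.length 1 then β else forceNat (packPow B p N T β ((q - 1) ^ 2)) fun s =>
        reduceBy B p N T (Nat.mul β (packPred B p N s))) fun z =>
          forceNat (opsWitness B p q N T L y) fun w => reduceBy B p N T (Nat.mul z w)

/-- An element which vanishes if the order of `b` divides the product of all but one of the listed
numbers. -/
def orderWitness (B p N : ℕ) (T : List ℕ) : List ℕ → ℕ → ℕ
  | [], _ => 1
  | l :: L, b => forceNat (packPow B p N T b L.prod) fun s => forceNat (packPow B p N T b l) fun b' =>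
      forceNat (orderWitness B p N T L b') fun w => reduceBy B p N T (Nat.mul (packPred B p N s) w)

/-- Primality by trial division. -/
def smallPrime (l : ℕ) : Bool :=
  Nat.blt 1 l && Nat.blt l 90000 &&
    (List.range 300).all fun d => Nat.blt d 2 || Nat.ble l d || Nat.blt 0 (l % d)

/-- The part of `certCheck` which depends on the table of powers. -/
def certCheckWith (B q n p N : ℕ) (T : List ℕ) (L : List (List ℕ)) (ls : List ℕ) : Bool :=
  let E := (q ^ n - 1) / 2
  Nat.beq (packPred B p N (packPow B p N T B E)) 0 &&
    L.all (fun o => Nat.ble o.length 2 && o.all fun c =>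
      Nat.beq (modDigits B p N (packPow B p N T c q + (p - 1) * c)) 0) &&
    Nat.beq (applyOps B p q N T L B) 0 &&
    forceNat (packPow B p N T B (E / ls.prod)) fun b =>
      forceNat (reduceBy B p N T (Nat.mul (orderWitness B p N T ls b)
        (opsWitness B p q N T L B))) fun z =>
          Nat.beq (packPred B p N (packPow B p N T z (q ^ n - 1))) 0

/-- Data certifying a suitable element of degree `n` over the field with `q` elements: the
characteristic `p`, the minimal polynomial `X ^ N - r` of the element over the prime field, the
factors of its order over the field with `q` elements, and the primes dividing `(q ^ n - 1) / 2`.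
The base of the packed arithmetic is `B`. -/
def certCheck (B q n p : ℕ) (r : List ℕ) (L : List (List (List ℕ))) (ls : List ℕ) : Bool :=
  let E := (q ^ n - 1) / 2
  let N := r.length
  Nat.blt 0 p && Nat.ble 2 N && Nat.blt ((N * p) ^ 3) B && r.all (fun c => Nat.blt c p) &&
    Nat.beq (q ^ n) (p ^ N) && Nat.beq (2 * E + 1) (q ^ n) &&
    ls.all smallPrime && Nat.beq (ls.prod ^ 50 % E) 0 && Nat.beq (E % ls.prod) 0 &&
    Nat.beq ((L.map List.length).sum + 2) n &&
    L.all (fun o => o.all fun c => Nat.ble c.length N && c.all fun d => Nat.blt d p) &&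
    forceList (basisTable B (packList B r) N 1) fun T' =>
      forceList (powerTable B p N T' (2 * N - 1) 1) fun T =>
        certCheckWith B q n p N T (L.map fun o => o.map (packList B)) ls

end Certificate

section Soundness

/-- The hypotheses under which packed arithmetic computes in a ring. -/
structure PackedRing {R : Type*} [CommRing R] (B p N : ℕ) (T : List ℕ) (θ : R) : Prop where
  char : (p : R) = 0
  pos : 0 < p
  two_le : 2 ≤ N
  bound : (N * p) ^ 3 < B
  table : RepresentsTable B θ (N * p) N T 1
  length : T.length + 1 = 2 * N

namespace PackedRing

variable {R : Type*} [CommRing R] {B p N : ℕ} {T : List ℕ} {θ : R} {a b : ℕ} {v w : R}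

lemma of_root {r : List ℕ} (char : (p : R) = 0) (pos : 0 < p) (two_le : 2 ≤ r.length)
    (bound : (r.length * p) ^ 3 < B) (hr : ∀ c ∈ r, c < p) (hθ : θ ^ r.length = listEval θ r) :
    PackedRing B p r.length (powerTable B p r.length (basisTable B (packList B r) r.length 1)
      (2 * r.length - 1) 1) θ := by
  have hN : 0 < r.length := by omega
  refine ⟨char, pos, two_le, bound, ?_, by rw [length_powerTable]; omega⟩
  refine representsTable_powerTable char pos hN ?_ bound (length_basisTable _ _ _) _ _ _ ?_
  · have := representsTable_basisTable (B := B) (θ := θ) (N := r.length) (s := packList B r) pos hN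
      (by rw [hθ]; exact represents_packList r hr) r.length 0 (by omega)
    rwa [pow_zero, pow_zero] at this
  · have := (represents_natCast (B := B) (θ := θ) 1).mono (S' := r.length * p) (D' := r.length)
      (Nat.mul_pos hN pos) hN
    rwa [Nat.cast_one] at this

/-- The reduced packed number `a` represents `v`. -/
def Rep (_ : PackedRing B p N T θ) (a : ℕ) (v : R) : Prop := Represents B θ (N * p) N a v

variable (H : PackedRing B p N T θ)

lemma rep_mul (h : H.Rep a v) (h' : H.Rep b w) : H.Rep (reduceBy B p N T (a * b)) (v * w) :=
  represents_mul H.char H.pos (by have := H.two_le; omega) H.table H.bound H.length h h'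

lemma rep_pow (h : H.Rep a v) (e : ℕ) : H.Rep (packPow B p N T a e) (v ^ e) :=
  represents_pow H.char H.pos (by have := H.two_le; omega) H.table H.bound H.length h e

lemma rep_pred (h : H.Rep a v) : H.Rep (packPred B p N a) (v - 1) :=
  represents_pred H.char H.pos H.bound H.two_le h

lemma rep_sub (h : H.Rep a v) (h' : H.Rep b w) :
    H.Rep (modDigits B p N (a + (p - 1) * b)) (v - w) :=
  represents_add_pred_mul H.char H.pos H.bound H.two_le h h'

lemma rep_add (h : H.Rep a v) (h' : H.Rep b w) : H.Rep (modDigits B p N (a + b)) (v + w) := by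
  have h2 := H.two_le
  have h3 := Nat.mul_le_mul h2 H.pos
  refine represents_modDigits_of_le H.char H.pos H.bound ?_ (by omega) (Represents.add h h')
  rw [pow_two, ← two_mul]
  exact Nat.mul_le_mul_right _ (by simpa using h3)

lemma rep_one : H.Rep 1 1 := by
  have h2 := H.two_le
  have := (represents_natCast (B := B) (θ := θ) 1).mono (S' := N * p) (D' := N)
    (Nat.mul_pos (by omega) H.pos) (by omega)
  rwa [Nat.cast_one] at this

lemma rep_var : H.Rep B θ :=
  represents_var.mono (Nat.mul_pos (by have := H.two_le; omega) H.pos) H.two_le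

lemma rep_packList {l : List ℕ} (hl : l.length ≤ N) (h : ∀ c ∈ l, c < p) :
    H.Rep (packList B l) (listEval θ l) :=
  (represents_packList l h).mono (Nat.mul_le_mul_right _ hl) hl

lemma eq_zero (h : H.Rep 0 v) : v = 0 :=
  Represents.eq_zero (lt_of_le_of_lt (Nat.zero_le _) H.bound) h

lemma eq_zero_of_beq (h : H.Rep a v) (ha : Nat.beq a 0 = true) : v = 0 := by
  rw [Nat.beq_eq] at ha
  exact H.eq_zero (ha ▸ h)

lemma rep_orderWitness [IsDomain R] : ∀ (ls : List ℕ) (b : ℕ) (v : R), (∀ l ∈ ls, 0 < l) →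
    H.Rep b v → ∃ z, H.Rep (orderWitness B p N T ls b) z ∧
      (z ≠ 0 → ∀ l ∈ ls, v ^ (ls.prod / l) ≠ 1)
  | [], _, _, _, _ => ⟨1, H.rep_one, by simp⟩
  | l :: L, b, v, hl, hb => by
    obtain ⟨z, hz, hzL⟩ := rep_orderWitness L _ _ (fun x hx => hl x (List.mem_cons_of_mem _ hx))
      (H.rep_pow hb l)
    have hl0 := hl l List.mem_cons_self
    refine ⟨(v ^ L.prod - 1) * z, ?_, fun h0 x hx => ?_⟩
    · rw [orderWitness, forceNat_eq, forceNat_eq, forceNat_eq]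
      exact H.rep_mul (H.rep_pred (H.rep_pow hb _)) hz
    · rw [List.prod_cons]
      rcases List.mem_cons.1 hx with rfl | hx
      · rw [Nat.mul_div_cancel_left _ hl0]
        exact sub_ne_zero.1 (left_ne_zero_of_mul h0)
      · rw [Nat.mul_div_assoc _ (List.dvd_prod hx), pow_mul]
        exact hzL (right_ne_zero_of_mul h0) x hx

end PackedRing

lemma exists_algebraMap_eq_of_pow_card_eq {k K : Type*} [Field k] [Fintype k] [Field K]
    [Algebra k K] {x : K} (hx : x ^ Fintype.card k = x) : ∃ c : k, algebraMap k K c = x := by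
  classical
  have h1 : 1 < Fintype.card k := Fintype.one_lt_card
  have h0 : (X ^ Fintype.card k - X : K[X]) ≠ 0 := FiniteField.X_pow_card_sub_X_ne_zero K h1
  have hsub : Finset.univ.image (algebraMap k K) ⊆ (X ^ Fintype.card k - X : K[X]).roots.toFinset := by
    intro y hy
    obtain ⟨c, -, rfl⟩ := Finset.mem_image.1 hy
    rw [Multiset.mem_toFinset, mem_roots h0]
    simp [← map_pow, FiniteField.pow_card]
  have heq := Finset.eq_of_subset_of_card_le hsub (by
    rw [Finset.card_image_of_injective _ (algebraMap k K).injective, Finset.card_univ]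
    exact (Multiset.toFinset_card_le _).trans ((card_roots' _).trans
      (FiniteField.X_pow_card_sub_X_natDegree_eq K h1).le))
  have hmem : x ∈ (X ^ Fintype.card k - X : K[X]).roots.toFinset := by
    rw [Multiset.mem_toFinset, mem_roots h0]
    simp [hx]
  rw [← heq] at hmem
  obtain ⟨c, -, hc⟩ := Finset.mem_image.1 hmem
  exact ⟨c, hc⟩

variable {Fq F : Type*} [Field Fq] [Field F] [Fintype Fq] [Fintype F] [Algebra Fq F]

lemma isKNormal_of_forall_irreducible {f : Fq[X]} {k : ℕ} {α : F} (hf : f.Monic)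
    (hdeg : f.natDegree = Module.finrank Fq F - k) (h0 : aeval (frob Fq F) f α = 0)
    (hirr : ∀ P h : Fq[X], Irreducible P → f = P * h → aeval (frob Fq F) h α ≠ 0) :
    IsKNormal Fq (Fintype.card Fq) (Module.finrank Fq F) k α := by
  classical
  have key : ∀ g : Fq[X], aeval (frob Fq F) g α = 0 → f ∣ g := by
    intro g hg
    have hd : aeval (frob Fq F) (EuclideanDomain.gcd f g) α = 0 :=
      aeval_frob_gcd ⟨EuclideanDomain.gcdA f g, EuclideanDomain.gcdB f g, by
        rw [EuclideanDomain.gcd_eq_gcd_ab]; ring⟩ h0 hg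
    obtain ⟨c, hc⟩ := EuclideanDomain.gcd_dvd_left f g
    by_cases hu : IsUnit c
    · refine dvd_trans ?_ (EuclideanDomain.gcd_dvd_right f g)
      obtain ⟨u, rfl⟩ := hu
      exact ⟨↑u⁻¹, (Units.eq_mul_inv_iff_mul_eq u).2 hc.symm⟩
    · exfalso
      obtain ⟨P, hPi, m, rfl⟩ := WfDvdMonoid.exists_irreducible_factor hu (by
        rintro rfl; rw [mul_zero] at hc; exact hf.ne_zero hc)
      refine hirr P (EuclideanDomain.gcd f g * m) hPi (hc.trans (by ring)) ?_
      exact aeval_frob_eq_zero_of_dvd (dvd_mul_right _ _) hd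
  refine ⟨f, ⟨hf, key _ (by rw [aeval_frob_X_pow_sub_one, LinearMap.zero_apply]), by
    rw [polyAct_eq_aeval, h0], fun h' hm _ hh => ?_⟩, hdeg⟩
  rw [polyAct_eq_aeval] at hh
  exact natDegree_le_of_dvd (key h' hh) hm.ne_zero

lemma aeval_frob_ne_zero_of_natDegree_le_one {u : Fq[X]} (hu : u ≠ 0) (hdeg : u.natDegree ≤ 1)
    {β : F} (hβ : β ≠ 0) (h : u.natDegree = 0 ∨ β ^ (Fintype.card Fq - 1) ^ 2 ≠ 1) :
    aeval (frob Fq F) u β ≠ 0 := by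
  intro h0
  have hq : 1 < Fintype.card Fq := Fintype.one_lt_card
  by_cases hd : u.natDegree = 0
  · obtain ⟨c, rfl⟩ := natDegree_eq_zero.1 hd
    rw [aeval_C, Module.algebraMap_end_apply] at h0
    rcases smul_eq_zero.1 h0 with h1 | h1
    · exact hu (by rw [h1, C_0])
    · exact hβ h1
  · have hpow := h.resolve_left hd
    obtain ⟨a, ha, b, rfl⟩ := natDegree_eq_one.1 (by omega : u.natDegree = 1)
    rw [map_add, map_mul, aeval_C, aeval_C, aeval_X, LinearMap.add_apply, Module.End.mul_apply,
      Module.algebraMap_end_apply, Module.algebraMap_end_apply, frob_apply, Algebra.smul_def,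
      Algebra.smul_def] at h0
    have ha' : algebraMap Fq F a ≠ 0 := by simpa using ha
    have h1 : β ^ (Fintype.card Fq - 1) = algebraMap Fq F (-b / a) := by
      have h2 : β * β ^ (Fintype.card Fq - 1) = β ^ Fintype.card Fq := by
        rw [← pow_succ']; congr 1; omega
      rw [map_div₀, map_neg, eq_div_iff ha']
      apply mul_left_cancel₀ hβ
      rw [← h2] at h0
      linear_combination h0
    have hc : -b / a ≠ 0 := by
      intro h2
      rw [h2, map_zero] at h1
      exact pow_ne_zero _ hβ h1
    apply hpow
    rw [pow_two, pow_mul, h1, ← map_pow, FiniteField.pow_card_sub_one_eq_one _ hc, map_one]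

namespace PackedRing

variable {B p N : ℕ} {T : List ℕ} {θ : F} (H : PackedRing B p N T θ)

lemma exists_applyOp : ∀ o : List ℕ, (∀ c ∈ o, ∃ a : Fq, H.Rep c (algebraMap Fq F a)) →
    ∃ P : Fq[X], P.Monic ∧ P.natDegree = o.length ∧ ∀ x v, H.Rep x v →
      H.Rep (applyOp B p (Fintype.card Fq) N T o x) (aeval (frob Fq F) P v)
  | [], _ => ⟨1, monic_one, by simp, fun x v h => by simpa [applyOp] using h⟩
  | c :: o, ho => by
    obtain ⟨P, hP, hdeg, hP'⟩ := exists_applyOp o fun d hd => ho d (List.mem_cons_of_mem _ hd)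
    obtain ⟨a, ha⟩ := ho c List.mem_cons_self
    have hXP : (X * P).Monic := monic_X.mul hP
    have hnd : (X * P).natDegree = o.length + 1 := by
      rw [monic_X.natDegree_mul hP, natDegree_X, hdeg, add_comm]
    have hlt : (C a).degree < (X * P).degree := by
      rw [degree_eq_natDegree hXP.ne_zero, hnd]
      exact degree_C_le.trans_lt (by exact_mod_cast Nat.succ_pos _)
    refine ⟨C a + X * P, ?_, ?_, fun x v h => ?_⟩
    · rw [add_comm]; exact hXP.add_of_left hlt
    · rw [natDegree_add_eq_right_of_degree_lt hlt, hnd, List.length_cons]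
    · rw [applyOp, forceNat_eq, forceNat_eq, map_add, aeval_C, LinearMap.add_apply, mul_comm X P,
        aeval_frob_mul, aeval_X, Module.algebraMap_end_apply, frob_apply, Algebra.smul_def]
      exact H.rep_add (H.rep_mul ha h) (hP' _ _ (H.rep_pow h _))

lemma exists_applyOps : ∀ L : List (List ℕ),
    (∀ o ∈ L, o.length ≤ 2 ∧ ∀ c ∈ o, ∃ a : Fq, H.Rep c (algebraMap Fq F a)) →
    ∃ f : Fq[X], f.Monic ∧ f.natDegree = (L.map List.length).sum ∧
      (∀ x v, H.Rep x v →
        H.Rep (applyOps B p (Fintype.card Fq) N T L x) (aeval (frob Fq F) f v)) ∧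
      ∀ x v, H.Rep x v → ∃ z, H.Rep (opsWitness B p (Fintype.card Fq) N T L x) z ∧
        (z ≠ 0 → ∀ P h : Fq[X], Irreducible P → f = P * h → aeval (frob Fq F) h v ≠ 0)
  | [], _ => ⟨1, monic_one, by simp, fun x v h => by simpa [applyOps] using h,
      fun x v h => ⟨1, H.rep_one, fun _ P h hP h1 => absurd (IsUnit.of_mul_eq_one h h1.symm)
        hP.not_isUnit⟩⟩
  | o :: L, hL => by
    obtain ⟨f, hf, hdeg, hf', hfw⟩ := exists_applyOps L fun d hd => hL d (List.mem_cons_of_mem _ hd)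
    obtain ⟨ho2, ho⟩ := hL o List.mem_cons_self
    obtain ⟨Q, hQ, hQdeg, hQ'⟩ := H.exists_applyOp o ho
    refine ⟨f * Q, hf.mul hQ, ?_, fun x v h => ?_, fun x v h => ?_⟩
    · rw [hf.natDegree_mul hQ, hdeg, hQdeg, List.map_cons, List.sum_cons, add_comm]
    · rw [applyOps, forceNat_eq, aeval_frob_mul]
      exact hf' _ _ (hQ' _ _ h)
    · have hβ := hf' _ _ h
      have hy := hQ' _ _ h
      obtain ⟨w, hw, hw'⟩ := hfw _ _ hy
      set β := aeval (frob Fq F) f v with hβdef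
      obtain ⟨z, hz, hz'⟩ : ∃ z, H.Rep (if Nat.ble o.length 1 then
          applyOps B p (Fintype.card Fq) N T L x else
          forceNat (packPow B p N T (applyOps B p (Fintype.card Fq) N T L x)
            ((Fintype.card Fq - 1) ^ 2)) fun s => reduceBy B p N T
              (Nat.mul (applyOps B p (Fintype.card Fq) N T L x) (packPred B p N s))) z ∧
          (z ≠ 0 → β ≠ 0 ∧ (o.length ≤ 1 ∨ β ^ (Fintype.card Fq - 1) ^ 2 ≠ 1)) := by
        by_cases h1 : o.length ≤ 1
        · refine ⟨β, ?_, fun h => ⟨h, Or.inl h1⟩⟩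
          rw [if_pos (Nat.ble_eq.symm.mp h1)]
          exact hβ
        · refine ⟨β * (β ^ (Fintype.card Fq - 1) ^ 2 - 1), ?_, fun h =>
            ⟨left_ne_zero_of_mul h, Or.inr (sub_ne_zero.1 (right_ne_zero_of_mul h))⟩⟩
          rw [if_neg (fun h => h1 (Nat.ble_eq.mp h)), forceNat_eq]
          exact H.rep_mul hβ (H.rep_pred (H.rep_pow hβ _))
      refine ⟨z * w, ?_, fun h0 P g hP hPg => ?_⟩
      · rw [opsWitness, forceNat_eq, forceNat_eq, forceNat_eq, forceNat_eq]
        exact H.rep_mul hz hw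
      · obtain ⟨hβ0, hβ1⟩ := hz' (left_ne_zero_of_mul h0)
        rcases hP.prime.dvd_or_dvd (Dvd.intro g hPg.symm) with ⟨h', hh'⟩ | ⟨u, hu⟩
        · have hg : g = h' * Q := by
            apply mul_left_cancel₀ hP.ne_zero
            rw [← hPg, hh']
            ring
          rw [hg, aeval_frob_mul]
          exact hw' (right_ne_zero_of_mul h0) P h' hP hh'
        · have hg : g = u * f := by
            apply mul_left_cancel₀ hP.ne_zero
            rw [← hPg, hu]
            ring
          have hu0 : u ≠ 0 := by
            rintro rfl
            rw [mul_zero] at hu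
            exact hQ.ne_zero hu
          have hsum : P.natDegree + u.natDegree = o.length := by
            rw [← hQdeg, hu, natDegree_mul hP.ne_zero hu0]
          have hPpos := hP.natDegree_pos
          rw [hg, aeval_frob_mul]
          exact aeval_frob_ne_zero_of_natDegree_le_one hu0 (by omega) hβ0
            (hβ1.imp (fun h => by omega) id)

end PackedRing

end Soundness

section CertificateSoundness

lemma prime_of_smallPrime {l : ℕ} (h : smallPrime l = true) : l.Prime := by
  simp only [smallPrime, Bool.and_eq_true, Nat.blt_eq, List.all_eq_true, List.mem_range,
    Bool.or_eq_true, Nat.ble_eq] at h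
  obtain ⟨⟨h1, h2⟩, h3⟩ := h
  rw [Nat.prime_def_le_sqrt]
  refine ⟨h1, fun m hm hml hdvd => ?_⟩
  have hlt : m * m ≤ l := Nat.le_sqrt.1 hml
  have hm300 : m < 300 := by nlinarith
  rcases h3 m hm300 with (h | h) | h
  · omega
  · have := Nat.mul_le_mul_right m hm
    omega
  · rw [Nat.mod_eq_zero_of_dvd hdvd] at h
    omega

lemma map_listEval {R S : Type*} [CommRing R] [CommRing S] (g : R →+* S) (θ : R) :
    ∀ l, listEval (g θ) l = g (listEval θ l)
  | [] => by simp [listEval]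
  | c :: l => by simp [listEval, map_listEval g θ l]

/-- The polynomial with the given coefficients. -/
def listPoly (R : Type*) [CommRing R] : List ℕ → R[X]
  | [] => 0
  | c :: l => C (c : R) + X * listPoly R l

lemma eval_listPoly {R : Type*} [CommRing R] (θ : R) : ∀ l, (listPoly R l).eval θ = listEval θ l
  | [] => by simp [listPoly, listEval]
  | c :: l => by simp [listPoly, listEval, eval_listPoly θ l]

lemma degree_listPoly_lt {R : Type*} [CommRing R] : ∀ l, (listPoly R l).degree < l.length
  | [] => by simp [listPoly]
  | c :: l => by
    rw [degree_lt_iff_coeff_zero]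
    intro m hm
    rw [List.length_cons] at hm
    obtain ⟨j, rfl⟩ : ∃ j, m = j + 1 := ⟨m - 1, by omega⟩
    have := (degree_lt_iff_coeff_zero _ _).1 (degree_listPoly_lt (R := R) l) j (by omega)
    rw [listPoly, coeff_add, coeff_C_succ, coeff_X_mul, this, zero_add]

lemma exists_pow_length_eq_listEval (K : Type*) [Field K] [IsAlgClosed K] {r : List ℕ}
    (hr : 0 < r.length) : ∃ θ : K, θ ^ r.length = listEval θ r := by
  have hdeg : (X ^ r.length - listPoly K r).degree = (r.length : WithBot ℕ) := by
    rw [degree_sub_eq_left_of_degree_lt, degree_X_pow]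
    rw [degree_X_pow]
    exact degree_listPoly_lt r
  obtain ⟨θ, hθ⟩ := IsAlgClosed.exists_root (X ^ r.length - listPoly K r)
    (by rw [hdeg]; exact_mod_cast hr.ne')
  refine ⟨θ, ?_⟩
  rw [IsRoot.def, eval_sub, eval_pow, eval_X, eval_listPoly, sub_eq_zero] at hθ
  exact hθ

variable {Fq F : Type*} [Field Fq] [Field F] [Fintype Fq] [Fintype F] [Algebra Fq F]

lemma hasTwoTwo_of_certCheck {B q n p : ℕ} {r : List ℕ} {L : List (List (List ℕ))} {ls : List ℕ}
    (hcard : Fintype.card Fq = q) (hn : Module.finrank Fq F = n)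
    (h : certCheck B q n p r L ls = true) : HasTwoTwo Fq F q n := by
  subst hcard
  simp only [certCheck, forceList_eq, Bool.and_eq_true, Nat.blt_eq, Nat.ble_eq, Nat.beq_eq,
    List.all_eq_true] at h
  obtain ⟨⟨⟨⟨⟨⟨⟨⟨⟨⟨⟨hp1, hN⟩, hB⟩, hr⟩, hqp⟩, hE⟩, hls⟩, hls50⟩, hlsE⟩, hLn⟩, hLp⟩, hW⟩ := h
  set q := Fintype.card Fq with hq
  set E := (q ^ n - 1) / 2 with hEdef
  have hcardF : Fintype.card F = q ^ n := by
    rw [hq, ← hn]; exact card_eq_card_pow_finrank (Fq := Fq)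
  have hpF : (p : F) = 0 := by
    have h0 : ((p ^ r.length : ℕ) : F) = 0 := by
      rw [← hqp, ← hcardF]; exact Nat.cast_card_eq_zero F
    rw [Nat.cast_pow] at h0
    exact eq_zero_of_pow_eq_zero h0
  have hq1 : 1 < q ^ n := hcardF ▸ Fintype.one_lt_card
  set T := powerTable B p r.length (basisTable B (packList B r) r.length 1) (2 * r.length - 1) 1
    with hTdef
  simp only [certCheckWith, forceNat_eq, Bool.and_eq_true, List.all_eq_true, ← hEdef] at hW
  obtain ⟨⟨⟨hWE, hWL⟩, hWf⟩, hWz⟩ := hW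
  obtain ⟨θ, hθ⟩ : ∃ θ : F, θ ^ r.length = listEval θ r := by
    obtain ⟨θ, hθ⟩ := exists_pow_length_eq_listEval (AlgebraicClosure F) (r := r) (by omega)
    have hpK : (p : AlgebraicClosure F) = 0 := by
      rw [← map_natCast (algebraMap F (AlgebraicClosure F)), hpF, map_zero]
    have H := PackedRing.of_root (B := B) hpK hp1 hN hB hr hθ
    have h1 := H.eq_zero_of_beq (H.rep_pred (H.rep_pow H.rep_var E)) hWE
    obtain ⟨x, rfl⟩ := exists_algebraMap_eq_of_pow_card_eq (k := F) (x := θ) (by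
      rw [hcardF, ← hE, pow_succ, mul_comm 2, pow_mul, sub_eq_zero.1 h1, one_pow, one_mul])
    refine ⟨x, (algebraMap F (AlgebraicClosure F)).injective ?_⟩
    rw [map_pow, hθ, map_listEval]
  have H := PackedRing.of_root (B := B) hpF hp1 hN hB hr hθ
  rw [← hTdef] at H
  have hθE := sub_eq_zero.1 (H.eq_zero_of_beq (H.rep_pred (H.rep_pow H.rep_var E)) hWE)
  have hops : ∀ o ∈ L.map fun o => o.map (packList B),
      o.length ≤ 2 ∧ ∀ c ∈ o, ∃ a : Fq, H.Rep c (algebraMap Fq F a) := by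
    intro o ho
    obtain ⟨ho2, hoq⟩ := hWL o ho
    refine ⟨Nat.ble_eq.mp ho2, fun c hc => ?_⟩
    obtain ⟨o', ho', rfl⟩ := List.mem_map.1 ho
    obtain ⟨c', hc', rfl⟩ := List.mem_map.1 hc
    obtain ⟨h1, h2⟩ := hLp o' ho' c' hc'
    have hrep := H.rep_packList h1 h2
    obtain ⟨a, ha⟩ := exists_algebraMap_eq_of_pow_card_eq (k := Fq)
      (sub_eq_zero.1 (H.eq_zero_of_beq (H.rep_sub (H.rep_pow hrep q) hrep) (hoq _ hc)))
    exact ⟨a, ha ▸ hrep⟩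
  obtain ⟨f, hf, hfdeg, hfe, hfw⟩ := H.exists_applyOps _ hops
  obtain ⟨z, hz, hz'⟩ := hfw _ _ H.rep_var
  have hprime : ∀ l ∈ ls, l.Prime := fun l hl => prime_of_smallPrime (hls l hl)
  obtain ⟨w, hw, hw'⟩ := H.rep_orderWitness ls _ _ (fun l hl => (hprime l hl).pos)
    (H.rep_pow H.rep_var (E / ls.prod))
  have hwz : w * z ≠ 0 := by
    have h1 := sub_eq_zero.1
      (H.eq_zero_of_beq (H.rep_pred (H.rep_pow (H.rep_mul hw hz) (q ^ n - 1))) hWz)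
    intro h0
    rw [h0, zero_pow (by omega)] at h1
    exact zero_ne_one h1
  have hEpos : 0 < E := by omega
  have hθ0 : θ ≠ 0 := by
    rintro rfl
    rw [zero_pow hEpos.ne'] at hθE
    exact zero_ne_one hθE
  have hord : orderOf θ = E := by
    refine orderOf_eq_of_pow_and_pow_div_prime hEpos hθE fun l hl hlE => ?_
    have hl1 : l ∣ ls.prod := hl.dvd_of_dvd_pow (hlE.trans (Nat.dvd_of_mod_eq_zero hls50))
    have hmem : l ∈ ls := mem_list_primes_of_dvd_prod hl.prime
      (fun x hx => (hprime x hx).prime) hl1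
    have := hw' (left_ne_zero_of_mul hwz) l hmem
    rwa [← pow_mul, ← Nat.mul_div_assoc _ hl1,
      Nat.div_mul_cancel (Nat.dvd_of_mod_eq_zero hlsE)] at this
  refine ⟨θ, hθ0, by rw [hord]; omega, ?_⟩
  subst hn
  refine isKNormal_of_forall_irreducible hf ?_
    (H.eq_zero_of_beq (hfe _ _ H.rep_var) hWf) (hz' (right_ne_zero_of_mul hwz))
  rw [hfdeg, List.map_map, ← hLn, Nat.add_sub_cancel]
  congr 1
  exact List.map_congr_left fun o _ => List.length_map _

end CertificateSoundness

section Exceptions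

/-- A tuple of arguments of `certCheck`, except for the base. -/
abbrev Certificate := ℕ × ℕ × ℕ × List ℕ × List (List (List ℕ)) × List ℕ

/-- Whether a certificate is valid. -/
def Certificate.check (w : Certificate) : Bool :=
  certCheck 1099511627776 w.1 w.2.1 w.2.2.1 w.2.2.2.1 w.2.2.2.2.1 w.2.2.2.2.2

/-- Certificates for the elements of `fourExceptions`. -/
def fourCertificates : List Certificate :=
  [(5, 4, 5, [1, 4, 4, 4], [[[4]], [[3]]], [13, 3, 2]),
    (9, 4, 3, [2, 2, 2, 1, 2, 0, 2, 0], [[[2]], [[1, 0, 2, 1, 2, 1, 1, 0]]], [41, 5, 2]),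
    (13, 4, 13, [9, 2, 12, 0], [[[1]], [[5]]], [17, 7, 5, 3, 2]),
    (17, 4, 17, [2, 16, 6, 1], [[[16]], [[4]]], [29, 5, 3, 2]),
    (29, 4, 29, [23, 28, 23, 0], [[[1]], [[17]]], [421, 7, 5, 3, 2]),
    (37, 4, 37, [34, 5, 19, 14], [[[36]], [[31]]], [137, 19, 5, 3, 2]),
    (41, 4, 41, [20, 26, 28, 12], [[[40]], [[9]]], [29, 7, 5, 3, 2]),
    (53, 4, 53, [24, 13, 13, 47], [[[52]], [[23]]], [281, 13, 5, 3, 2]),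
    (73, 4, 73, [25, 61, 20, 0], [[[1]], [[27]]], [41, 37, 13, 5, 3, 2]),
    (89, 4, 89, [53, 88, 66, 0], [[[1]], [[34]]], [233, 17, 11, 5, 3, 2]),
    (109, 4, 109, [22, 76, 54, 40], [[[108]], [[33]]], [457, 13, 11, 5, 3, 2]),
    (113, 4, 113, [91, 105, 71, 15], [[[112]], [[98]]], [1277, 19, 7, 5, 3, 2]),
    (125, 4, 5, [1, 4, 2, 4, 4, 1, 3, 0, 2, 1, 0, 2], [[[4]], [[2]]], [601, 31, 13, 7, 3, 2]),
    (137, 4, 137, [44, 77, 52, 0], [[[1]], [[37]]], [1877, 23, 17, 5, 3, 2]),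
    (149, 4, 149, [67, 56, 25, 70], [[[148]], [[105]]], [653, 37, 17, 5, 3, 2]),
    (173, 4, 173, [140, 64, 4, 77], [[[172]], [[93]]], [73, 43, 41, 29, 5, 3, 2]),
    (197, 4, 197, [132, 93, 29, 137], [[[196]], [[183]]], [3881, 11, 7, 5, 3, 2]),
    (233, 4, 233, [224, 137, 191, 186], [[[232]], [[89]]], [89, 61, 29, 13, 5, 3, 2]),
    (293, 4, 293, [39, 171, 4, 183], [[[292]], [[155]]], [101, 73, 17, 7, 5, 3, 2]),
    (317, 4, 317, [182, 252, 225, 44], [[[316]], [[203]]], [773, 79, 53, 13, 5, 3, 2]),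
    (353, 4, 353, [65, 154, 126, 0], [[[1]], [[42]]], [733, 59, 17, 11, 5, 3, 2]),
    (389, 4, 389, [74, 297, 221, 0], [[[1]], [[115]]], [2609, 97, 29, 13, 5, 3, 2]),
    (509, 4, 509, [107, 470, 424, 0], [[[1]], [[208]]], [461, 281, 127, 17, 5, 3, 2]),
    (593, 4, 593, [333, 539, 275, 178], [[[592]], [[77]]], [541, 37, 13, 11, 5, 3, 2]),
    (797, 4, 797, [425, 604, 748, 0], [[[1]], [[582]]], [63521, 199, 19, 7, 5, 3, 2]),
    (857, 4, 857, [209, 710, 509, 0], [[[1]], [[650]]], [397, 107, 37, 13, 11, 5, 3, 2]),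
    (1217, 4, 1217, [729, 862, 358, 0], [[[1]], [[1139]]], [11393, 29, 19, 13, 7, 5, 3, 2]),
    (2309, 4, 2309, [1077, 959, 1003, 1684], [[[2308]], [[688]]], [577, 73, 53, 13, 11, 7, 5,
      3, 2])]

/-- Certificates for the elements of `generalExceptions`. -/
def generalCertificates : List Certificate :=
  [(5, 5, 5, [4, 0, 1, 2, 0], [[[4]], [[4]], [[4]]], [71, 11, 2]),
    (11, 5, 11, [9, 9, 8, 4, 10], [[[8]], [[6]], [[10]]], [3221, 5]),
    (31, 5, 31, [9, 17, 29, 2, 0], [[[29]], [[27]], [[23]]], [17351, 11, 5, 3]),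
    (3, 6, 3, [2, 1, 1, 1, 1, 2], [[[2]], [[2]], [[2]], [[1]]], [13, 7, 2]),
    (5, 6, 5, [1, 4, 0, 4, 4, 4], [[[1]], [[4]], [[1], [1]]], [31, 7, 3, 2]),
    (7, 6, 7, [5, 5, 4, 1, 3, 1], [[[3]], [[4]], [[6]], [[1]]], [43, 19, 3, 2]),
    (9, 6, 3, [2, 1, 1, 0, 1, 2, 2, 1, 0, 2, 0, 0], [[[2]], [[2]], [[2]], [[1]]], [73, 13, 7,
      5, 2]),
    (11, 6, 11, [6, 5, 10, 8, 7, 10], [[[1]], [[10]], [[1], [1]]], [37, 19, 7, 5, 3, 2]),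
    (13, 6, 13, [3, 11, 4, 4, 11, 4], [[[3]], [[10]], [[9]], [[12]]], [157, 61, 7, 3, 2]),
    (17, 6, 17, [2, 8, 7, 5, 12, 3], [[[1]], [[16]], [[1], [16]]], [307, 13, 7, 3, 2]),
    (19, 6, 19, [3, 3, 7, 18, 10, 0], [[[1]], [[7]], [[12]], [[8]]], [127, 7, 5, 3, 2]),
    (23, 6, 23, [14, 19, 21, 6, 9, 11], [[[1]], [[22]], [[1], [1]]], [79, 13, 11, 7, 3, 2]),
    (25, 6, 5, [1, 1, 1, 2, 3, 4, 4, 2, 1, 4, 0, 0], [[[1], [1]], [[1], [4]]], [601, 31, 13,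
      7, 3, 2]),
    (27, 6, 3, [2, 2, 2, 1, 0, 0, 2, 1, 0, 1, 0, 2, 2, 2, 1, 1, 1, 0], [[[2]], [[2]], [[1]],
      [[1]]], [757, 37, 19, 13, 7, 2]),
    (29, 6, 29, [23, 25, 28, 25, 9, 0], [[[1], [1]], [[1], [28]]], [271, 67, 13, 7, 5, 3, 2]),
    (31, 6, 31, [13, 8, 2, 7, 10, 7], [[[6]], [[1]], [[5]], [[30]]], [331, 19, 7, 5, 3, 2]),
    (37, 6, 37, [9, 27, 8, 15, 1, 34], [[[11]], [[10]], [[27]], [[36]]], [67, 43, 31, 19, 7,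
      3, 2]),
    (41, 6, 41, [2, 36, 28, 29, 11, 0], [[[1], [1]], [[1], [40]]], [1723, 547, 7, 5, 3, 2]),
    (43, 6, 43, [26, 35, 14, 4, 35, 0], [[[1]], [[7]], [[37]], [[36]]], [631, 139, 13, 11, 7,
      3, 2]),
    (47, 6, 47, [20, 23, 19, 15, 39, 0], [[[1], [1]], [[1], [46]]], [103, 61, 37, 23, 7, 3,
      2]),
    (49, 6, 7, [3, 1, 6, 5, 5, 1, 0, 6, 5, 5, 5, 0], [[[4]], [[3]], [[5]], [[1]]], [181, 43,
      19, 13, 5, 3, 2]),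
    (59, 6, 59, [11, 30, 24, 0, 44, 8], [[[1]], [[58]], [[1], [1]]], [3541, 163, 29, 7, 5, 3,
      2]),
    (61, 6, 61, [15, 43, 31, 21, 38, 28], [[[60]], [[14]], [[47]], [[13]]], [523, 97, 31, 13,
      7, 5, 3, 2]),
    (67, 6, 67, [18, 3, 63, 3, 3, 24], [[[38]], [[37]], [[29]], [[66]]], [4423, 31, 17, 11, 7,
      3, 2]),
    (73, 6, 73, [25, 21, 64, 37, 62, 24], [[[9]], [[64]], [[72]], [[65]]], [1801, 751, 37, 7,
      3, 2]),
    (79, 6, 79, [30, 27, 23, 17, 34, 25], [[[55]], [[78]], [[56]], [[1]]], [6163, 43, 13, 7,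
      5, 3, 2]),
    (89, 6, 89, [20, 46, 60, 67, 48, 0], [[[1], [1]], [[1], [88]]], [8011, 373, 11, 7, 5, 3,
      2]),
    (101, 6, 101, [56, 23, 76, 87, 14, 31], [[[1]], [[100]], [[1], [1]]], [10303, 37, 17, 13,
      7, 5, 3, 2]),
    (103, 6, 103, [44, 55, 50, 21, 1, 12], [[[46]], [[1]], [[102]], [[57]]], [3571, 79, 19,
      17, 13, 7, 3, 2]),
    (109, 6, 109, [49, 46, 86, 71, 43, 94], [[[1]], [[45]], [[108]], [[46]]], [571, 193, 61,
      11, 7, 5, 3, 2]),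
    (121, 6, 11, [7, 5, 8, 5, 6, 9, 3, 1, 5, 10, 10, 0], [[[1], [1]], [[1], [10]]], [1117, 61,
      37, 19, 13, 7, 5, 3, 2]),
    (139, 6, 139, [130, 87, 14, 51, 96, 0], [[[43]], [[96]], [[1]], [[42]]], [19183, 499, 23,
      13, 7, 5, 3, 2]),
    (3, 8, 3, [2, 2, 0, 0, 1, 2, 1, 0], [[[1], [0]], [[2], [1]], [[2], [2]]], [41, 5, 2]),
    (5, 8, 5, [1, 3, 0, 4, 2, 3, 4, 0], [[[3]], [[2]], [[2], [0]], [[3], [0]]], [313, 13, 3,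
      2]),
    (9, 8, 3, [2, 2, 0, 2, 2, 2, 2, 2, 1, 0, 0, 1, 1, 2, 2, 0], [[[1], [0]], [[2], [1]], [[2],
      [2]]], [193, 41, 17, 5, 2]),
    (3, 12, 3, [2, 0, 0, 0, 0, 2, 2, 2, 1, 2, 2, 1], [[[2]], [[2]], [[2]], [[1]], [[1]],
      [[1]], [[1], [0]], [[1], [0]]], [73, 13, 7, 5, 2])]

set_option maxRecDepth 100000 in
lemma fourCertificates_check : fourCertificates.all Certificate.check = true := by decide +kernel

set_option maxRecDepth 100000 in
lemma generalCertificates_check : generalCertificates.all Certificate.check = true := by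
  decide +kernel

lemma fourCertificates_map : fourCertificates.map (fun w => (w.1, w.2.1)) =
    fourExceptions.map fun q => (q, 4) := by decide +kernel

lemma generalCertificates_map : generalCertificates.map (fun w => (w.1, w.2.1)) =
    generalExceptions := by decide +kernel

variable {Fq F : Type*} [Field Fq] [Field F] [Fintype Fq] [Fintype F] [Algebra Fq F]

lemma hasTwoTwo_of_mem_certificates {q n : ℕ} {W : List Certificate}
    (hW : W.all Certificate.check = true) (h : (q, n) ∈ W.map fun w => (w.1, w.2.1))
    (hcard : Fintype.card Fq = q) (hn : Module.finrank Fq F = n) : HasTwoTwo Fq F q n := by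
  obtain ⟨w, hw, hwq⟩ := List.mem_map.1 h
  obtain ⟨rfl, rfl⟩ := Prod.mk.inj hwq
  exact hasTwoTwo_of_certCheck hcard hn (List.all_eq_true.1 hW w hw)

end Exceptions

/-- There exists a `2`-primitive `2`-normal element of `F_{q^n}` over `F_q` if and only
if `q` is odd and either `n ≥ 5` and `gcd(q^3 - q, n) ≠ 1`, or `n = 4` and
`q ≡ 1 (mod 4)`. -/
theorem exists_two_primitive_two_normal_iff
    (q n : ℕ) (hq : IsPrimePow q) (hn : 0 < n)
    (Fq F : Type*) [Field Fq] [Field F] [Fintype Fq] [Fintype F] [Algebra Fq F]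
    (hcard : Fintype.card Fq = q) (hdim : Module.finrank Fq F = n) :
    (∃ α : F, α ≠ 0 ∧ 2 * orderOf α = q ^ n - 1 ∧ IsKNormal Fq q n 2 α) ↔
    (Odd q ∧ ((5 ≤ n ∧ Nat.gcd (q ^ 3 - q) n ≠ 1) ∨ (n = 4 ∧ q % 4 = 1))) := by
  constructor
  · rintro ⟨α, hα0, hα, hnormal⟩
    exact necessity hn hcard hα0 hα hnormal
  · rintro ⟨hodd, ⟨hn5, hgcd⟩ | ⟨rfl, hq4⟩⟩
    · rcases hasTwoTwo_or_mem_generalExceptions hq hcard hdim hn5 hodd hgcd with h | h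
      · exact h
      · exact hasTwoTwo_of_mem_certificates generalCertificates_check
          (generalCertificates_map ▸ h) hcard hdim
    · rcases hasTwoTwo_four_or_mem_fourExceptions hq hcard hdim hq4 with h | h
      · exact h
      · exact hasTwoTwo_of_mem_certificates fourCertificates_check
          (by rw [fourCertificates_map]; exact List.mem_map.2 ⟨q, h, rfl⟩) hcard hdim

end
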